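/- Let F = (P,Q) be a Keller map such that both P and Q are rational polynomials. Then every fiber of P is irreducible: for every c ∈ ℂ, the polynomial P − c is irreducible in ℂ[x,y]. -/

import Mathlib

open MvPolynomial Filter

/-- Evaluation of a bivariate polynomial at a point of `ℂ × ℂ`. -/
noncomputable def evalPoly (P : MvPolynomial (Fin 2) ℂ) (p : ℂ × ℂ) : ℂ :=
  MvPolynomial.eval ![p.1, p.2] P

/-- The polynomial map `ℂ² → ℂ²` given by a pair of polynomials. -/
noncomputable def polyMap (P Q : MvPolynomial (Fin 2) ℂ) (p : ℂ × ℂ) : ℂ × ℂ :=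
  (evalPoly P p, evalPoly Q p)

/-- `(P, Q)` is a Keller map: the Jacobian determinant is a nonzero constant. -/
def IsKeller (P Q : MvPolynomial (Fin 2) ℂ) : Prop :=
  ∃ c : ℂ, c ≠ 0 ∧
    pderiv 0 P * pderiv 1 Q - pderiv 1 P * pderiv 0 Q = MvPolynomial.C c

/-- `P` is a rational polynomial: away from finitely many values `c`, the fiber
`P = c` is homeomorphic to `ℂ` minus a finite set of points. -/
def IsRationalPoly (P : MvPolynomial (Fin 2) ℂ) : Prop :=
  ∃ S : Finset ℂ, ∀ c ∉ S, ∃ T : Finset ℂ,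
    Nonempty ({p : ℂ × ℂ // evalPoly P p = c} ≃ₜ {z : ℂ // z ∉ T})

/-- The polynomial map `(P, Q)` has a polynomial inverse. -/
def IsInvertible (P Q : MvPolynomial (Fin 2) ℂ) : Prop :=
  ∃ A B : MvPolynomial (Fin 2) ℂ,
    polyMap A B ∘ polyMap P Q = id ∧ polyMap P Q ∘ polyMap A B = id

/-- The non-proper value set of a map `F : ℂ² → ℂ²`. -/
def nonProperSet (F : ℂ × ℂ → ℂ × ℂ) : Set (ℂ × ℂ) :=
  {a | ∃ b : ℕ → ℂ × ℂ,
    Tendsto (fun i => ‖b i‖) atTop atTop ∧ Tendsto (fun i => F (b i)) atTop (nhds a)}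

namespace KellerRational

/-- Generalized Puiseux series in `t = 1 / x` with real exponents. -/
abbrev HS := HahnSeries ℝ ℂ

/-- `y` is `α t ^ e` plus terms of exponent bigger than `e` (`α` may vanish). -/
def Lead (y : HS) (e : ℝ) (α : ℂ) : Prop :=
  (∀ a < e, y.coeff a = 0) ∧ y.coeff e = α

/-- `y` has valuation at least `e`. -/
def Ge (y : HS) (e : ℝ) : Prop := ∀ a < e, y.coeff a = 0

/-- `y` has valuation bigger than `e`. -/
def Gt (y : HS) (e : ℝ) : Prop := ∀ a ≤ e, y.coeff a = 0

theorem Lead.ge {y e α} (h : Lead y e α) : Ge y e := h.1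

theorem Ge.lead {y e} (h : Ge y e) : Lead y e (y.coeff e) := ⟨h, rfl⟩

theorem Gt.lead {y e} (h : Gt y e) : Lead y e 0 := ⟨fun a ha => h a ha.le, h e le_rfl⟩

theorem Lead.gt {y e} (h : Lead y e 0) : Gt y e := fun a ha => by
  rcases ha.lt_or_eq with h1 | rfl
  · exact h.1 a h1
  · exact h.2

theorem Ge.mono {y e e'} (h : Ge y e) (he : e' ≤ e) : Ge y e' :=
  fun a ha => h a (ha.trans_le he)

theorem Gt.ge {y e} (h : Gt y e) : Ge y e := fun a ha => h a ha.le

theorem Ge.gt {y e e'} (h : Ge y e) (he : e' < e) : Gt y e' :=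
  fun a ha => h a (ha.trans_lt he)

theorem Gt.mono {y e e'} (h : Gt y e) (he : e' ≤ e) : Gt y e' :=
  fun a ha => h a (ha.trans he)

theorem Lead.unique {y e α β} (h : Lead y e α) (h' : Lead y e β) : α = β := h.2.symm.trans h'.2

theorem Lead.exp_le {y e e' α β} (h : Lead y e α) (h' : Lead y e' β) (hβ : β ≠ 0) : e ≤ e' := by
  by_contra hlt
  exact hβ (h'.2.symm.trans (h.1 e' (not_le.1 hlt)))

theorem Lead.exp_unique {y e e' α β} (h : Lead y e α) (h' : Lead y e' β) (hα : α ≠ 0)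
    (hβ : β ≠ 0) : e = e' := le_antisymm (h.exp_le h' hβ) (h'.exp_le h hα)

theorem Ge.le_of_lead {y e e' β} (h : Ge y e) (h' : Lead y e' β) (hβ : β ≠ 0) : e ≤ e' :=
  h.lead.exp_le h' hβ

theorem Gt.lt_of_lead {y e e' β} (h : Gt y e) (h' : Lead y e' β) (hβ : β ≠ 0) : e < e' := by
  by_contra hlt
  exact hβ (h'.2.symm.trans (h e' (not_lt.1 hlt)))

theorem Lead.ne_zero {y e α} (h : Lead y e α) (hα : α ≠ 0) : y ≠ 0 := by
  rintro rfl
  exact hα (h.2.symm.trans (by simp))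

theorem exists_lead {y : HS} (hy : y ≠ 0) : Lead y y.order y.leadingCoeff :=
  ⟨fun _ ha => HahnSeries.coeff_eq_zero_of_lt_order ha, HahnSeries.leadingCoeff_eq.symm⟩

theorem leadingCoeff_ne {y : HS} (hy : y ≠ 0) : y.leadingCoeff ≠ 0 := by
  simpa using hy

theorem Lead.order_eq {y e α} (h : Lead y e α) (hα : α ≠ 0) : y.order = e :=
  (exists_lead (h.ne_zero hα)).exp_unique h (leadingCoeff_ne (h.ne_zero hα)) hα

theorem lead_zero (e : ℝ) : Lead 0 e 0 := ⟨fun _ _ => by simp, by simp⟩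

theorem ge_zero (e : ℝ) : Ge 0 e := (lead_zero e).ge

theorem Lead.add {x y e α β} (hx : Lead x e α) (hy : Lead y e β) : Lead (x + y) e (α + β) :=
  ⟨fun a ha => by simp [hx.1 a ha, hy.1 a ha], by simp [hx.2, hy.2]⟩

theorem Lead.neg {x e α} (hx : Lead x e α) : Lead (-x) e (-α) :=
  ⟨fun a ha => by simp [hx.1 a ha], by simp [hx.2]⟩

theorem Lead.sub {x y e α β} (hx : Lead x e α) (hy : Lead y e β) : Lead (x - y) e (α - β) := by
  simpa [sub_eq_add_neg] using hx.add hy.neg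

theorem Lead.sum {ι : Type*} (s : Finset ι) {x : ι → HS} {e : ℝ} {α : ι → ℂ}
    (h : ∀ i ∈ s, Lead (x i) e (α i)) : Lead (∑ i ∈ s, x i) e (∑ i ∈ s, α i) := by
  classical
  induction s using Finset.induction_on with
  | empty => simpa using lead_zero e
  | insert a s ha ih =>
    rw [Finset.sum_insert ha, Finset.sum_insert ha]
    exact (h a (by simp)).add (ih fun i hi => h i (by simp [hi]))

theorem lead_single (e : ℝ) (c : ℂ) : Lead (HahnSeries.single e c) e c :=
  ⟨fun a ha => by simp [HahnSeries.coeff_single_of_ne ha.ne], by simp⟩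

theorem lead_C (c : ℂ) : Lead (HahnSeries.C c) 0 c := lead_single 0 c

theorem lead_one : Lead 1 0 1 := lead_single 0 1

theorem coeff_mul_superset {x y : HS} {s t : Set ℝ} (hs : s.IsPWO) (ht : t.IsPWO)
    (hxs : x.support ⊆ s) (hyt : y.support ⊆ t) (a : ℝ) :
    (x * y).coeff a =
      ∑ ij ∈ Finset.antidiagonal hs ht a, x.coeff ij.1 * y.coeff ij.2 := by
  rw [HahnSeries.coeff_mul]
  refine Finset.sum_subset ?_ ?_
  · intro ij hij
    simp only [Finset.mem_antidiagonal] at hij ⊢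
    exact ⟨hxs hij.1, hyt hij.2.1, hij.2.2⟩
  · intro ij hij h
    simp only [Finset.mem_antidiagonal, HahnSeries.mem_support, ne_eq, not_and] at hij h
    by_cases hx : x.coeff ij.1 = 0
    · simp [hx]
    by_cases hy : y.coeff ij.2 = 0
    · simp [hy]
    exact absurd hij.2.2 (h hx hy)

theorem Lead.mul {x y e e' α β} (hx : Lead x e α) (hy : Lead y e' β) :
    Lead (x * y) (e + e') (α * β) := by
  have key : ∀ a ≤ e + e', ∀ i j : ℝ, i + j = a → x.coeff i ≠ 0 → y.coeff j ≠ 0 →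
      i = e ∧ j = e' ∧ a = e + e' := by
    intro a ha i j hij hi hj
    have h1 : e ≤ i := by
      by_contra h; exact hi (hx.1 i (not_le.1 h))
    have h2 : e' ≤ j := by
      by_contra h; exact hj (hy.1 j (not_le.1 h))
    refine ⟨?_, ?_, ?_⟩ <;> linarith
  constructor
  · intro a ha
    rw [HahnSeries.coeff_mul]
    refine Finset.sum_eq_zero fun ij hij => ?_
    simp only [Finset.mem_antidiagonal, HahnSeries.mem_support] at hij
    exact absurd (key a ha.le _ _ hij.2.2 hij.1 hij.2.1).2.2 ha.ne
  · rw [HahnSeries.coeff_mul]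
    rw [Finset.sum_eq_single (e, e')]
    · simp [hx.2, hy.2]
    · intro ij hij hne
      simp only [Finset.mem_antidiagonal, HahnSeries.mem_support] at hij
      have := key _ le_rfl _ _ hij.2.2 hij.1 hij.2.1
      exact absurd (Prod.ext this.1 this.2.1) hne
    · intro h
      simp only [Finset.mem_antidiagonal, HahnSeries.mem_support, and_true, not_and,
        not_not] at h
      by_cases hx0 : x.coeff e = 0
      · simp [hx0]
      · simp [h hx0]

theorem Lead.prod {ι : Type*} (s : Finset ι) {x : ι → HS} {e : ι → ℝ} {α : ι → ℂ}
    (h : ∀ i ∈ s, Lead (x i) (e i) (α i)) :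
    Lead (∏ i ∈ s, x i) (∑ i ∈ s, e i) (∏ i ∈ s, α i) := by
  classical
  induction s using Finset.induction_on with
  | empty => simpa using lead_one
  | insert a s ha ih =>
    rw [Finset.prod_insert ha, Finset.prod_insert ha, Finset.sum_insert ha]
    exact (h a (by simp)).mul (ih fun i hi => h i (by simp [hi]))

theorem Lead.pow {x e α} (hx : Lead x e α) (n : ℕ) : Lead (x ^ n) (n * e) (α ^ n) := by
  simpa using Lead.prod (Finset.range n) (x := fun _ => x) (e := fun _ => e) (α := fun _ => α)
    (fun _ _ => hx)

theorem Ge.add {x y e} (hx : Ge x e) (hy : Ge y e) : Ge (x + y) e := (hx.lead.add hy.lead).ge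
theorem Ge.sub {x y e} (hx : Ge x e) (hy : Ge y e) : Ge (x - y) e := (hx.lead.sub hy.lead).ge
theorem Ge.neg {x e} (hx : Ge x e) : Ge (-x) e := hx.lead.neg.ge
theorem Ge.mul {x y e e'} (hx : Ge x e) (hy : Ge y e') : Ge (x * y) (e + e') :=
  (hx.lead.mul hy.lead).ge
theorem Ge.sum {ι : Type*} (s : Finset ι) {x : ι → HS} {e : ℝ}
    (h : ∀ i ∈ s, Ge (x i) e) : Ge (∑ i ∈ s, x i) e :=
  (Lead.sum s fun i hi => (h i hi).lead).ge
theorem Gt.add {x y e} (hx : Gt x e) (hy : Gt y e) : Gt (x + y) e := by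
  have := hx.lead.add hy.lead; rw [add_zero] at this; exact this.gt
theorem Gt.neg {x e} (hx : Gt x e) : Gt (-x) e := by
  have := hx.lead.neg; rw [neg_zero] at this; exact this.gt
theorem Gt.sub {x y e} (hx : Gt x e) (hy : Gt y e) : Gt (x - y) e := by
  rw [sub_eq_add_neg]; exact hx.add hy.neg
theorem Gt.mul_ge {x y e e'} (hx : Gt x e) (hy : Ge y e') : Gt (x * y) (e + e') := by
  have := hx.lead.mul hy.lead; rw [zero_mul] at this; exact this.gt
theorem Lead.add_gt {x y e α} (hx : Lead x e α) (hy : Gt y e) : Lead (x + y) e α := by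
  simpa using hx.add hy.lead

theorem ge_iff_order {y : HS} (hy : y ≠ 0) {e : ℝ} : Ge y e ↔ e ≤ y.order :=
  ⟨fun h => h.le_of_lead (exists_lead hy) (leadingCoeff_ne hy),
    fun h => (exists_lead hy).ge.mono h⟩

theorem gt_iff_order {y : HS} (hy : y ≠ 0) {e : ℝ} : Gt y e ↔ e < y.order :=
  ⟨fun h => h.lt_of_lead (exists_lead hy) (leadingCoeff_ne hy),
    fun h => (exists_lead hy).ge.gt h⟩

/-- Multiply the coefficient of exponent `a` by `χ a`. -/
noncomputable def twist (χ : ℝ → ℂ) (y : HS) : HS where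
  coeff a := χ a * y.coeff a
  isPWO_support' := y.isPWO_support.mono fun a ha => by
    simp only [Function.mem_support, ne_eq, mul_eq_zero, not_or] at ha
    exact ha.2

@[simp] theorem twist_coeff (χ : ℝ → ℂ) (y : HS) (a : ℝ) :
    (twist χ y).coeff a = χ a * y.coeff a := rfl

theorem twist_support (χ : ℝ → ℂ) (y : HS) : (twist χ y).support ⊆ y.support := by
  intro a ha
  simp only [HahnSeries.mem_support, twist_coeff, ne_eq, mul_eq_zero, not_or] at ha
  exact ha.2

theorem twist_add (χ : ℝ → ℂ) (x y : HS) : twist χ (x + y) = twist χ x + twist χ y := by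
  ext a; simp [mul_add]

theorem coeff_twist_mul_twist (χ ψ : ℝ → ℂ) (x y : HS) (a : ℝ) :
    (twist χ x * twist ψ y).coeff a =
      ∑ ij ∈ Finset.antidiagonal x.isPWO_support y.isPWO_support a,
        χ ij.1 * ψ ij.2 * (x.coeff ij.1 * y.coeff ij.2) := by
  rw [coeff_mul_superset x.isPWO_support y.isPWO_support (twist_support χ x) (twist_support ψ y)]
  exact Finset.sum_congr rfl fun ij _ => by simp only [twist_coeff]; ring

theorem twist_one_fun (x : HS) : twist (fun _ => 1) x = x := by ext; simp

/-- The character `a ↦ exp (2 π i a)`. -/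
noncomputable def chr (a : ℝ) : ℂ := Complex.exp (2 * Real.pi * Complex.I * a)

theorem chr_add (a b : ℝ) : chr (a + b) = chr a * chr b := by
  simp only [chr, ← Complex.exp_add]; congr 1; push_cast; ring

theorem chr_zero : chr 0 = 1 := by simp [chr]

theorem chr_ne_zero (a : ℝ) : chr a ≠ 0 := Complex.exp_ne_zero _

theorem chr_eq_one_iff (a : ℝ) : chr a = 1 ↔ ∃ n : ℤ, a = n := by
  rw [chr, Complex.exp_eq_one_iff]
  constructor
  · rintro ⟨n, hn⟩
    refine ⟨n, ?_⟩
    have h : (2 * Real.pi * Complex.I : ℂ) ≠ 0 := by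
      simp [Real.pi_ne_zero, Complex.I_ne_zero]
    have : (a : ℂ) = n := mul_left_cancel₀ h (by rw [hn]; ring)
    exact_mod_cast this
  · rintro ⟨n, rfl⟩
    exact ⟨n, by push_cast; ring⟩

/-- The monodromy automorphism. -/
noncomputable def sigma : HS →+* HS where
  toFun := twist chr
  map_one' := by
    ext a
    by_cases h : a = 0 <;> simp [HahnSeries.coeff_one, h, chr_zero]
  map_zero' := by ext; simp
  map_add' := twist_add _
  map_mul' x y := by
    ext a
    rw [coeff_twist_mul_twist, twist_coeff, HahnSeries.coeff_mul, Finset.mul_sum]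
    refine Finset.sum_congr rfl fun ij hij => ?_
    rw [← (Finset.mem_antidiagonal.1 hij).2.2, chr_add]

@[simp] theorem sigma_coeff (y : HS) (a : ℝ) : (sigma y).coeff a = chr a * y.coeff a := rfl

theorem sigma_injective : Function.Injective sigma := sigma.injective

theorem sigma_iterate_coeff (j : ℕ) (y : HS) (a : ℝ) :
    (sigma^[j] y).coeff a = chr (j * a) * y.coeff a := by
  induction j with
  | zero => simp [chr_zero]
  | succ j ih =>
    rw [Function.iterate_succ_apply', sigma_coeff, ih, ← mul_assoc, ← chr_add]
    congr 2; push_cast; ring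

theorem sigma_iterate_eq_iff (j : ℕ) (y : HS) :
    sigma^[j] y = y ↔ ∀ a, y.coeff a ≠ 0 → ∃ n : ℤ, j * a = n := by
  constructor
  · intro h a ha
    have h1 := sigma_iterate_coeff j y a
    rw [h] at h1
    have : chr (j * a) = 1 := by
      have := mul_right_cancel₀ ha (h1.symm.trans (one_mul _).symm)
      exact this
    exact (chr_eq_one_iff _).1 this
  · intro h
    ext a
    rw [sigma_iterate_coeff]
    by_cases ha : y.coeff a = 0
    · simp [ha]
    · rw [(chr_eq_one_iff _).2 (h a ha), one_mul]

theorem sigma_single_int (n : ℤ) (c : ℂ) :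
    sigma (HahnSeries.single (n : ℝ) c) = HahnSeries.single (n : ℝ) c := by
  have := (sigma_iterate_eq_iff 1 (HahnSeries.single (n : ℝ) c)).2 (by
    intro a ha
    by_cases h : a = n
    · exact ⟨n, by simp [h]⟩
    · exact absurd (HahnSeries.coeff_single_of_ne h) ha)
  simpa using this

theorem lead_sigma {y e α} (h : Lead y e α) : Lead (sigma y) e (chr e * α) :=
  ⟨fun a ha => by simp [h.1 a ha], by simp [h.2]⟩

theorem ge_sigma_iff {y : HS} {e : ℝ} : Ge (sigma y) e ↔ Ge y e := by
  simp [Ge, chr_ne_zero]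

theorem gt_sigma_iff {y : HS} {e : ℝ} : Gt (sigma y) e ↔ Gt y e := by
  simp [Gt, chr_ne_zero]

/-- The Euler derivation `t d/dt`. -/
noncomputable def euler : HS → HS := twist (fun a => (a : ℂ))

theorem euler_mul (x y : HS) : euler (x * y) = euler x * y + x * euler y := by
  ext a
  rw [HahnSeries.coeff_add]
  conv_rhs => rw [← twist_one_fun y, ← twist_one_fun x]
  rw [twist_one_fun y, twist_one_fun x]
  have h1 : (euler x * y).coeff a = (twist (fun a => (a : ℂ)) x * twist (fun _ => 1) y).coeff a := by
    rw [twist_one_fun]; rfl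
  have h2 : (x * euler y).coeff a = (twist (fun _ => 1) x * twist (fun a => (a : ℂ)) y).coeff a := by
    rw [twist_one_fun]; rfl
  rw [h1, h2, coeff_twist_mul_twist, coeff_twist_mul_twist, euler, twist_coeff,
    HahnSeries.coeff_mul, Finset.mul_sum, ← Finset.sum_add_distrib]
  refine Finset.sum_congr rfl fun ij hij => ?_
  rw [← (Finset.mem_antidiagonal.1 hij).2.2]
  push_cast; ring

/-- The variable `x`, as a series in `t = 1 / x`. -/
noncomputable def xx : HS := HahnSeries.single (-1) 1

/-- The derivation `d/dx`. -/
noncomputable def dx (y : HS) : HS := -(HahnSeries.single 1 1 * euler y)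

theorem dx_add (x y : HS) : dx (x + y) = dx x + dx y := by
  simp only [dx, euler, twist_add]; ring

theorem dx_mul (x y : HS) : dx (x * y) = dx x * y + x * dx y := by
  simp only [dx, euler_mul]; ring

theorem dx_coeff (y : HS) (a : ℝ) : (dx y).coeff a = -((a - 1 : ℝ) * y.coeff (a - 1)) := by
  rw [dx, HahnSeries.coeff_neg, HahnSeries.coeff_single_mul]
  simp [euler]

theorem dx_C (c : ℂ) : dx (HahnSeries.C c) = 0 := by
  ext a
  rw [dx_coeff]
  by_cases h : a - 1 = 0
  · simp [h]
  · have : (HahnSeries.C c : HS).coeff (a - 1) = 0 := HahnSeries.coeff_single_of_ne h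
    rw [this]; simp

theorem dx_xx : dx xx = 1 := by
  ext a
  rw [dx_coeff, xx]
  by_cases h : a = 0
  · subst h; simp
  · rw [HahnSeries.coeff_single_of_ne (by contrapose! h; linarith), HahnSeries.coeff_one, if_neg h]
    simp

theorem Lead.dx {y e α} (h : Lead y e α) : Lead (dx y) (e + 1) (-(e * α)) := by
  constructor
  · intro a ha
    rw [dx_coeff, h.1 (a - 1) (by linarith)]; simp
  · rw [dx_coeff]
    simp [h.2]

/-- The Newton polygon of `g` lies above the line through `(0, γ)` of slope `-ρ` and touches it
in positive degree. -/
def WeakEdge (g : Polynomial HS) (γ ρ : ℝ) : Prop :=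
  (∀ i : ℕ, Ge (g.coeff i) (γ - i * ρ)) ∧ ∃ i : ℕ, 1 ≤ i ∧ (g.coeff i).coeff (γ - i * ρ) ≠ 0

theorem exists_weakEdge (g : Polynomial HS) (h0 : g.coeff 0 ≠ 0) (hd : g.natDegree ≠ 0) :
    ∃ ρ, WeakEdge g (g.coeff 0).order ρ := by
  classical
  set γ := (g.coeff 0).order
  let I := (Finset.range (g.natDegree + 1)).filter fun i => 1 ≤ i ∧ g.coeff i ≠ 0
  have hI : I.Nonempty := ⟨g.natDegree, by
    simp only [I, Finset.mem_filter, Finset.mem_range]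
    refine ⟨by omega, by omega, ?_⟩
    rw [Polynomial.coeff_natDegree, Polynomial.leadingCoeff_ne_zero]
    rintro rfl; simp at h0⟩
  obtain ⟨i, hi, hmax⟩ := Finset.exists_max_image I (fun i => (γ - (g.coeff i).order) / i) hI
  simp only [I, Finset.mem_filter, Finset.mem_range] at hi hmax
  have hi0 : (0 : ℝ) < i := by exact_mod_cast hi.2.1
  refine ⟨(γ - (g.coeff i).order) / i, fun j => ?_, i, hi.2.1, ?_⟩
  · rcases Nat.eq_zero_or_pos j with rfl | hj
    · simpa using (exists_lead h0).ge
    by_cases hj0 : g.coeff j = 0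
    · rw [hj0]; exact ge_zero _
    have hjn : j < g.natDegree + 1 := Nat.lt_succ_of_le (Polynomial.le_natDegree_of_ne_zero hj0)
    have := hmax j ⟨hjn, hj, hj0⟩
    have hj' : (0 : ℝ) < j := by exact_mod_cast hj
    rw [div_le_iff₀ hj'] at this
    exact (exists_lead hj0).ge.mono (by linarith)
  · have : γ - i * ((γ - (g.coeff i).order) / i) = (g.coeff i).order := by
      field_simp; ring
    rw [this, (exists_lead hi.2.2).2]
    exact leadingCoeff_ne hi.2.2

theorem WeakEdge.le {g : Polynomial HS} {γ ρ ρ' : ℝ} (h0 : g.coeff 0 ≠ 0)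
    (h : WeakEdge g γ ρ) (h' : WeakEdge g (g.coeff 0).order ρ') :
    ρ ≤ ρ' ∧ (Gt (g.coeff 0) γ → ρ < ρ') := by
  obtain ⟨i, hi, hne⟩ := h.2
  have hi0 : (0 : ℝ) < i := by exact_mod_cast hi
  have h1 : (g.coeff 0).order - i * ρ' ≤ γ - i * ρ :=
    (h'.1 i).le_of_lead (h.1 i).lead hne
  have h2 : γ ≤ (g.coeff 0).order := by
    have := (ge_iff_order h0).1 (h.1 0)
    simpa using this
  refine ⟨?_, fun hgt => ?_⟩
  · by_contra hlt; nlinarith [not_le.1 hlt]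
  · have h3 := (gt_iff_order h0).1 hgt
    by_contra hlt; nlinarith [not_lt.1 hlt]

/-- The polynomial read off along an edge of the Newton polygon. -/
noncomputable def edgePoly (g : Polynomial HS) (γ ρ : ℝ) : Polynomial ℂ :=
  ∑ i ∈ Finset.range (g.natDegree + 1), Polynomial.monomial i ((g.coeff i).coeff (γ - i * ρ))

theorem edgePoly_coeff (g : Polynomial HS) (γ ρ : ℝ) (i : ℕ) :
    (edgePoly g γ ρ).coeff i = (g.coeff i).coeff (γ - i * ρ) := by
  simp only [edgePoly, Polynomial.finsetSum_coeff, Polynomial.coeff_monomial]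
  rw [Finset.sum_ite_eq']
  split_ifs with h
  · rfl
  · rw [Polynomial.coeff_eq_zero_of_natDegree_lt (by simpa using h)]; simp

theorem taylor_coeff_eq_sum {R : Type*} [CommRing R] (g : Polynomial R) (h : R) (j N : ℕ)
    (hN : g.natDegree < N) : (Polynomial.taylor h g).coeff j =
      ∑ n ∈ Finset.range N, ((n + j).choose j : R) * g.coeff (n + j) * h ^ n := by
  rw [Polynomial.taylor_coeff, Polynomial.eval_eq_sum_range' (n := N)]
  · simp [Polynomial.hasseDeriv_coeff]
  · exact lt_of_le_of_lt (Polynomial.natDegree_hasseDeriv_le g j) (by omega)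

theorem lead_taylor {g : Polynomial HS} {γ ρ : ℝ} (hg : ∀ i : ℕ, Ge (g.coeff i) (γ - i * ρ))
    {h : HS} {η : ℂ} (hh : Lead h ρ η) (j : ℕ) :
    Lead ((Polynomial.taylor h g).coeff j) (γ - j * ρ)
      ((Polynomial.taylor η (edgePoly g γ ρ)).coeff j) := by
  have hN : (edgePoly g γ ρ).natDegree < g.natDegree + 1 := by
    refine Nat.lt_succ_of_le (Polynomial.natDegree_le_iff_coeff_eq_zero.2 fun i hi => ?_)
    rw [edgePoly_coeff, Polynomial.coeff_eq_zero_of_natDegree_lt hi]; simp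
  rw [taylor_coeff_eq_sum g h j (g.natDegree + 1) (by omega),
    taylor_coeff_eq_sum _ η j (g.natDegree + 1) hN]
  refine Lead.sum _ fun n _ => ?_
  rw [edgePoly_coeff]
  have h1 := ((lead_C ((n + j).choose j : ℂ)).mul (hg (n + j)).lead).mul (hh.pow n)
  have e : (0 : ℝ) + (γ - ((n + j : ℕ) : ℝ) * ρ) + n * ρ = γ - j * ρ := by push_cast; ring
  rw [e, map_natCast] at h1
  exact h1

theorem WeakEdge.natDegree_edgePoly {g : Polynomial HS} {γ ρ : ℝ} (h : WeakEdge g γ ρ) :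
    (edgePoly g γ ρ).natDegree ≠ 0 := by
  obtain ⟨i, hi, hne⟩ := h.2
  rw [← edgePoly_coeff] at hne
  have := Polynomial.le_natDegree_of_ne_zero hne
  omega

theorem WeakEdge.taylor {g : Polynomial HS} {γ ρ : ℝ} (hg : WeakEdge g γ ρ)
    {h : HS} (hh : Ge h ρ) : WeakEdge (Polynomial.taylor h g) γ ρ := by
  have key := lead_taylor hg.1 hh.lead
  have hd := hg.natDegree_edgePoly
  refine ⟨fun i => (key i).ge, (edgePoly g γ ρ).natDegree, by omega, ?_⟩
  rw [(key _).2]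
  have := Polynomial.natDegree_taylor (edgePoly g γ ρ) (h.coeff ρ)
  conv_lhs => rw [← this]
  rw [Polynomial.coeff_natDegree, Polynomial.leadingCoeff_ne_zero]
  intro h0
  rw [h0] at this
  simp at this
  exact hd this.symm

theorem exists_newton_step {g : Polynomial HS} {γ ρ : ℝ} (hg : WeakEdge g γ ρ) :
    ∃ h : HS, Ge h ρ ∧ Gt ((Polynomial.taylor h g).coeff 0) γ := by
  have hd := hg.natDegree_edgePoly
  obtain ⟨η, hη⟩ := IsAlgClosed.exists_root (edgePoly g γ ρ)
    (fun h => hd (Polynomial.natDegree_eq_of_degree_eq_some h))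
  refine ⟨HahnSeries.single ρ η, (lead_single _ _).ge, ?_⟩
  have := lead_taylor hg.1 (lead_single ρ η) 0
  rw [Polynomial.taylor_coeff_zero η, hη.eq_zero] at this
  simpa using this.gt

/-- A chain of series agreeing up to increasing precision has a pseudo-limit. -/
theorem exists_pseudoLimit (c : Set HS) (ρ : HS → ℝ)
    (hc : ∀ z ∈ c, ∀ z' ∈ c, ∀ a, a < ρ z → a < ρ z' → z.coeff a = z'.coeff a) :
    ∃ y : HS, ∀ z ∈ c, Ge (y - z) (ρ z) := by
  classical
  let f : ℝ → ℂ := fun a => if h : ∃ z ∈ c, a < ρ z then h.choose.coeff a else 0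
  have hf : ∀ z ∈ c, ∀ a < ρ z, f a = z.coeff a := by
    intro z hz a ha
    have h : ∃ z ∈ c, a < ρ z := ⟨z, hz, ha⟩
    simp only [f, dif_pos h]
    exact hc _ h.choose_spec.1 z hz a h.choose_spec.2 ha
  have hpwo : (Function.support f).IsPWO := by
    rw [Set.isPWO_iff_isWF, Set.isWF_iff_no_descending_seq]
    intro s hs hmem
    have h0 : f (s 0) ≠ 0 := hmem 0
    have : ∃ z ∈ c, s 0 < ρ z := by
      by_contra h
      exact h0 (by simp only [f, dif_neg h])
    obtain ⟨z, hz, hlt⟩ := this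
    have hwf := z.isPWO_support
    change Set.IsPWO z.support at hwf
    rw [Set.isPWO_iff_isWF, Set.isWF_iff_no_descending_seq] at hwf
    refine hwf s hs fun n => ?_
    have hn : s n < ρ z := lt_of_le_of_lt (hs.antitone (Nat.zero_le n)) hlt
    have : f (s n) ≠ 0 := hmem n
    rwa [hf z hz _ hn] at this
  refine ⟨⟨f, hpwo⟩, fun z hz a ha => ?_⟩
  rw [HahnSeries.coeff_sub, sub_eq_zero]
  exact hf z hz a ha

instance : IsAlgClosed HS := by
  refine IsAlgClosed.of_exists_root _ fun p _ hirr => ?_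
  by_contra hno
  push Not at hno
  have h0 : ∀ z, (Polynomial.taylor z p).coeff 0 ≠ 0 := fun z => by
    rw [Polynomial.taylor_coeff_zero]; exact hno z
  have hd : ∀ z, (Polynomial.taylor z p).natDegree ≠ 0 := fun z => by
    rw [Polynomial.natDegree_taylor]; exact hirr.natDegree_pos.ne'
  choose ρ hρ using fun z => exists_weakEdge _ (h0 z) (hd z)
  have htay : ∀ z h : HS, Polynomial.taylor (z + h) p =
      Polynomial.taylor h (Polynomial.taylor z p) := fun z h => by
    rw [Polynomial.taylor_taylor, add_comm]
  have hmono : ∀ z h, Ge h (ρ z) → ρ z ≤ ρ (z + h) := fun z h hh => by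
    have h1 := (hρ z).taylor hh
    rw [← htay] at h1
    exact (h1.le (h0 _) (hρ _)).1
  have hstep : ∀ z, ∃ h, Ge h (ρ z) ∧ ρ z < ρ (z + h) := fun z => by
    obtain ⟨h, hh, hgt⟩ := exists_newton_step (hρ z)
    refine ⟨h, hh, ?_⟩
    have h1 := (hρ z).taylor hh
    rw [← htay] at h1 hgt
    exact (h1.le (h0 _) (hρ _)).2 hgt
  let r : HS → HS → Prop := fun z z' => z = z' ∨ (Ge (z' - z) (ρ z) ∧ ρ z < ρ z')
  have htrans : ∀ {a b d}, r a b → r b d → r a d := by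
    rintro a b d (rfl | h1) (rfl | h2)
    · exact Or.inl rfl
    · exact Or.inr h2
    · exact Or.inr h1
    · refine Or.inr ⟨?_, h1.2.trans h2.2⟩
      have := (h2.1.mono h1.2.le).add h1.1
      simpa using this
  have hbound : ∀ c, IsChain r c → ∃ ub, ∀ a ∈ c, r a ub := by
    intro c hc
    by_cases hmax : ∃ z ∈ c, ∀ z' ∈ c, r z' z
    · obtain ⟨z, _, hz⟩ := hmax
      exact ⟨z, hz⟩
    push Not at hmax
    obtain ⟨y, hy⟩ := exists_pseudoLimit c ρ (by
      have aux : ∀ z z' : HS, r z z' → ∀ a, a < ρ z → z.coeff a = z'.coeff a := by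
        rintro z z' (rfl | ⟨h1, -⟩) a ha
        · rfl
        · have := h1 a ha
          rw [HahnSeries.coeff_sub, sub_eq_zero] at this
          exact this.symm
      intro z hz z' hz' a ha ha'
      rcases eq_or_ne z z' with rfl | hne
      · rfl
      rcases hc hz hz' hne with h | h
      · exact aux _ _ h a ha
      · exact (aux _ _ h a ha').symm)
    refine ⟨y, fun z hz => Or.inr ⟨hy z hz, ?_⟩⟩
    obtain ⟨z', hz', hnr⟩ := hmax z hz
    have hne : z' ≠ z := fun h => hnr (Or.inl h)
    have hlt : ρ z < ρ z' := by
      rcases hc hz' hz hne with h | h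
      · exact absurd h hnr
      · rcases h with h | h
        · exact absurd h.symm hne
        · exact h.2
    refine hlt.trans_le ?_
    simpa using hmono z' (y - z') (hy z' hz')
  obtain ⟨m, hm⟩ := exists_maximal_of_chains_bounded hbound htrans
  obtain ⟨h, hh, hlt⟩ := hstep m
  rcases hm (m + h) (Or.inr ⟨by simpa using hh, hlt⟩) with h1 | h1
  · rw [h1] at hlt; exact lt_irrefl _ hlt
  · exact lt_asymm hlt h1.2

open Classical in
/-- The minimum of `r` and the valuation of `y`. -/
noncomputable def mnv (y : HS) (r : ℝ) : ℝ := if y = 0 then r else min y.order r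

theorem mnv_of_ge {y : HS} {r : ℝ} (h : Ge y r) : mnv y r = r := by
  unfold mnv
  split_ifs with h0
  · rfl
  · exact min_eq_right ((ge_iff_order h0).1 h)

theorem ne_zero_of_not_ge {y : HS} {r : ℝ} (h : ¬ Ge y r) : y ≠ 0 := by
  rintro rfl; exact h (ge_zero r)

theorem mnv_of_not_ge {y : HS} {r : ℝ} (h : ¬ Ge y r) : mnv y r = y.order := by
  have h0 := ne_zero_of_not_ge h
  rw [mnv, if_neg h0, min_eq_left]
  rw [ge_iff_order h0] at h
  exact (not_le.1 h).le

theorem mnv_lt_of_not_ge {y : HS} {r : ℝ} (h : ¬ Ge y r) : mnv y r < r := by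
  rw [mnv_of_not_ge h]
  rw [ge_iff_order (ne_zero_of_not_ge h)] at h
  exact not_le.1 h

theorem continuous_mnv (y : HS) : Continuous (mnv y) := by
  unfold mnv
  split_ifs
  · exact continuous_id
  · exact continuous_const.min continuous_id

theorem mnv_congr {y y' : HS} {r s : ℝ} (h : Ge (y - y') r) (hs : s ≤ r) : mnv y s = mnv y' s := by
  have hh := h.mono hs
  by_cases h1 : Ge y s
  · rw [mnv_of_ge h1, mnv_of_ge]
    simpa using h1.sub hh
  · have h2 : ¬ Ge y' s := fun h2 => h1 (by simpa using h2.add hh)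
    rw [mnv_of_not_ge h1, mnv_of_not_ge h2]
    have h0 := ne_zero_of_not_ge h1
    have hlt : y.order < s := by
      rw [ge_iff_order h0] at h1; exact not_le.1 h1
    have := (exists_lead h0).add_gt (hh.gt hlt).neg
    rw [neg_sub, add_sub_cancel] at this
    exact (this.order_eq (leadingCoeff_ne h0)).symm

theorem mnv_linear {y : HS} {r s : ℝ} (hrs : r ≤ s) (h : Gt y r → Ge y s) :
    mnv y s = mnv y r + (open Classical in if Gt y r then s - r else 0) := by
  split_ifs with h1
  · rw [mnv_of_ge (h h1), mnv_of_ge h1.ge]; ring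
  · rcases eq_or_ne y 0 with rfl | h0
    · exact absurd (fun a _ => by simp) h1
    rw [gt_iff_order h0, not_lt] at h1
    simp [mnv, h0, h1, h1.trans hrs]

/-- The monic polynomial function with roots `Z`. -/
noncomputable def pf (Z : Finset HS) (y : HS) : HS := ∏ u ∈ Z, (y - u)

open Classical in
/-- The derivative of `pf Z`. -/
noncomputable def pd (Z : Finset HS) (y : HS) : HS := ∑ u ∈ Z, ∏ v ∈ Z.erase u, (y - v)

/-- The generic valuation of `pf Z` on the disc of centre `z` and radius `r`. -/
noncomputable def Av (Z : Finset HS) (z : HS) (r : ℝ) : ℝ := ∑ u ∈ Z, mnv (z - u) r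

open Classical in
/-- The number of elements of `Z` in the closed disc. -/
noncomputable def Nge (Z : Finset HS) (z : HS) (r : ℝ) : ℕ := (Z.filter fun u => Ge (z - u) r).card

open Classical in
/-- The number of elements of `Z` in the open disc. -/
noncomputable def Ngt (Z : Finset HS) (z : HS) (r : ℝ) : ℕ := (Z.filter fun u => Gt (z - u) r).card

open Classical in
/-- The reduction of one factor of `pf Z` to the disc of centre `z` and radius `r`. -/
noncomputable def hatF (z : HS) (r : ℝ) (u : HS) : Polynomial ℂ :=
  if Ge (z - u) r then Polynomial.X - Polynomial.C ((u - z).coeff r)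
  else Polynomial.C (z - u).leadingCoeff

/-- The reduction of `pf Z` to the disc of centre `z` and radius `r`. -/
noncomputable def hat (Z : Finset HS) (z : HS) (r : ℝ) : Polynomial ℂ := ∏ u ∈ Z, hatF z r u

theorem hatF_ne_zero (z r u) : hatF z r u ≠ 0 := by
  unfold hatF
  split_ifs with h
  · exact Polynomial.X_sub_C_ne_zero _
  · rw [Polynomial.C_ne_zero]; exact leadingCoeff_ne (ne_zero_of_not_ge h)

theorem hat_ne_zero (Z z r) : hat Z z r ≠ 0 :=
  Finset.prod_ne_zero_iff.2 fun u _ => hatF_ne_zero z r u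

theorem lead_factor {z y : HS} {r : ℝ} {ξ : ℂ} (h : Lead (y - z) r ξ) (u : HS) :
    Lead (y - u) (mnv (z - u) r) ((hatF z r u).eval ξ) := by
  have e : y - u = (z - u) + (y - z) := by ring
  unfold hatF
  split_ifs with h1
  · rw [mnv_of_ge h1, e]
    have := h1.lead.add h
    convert this using 1
    simp [HahnSeries.coeff_sub]; ring
  · rw [mnv_of_not_ge h1, e, Polynomial.eval_C]
    refine (exists_lead (ne_zero_of_not_ge h1)).add_gt (h.ge.gt ?_)
    have := mnv_lt_of_not_ge h1
    rwa [mnv_of_not_ge h1] at this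

theorem lead_pf (Z : Finset HS) {z y : HS} {r : ℝ} {ξ : ℂ} (h : Lead (y - z) r ξ) :
    Lead (pf Z y) (Av Z z r) ((hat Z z r).eval ξ) := by
  rw [hat, Polynomial.eval_prod]
  exact Lead.prod Z fun u _ => lead_factor h u

theorem lead_pd (Z : Finset HS) {z y : HS} {r : ℝ} {ξ : ℂ} (h : Lead (y - z) r ξ) :
    Lead (pd Z y) (Av Z z r - r) ((hat Z z r).derivative.eval ξ) := by
  classical
  rw [hat, Polynomial.derivative_prod_finset, Polynomial.eval_finsetSum, pd]
  refine Lead.sum Z fun u hu => ?_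
  have h1 : Lead (∏ v ∈ Z.erase u, (y - v)) (Av Z z r - mnv (z - u) r)
      ((∏ v ∈ Z.erase u, hatF z r v).eval ξ) := by
    rw [Polynomial.eval_prod, Av, ← Finset.sum_erase_eq_sub hu]
    exact Lead.prod _ fun v _ => lead_factor h v
  rw [Polynomial.eval_mul]
  by_cases h2 : Ge (z - u) r
  · rw [mnv_of_ge h2] at h1
    simpa [hatF, h2] using h1
  · have := h1.ge.gt (e' := Av Z z r - r) (by linarith [mnv_lt_of_not_ge h2])
    simpa [hatF, h2] using this.lead

theorem continuous_Av (Z : Finset HS) (z : HS) : Continuous (Av Z z) :=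
  continuous_finsetSum _ fun _ _ => continuous_mnv _

theorem Av_congr (Z : Finset HS) {z z' : HS} {r s : ℝ} (h : Ge (z - z') r) (hs : s ≤ r) :
    Av Z z s = Av Z z' s :=
  Finset.sum_congr rfl fun u _ => mnv_congr (by simpa using h) hs

theorem ge_congr {z z' u : HS} {r s : ℝ} (h : Ge (z - z') r) (hs : s ≤ r) :
    Ge (z - u) s ↔ Ge (z' - u) s := by
  constructor
  · intro h1; simpa using h1.sub (h.mono hs)
  · intro h1; simpa using h1.add (h.mono hs)

theorem Nge_congr (Z : Finset HS) {z z' : HS} {r s : ℝ} (h : Ge (z - z') r) (hs : s ≤ r) :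
    Nge Z z s = Nge Z z' s := by
  classical
  unfold Nge
  simp only [ge_congr h hs]

theorem Av_linear (Z : Finset HS) {z : HS} {r s : ℝ} (hrs : r ≤ s)
    (h : ∀ u ∈ Z, Gt (z - u) r → Ge (z - u) s) :
    Av Z z s = Av Z z r + Ngt Z z r * (s - r) := by
  classical
  unfold Av Ngt
  rw [Finset.sum_congr rfl fun u hu => mnv_linear hrs (h u hu), Finset.sum_add_distrib,
    ← Finset.sum_filter, Finset.sum_const, nsmul_eq_mul]

theorem Av_of_forall_ge (Z : Finset HS) {z : HS} {r : ℝ} (h : ∀ u ∈ Z, Ge (z - u) r) :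
    Av Z z r = Z.card * r := by
  rw [Av, Finset.sum_congr rfl fun u hu => mnv_of_ge (h u hu), Finset.sum_const, nsmul_eq_mul]

/-- If no element of `Z` lies at distance exactly `r` from `z`, the reduction is a monomial. -/
theorem hat_generic (Z : Finset HS) {z : HS} {r : ℝ} (h : ∀ u ∈ Z, Ge (z - u) r → Gt (z - u) r) :
    ∃ c : ℂ, c ≠ 0 ∧ hat Z z r = Polynomial.C c * Polynomial.X ^ Ngt Z z r := by
  classical
  refine ⟨∏ u ∈ Z.filter (fun u => ¬ Gt (z - u) r), (z - u).leadingCoeff, ?_, ?_⟩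
  · refine Finset.prod_ne_zero_iff.2 fun u hu => ?_
    rw [Finset.mem_filter] at hu
    refine leadingCoeff_ne fun h0 => hu.2 ?_
    rw [h0]; intro a _; simp
  · rw [hat, ← Finset.prod_filter_mul_prod_filter_not Z (fun u => Gt (z - u) r), mul_comm]
    congr 1
    · rw [map_prod]
      refine Finset.prod_congr rfl fun u hu => ?_
      rw [Finset.mem_filter] at hu
      rw [hatF, if_neg fun h1 => hu.2 (h u hu.1 h1)]
    · rw [Ngt, ← Finset.prod_const]
      refine Finset.prod_congr rfl fun u hu => ?_
      rw [Finset.mem_filter] at hu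
      have : (u - z).coeff r = 0 := by
        have := hu.2.neg r le_rfl
        rwa [neg_sub] at this
      rw [hatF, if_pos hu.2.ge, this]; simp

theorem hat_eval_eq_zero_iff (Z : Finset HS) (z : HS) (r : ℝ) (ξ : ℂ) :
    (hat Z z r).eval ξ = 0 ↔ ∃ u ∈ Z, Lead (u - z) r ξ := by
  classical
  rw [hat, Polynomial.eval_prod, Finset.prod_eq_zero_iff]
  refine exists_congr fun u => and_congr_right fun _ => ?_
  unfold hatF
  split_ifs with h
  · have h' : Ge (u - z) r := by simpa using h.neg
    simp only [Polynomial.eval_sub, Polynomial.eval_X, Polynomial.eval_C, sub_eq_zero]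
    exact ⟨fun e => ⟨h', e.symm⟩, fun e => e.2.symm⟩
  · simp only [Polynomial.eval_C]
    refine ⟨fun e => absurd e (leadingCoeff_ne (ne_zero_of_not_ge h)), fun e => ?_⟩
    exact absurd (by simpa using e.ge.neg) h

theorem hat_natDegree (Z : Finset HS) (z : HS) (r : ℝ) :
    (hat Z z r).natDegree = Nge Z z r := by
  classical
  rw [hat, Polynomial.natDegree_prod _ _ fun u _ => hatF_ne_zero z r u, Nge, Finset.card_filter]
  refine Finset.sum_congr rfl fun u _ => ?_
  unfold hatF
  split_ifs
  · exact Polynomial.natDegree_X_sub_C _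
  · exact Polynomial.natDegree_C _

/-- Root sets of two `y`-monic polynomials with constant Jacobian determinant `κ`. -/
structure KPair (Zp Zq : Finset HS) (κ : ℂ) : Prop where
  kappa_ne : κ ≠ 0
  key : ∀ y : HS, dx (pf Zp y) * pd Zq y - pd Zp y * dx (pf Zq y) = HahnSeries.C κ
  card_pos : 0 < Zq.card
  card_lt : Zq.card < Zp.card

/-- The defect of the disc of centre `z` and radius `r`. -/
noncomputable def ff (Zp Zq : Finset HS) (z : HS) (r : ℝ) : ℝ := r - Av Zp z r - Av Zq z r - 1

/-- No disc strictly containing the disc of centre `z` and radius `r` is terminal. -/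
def Unt (Zp Zq : Finset HS) (z : HS) (r : ℝ) : Prop :=
  ∀ s < r, 0 < ff Zp Zq z s ∧ Av Zp z s < 0

/-- The disc of centre `z` and radius `r` is terminal. -/
def Term (Zp Zq : Finset HS) (z : HS) (r : ℝ) : Prop :=
  Unt Zp Zq z r ∧ (ff Zp Zq z r = 0 ∨ Av Zp z r = 0)

theorem continuous_ff (Zp Zq : Finset HS) (z : HS) : Continuous (ff Zp Zq z) := by
  have := continuous_Av Zp z
  have := continuous_Av Zq z
  unfold ff
  fun_prop

theorem eventually_gt_right (Z : Finset HS) (z : HS) (s : ℝ) :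
    ∀ᶠ s' in nhdsWithin s (Set.Ioi s), ∀ u ∈ Z, Gt (z - u) s → Gt (z - u) s' := by
  rw [Filter.eventually_all_finset]
  intro u _
  by_cases h : Gt (z - u) s
  · by_cases h0 : z - u = 0
    · exact Eventually.of_forall fun s' _ a _ => by rw [h0]; rfl
    · have h1 := (gt_iff_order h0).1 h
      have : ∀ᶠ s' in nhdsWithin s (Set.Ioi s), s' < (z - u).order :=
        mem_nhdsWithin_of_mem_nhds (Iio_mem_nhds h1)
      filter_upwards [this] with s' hs' _
      exact (gt_iff_order h0).2 hs'
  · exact Eventually.of_forall fun s' h' => absurd h' h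

theorem eventually_ge_left (Z : Finset HS) (z : HS) (r : ℝ) :
    ∀ᶠ s in nhdsWithin r (Set.Iio r), ∀ u ∈ Z, Ge (z - u) s → Ge (z - u) r := by
  rw [Filter.eventually_all_finset]
  intro u _
  by_cases h : Ge (z - u) r
  · exact Eventually.of_forall fun s' _ => h
  · have h0 := ne_zero_of_not_ge h
    have h1 := h
    rw [ge_iff_order h0, not_le] at h1
    have : ∀ᶠ s' in nhdsWithin r (Set.Iio r), (z - u).order < s' :=
      mem_nhdsWithin_of_mem_nhds (Ioi_mem_nhds h1)
    filter_upwards [this] with s' hs' hh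
    exact absurd ((ge_iff_order h0).1 hh) (not_le.2 hs')

theorem eventually_ge_atBot (Z : Finset HS) (z : HS) :
    ∀ᶠ s in atBot, ∀ u ∈ Z, Ge (z - u) s := by
  rw [Filter.eventually_all_finset]
  intro u _
  by_cases h0 : z - u = 0
  · exact Eventually.of_forall fun s' => by rw [h0]; exact ge_zero _
  · filter_upwards [eventually_le_atBot (z - u).order] with s hs
    exact (ge_iff_order h0).2 hs

namespace KPair

variable {Zp Zq : Finset HS} {κ : ℂ} (K : KPair Zp Zq κ)
include K

theorem lead_key (z : HS) (r : ℝ) (ξ : ℂ) :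
    Lead (HahnSeries.C κ) (-ff Zp Zq z r)
      (Av Zq z r * (hat Zp z r).derivative.eval ξ * (hat Zq z r).eval ξ -
        Av Zp z r * (hat Zp z r).eval ξ * (hat Zq z r).derivative.eval ξ) := by
  have h : Lead (z + HahnSeries.single r ξ - z) r ξ := by
    rw [add_sub_cancel_left]; exact lead_single r ξ
  rw [← K.key (z + HahnSeries.single r ξ)]
  have h1 := (lead_pf Zp h).dx.mul (lead_pd Zq h)
  have h2 := (lead_pd Zp h).mul (lead_pf Zq h).dx
  rw [show Av Zp z r + 1 + (Av Zq z r - r) = -ff Zp Zq z r by unfold ff; ring] at h1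
  rw [show Av Zp z r - r + (Av Zq z r + 1) = -ff Zp Zq z r by unfold ff; ring] at h2
  convert h1.sub h2 using 1
  ring

theorem ff_nonneg (z : HS) (r : ℝ) : 0 ≤ ff Zp Zq z r := by
  have := (K.lead_key z r 0).exp_le (lead_C κ) K.kappa_ne
  linarith

theorem wronskian_eq_zero {z : HS} {r : ℝ} (h : 0 < ff Zp Zq z r) (ξ : ℂ) :
    (Av Zq z r * (hat Zp z r).derivative.eval ξ * (hat Zq z r).eval ξ : ℂ) =
        Av Zp z r * (hat Zp z r).eval ξ * (hat Zq z r).derivative.eval ξ := by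
  have := (K.lead_key z r ξ).2
  rw [(lead_C κ).1 _ (by linarith)] at this
  exact (sub_eq_zero.1 this.symm)

theorem wronskian_eq {z : HS} {r : ℝ} (h : ff Zp Zq z r = 0) (ξ : ℂ) :
    (Av Zq z r * (hat Zp z r).derivative.eval ξ * (hat Zq z r).eval ξ -
        Av Zp z r * (hat Zp z r).eval ξ * (hat Zq z r).derivative.eval ξ : ℂ) = κ := by
  have := K.lead_key z r ξ
  rw [h, neg_zero] at this
  exact this.unique (lead_C κ)

theorem slope_generic {z : HS} {r : ℝ} (h : 0 < ff Zp Zq z r)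
    (hp : ∀ u ∈ Zp, Ge (z - u) r → Gt (z - u) r) (hq : ∀ u ∈ Zq, Ge (z - u) r → Gt (z - u) r) :
    Av Zq z r * Ngt Zp z r = Av Zp z r * Ngt Zq z r := by
  obtain ⟨c, hc, hc'⟩ := hat_generic Zp hp
  obtain ⟨e, he, he'⟩ := hat_generic Zq hq
  have := K.wronskian_eq_zero h 1
  rw [hc', he'] at this
  simp [Polynomial.derivative_X_pow] at this
  have h2 : (Av Zq z r * Ngt Zp z r : ℂ) = Av Zp z r * Ngt Zq z r := by
    apply mul_right_cancel₀ (mul_ne_zero hc he)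
    linear_combination this
  exact_mod_cast h2

theorem slope {z : HS} {s : ℝ} (h : ∀ᶠ s' in nhdsWithin s (Set.Ioi s), 0 < ff Zp Zq z s') :
    Av Zq z s * Ngt Zp z s = Av Zp z s * Ngt Zq z s := by
  classical
  have hq := ((continuous_Av Zq z).tendsto s).mono_left (nhdsWithin_le_nhds (s := Set.Ioi s))
  have hp := ((continuous_Av Zp z).tendsto s).mono_left (nhdsWithin_le_nhds (s := Set.Ioi s))
  refine tendsto_nhds_unique_of_eventuallyEq (hq.mul_const (Ngt Zp z s : ℝ))
    (hp.mul_const (Ngt Zq z s : ℝ)) ?_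
  filter_upwards [h, eventually_gt_right Zp z s, eventually_gt_right Zq z s,
    self_mem_nhdsWithin] with s' hs hp hq hlt
  have hlt : s < s' := hlt
  have e : ∀ Z : Finset HS, (∀ u ∈ Z, Gt (z - u) s → Gt (z - u) s') →
      Ngt Z z s = Ngt Z z s' := by
    intro Z hZ
    unfold Ngt
    congr 1
    refine Finset.filter_congr fun u hu => ⟨hZ u hu, fun h => h.mono hlt.le⟩
  rw [e Zp hp, e Zq hq]
  exact K.slope_generic hs (fun u hu h => hp u hu (h.gt hlt)) fun u hu h => hq u hu (h.gt hlt)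

omit K in
theorem hasDerivWithinAt_Av (Z : Finset HS) (z : HS) (s : ℝ) :
    HasDerivWithinAt (Av Z z) (Ngt Z z s) (Set.Ici s) s := by
  have h1 : HasDerivWithinAt (fun s' => Av Z z s + Ngt Z z s * (s' - s)) (Ngt Z z s)
      (Set.Ioi s) s := by
    have := (((hasDerivAt_id s).sub_const s).const_mul (Ngt Z z s : ℝ)).const_add (Av Z z s)
    simpa using this.hasDerivWithinAt
  rw [← hasDerivWithinAt_Ioi_iff_Ici]
  refine h1.congr_of_eventuallyEq ?_ (by simp)
  filter_upwards [eventually_gt_right Z z s, self_mem_nhdsWithin] with s' h hlt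
  exact Av_linear Z (le_of_lt hlt) fun u hu hh => (h u hu hh).ge

theorem unt_ratio {z : HS} {r : ℝ} (h : Unt Zp Zq z r) {s : ℝ} (hs : s < r) :
    (Zq.card : ℝ) * Av Zp z s = Zp.card * Av Zq z s := by
  obtain ⟨s0, hs0⟩ := (((eventually_ge_atBot Zp z).and (eventually_ge_atBot Zq z)).and
    ((eventually_le_atBot s).and (eventually_lt_atBot 0))).exists
  obtain ⟨⟨hp, hq⟩, h1, h2⟩ := hs0
  have hA0 := Av_of_forall_ge Zp hp
  have hB0 := Av_of_forall_ge Zq hq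
  have hne : ∀ x ∈ Set.Icc s0 s, Av Zp z x ≠ 0 := fun x hx => (h x (hx.2.trans_lt hs)).2.ne
  have := constant_of_has_deriv_right_zero (f := fun x => Av Zq z x / Av Zp z x) (a := s0) (b := s)
    ((continuous_Av Zq z).continuousOn.div (continuous_Av Zp z).continuousOn hne) (by
      intro x hx
      have hx' : x < r := hx.2.trans hs
      have hd := (hasDerivWithinAt_Av Zq z x).div (hasDerivWithinAt_Av Zp z x)
        (hne x ⟨hx.1, hx.2.le⟩)
      have hs := K.slope (z := z) (s := x) (by
        filter_upwards [mem_nhdsWithin_of_mem_nhds (Iio_mem_nhds hx')] with s' hs'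
        exact (h s' hs').1)
      rw [mul_comm (Ngt Zq z x : ℝ), ← hs, sub_self, zero_div] at hd
      exact hd) s ⟨h1, le_rfl⟩
  have hp0 : (0 : ℝ) < Zp.card := by exact_mod_cast K.card_pos.trans K.card_lt
  have e1 := hne s ⟨h1, le_rfl⟩
  simp only [hA0, hB0] at this
  rw [mul_div_mul_right _ _ h2.ne, div_eq_div_iff e1 hp0.ne'] at this
  linarith

theorem ratio {z : HS} {r : ℝ} (h : Unt Zp Zq z r) :
    (Zq.card : ℝ) * Av Zp z r = Zp.card * Av Zq z r := by
  have hq := ((continuous_Av Zq z).tendsto r).mono_left (nhdsWithin_le_nhds (s := Set.Iio r))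
  have hp := ((continuous_Av Zp z).tendsto r).mono_left (nhdsWithin_le_nhds (s := Set.Iio r))
  refine tendsto_nhds_unique_of_eventuallyEq (hp.const_mul (Zq.card : ℝ))
    (hq.const_mul (Zp.card : ℝ)) ?_
  filter_upwards [self_mem_nhdsWithin] with s hs
  exact K.unt_ratio h hs

theorem card_ratio {z : HS} {r : ℝ} (h : Unt Zp Zq z r) :
    Zq.card * Nge Zp z r = Zp.card * Nge Zq z r := by
  classical
  obtain ⟨s, hs⟩ := (((eventually_ge_left Zp z r).and (eventually_ge_left Zq z r)).and
    (self_mem_nhdsWithin)).exists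
  obtain ⟨⟨hp, hq⟩, hlt⟩ := hs
  have hlt : s < r := hlt
  have e : ∀ Z : Finset HS, (∀ u ∈ Z, Ge (z - u) s → Ge (z - u) r) → Ngt Z z s = Nge Z z r := by
    intro Z hZ
    unfold Ngt Nge
    congr 1
    exact Finset.filter_congr fun u hu => ⟨fun h => hZ u hu h.ge, fun h => h.gt hlt⟩
  have h1 := Av_linear Zp (z := z) hlt.le fun u hu hh => hp u hu hh.ge
  have h2 := Av_linear Zq (z := z) hlt.le fun u hu hh => hq u hu hh.ge
  rw [e _ hp] at h1
  rw [e _ hq] at h2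
  have h3 := K.ratio h
  have h4 := K.unt_ratio h hlt
  rw [h1, h2] at h3
  have h5 : (Zq.card * Nge Zp z r : ℝ) = Zp.card * Nge Zq z r := by
    have : r - s ≠ 0 := by linarith
    apply mul_right_cancel₀ this
    linarith
  exact_mod_cast h5

omit K in
theorem _root_.KellerRational.Unt.Av_nonpos {z : HS} {r : ℝ} (h : Unt Zp Zq z r) :
    Av Zp z r ≤ 0 := by
  have hp := ((continuous_Av Zp z).tendsto r).mono_left (nhdsWithin_le_nhds (s := Set.Iio r))
  refine le_of_tendsto hp ?_
  filter_upwards [self_mem_nhdsWithin] with s hs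
  exact (h s hs).2.le

theorem exists_term {z : HS} (h : ∃ s, ¬ (0 < ff Zp Zq z s ∧ Av Zp z s < 0)) :
    ∃ r, Term Zp Zq z r := by
  set C : Set ℝ := {s | ff Zp Zq z s ≤ 0} ∪ {s | 0 ≤ Av Zp z s} with hC
  have hcl : IsClosed C := (isClosed_le (continuous_ff _ _ _) continuous_const).union
    (isClosed_le continuous_const (continuous_Av _ _))
  have hne : C.Nonempty := by
    obtain ⟨s, hs⟩ := h
    refine ⟨s, ?_⟩
    by_contra h1
    simp only [hC, Set.mem_union, Set.mem_ofPred_eq, not_or, not_le] at h1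
    exact hs h1
  have hp0 : (1 : ℝ) ≤ Zp.card := by exact_mod_cast K.card_pos.trans K.card_lt
  have hq0 : (1 : ℝ) ≤ Zq.card := by exact_mod_cast K.card_pos
  have hbd : BddBelow C := by
    obtain ⟨s0, hs0⟩ := ((((eventually_ge_atBot Zp z).and (eventually_ge_atBot Zq z)).and
      (eventually_lt_atBot (-1)))).exists
    refine ⟨s0, fun s hs => ?_⟩
    by_contra hlt
    rw [not_le] at hlt
    have e1 := Av_of_forall_ge Zp fun u hu => (hs0.1.1 u hu).mono hlt.le
    have e2 := Av_of_forall_ge Zq fun u hu => (hs0.1.2 u hu).mono hlt.le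
    have hs1 : s < -1 := hlt.trans hs0.2
    rcases hs with hs | hs
    · simp only [Set.mem_ofPred_eq, ff, e1, e2] at hs
      nlinarith
    · simp only [Set.mem_ofPred_eq, e1] at hs
      nlinarith
  have hU : Unt Zp Zq z (sInf C) := by
    intro s hs
    have := notMem_of_lt_csInf hs hbd
    simpa [hC] using this
  refine ⟨sInf C, hU, ?_⟩
  rcases hcl.csInf_mem hne hbd with h1 | h1
  · exact Or.inl (le_antisymm h1 (K.ff_nonneg _ _))
  · exact Or.inr (le_antisymm hU.Av_nonpos h1)

omit K in
theorem _root_.KellerRational.Term.unique {z : HS} {r r' : ℝ} (h : Term Zp Zq z r)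
    (h' : Term Zp Zq z r') : r = r' := by
  have aux : ∀ r r', Term Zp Zq z r → Term Zp Zq z r' → ¬ r < r' := by
    intro r r' h h' hlt
    have := h'.1 r hlt
    rcases h.2 with h | h <;> linarith
  exact le_antisymm (not_lt.1 (aux _ _ h' h)) (not_lt.1 (aux _ _ h h'))

omit K in
theorem _root_.KellerRational.ff_congr {z z' : HS} {r s : ℝ} (hz : Ge (z - z') r) (hs : s ≤ r) :
    ff Zp Zq z s = ff Zp Zq z' s := by
  rw [ff, ff, Av_congr Zp hz hs, Av_congr Zq hz hs]

omit K in
theorem _root_.KellerRational.Term.congr {z z' : HS} {r : ℝ} (h : Term Zp Zq z r)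
    (hz : Ge (z - z') r) : Term Zp Zq z' r := by
  refine ⟨fun s hs => ?_, ?_⟩
  · rw [← ff_congr hz hs.le, ← Av_congr Zp hz hs.le]; exact h.1 s hs
  · rw [← ff_congr hz le_rfl, ← Av_congr Zp hz le_rfl]; exact h.2

/-- Terminal discs are of two kinds. -/
theorem term_cases {z : HS} {r : ℝ} (h : Term Zp Zq z r) :
    (ff Zp Zq z r = 0 ∧ Av Zp z r < 0 ∧ Av Zq z r < 0) ∨
      (Av Zp z r = 0 ∧ Av Zq z r = 0 ∧ 0 < ff Zp Zq z r) := by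
  have hr := K.ratio h.1
  have hp0 : (0 : ℝ) < Zp.card := by exact_mod_cast K.card_pos.trans K.card_lt
  have hq0 : (0 : ℝ) < Zq.card := by exact_mod_cast K.card_pos
  rcases h.1.Av_nonpos.lt_or_eq with h1 | h1
  · left
    refine ⟨h.2.resolve_right h1.ne, h1, ?_⟩
    by_contra hB
    nlinarith
  · right
    have hB : Av Zq z r = 0 := by
      rw [h1, mul_zero] at hr
      rcases mul_eq_zero.1 hr.symm with h | h
      · exact absurd h hp0.ne'
      · exact h
    refine ⟨h1, hB, (K.ff_nonneg z r).lt_of_ne fun h0 => K.kappa_ne ?_⟩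
    rw [← K.wronskian_eq h0.symm 0, h1, hB]; simp

omit K in
theorem _root_.KellerRational.eventually_Av (Z : Finset HS) {z : HS} (hz : z ∉ Z) :
    ∀ᶠ s in atTop, Av Z z s = ∑ u ∈ Z, (z - u).order := by
  have : ∀ᶠ s : ℝ in atTop, ∀ u ∈ Z, (z - u).order ≤ s := by
    rw [Filter.eventually_all_finset]
    exact fun u _ => eventually_ge_atTop _
  filter_upwards [this] with s hs
  refine Finset.sum_congr rfl fun u hu => ?_
  have h0 : z - u ≠ 0 := sub_ne_zero.2 fun h => hz (h ▸ hu)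
  rw [mnv, if_neg h0, min_eq_left (hs u hu)]

omit K in
theorem _root_.KellerRational.tendsto_Av (Z : Finset HS) {z : HS} (hz : z ∈ Z) :
    Tendsto (Av Z z) atTop atTop := by
  classical
  have h1 := eventually_Av (Z.erase z) (z := z) (by simp)
  have h2 : Tendsto (fun s : ℝ => s + ∑ u ∈ Z.erase z, (z - u).order) atTop atTop :=
    tendsto_atTop_add_const_right _ _ tendsto_id
  refine h2.congr' ?_
  filter_upwards [h1] with s hs
  rw [← hs, Av, Av, ← Finset.add_sum_erase Z _ hz]
  simp [mnv]

omit K in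
theorem _root_.KellerRational.order_pf {Z : Finset HS} {z : HS} (hz : z ∉ Z) :
    Lead (pf Z z) (∑ u ∈ Z, (z - u).order) (∏ u ∈ Z, (z - u).leadingCoeff) :=
  Lead.prod Z fun _ hu => exists_lead (sub_ne_zero.2 fun h => hz (h ▸ hu))

theorem exists_term_of_mem_p {z : HS} (hz : z ∈ Zp) : ∃ r, Term Zp Zq z r := by
  refine K.exists_term ?_
  obtain ⟨s, hs⟩ := ((tendsto_Av Zp hz).eventually_ge_atTop 0).exists
  exact ⟨s, fun h => absurd h.2 (not_lt.2 hs)⟩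

theorem exists_term_of_eventually {z : HS} (hz : ∃ᶠ s in atTop, 0 ≤ Av Zq z s) :
    ∃ r, Term Zp Zq z r := by
  refine K.exists_term ?_
  by_contra hcon
  push Not at hcon
  obtain ⟨s, hs⟩ := hz.exists
  have := K.ratio (z := z) (r := s) fun s' _ => hcon s'
  have h1 := (hcon s).2
  have hp0 : (0 : ℝ) < Zp.card := by exact_mod_cast K.card_pos.trans K.card_lt
  have hq0 : (0 : ℝ) < Zq.card := by exact_mod_cast K.card_pos
  nlinarith [mul_nonneg hp0.le hs, mul_neg_of_pos_of_neg hq0 h1]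

theorem exists_term_of_mem_q {z : HS} (hz : z ∈ Zq) : ∃ r, Term Zp Zq z r :=
  K.exists_term_of_eventually ((tendsto_Av Zq hz).eventually_ge_atTop 0).frequently

end KPair

/-- The truncation of a series to exponents below `r`. -/
noncomputable def tr (r : ℝ) (y : HS) : HS := open Classical in twist (fun a => if a < r then 1 else 0) y

theorem tr_coeff (r : ℝ) (y : HS) (a : ℝ) :
    (tr r y).coeff a = open Classical in if a < r then y.coeff a else 0 := by
  classical
  rw [tr, twist_coeff]; split_ifs <;> simp

theorem ge_sub_tr (r : ℝ) (y : HS) : Ge (y - tr r y) r := by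
  intro a ha
  rw [HahnSeries.coeff_sub, tr_coeff, if_pos ha, sub_self]

theorem tr_congr {r : ℝ} {y y' : HS} (h : Ge (y - y') r) : tr r y = tr r y' := by
  ext a
  rw [tr_coeff, tr_coeff]
  split_ifs with ha
  · have := h a ha
    rwa [HahnSeries.coeff_sub, sub_eq_zero] at this
  · rfl

/-- The ramification index of a series. -/
noncomputable def nu (y : HS) : ℕ := Function.minimalPeriod sigma y

theorem nu_dvd_iff {y : HS} {j : ℕ} : nu y ∣ j ↔ sigma^[j] y = y :=
  (Function.isPeriodicPt_iff_minimalPeriod_dvd).symm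

theorem nu_dvd_iff' {y : HS} {j : ℕ} :
    nu y ∣ j ↔ ∀ a, y.coeff a ≠ 0 → ∃ n : ℤ, j * a = n :=
  nu_dvd_iff.trans (sigma_iterate_eq_iff j y)

theorem nu_sigma (y : HS) : nu (sigma y) = nu y := by
  apply Nat.dvd_antisymm
  · rw [nu_dvd_iff, ← Function.iterate_succ_apply, Function.iterate_succ_apply',
      nu_dvd_iff.1 dvd_rfl]
  · rw [nu_dvd_iff]
    apply sigma_injective
    rw [← Function.iterate_succ_apply' sigma, Function.iterate_succ_apply, nu_dvd_iff.1 dvd_rfl]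

theorem exp_mem {y : HS} {e : ℝ} {α : ℂ} (h : Lead y e α) (hα : α ≠ 0) {j : ℕ}
    (hj : sigma^[j] y = y) : ∃ n : ℤ, j * e = n :=
  (sigma_iterate_eq_iff j y).1 hj e (by rw [h.2]; exact hα)

/-- The set `Z` is stable under `sigma`. -/
def Stab (Z : Finset HS) : Prop := ∀ u ∈ Z, sigma u ∈ Z

namespace Stab

variable {Z : Finset HS} (hZ : Stab Z)
include hZ

theorem iterate {u : HS} (hu : u ∈ Z) (j : ℕ) : sigma^[j] u ∈ Z := by
  induction j with
  | zero => exact hu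
  | succ j ih => rw [Function.iterate_succ_apply']; exact hZ _ ih

theorem nu_pos {u : HS} (hu : u ∈ Z) : 0 < nu u := by
  obtain ⟨i, j, hij, h⟩ := Finite.exists_ne_map_eq_of_infinite
    (fun j : ℕ => (⟨sigma^[j] u, hZ.iterate hu j⟩ : Z))
  have h : sigma^[i] u = sigma^[j] u := congrArg Subtype.val h
  have aux : ∀ i j : ℕ, i < j → sigma^[i] u = sigma^[j] u → 0 < nu u := by
    intro i j hlt h
    have h1 : sigma^[j - i] u = u := by
      apply sigma_injective.iterate i
      rw [← Function.iterate_add_apply, Nat.add_sub_cancel' hlt.le, h]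
    exact Nat.pos_of_dvd_of_pos (nu_dvd_iff.2 h1) (by omega)
  rcases lt_or_gt_of_ne hij with h1 | h1
  · exact aux _ _ h1 h
  · exact aux _ _ h1 h.symm

theorem image : open Classical in Z.image sigma = Z := by
  classical
  apply Finset.eq_of_subset_of_card_le
  · intro x hx
    obtain ⟨u, hu, rfl⟩ := Finset.mem_image.1 hx
    exact hZ u hu
  · rw [Finset.card_image_of_injective _ sigma_injective]

theorem sigma_pf (y : HS) : sigma (pf Z y) = pf Z (sigma y) := by
  classical
  conv_rhs => rw [pf, ← hZ.image]
  rw [Finset.prod_image fun _ _ _ _ h => sigma_injective h, pf, map_prod]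
  simp

theorem sigma_pd (y : HS) : sigma (pd Z y) = pd Z (sigma y) := by
  classical
  conv_rhs => rw [pd, ← hZ.image]
  rw [Finset.sum_image fun _ _ _ _ h => sigma_injective h, pd, map_sum]
  refine Finset.sum_congr rfl fun u _ => ?_
  rw [← Finset.image_erase sigma_injective, Finset.prod_image fun _ _ _ _ h => sigma_injective h,
    map_prod]
  simp

theorem iterate_pf {y : HS} {j : ℕ} (h : sigma^[j] y = y) : sigma^[j] (pf Z y) = pf Z y := by
  have : ∀ j : ℕ, sigma^[j] (pf Z y) = pf Z (sigma^[j] y) := by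
    intro j
    induction j with
    | zero => rfl
    | succ j ih => rw [Function.iterate_succ_apply', Function.iterate_succ_apply', ih, hZ.sigma_pf]
  rw [this, h]

theorem iterate_pd {y : HS} {j : ℕ} (h : sigma^[j] y = y) : sigma^[j] (pd Z y) = pd Z y := by
  have : ∀ j : ℕ, sigma^[j] (pd Z y) = pd Z (sigma^[j] y) := by
    intro j
    induction j with
    | zero => rfl
    | succ j ih => rw [Function.iterate_succ_apply', Function.iterate_succ_apply', ih, hZ.sigma_pd]
  rw [this, h]

omit hZ in
theorem orbit_card {u : HS} : open Classical in
    ((Finset.range (nu u)).image fun j => sigma^[j] u).card = nu u := by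
  classical
  rw [Finset.card_image_of_injOn, Finset.card_range]
  intro i hi j hj h
  simp only [Finset.coe_range, Set.mem_Iio] at hi hj
  exact (Function.iterate_eq_iterate_iff_of_lt_minimalPeriod hi hj).1 h

omit hZ in
theorem iterate_invariant {g : HS → ℝ} (hg : ∀ y, g (sigma y) = g y) (u : HS) (j : ℕ) :
    g (sigma^[j] u) = g u := by
  induction j with
  | zero => rfl
  | succ j ih => rw [Function.iterate_succ_apply', hg, ih]

theorem orbit_sum_le {g : HS → ℝ} (hg : ∀ y, g (sigma y) = g y) (h0 : ∀ u ∈ Z, 0 ≤ g u)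
    {u : HS} (hu : u ∈ Z) : nu u * g u ≤ ∑ v ∈ Z, g v := by
  classical
  calc nu u * g u = ∑ v ∈ (Finset.range (nu u)).image fun j => sigma^[j] u, g v := by
        rw [Finset.sum_congr rfl (g := fun _ => g u), Finset.sum_const, orbit_card, nsmul_eq_mul]
        intro v hv
        obtain ⟨j, _, rfl⟩ := Finset.mem_image.1 hv
        exact iterate_invariant hg u j
    _ ≤ _ := by
        apply Finset.sum_le_sum_of_subset_of_nonneg
        · intro v hv
          obtain ⟨j, _, rfl⟩ := Finset.mem_image.1 hv
          exact hZ.iterate hu j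
        · exact fun v hv _ => h0 v hv

theorem two_orbits {g : HS → ℝ} (hg : ∀ y, g (sigma y) = g y) (h0 : ∀ u ∈ Z, 0 ≤ g u)
    {u v : HS} (hu : u ∈ Z) (hv : v ∈ Z) (huv : ∀ j : ℕ, sigma^[j] u ≠ v) :
    nu u * g u + nu v * g v ≤ ∑ v ∈ Z, g v := by
  classical
  set O := (Finset.range (nu u)).image fun j => sigma^[j] u with hO
  have hsub : O ⊆ Z := by
    intro v hv
    obtain ⟨j, _, rfl⟩ := Finset.mem_image.1 hv
    exact hZ.iterate hu j
  have memO : ∀ w, w ∈ O ↔ ∃ j : ℕ, sigma^[j] u = w := by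
    intro w
    constructor
    · intro hw
      obtain ⟨j, _, rfl⟩ := Finset.mem_image.1 hw
      exact ⟨j, rfl⟩
    · rintro ⟨j, rfl⟩
      exact Finset.mem_image.2 ⟨j % nu u, Finset.mem_range.2 (Nat.mod_lt _ (hZ.nu_pos hu)),
        Function.iterate_mod_minimalPeriod_eq⟩
  have hst : Stab (Z \ O) := by
    intro w hw
    rw [Finset.mem_sdiff] at hw ⊢
    refine ⟨hZ w hw.1, fun h => hw.2 ?_⟩
    obtain ⟨j, hj⟩ := (memO _).1 h
    refine (memO _).2 ⟨j + nu u - 1, ?_⟩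
    apply sigma_injective
    rw [← Function.iterate_succ_apply' sigma, ← hj]
    rw [show (j + nu u - 1).succ = j + nu u by have := hZ.nu_pos hu; omega,
      Function.iterate_add_apply, nu_dvd_iff.1 dvd_rfl]
  have h1 := hst.orbit_sum_le hg (fun w hw => h0 w (Finset.mem_sdiff.1 hw).1)
    (u := v) (Finset.mem_sdiff.2 ⟨hv, fun h => by obtain ⟨j, hj⟩ := (memO _).1 h; exact huv j hj⟩)
  have h2 : ∑ w ∈ O, g w = nu u * g u := by
    rw [Finset.sum_congr rfl (g := fun _ => g u), Finset.sum_const, orbit_card, nsmul_eq_mul]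
    intro v hv
    obtain ⟨j, rfl⟩ := (memO _).1 hv
    exact iterate_invariant hg u j
  rw [← Finset.sum_sdiff hsub, h2]
  linarith

end Stab

/-- A `KPair` with roots stable under monodromy and separated by terminal discs. -/
structure KTree (Zp Zq : Finset HS) (κ : ℂ) : Prop extends KPair Zp Zq κ where
  sigP : Stab Zp
  sigQ : Stab Zq
  gen : ∀ z r, Term Zp Zq z r → Av Zp z r = 0 → ∀ ξ,
    ((hat Zp z r).eval ξ = 0 → (hat Zp z r).derivative.eval ξ ≠ 0 ∧ (hat Zq z r).eval ξ ≠ 0) ∧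
    ((hat Zq z r).eval ξ = 0 → (hat Zq z r).derivative.eval ξ ≠ 0)

open Classical in
/-- The terminal radius. -/
noncomputable def rad (Zp Zq : Finset HS) (z : HS) : ℝ :=
  if h : ∃ r, Term Zp Zq z r then h.choose else 0

theorem Term.rad_eq {Zp Zq : Finset HS} {z : HS} {r : ℝ} (h : Term Zp Zq z r) :
    rad Zp Zq z = r := by
  have h' : ∃ r, Term Zp Zq z r := ⟨r, h⟩
  rw [rad, dif_pos h']
  exact h'.choose_spec.unique h

theorem mnv_sigma (y : HS) (r : ℝ) : mnv (sigma y) r = mnv y r := by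
  by_cases h : Ge y r
  · rw [mnv_of_ge h, mnv_of_ge (ge_sigma_iff.2 h)]
  · have h' : ¬ Ge (sigma y) r := fun h' => h (ge_sigma_iff.1 h')
    rw [mnv_of_not_ge h, mnv_of_not_ge h']
    have h0 := ne_zero_of_not_ge h
    exact (lead_sigma (exists_lead h0)).order_eq (mul_ne_zero (chr_ne_zero _) (leadingCoeff_ne h0))

theorem Stab.Av_sigma {Z : Finset HS} (hZ : Stab Z) (z : HS) (r : ℝ) :
    Av Z (sigma z) r = Av Z z r := by
  classical
  conv_lhs => rw [Av, ← hZ.image]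
  rw [Finset.sum_image fun _ _ _ _ h => sigma_injective h, Av]
  refine Finset.sum_congr rfl fun u _ => ?_
  rw [← map_sub, mnv_sigma]

namespace KTree

variable {Zp Zq : Finset HS} {κ : ℂ} (T : KTree Zp Zq κ)
include T

theorem sep {z : HS} {r : ℝ} (h : Term Zp Zq z r) (ξ : ℂ) :
    ((hat Zp z r).eval ξ = 0 → (hat Zp z r).derivative.eval ξ ≠ 0 ∧ (hat Zq z r).eval ξ ≠ 0) ∧
    ((hat Zq z r).eval ξ = 0 → (hat Zq z r).derivative.eval ξ ≠ 0) := by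
  rcases T.term_cases h with h1 | h1
  · have := T.wronskian_eq h1.1 ξ
    refine ⟨fun h0 => ?_, fun h0 h2 => ?_⟩
    · constructor <;>
      · intro h2; rw [h0, h2] at this; exact T.kappa_ne (by rw [← this]; ring)
    · rw [h0, h2] at this; exact T.kappa_ne (by rw [← this]; ring)
  · exact T.gen z r h h1.1 ξ

theorem term_p {u : HS} (hu : u ∈ Zp) : Term Zp Zq u (rad Zp Zq u) := by
  obtain ⟨r, hr⟩ := T.exists_term_of_mem_p hu
  rwa [hr.rad_eq]

theorem term_q {u : HS} (hu : u ∈ Zq) : Term Zp Zq u (rad Zp Zq u) := by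
  obtain ⟨r, hr⟩ := T.exists_term_of_mem_q hu
  rwa [hr.rad_eq]

theorem term_sigma_iff (z : HS) (r : ℝ) : Term Zp Zq (sigma z) r ↔ Term Zp Zq z r := by
  simp only [Term, Unt, ff, T.sigP.Av_sigma, T.sigQ.Av_sigma]

theorem rad_sigma (z : HS) : rad Zp Zq (sigma z) = rad Zp Zq z := by
  by_cases h : ∃ r, Term Zp Zq z r
  · obtain ⟨r, hr⟩ := h
    rw [hr.rad_eq, ((T.term_sigma_iff z r).2 hr).rad_eq]
  · rw [rad, rad, dif_neg h, dif_neg fun ⟨r, hr⟩ => h ⟨r, (T.term_sigma_iff z r).1 hr⟩]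

omit T in
theorem _root_.KellerRational.Term.eq_of_gt {z u v : HS} {r : ℝ} {Z : Finset HS}
    (hs : ∀ ξ, (hat Z z r).eval ξ = 0 → (hat Z z r).derivative.eval ξ ≠ 0)
    (hu : u ∈ Z) (hv : v ∈ Z) (hzu : Ge (z - u) r)
    (huv : Gt (u - v) r) : u = v := by
  classical
  have hzv : Ge (z - v) r := by simpa using hzu.add huv.ge
  have e : (u - z).coeff r = (v - z).coeff r := by
    have := huv r le_rfl
    simp only [HahnSeries.coeff_sub, sub_eq_zero] at this ⊢
    rw [this]
  by_contra hne
  have h0 : (hat Z z r).eval ((u - z).coeff r) = 0 :=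
    (hat_eval_eq_zero_iff _ _ _ _).2 ⟨u, hu, by have := hzu.neg; rwa [neg_sub] at this, rfl⟩
  refine hs _ h0 ?_
  have h1 : hat Z z r = hatF z r u * (hatF z r v * ∏ w ∈ (Z.erase u).erase v, hatF z r w) := by
    rw [hat, ← Finset.mul_prod_erase Z _ hu, ← Finset.mul_prod_erase (Z.erase u) _
      (Finset.mem_erase.2 ⟨Ne.symm hne, hv⟩)]
  have e1 : (hatF z r u).eval ((u - z).coeff r) = 0 := by simp [hatF, hzu]
  have e2 : (hatF z r v).eval ((u - z).coeff r) = 0 := by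
    rw [e]; simp [hatF, hzv]
  rw [h1, Polynomial.derivative_mul, Polynomial.eval_add, Polynomial.eval_mul, Polynomial.eval_mul,
    Polynomial.eval_mul, e1, e2]
  ring

theorem double_count {g : HS → ℝ}
    (hg : ∀ u ∈ Zp, ∀ w ∈ Zq, Ge (u - w) (rad Zp Zq u) → g u = g w) :
    (Zq.card : ℝ) * ∑ u ∈ Zp, g u = Zp.card * ∑ w ∈ Zq, g w := by
  classical
  have hrad : ∀ u ∈ Zp, ∀ w ∈ Zq, (Ge (u - w) (rad Zp Zq u) ↔ Ge (w - u) (rad Zp Zq w)) := by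
    intro u hu w hw
    constructor
    · intro h
      rw [((T.term_p hu).congr h).rad_eq]; simpa using h.neg
    · intro h
      rw [((T.term_q hw).congr h).rad_eq]; simpa using h.neg
  have hr : ∀ u ∈ Zp, ∀ w ∈ Zq, Ge (u - w) (rad Zp Zq u) → rad Zp Zq w = rad Zp Zq u :=
    fun u hu w hw h => ((T.term_p hu).congr h).rad_eq
  have hn : ∀ u, u ∈ Zp → (Zq.card : ℝ) * Nge Zp u (rad Zp Zq u) =
      Zp.card * Nge Zq u (rad Zp Zq u) := by
    intro u hu
    exact_mod_cast T.card_ratio (T.term_p hu).1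
  have hm : ∀ u, u ∈ Zq → (Zq.card : ℝ) * Nge Zp u (rad Zp Zq u) =
      Zp.card * Nge Zq u (rad Zp Zq u) := by
    intro u hu
    exact_mod_cast T.card_ratio (T.term_q hu).1
  have hp0 : (0 : ℝ) < Zp.card := by exact_mod_cast T.card_pos.trans T.card_lt
  have hq0 : (0 : ℝ) < Zq.card := by exact_mod_cast T.card_pos
  have h1 : ∀ (Z : Finset HS), ∀ u ∈ Z, (0 : ℝ) < Nge Z u (rad Zp Zq u) := by
    intro Z u hu
    exact_mod_cast Finset.card_pos.2 ⟨u, Finset.mem_filter.2 ⟨hu, by simpa using ge_zero _⟩⟩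
  calc (Zq.card : ℝ) * ∑ u ∈ Zp, g u
      = ∑ u ∈ Zp, ∑ w ∈ Zq.filter (fun w => Ge (u - w) (rad Zp Zq u)),
          Zp.card * (g u / Nge Zp u (rad Zp Zq u)) := by
        rw [Finset.mul_sum]
        refine Finset.sum_congr rfl fun u hu => ?_
        rw [Finset.sum_const, nsmul_eq_mul]
        change _ = (Nge Zq u (rad Zp Zq u) : ℝ) * _
        have := h1 Zp u hu
        field_simp
        linear_combination (g u) * hn u hu
    _ = ∑ w ∈ Zq, ∑ u ∈ Zp.filter (fun u => Ge (w - u) (rad Zp Zq w)),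
          Zp.card * (g w / Nge Zp w (rad Zp Zq w)) := by
        simp only [Finset.sum_filter]
        rw [Finset.sum_comm]
        refine Finset.sum_congr rfl fun w hw => Finset.sum_congr rfl fun u hu => ?_
        by_cases h : Ge (u - w) (rad Zp Zq u)
        · rw [if_pos h, if_pos ((hrad u hu w hw).1 h), hg u hu w hw h, hr u hu w hw h,
            Nge_congr Zp h le_rfl]
        · rw [if_neg h, if_neg fun h' => h ((hrad u hu w hw).2 h')]
    _ = Zp.card * ∑ w ∈ Zq, g w := by
        rw [Finset.mul_sum]
        refine Finset.sum_congr rfl fun w hw => ?_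
        rw [Finset.sum_const, nsmul_eq_mul]
        change (Nge Zp w (rad Zp Zq w) : ℝ) * _ = _
        have h3 : (0 : ℝ) < Nge Zp w (rad Zp Zq w) := by
          have := h1 Zq w hw
          have h4 := hm w hw
          by_contra h5
          have h6 : (Nge Zp w (rad Zp Zq w) : ℝ) = 0 := le_antisymm (not_lt.1 h5) (by positivity)
          rw [h6, mul_zero] at h4
          exact (mul_pos hp0 this).ne h4
        field_simp

end KTree

theorem dvd_disc_iff (r : ℝ) (y : HS) (j : ℕ) :
    nu (tr r y + HahnSeries.single r 1) ∣ j ↔ nu (tr r y) ∣ j ∧ ∃ n : ℤ, j * r = n := by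
  classical
  have hr : (tr r y).coeff r = 0 := by rw [tr_coeff, if_neg (lt_irrefl r)]
  rw [nu_dvd_iff', nu_dvd_iff']
  constructor
  · intro h
    refine ⟨fun a ha => h a ?_, h r ?_⟩
    · have : a ≠ r := by rintro rfl; exact ha hr
      rwa [HahnSeries.coeff_add, HahnSeries.coeff_single_of_ne this, add_zero]
    · rw [HahnSeries.coeff_add, hr]; simp
  · rintro ⟨h1, h2⟩ a ha
    by_cases har : a = r
    · rw [har]; exact h2
    · rw [HahnSeries.coeff_add, HahnSeries.coeff_single_of_ne har, add_zero] at ha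
      exact h1 a ha

theorem Stab.nu_root {Z : Finset HS} (hZ : Stab Z) {u : HS} {r : ℝ} (hu : u ∈ Z)
    (hs : ∀ ξ, (hat Z u r).eval ξ = 0 → (hat Z u r).derivative.eval ξ ≠ 0) :
    nu u = open Classical in if u.coeff r = 0 then nu (tr r u)
      else nu (tr r u + HahnSeries.single r 1) := by
  classical
  have key : ∀ j, nu u ∣ j ↔ ∀ a ≤ r, u.coeff a ≠ 0 → ∃ n : ℤ, j * a = n := by
    intro j
    rw [nu_dvd_iff]
    constructor
    · intro h a _ ha
      exact (sigma_iterate_eq_iff j u).1 h a ha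
    · intro h
      refine (Term.eq_of_gt hs hu (hZ.iterate hu j) (by simpa using ge_zero r) ?_).symm
      intro a ha
      rw [HahnSeries.coeff_sub, sigma_iterate_coeff]
      by_cases h0 : u.coeff a = 0
      · simp [h0]
      · rw [(chr_eq_one_iff _).2 (h a ha h0), one_mul, sub_self]
  have h0 : ∀ j, nu (tr r u) ∣ j ↔ ∀ a < r, u.coeff a ≠ 0 → ∃ n : ℤ, j * a = n := by
    intro j
    rw [nu_dvd_iff']
    refine forall_congr' fun a => ?_
    rw [tr_coeff]
    split_ifs with h <;> simp [h]
  have main : ∀ n, (∀ j, nu u ∣ j ↔ n ∣ j) → nu u = n := fun n h =>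
    Nat.dvd_antisymm ((h n).2 dvd_rfl) ((h (nu u)).1 dvd_rfl)
  split_ifs with hr
  · refine main _ fun j => ?_
    rw [key, h0]
    refine ⟨fun h a ha => h a ha.le, fun h a ha ha' => ?_⟩
    rcases ha.lt_or_eq with h1 | rfl
    · exact h a h1 ha'
    · exact absurd hr ha'
  · refine main _ fun j => ?_
    rw [key, dvd_disc_iff, h0]
    refine ⟨fun h => ⟨fun a ha => h a ha.le, h r le_rfl hr⟩, fun h a ha ha' => ?_⟩
    rcases ha.lt_or_eq with h1 | rfl
    · exact h.1 a h1 ha'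
    · exact h.2

section defs

variable (Zp Zq : Finset HS) (z : HS)

/-- Generic order of the first function in the terminal disc. -/
noncomputable def ap : ℝ := Av Zp z (rad Zp Zq z)
/-- Generic order of the second function in the terminal disc. -/
noncomputable def bq : ℝ := Av Zq z (rad Zp Zq z)
/-- The defect of the terminal disc. -/
noncomputable def fd : ℝ := ff Zp Zq z (rad Zp Zq z)
/-- Ramification index of the centre of the terminal disc. -/
noncomputable def nu0 : ℕ := nu (tr (rad Zp Zq z) z)
/-- Ramification index of the generic point of the terminal disc. -/
noncomputable def nu1 : ℕ := nu (tr (rad Zp Zq z) z + HahnSeries.single (rad Zp Zq z) 1)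
open Classical in
/-- Excess of the inverse ramification index over that of a generic point. -/
noncomputable def ee : ℝ :=
  if z.coeff (rad Zp Zq z) = 0 then (1 : ℝ) / nu0 Zp Zq z - 1 / nu1 Zp Zq z else 0

end defs

theorem Term.class_eq {Zp Zq : Finset HS} {u w : HS} (h : Term Zp Zq u (rad Zp Zq u))
    (hw : Ge (u - w) (rad Zp Zq u)) :
    rad Zp Zq w = rad Zp Zq u ∧ ap Zp Zq w = ap Zp Zq u ∧ bq Zp Zq w = bq Zp Zq u ∧
    fd Zp Zq w = fd Zp Zq u ∧ nu0 Zp Zq w = nu0 Zp Zq u ∧ nu1 Zp Zq w = nu1 Zp Zq u := by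
  have hr : rad Zp Zq w = rad Zp Zq u := (h.congr hw).rad_eq
  refine ⟨hr, ?_, ?_, ?_, ?_, ?_⟩
  · rw [ap, ap, hr, Av_congr Zp hw le_rfl]
  · rw [bq, bq, hr, Av_congr Zq hw le_rfl]
  · rw [fd, fd, hr, ff_congr hw le_rfl]
  · rw [nu0, nu0, hr, tr_congr hw]
  · rw [nu1, nu1, hr, tr_congr hw]

theorem nu0_dvd_nu1 (Zp Zq : Finset HS) (z : HS) : nu0 Zp Zq z ∣ nu1 Zp Zq z :=
  ((dvd_disc_iff _ _ _).1 dvd_rfl).1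

namespace KTree

variable {Zp Zq : Finset HS} {κ : ℂ} (T : KTree Zp Zq κ)
include T

theorem simple_p {z : HS} {r : ℝ} (h : Term Zp Zq z r) :
    ∀ ξ, (hat Zp z r).eval ξ = 0 → (hat Zp z r).derivative.eval ξ ≠ 0 :=
  fun ξ h0 => ((T.sep h ξ).1 h0).1

theorem simple_q {z : HS} {r : ℝ} (h : Term Zp Zq z r) :
    ∀ ξ, (hat Zq z r).eval ξ = 0 → (hat Zq z r).derivative.eval ξ ≠ 0 :=
  fun ξ h0 => (T.sep h ξ).2 h0

omit T in
theorem lead_self (u : HS) (r : ℝ) : Lead (u - u) r 0 := by rw [sub_self]; exact lead_zero r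

omit T in
theorem hat_self {Z : Finset HS} {u : HS} (hu : u ∈ Z) (r : ℝ) : (hat Z u r).eval 0 = 0 :=
  (hat_eval_eq_zero_iff _ _ _ _).2 ⟨u, hu, lead_self u r⟩

theorem hat_q_ne {u : HS} (hu : u ∈ Zp) : (hat Zq u (rad Zp Zq u)).eval 0 ≠ 0 :=
  ((T.sep (T.term_p hu) 0).1 (hat_self hu _)).2

theorem hat_p_ne {w : HS} (hw : w ∈ Zq) : (hat Zp w (rad Zp Zq w)).eval 0 ≠ 0 := fun h =>
  ((T.sep (T.term_q hw) 0).1 h).2 (hat_self hw _)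

omit T in
theorem lead_q_at_p (u : HS) :
    Lead (pf Zq u) (bq Zp Zq u) ((hat Zq u (rad Zp Zq u)).eval 0) := lead_pf Zq (lead_self u _)

omit T in
theorem lead_p_at_q (w : HS) :
    Lead (pf Zp w) (ap Zp Zq w) ((hat Zp w (rad Zp Zq w)).eval 0) := lead_pf Zp (lead_self w _)

theorem int_bq {u : HS} (hu : u ∈ Zp) : ∃ n : ℤ, nu u * bq Zp Zq u = n :=
  exp_mem (lead_q_at_p u) (T.hat_q_ne hu) (T.sigQ.iterate_pf (nu_dvd_iff.1 dvd_rfl))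

theorem int_ap {w : HS} (hw : w ∈ Zq) : ∃ n : ℤ, nu w * ap Zp Zq w = n :=
  exp_mem (lead_p_at_q w) (T.hat_p_ne hw) (T.sigP.iterate_pf (nu_dvd_iff.1 dvd_rfl))

theorem int_dp {u : HS} (hu : u ∈ Zp) : ∃ n : ℤ, nu u * (ap Zp Zq u - rad Zp Zq u) = n :=
  exp_mem (lead_pd Zp (lead_self u _)) (T.simple_p (T.term_p hu) 0 (hat_self hu _))
    (T.sigP.iterate_pd (nu_dvd_iff.1 dvd_rfl))

theorem int_dq {w : HS} (hw : w ∈ Zq) : ∃ n : ℤ, nu w * (bq Zp Zq w - rad Zp Zq w) = n :=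
  exp_mem (lead_pd Zq (lead_self w _)) (T.simple_q (T.term_q hw) 0 (hat_self hw _))
    (T.sigQ.iterate_pd (nu_dvd_iff.1 dvd_rfl))

theorem nu_p {u : HS} (hu : u ∈ Zp) :
    nu u = open Classical in if u.coeff (rad Zp Zq u) = 0 then nu0 Zp Zq u else nu1 Zp Zq u :=
  T.sigP.nu_root hu (T.simple_p (T.term_p hu))

theorem nu_q {u : HS} (hu : u ∈ Zq) :
    nu u = open Classical in if u.coeff (rad Zp Zq u) = 0 then nu0 Zp Zq u else nu1 Zp Zq u :=
  T.sigQ.nu_root hu (T.simple_q (T.term_q hu))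

theorem ap_cases {z : HS} (h : Term Zp Zq z (rad Zp Zq z)) :
    (fd Zp Zq z = 0 ∧ ap Zp Zq z < 0 ∧ bq Zp Zq z < 0) ∨
      (ap Zp Zq z = 0 ∧ bq Zp Zq z = 0 ∧ 0 < fd Zp Zq z) := T.term_cases h

theorem ap_bq {z : HS} (h : Term Zp Zq z (rad Zp Zq z)) :
    (Zq.card : ℝ) * ap Zp Zq z = Zp.card * bq Zp Zq z := T.ratio h.1

theorem card_p_pos : (0 : ℝ) < Zp.card := by exact_mod_cast T.card_pos.trans T.card_lt

theorem card_q_pos : (0 : ℝ) < Zq.card := by exact_mod_cast T.card_pos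

theorem Np_Nq {z : HS} (h : Term Zp Zq z (rad Zp Zq z)) :
    Nge Zp z (rad Zp Zq z) = 0 ∧ Nge Zq z (rad Zp Zq z) = 0 ∨
    0 < Nge Zq z (rad Zp Zq z) ∧ Nge Zq z (rad Zp Zq z) < Nge Zp z (rad Zp Zq z) := by
  have := T.card_ratio h.1
  have h1 := T.card_pos
  have h2 := T.card_lt
  rcases Nat.eq_zero_or_pos (Nge Zq z (rad Zp Zq z)) with h0 | h0
  · left
    rw [h0, mul_zero] at this
    refine ⟨?_, h0⟩
    rcases Nat.mul_eq_zero.1 this with h | h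
    · omega
    · exact h
  · right
    refine ⟨h0, ?_⟩
    by_contra hle
    nlinarith

omit T in
theorem Nge_self_pos {Z : Finset HS} {z : HS} (hz : z ∈ Z) (r : ℝ) : 0 < Nge Z z r := by
  classical
  exact Finset.card_pos.2 ⟨z, Finset.mem_filter.2 ⟨hz, by simpa using ge_zero _⟩⟩

theorem exists_q_of_p {u : HS} (hu : u ∈ Zp) : ∃ w ∈ Zq, Ge (u - w) (rad Zp Zq u) := by
  classical
  have h0 := Nge_self_pos hu (rad Zp Zq u)
  have h1 : 0 < Nge Zq u (rad Zp Zq u) := by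
    rcases T.Np_Nq (T.term_p hu) with h | h
    · omega
    · exact h.1
  obtain ⟨w, hw⟩ := Finset.card_pos.1 h1
  rw [Finset.mem_filter] at hw
  exact ⟨w, hw⟩

/-- There is a root of the first function in the same terminal disc, not at its centre. -/
theorem exists_p_generic {z : HS} (h : Term Zp Zq z (rad Zp Zq z))
    (hN : 0 < Nge Zq z (rad Zp Zq z)) :
    ∃ u ∈ Zp, Ge (z - u) (rad Zp Zq z) ∧ u.coeff (rad Zp Zq z) ≠ 0 := by
  classical
  have h2 : 1 < Nge Zp z (rad Zp Zq z) := by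
    rcases T.Np_Nq h with h | h <;> omega
  obtain ⟨u, hu, v, hv, huv⟩ := Finset.one_lt_card.1 h2
  rw [Finset.mem_filter] at hu hv
  by_contra hcon
  push Not at hcon
  have e1 := hcon u hu.1 hu.2
  have e2 := hcon v hv.1 hv.2
  refine huv (Term.eq_of_gt (T.simple_p h) hu.1 hv.1 hu.2 (Lead.gt ⟨?_, ?_⟩))
  · have := hv.2.sub hu.2
    rw [sub_sub_sub_cancel_left] at this
    exact this
  · rw [HahnSeries.coeff_sub, e1, e2, sub_zero]

theorem nu1_eq_of_generic {z u : HS} (h : Term Zp Zq z (rad Zp Zq z)) (hu : u ∈ Zp)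
    (hzu : Ge (z - u) (rad Zp Zq z)) (hc : u.coeff (rad Zp Zq z) ≠ 0) : nu u = nu1 Zp Zq z := by
  obtain ⟨h1, -, -, -, -, h2⟩ := h.class_eq hzu
  rw [T.nu_p hu, if_neg (by rwa [h1]), h2]

theorem nu1_eq_of_generic_q {z u : HS} (h : Term Zp Zq z (rad Zp Zq z)) (hu : u ∈ Zq)
    (hzu : Ge (z - u) (rad Zp Zq z)) (hc : u.coeff (rad Zp Zq z) ≠ 0) : nu u = nu1 Zp Zq z := by
  obtain ⟨h1, -, -, -, -, h2⟩ := h.class_eq hzu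
  rw [T.nu_q hu, if_neg (by rwa [h1]), h2]

theorem nu1_pos {z : HS} (h : Term Zp Zq z (rad Zp Zq z)) (hN : 0 < Nge Zq z (rad Zp Zq z)) :
    0 < nu1 Zp Zq z := by
  obtain ⟨u, hu, hzu, hc⟩ := T.exists_p_generic h hN
  rw [← T.nu1_eq_of_generic h hu hzu hc]
  exact T.sigP.nu_pos hu

theorem Nq_pos_of_p {u : HS} (hu : u ∈ Zp) : 0 < Nge Zq u (rad Zp Zq u) := by
  have h0 := Nge_self_pos hu (rad Zp Zq u)
  rcases T.Np_Nq (T.term_p hu) with h | h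
  · omega
  · exact h.1

theorem nu0_pos {z : HS} (h : Term Zp Zq z (rad Zp Zq z)) (hN : 0 < Nge Zq z (rad Zp Zq z)) :
    0 < nu0 Zp Zq z :=
  Nat.pos_of_dvd_of_pos (nu0_dvd_nu1 _ _ _) (T.nu1_pos h hN)

theorem ee_nonneg {z : HS} (h : Term Zp Zq z (rad Zp Zq z))
    (hN : 0 < Nge Zq z (rad Zp Zq z)) : 0 ≤ ee Zp Zq z := by
  unfold ee
  split_ifs
  · have h0 : (0 : ℝ) < nu0 Zp Zq z := by exact_mod_cast T.nu0_pos h hN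
    have h1 : (nu0 Zp Zq z : ℝ) ≤ nu1 Zp Zq z := by
      exact_mod_cast Nat.le_of_dvd (T.nu1_pos h hN) (nu0_dvd_nu1 _ _ _)
    have := one_div_le_one_div_of_le h0 h1
    linarith
  · exact le_rfl

theorem inv_nu_p {u : HS} (hu : u ∈ Zp) : (1 : ℝ) / nu u = 1 / nu1 Zp Zq u + ee Zp Zq u := by
  rw [T.nu_p hu, ee]; split_ifs <;> ring

theorem inv_nu_q {u : HS} (hu : u ∈ Zq) : (1 : ℝ) / nu u = 1 / nu1 Zp Zq u + ee Zp Zq u := by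
  rw [T.nu_q hu, ee]; split_ifs <;> ring

omit T in
theorem nu1_eq_nu0_of_int {z : HS} (h : ∃ n : ℤ, nu0 Zp Zq z * rad Zp Zq z = n) :
    nu1 Zp Zq z = nu0 Zp Zq z :=
  Nat.dvd_antisymm ((dvd_disc_iff _ _ _).2 ⟨dvd_rfl, h⟩) (nu0_dvd_nu1 _ _ _)

/-- In a disc where neither function vanishes at the centre, there is no extra ramification. -/
theorem nu1_eq_nu0_of_no_center {z : HS}
    (hf : fd Zp Zq z = 0)
    (hp : ∀ u ∈ Zp, Ge (z - u) (rad Zp Zq z) → u.coeff (rad Zp Zq z) ≠ 0)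
    (hq : ∀ u ∈ Zq, Ge (z - u) (rad Zp Zq z) → u.coeff (rad Zp Zq z) ≠ 0) :
    nu1 Zp Zq z = nu0 Zp Zq z := by
  classical
  set r := rad Zp Zq z with hr
  have ht : Ge (z - tr r z) r := ge_sub_tr r z
  have hs : sigma^[nu (tr r z)] (tr r z) = tr r z := nu_dvd_iff.1 dvd_rfl
  have ex : ∀ Z : Finset HS, Stab Z → (∀ u ∈ Z, Ge (z - u) r → u.coeff r ≠ 0) →
      ∃ n : ℤ, nu (tr r z) * Av Z z r = n := by
    intro Z hZ hne
    rw [Av_congr Z ht le_rfl]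
    refine exp_mem (lead_pf Z (lead_self (tr r z) r)) ?_ (hZ.iterate_pf hs)
    intro h0
    obtain ⟨u, hu, hu'⟩ := (hat_eval_eq_zero_iff _ _ _ _).1 h0
    refine hne u hu ?_ ?_
    · have := ht.sub hu'.ge
      simpa using this
    · have := hu'.2
      rwa [HahnSeries.coeff_sub, tr_coeff, if_neg (lt_irrefl r), sub_zero] at this
  obtain ⟨n1, h1⟩ := ex Zp T.sigP hp
  obtain ⟨n2, h2⟩ := ex Zq T.sigQ hq
  refine nu1_eq_nu0_of_int ⟨n1 + n2 + nu (tr r z), ?_⟩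
  have e : r = Av Zp z r + Av Zq z r + 1 := by
    have : r - Av Zp z r - Av Zq z r - 1 = 0 := hf
    linarith
  rw [← hr, show nu0 Zp Zq z = nu (tr r z) from rfl]
  push_cast
  linear_combination (nu (tr r z) : ℝ) * e + h1 + h2

/-- Excess ramification only occurs in discs of the first kind. -/
theorem ee_eq_zero_of_fd {u : HS} (hu : u ∈ Zp ∨ u ∈ Zq) (hA : ap Zp Zq u = 0) :
    ee Zp Zq u = 0 := by
  unfold ee
  split_ifs with hc
  · have key : ∃ n : ℤ, nu0 Zp Zq u * rad Zp Zq u = n := by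
      rcases hu with hu | hu
      · obtain ⟨n, hn⟩ := T.int_dp hu
        rw [T.nu_p hu, if_pos hc, hA] at hn
        exact ⟨-n, by push_cast; rw [← hn]; ring⟩
      · obtain ⟨n, hn⟩ := T.int_dq hu
        have hB : bq Zp Zq u = 0 := by
          rcases T.ap_cases (T.term_q hu) with h | h
          · exact absurd hA h.2.1.ne
          · exact h.2.1
        rw [T.nu_q hu, if_pos hc, hB] at hn
        exact ⟨-n, by push_cast; rw [← hn]; ring⟩
    rw [nu1_eq_nu0_of_int key, sub_self]
  · rfl

theorem ap_sigma (z : HS) : ap Zp Zq (sigma z) = ap Zp Zq z := by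
  rw [ap, ap, T.rad_sigma, T.sigP.Av_sigma]

theorem bq_sigma (z : HS) : bq Zp Zq (sigma z) = bq Zp Zq z := by
  rw [bq, bq, T.rad_sigma, T.sigQ.Av_sigma]

/-- A pole of the second function on the first curve contributes at least one. -/
theorem one_le_p {u : HS} (hu : u ∈ Zp) (h : bq Zp Zq u < 0) : 1 ≤ nu u * -bq Zp Zq u := by
  obtain ⟨n, hn⟩ := T.int_bq hu
  have h0 : (0 : ℝ) < nu u := by exact_mod_cast T.sigP.nu_pos hu
  have : (0 : ℝ) < ((-n : ℤ) : ℝ) := by push_cast; rw [← hn]; nlinarith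
  have h1 : (1 : ℤ) ≤ -n := by
    have : (0 : ℤ) < -n := by exact_mod_cast this
    omega
  have h2 : (1 : ℝ) ≤ ((-n : ℤ) : ℝ) := by exact_mod_cast h1
  push_cast at h2
  rw [← hn] at h2; linarith

theorem one_le_q {w : HS} (hw : w ∈ Zq) (h : ap Zp Zq w < 0) : 1 ≤ nu w * -ap Zp Zq w := by
  obtain ⟨n, hn⟩ := T.int_ap hw
  have h0 : (0 : ℝ) < nu w := by exact_mod_cast T.sigQ.nu_pos hw
  have : (0 : ℝ) < ((-n : ℤ) : ℝ) := by push_cast; rw [← hn]; nlinarith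
  have h1 : (1 : ℤ) ≤ -n := by
    have : (0 : ℤ) < -n := by exact_mod_cast this
    omega
  have h2 : (1 : ℝ) ≤ ((-n : ℤ) : ℝ) := by exact_mod_cast h1
  push_cast at h2
  rw [← hn] at h2; linarith

theorem ap_nonpos {z : HS} (h : Term Zp Zq z (rad Zp Zq z)) : ap Zp Zq z ≤ 0 ∧ bq Zp Zq z ≤ 0 := by
  rcases T.ap_cases h with h | h
  · exact ⟨h.2.1.le, h.2.2.le⟩
  · exact ⟨h.1.le, h.2.1.le⟩

theorem sum_bq_eq_sum_ap : ∑ u ∈ Zp, bq Zp Zq u = ∑ w ∈ Zq, ap Zp Zq w := by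
  have h1 := T.double_count (g := ap Zp Zq)
    fun u hu w hw h => ((T.term_p hu).class_eq h).2.1.symm
  have h2 : (Zq.card : ℝ) * ∑ u ∈ Zp, ap Zp Zq u = Zp.card * ∑ u ∈ Zp, bq Zp Zq u := by
    rw [Finset.mul_sum, Finset.mul_sum]
    exact Finset.sum_congr rfl fun u hu => T.ap_bq (T.term_p hu)
  rw [h2] at h1
  exact mul_left_cancel₀ T.card_p_pos.ne' h1

end KTree

theorem tr_sigma (r : ℝ) (z : HS) : tr r (sigma z) = sigma (tr r z) := by
  ext a
  rw [tr_coeff, sigma_coeff, sigma_coeff, tr_coeff]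
  split_ifs <;> simp

/-- All roots satisfying `S` lie in a single orbit of the monodromy. -/
def OneOrbit (Z : Finset HS) (S : HS → Prop) : Prop :=
  ∀ u ∈ Z, ∀ v ∈ Z, S u → S v → ∃ j : ℕ, sigma^[j] u = v

/-- A weight whose total is less than twice the weight of each orbit forces a single orbit. -/
theorem Stab.oneOrbit {Z : Finset HS} (hZ : Stab Z) {S : HS → Prop} {g : HS → ℝ} {c : ℝ}
    (hg : ∀ y, g (sigma y) = g y) (h0 : ∀ u ∈ Z, 0 ≤ g u) (h1 : ∀ u ∈ Z, S u → c ≤ nu u * g u)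
    (h2 : ∑ u ∈ Z, g u < 2 * c) : OneOrbit Z S := by
  intro u hu v hv hsu hsv
  by_contra hcon
  push Not at hcon
  have := hZ.two_orbits hg h0 hu hv hcon
  linarith [h1 u hu hsu, h1 v hv hsv]

namespace KTree

variable {Zp Zq : Finset HS} {κ : ℂ} (T : KTree Zp Zq κ)
include T

theorem nu0_sigma (z : HS) : nu0 Zp Zq (sigma z) = nu0 Zp Zq z := by
  rw [nu0, nu0, T.rad_sigma, tr_sigma, nu_sigma]

theorem nu1_sigma (z : HS) : nu1 Zp Zq (sigma z) = nu1 Zp Zq z := by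
  have h : ∀ j, nu1 Zp Zq (sigma z) ∣ j ↔ nu1 Zp Zq z ∣ j := fun j => by
    rw [nu1, nu1, T.rad_sigma, dvd_disc_iff, dvd_disc_iff, tr_sigma, nu_sigma]
  exact Nat.dvd_antisymm ((h _).2 dvd_rfl) ((h _).1 dvd_rfl)

theorem ee_sigma (z : HS) : ee Zp Zq (sigma z) = ee Zp Zq z := by
  rw [ee, ee, T.rad_sigma, T.nu0_sigma, T.nu1_sigma, sigma_coeff]
  simp [chr_ne_zero]

theorem one_div_nu1_sum :
    (Zq.card : ℝ) * ∑ u ∈ Zp, (1 : ℝ) / nu1 Zp Zq u = Zp.card * ∑ w ∈ Zq, (1 : ℝ) / nu1 Zp Zq w :=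
  T.double_count fun _ hu _ _ h => by
    rw [((T.term_p hu).class_eq h).2.2.2.2.2]

theorem fd_sum :
    (Zq.card : ℝ) * ∑ u ∈ Zp, fd Zp Zq u = Zp.card * ∑ w ∈ Zq, fd Zp Zq w :=
  T.double_count fun _ hu _ _ h => ((T.term_p hu).class_eq h).2.2.2.1.symm

/-- The comparison of the two Euler characteristics. -/
theorem euler_comparison :
    (Zp.card : ℝ) * ∑ w ∈ Zq, (fd Zp Zq w - 1 / nu w) - Zq.card * ∑ u ∈ Zp, (fd Zp Zq u - 1 / nu u) =
      Zq.card * ∑ u ∈ Zp, ee Zp Zq u - Zp.card * ∑ w ∈ Zq, ee Zp Zq w := by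
  have e1 : ∑ u ∈ Zp, (fd Zp Zq u - 1 / nu u) =
      ∑ u ∈ Zp, fd Zp Zq u - ∑ u ∈ Zp, (1 : ℝ) / nu1 Zp Zq u - ∑ u ∈ Zp, ee Zp Zq u := by
    rw [← Finset.sum_sub_distrib, ← Finset.sum_sub_distrib]
    exact Finset.sum_congr rfl fun u hu => by rw [T.inv_nu_p hu]; ring
  have e2 : ∑ u ∈ Zq, (fd Zp Zq u - 1 / nu u) =
      ∑ u ∈ Zq, fd Zp Zq u - ∑ u ∈ Zq, (1 : ℝ) / nu1 Zp Zq u - ∑ u ∈ Zq, ee Zp Zq u := by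
    rw [← Finset.sum_sub_distrib, ← Finset.sum_sub_distrib]
    exact Finset.sum_congr rfl fun u hu => by rw [T.inv_nu_q hu]; ring
  rw [e1, e2]
  linear_combination T.one_div_nu1_sum - T.fd_sum

theorem ee_nonneg_q {w : HS} (hw : w ∈ Zq) : 0 ≤ ee Zp Zq w :=
  T.ee_nonneg (T.term_q hw) (Nge_self_pos hw _)

theorem oneOrbit_p_of_lt (hd : -∑ u ∈ Zp, bq Zp Zq u < 2) :
    OneOrbit Zp fun u => bq Zp Zq u < 0 :=
  T.sigP.oneOrbit (g := fun y => -bq Zp Zq y) (c := 1) (fun y => by rw [T.bq_sigma])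
    (fun u hu => by linarith [(T.ap_nonpos (T.term_p hu)).2])
    (fun u hu h => T.one_le_p hu h) (by rw [Finset.sum_neg_distrib]; linarith)

theorem oneOrbit_q_of_lt (hd : -∑ u ∈ Zp, bq Zp Zq u < 2) :
    OneOrbit Zq fun w => ap Zp Zq w < 0 :=
  T.sigQ.oneOrbit (g := fun y => -ap Zp Zq y) (c := 1) (fun y => by rw [T.ap_sigma])
    (fun u hu => by linarith [(T.ap_nonpos (T.term_q hu)).1])
    (fun u hu h => T.one_le_q hu h)
    (by rw [Finset.sum_neg_distrib, ← T.sum_bq_eq_sum_ap]; linarith)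

theorem nu0_eq_nu1_of_ee {u : HS} (hz : Term Zp Zq u (rad Zp Zq u))
    (hN : 0 < Nge Zq u (rad Zp Zq u)) (h : ee Zp Zq u = 0)
    (hc : u.coeff (rad Zp Zq u) = 0) : nu1 Zp Zq u = nu0 Zp Zq u := by
  have h0 : (nu0 Zp Zq u : ℝ) ≠ 0 := by exact_mod_cast (T.nu0_pos hz hN).ne'
  have h1 : (nu1 Zp Zq u : ℝ) ≠ 0 := by exact_mod_cast (T.nu1_pos hz hN).ne'
  rw [ee, if_pos hc] at h
  field_simp at h
  have : (nu1 Zp Zq u : ℝ) = nu0 Zp Zq u := by linarith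
  exact_mod_cast this

/-- Without excess ramification, each orbit of poles contributes at least two. -/
theorem two_le_q (hp : ∀ u ∈ Zp, ee Zp Zq u = 0) (hq : ∀ w ∈ Zq, ee Zp Zq w = 0) {w : HS}
    (hw : w ∈ Zq) (h : ap Zp Zq w < 0) : 2 ≤ nu w * -ap Zp Zq w := by
  have ht := T.term_q hw
  have hN : 0 < Nge Zq w (rad Zp Zq w) := Nge_self_pos hw _
  have h01 : nu1 Zp Zq w = nu0 Zp Zq w := by
    by_cases h1 : ∃ u ∈ Zp, Ge (w - u) (rad Zp Zq w) ∧ u.coeff (rad Zp Zq w) = 0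
    · obtain ⟨u, hu, hwu, hc⟩ := h1
      obtain ⟨e1, -, -, -, e2, e3⟩ := ht.class_eq hwu
      rw [← e2, ← e3]
      exact T.nu0_eq_nu1_of_ee (T.term_p hu) (T.Nq_pos_of_p hu) (hp u hu) (by rwa [e1])
    by_cases h2 : ∃ u ∈ Zq, Ge (w - u) (rad Zp Zq w) ∧ u.coeff (rad Zp Zq w) = 0
    · obtain ⟨u, hu, hwu, hc⟩ := h2
      obtain ⟨e1, -, -, -, e2, e3⟩ := ht.class_eq hwu
      rw [← e2, ← e3]
      exact T.nu0_eq_nu1_of_ee (T.term_q hu) (Nge_self_pos hu _) (hq u hu) (by rwa [e1])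
    push Not at h1 h2
    refine T.nu1_eq_nu0_of_no_center ?_ h1 h2
    rcases T.ap_cases ht with h' | h'
    · exact h'.1
    · exact absurd h'.1 h.ne
  have hnw : nu w = nu1 Zp Zq w := by
    rw [T.nu_q hw]; split_ifs
    · exact h01.symm
    · rfl
  obtain ⟨u, hu, hwu, hc⟩ := T.exists_p_generic ht hN
  have hnu : nu u = nu1 Zp Zq w := T.nu1_eq_of_generic ht hu hwu hc
  obtain ⟨e1, e4, e5, -, e2, e3⟩ := ht.class_eq hwu
  have hb : bq Zp Zq u < 0 := by
    rcases T.ap_cases ht with h' | h'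
    · rw [e5]; exact h'.2.2
    · exact absurd h'.1 h.ne
  have h1 := T.one_le_p hu hb
  have h3 := T.ap_bq ht
  have hlt : (Zq.card : ℝ) < Zp.card := by exact_mod_cast T.card_lt
  have hab : -bq Zp Zq w < -ap Zp Zq w := by
    have := T.card_q_pos
    rw [← e5]  at *
    nlinarith
  obtain ⟨k, hk⟩ := T.int_ap hw
  rw [e5, hnu, ← hnw] at h1
  have h0 : (0 : ℝ) < nu w := by exact_mod_cast T.sigQ.nu_pos hw
  have : (1 : ℝ) < ((-k : ℤ) : ℝ) := by push_cast; rw [← hk]; nlinarith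
  have : (1 : ℤ) < -k := by exact_mod_cast this
  have : (2 : ℤ) ≤ -k := by omega
  have : (2 : ℝ) ≤ ((-k : ℤ) : ℝ) := by exact_mod_cast this
  push_cast at this
  rw [← hk] at this; linarith

theorem bad_facts {u : HS} (hu : u ∈ Zp) (h : ee Zp Zq u ≠ 0) :
    u.coeff (rad Zp Zq u) = 0 ∧ nu u = nu0 Zp Zq u ∧ ap Zp Zq u < 0 ∧ bq Zp Zq u < 0 := by
  have hc : u.coeff (rad Zp Zq u) = 0 := by
    by_contra hc
    exact h (by rw [ee, if_neg hc])
  refine ⟨hc, by rw [T.nu_p hu, if_pos hc], ?_⟩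
  rcases T.ap_cases (T.term_p hu) with h' | h'
  · exact h'.2
  · exact absurd (T.ee_eq_zero_of_fd (Or.inl hu) h'.1) h

theorem nu_q_of_bad {u w : HS} (hu : u ∈ Zp) (hc : u.coeff (rad Zp Zq u) = 0) (hw : w ∈ Zq)
    (huw : Ge (u - w) (rad Zp Zq u)) : nu w = nu1 Zp Zq u := by
  refine T.nu1_eq_of_generic_q (T.term_p hu) hw huw fun hw0 => ?_
  refine T.hat_q_ne hu ((hat_eval_eq_zero_iff _ _ _ _).2 ⟨w, hw, ?_⟩)
  have : Lead (w - u) (rad Zp Zq u) ((w - u).coeff (rad Zp Zq u)) := by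
    have := huw.neg.lead
    rwa [neg_sub] at this
  rwa [HahnSeries.coeff_sub, hw0, hc, sub_zero] at this

/-- The excess ramification is bounded by the number of roots in the disc. -/
theorem ratio_le_Nq {u : HS} (hu : u ∈ Zp) (hc : u.coeff (rad Zp Zq u) = 0)
    (hn : nu u = nu0 Zp Zq u) : nu1 Zp Zq u / nu0 Zp Zq u ≤ Nge Zq u (rad Zp Zq u) := by
  classical
  obtain ⟨w, hw, huw⟩ := T.exists_q_of_p hu
  have hnw := T.nu_q_of_bad hu hc hw huw
  set r := rad Zp Zq u
  set k := nu1 Zp Zq u / nu0 Zp Zq u with hk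
  have hpos : 0 < nu0 Zp Zq u := T.nu0_pos (T.term_p hu) (T.Nq_pos_of_p hu)
  have hkk : nu0 Zp Zq u * k = nu1 Zp Zq u := Nat.mul_div_cancel' (nu0_dvd_nu1 _ _ _)
  have hsub : ((Finset.range k).image fun j => sigma^[nu0 Zp Zq u * j] w) ⊆
      Zq.filter fun w => Ge (u - w) r := by
    intro v hv
    obtain ⟨j, -, rfl⟩ := Finset.mem_image.1 hv
    refine Finset.mem_filter.2 ⟨T.sigQ.iterate hw _, ?_⟩
    have hu' : sigma^[nu0 Zp Zq u * j] u = u := nu_dvd_iff.1 (by rw [hn]; exact dvd_mul_right _ _)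
    intro a ha
    have h1 := huw a ha
    rw [HahnSeries.coeff_sub] at h1 ⊢
    have h2 := sigma_iterate_coeff (nu0 Zp Zq u * j) u a
    rw [hu'] at h2
    rw [h2, sigma_iterate_coeff, ← mul_sub, h1, mul_zero]
  have hcard := Finset.card_le_card hsub
  rw [Finset.card_image_of_injOn, Finset.card_range] at hcard
  · exact hcard
  intro i hi j hj hij
  have hi' : nu0 Zp Zq u * i < nu w := by
    rw [hnw, ← hkk]; exact Nat.mul_lt_mul_of_pos_left (by simpa using hi) hpos
  have hj' : nu0 Zp Zq u * j < nu w := by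
    rw [hnw, ← hkk]; exact Nat.mul_lt_mul_of_pos_left (by simpa using hj) hpos
  have := Function.iterate_injOn_Iio_minimalPeriod (f := sigma) (x := w) hi' hj' hij
  exact Nat.eq_of_mul_eq_mul_left hpos this

/-- A class contains at most one root with excess ramification. -/
theorem bad_unique {u u' v : HS} (hu : u ∈ Zp) (hu' : u' ∈ Zp)
    (hc : u.coeff (rad Zp Zq u) = 0) (hc' : u'.coeff (rad Zp Zq u') = 0)
    (h : Ge (u - v) (rad Zp Zq u)) (h' : Ge (u' - v) (rad Zp Zq u')) : u = u' := by
  have e1 := ((T.term_p hu).class_eq h).1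
  have e2 := ((T.term_p hu').class_eq h').1
  rw [← e2, e1] at h' hc'
  refine Term.eq_of_gt (T.simple_p (T.term_p hu)) hu hu' (by simpa using ge_zero _)
    (Lead.gt ⟨?_, ?_⟩)
  · have := h.sub h'
    rw [sub_sub_sub_cancel_right] at this
    exact this
  · rw [HahnSeries.coeff_sub, hc, hc', sub_zero]

/-- Weights summed over the classes of a set of roots with excess ramification. -/
theorem sum_bad_eq {B : Finset HS} (hB : ∀ u ∈ B, u ∈ Zp ∧ u.coeff (rad Zp Zq u) = 0)
    (Z : Finset HS) (g h : HS → ℝ)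
    (hgh : ∀ u ∈ B, ∀ v ∈ Z, Ge (u - v) (rad Zp Zq u) → h u = g v) :
    ∑ u ∈ B, (Nge Z u (rad Zp Zq u) : ℝ) * h u =
      ∑ v ∈ Z, open Classical in if ∃ u ∈ B, Ge (u - v) (rad Zp Zq u) then g v else 0 := by
  classical
  have e : ∀ u ∈ B, (Nge Z u (rad Zp Zq u) : ℝ) * h u =
      ∑ v ∈ Z, if Ge (u - v) (rad Zp Zq u) then g v else 0 := by
    intro u hu
    rw [← Finset.sum_filter, Nge, ← nsmul_eq_mul, ← Finset.sum_const]
    refine Finset.sum_congr (by congr) fun v hv => ?_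
    rw [Finset.mem_filter] at hv
    exact hgh u hu v hv.1 hv.2
  rw [Finset.sum_congr rfl e, Finset.sum_comm]
  refine Finset.sum_congr rfl fun v hv => ?_
  split_ifs with hex
  · obtain ⟨u, hu, huv⟩ := hex
    rw [Finset.sum_eq_single_of_mem u hu]
    · rw [if_pos huv]
    · intro u' hu' hne
      rw [if_neg]
      intro h'
      exact hne (T.bad_unique (hB u' hu').1 (hB u hu).1 (hB u' hu').2 (hB u hu).2 h' huv)
  · exact Finset.sum_eq_zero fun u hu => if_neg fun h => hex ⟨u, hu, h⟩

omit T in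
theorem class_ineq {M N k q p : ℝ} (hM : 0 < M) (hk : 0 < k) (hkq : k ≤ q) (hqp : q + 1 ≤ p)
    (h : M * p = N * q) : M * (1 - 1 / k) ≤ M * (1 - 1 / q) ∧
      M * (1 - 1 / q) ≤ (N - M) * (p - 2) := by
  have hq : 0 < q := hk.trans_le hkq
  constructor
  · have := one_div_le_one_div_of_le hk hkq
    exact mul_le_mul_of_nonneg_left (by linarith) hM.le
  · have e : (N - M) * (p - 2) - M * (1 - 1 / q) =
        M / q * ((p - q - 1) * q + (p - q - 1) ^ 2) := by
      have : N = M * p / q := by field_simp; linarith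
      rw [this]; field_simp; ring
    have : 0 ≤ M / q * ((p - q - 1) * q + (p - q - 1) ^ 2) :=
      mul_nonneg (by positivity) (add_nonneg (mul_nonneg (by linarith) hq.le) (sq_nonneg _))
    linarith

/-- The numerical core: either the poles have total order less than two, or the estimates are
sharp. -/
theorem dichotomy
    (hP : ∑ u ∈ Zp, (fd Zp Zq u - 1 / nu u) ≤ -∑ u ∈ Zp, bq Zp Zq u - 2)
    (hQ : -∑ u ∈ Zp, bq Zp Zq u - 2 ≤ ∑ w ∈ Zq, (fd Zp Zq w - 1 / nu w))
    (hd : 2 ≤ -∑ u ∈ Zp, bq Zp Zq u) :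
    OneOrbit Zq (fun w => ap Zp Zq w < 0) ∧
      ∑ w ∈ Zq, (fd Zp Zq w - 1 / nu w) = -∑ u ∈ Zp, bq Zp Zq u - 2 := by
  classical
  set d := -∑ u ∈ Zp, bq Zp Zq u with hd_def
  set κQ := ∑ w ∈ Zq, (fd Zp Zq w - 1 / nu w)
  set κP := ∑ u ∈ Zp, (fd Zp Zq u - 1 / nu u)
  have hn := T.card_p_pos
  have hm := T.card_q_pos
  have hmn : (Zq.card : ℝ) < Zp.card := by exact_mod_cast T.card_lt
  set N : ℝ := (Zp.card : ℝ)
  set M : ℝ := (Zq.card : ℝ)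
  have comp : N * κQ - M * κP = M * ∑ u ∈ Zp, ee Zp Zq u - N * ∑ w ∈ Zq, ee Zp Zq w :=
    T.euler_comparison
  have hmP : M * κP ≤ M * (d - 2) := mul_le_mul_of_nonneg_left hP hm.le
  have hnQ : N * (d - 2) ≤ N * κQ := mul_le_mul_of_nonneg_left hQ hn.le
  have heq : 0 ≤ ∑ w ∈ Zq, ee Zp Zq w := Finset.sum_nonneg fun w hw => T.ee_nonneg_q hw
  have heqN : 0 ≤ N * ∑ w ∈ Zq, ee Zp Zq w := mul_nonneg hn.le heq
  by_cases hbad : ∀ u ∈ Zp, ee Zp Zq u = 0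
  · rw [Finset.sum_eq_zero hbad, mul_zero] at comp
    have hd2 : d = 2 := by nlinarith
    rw [hd2] at hmP hnQ
    have e0 : N * ∑ w ∈ Zq, ee Zp Zq w = 0 := by linarith
    have e1 : ∑ w ∈ Zq, ee Zp Zq w = 0 := by
      rcases mul_eq_zero.1 e0 with h | h
      · exact absurd h hn.ne'
      · exact h
    have e2 := (Finset.sum_eq_zero_iff_of_nonneg fun w hw => T.ee_nonneg_q hw).1 e1
    refine ⟨T.sigQ.oneOrbit (g := fun y => -ap Zp Zq y) (c := 2) (fun y => by rw [T.ap_sigma])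
      (fun u hu => by linarith [(T.ap_nonpos (T.term_q hu)).1])
      (fun u hu h => T.two_le_q hbad e2 hu h) ?_, ?_⟩
    · rw [Finset.sum_neg_distrib, ← T.sum_bq_eq_sum_ap, ← hd_def, hd2]; norm_num
    · have : N * κQ = N * (d - 2) := by rw [hd2]; linarith
      exact mul_left_cancel₀ hn.ne' this
  push Not at hbad
  set B := Zp.filter fun u => ee Zp Zq u ≠ 0 with hB_def
  have hB : ∀ u ∈ B, u ∈ Zp ∧ ee Zp Zq u ≠ 0 := fun u hu => Finset.mem_filter.1 hu
  have hBc : ∀ u ∈ B, u ∈ Zp ∧ u.coeff (rad Zp Zq u) = 0 := fun u hu =>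
    ⟨(hB u hu).1, (T.bad_facts (hB u hu).1 (hB u hu).2).1⟩
  set k : HS → ℕ := fun u => nu1 Zp Zq u / nu0 Zp Zq u with hk_def
  set p : HS → ℝ := fun u => Nge Zp u (rad Zp Zq u) with hp_def
  set q : HS → ℝ := fun u => Nge Zq u (rad Zp Zq u) with hq_def
  have h0 : ∀ u ∈ B, 0 < nu0 Zp Zq u := fun u hu =>
    T.nu0_pos (T.term_p (hB u hu).1) (T.Nq_pos_of_p (hB u hu).1)
  have h1 : ∀ u ∈ B, 0 < nu1 Zp Zq u := fun u hu =>
    T.nu1_pos (T.term_p (hB u hu).1) (T.Nq_pos_of_p (hB u hu).1)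
  have hkk : ∀ u, nu0 Zp Zq u * k u = nu1 Zp Zq u := fun u =>
    Nat.mul_div_cancel' (nu0_dvd_nu1 _ _ _)
  have hkpos : ∀ u ∈ B, 0 < k u := fun u hu => by
    refine Nat.pos_of_ne_zero fun h => ?_
    have := hkk u
    rw [h, mul_zero] at this
    exact (h1 u hu).ne this
  have h0' : ∀ u ∈ B, (0 : ℝ) < nu0 Zp Zq u := fun u hu => by exact_mod_cast h0 u hu
  have hkpos' : ∀ u ∈ B, (0 : ℝ) < k u := fun u hu => by exact_mod_cast hkpos u hu
  have hee : ∀ u ∈ B, ee Zp Zq u = 1 / nu0 Zp Zq u * (1 - 1 / k u) := by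
    intro u hu
    have ha := h0' u hu
    have hb := hkpos' u hu
    rw [ee, if_pos (hBc u hu).2, ← hkk u]
    push_cast
    field_simp
  have hci : ∀ u ∈ B, M * (1 - 1 / k u) ≤ M * (1 - 1 / q u) ∧
      M * (1 - 1 / q u) ≤ (N - M) * (p u - 2) := by
    intro u hu
    have hz := T.term_p (hB u hu).1
    refine class_ineq hm (hkpos' u hu) ?_ ?_ ?_
    · simp only [hq_def, hk_def]
      have := T.ratio_le_Nq (hB u hu).1 (hBc u hu).2 (T.bad_facts (hB u hu).1 (hB u hu).2).2.1
      exact_mod_cast this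
    · have h2 := T.Nq_pos_of_p (hB u hu).1
      have h3 : Nge Zq u (rad Zp Zq u) + 1 ≤ Nge Zp u (rad Zp Zq u) := by
        rcases T.Np_Nq hz with h | h <;> omega
      simp only [hq_def, hp_def]
      exact_mod_cast h3
    · have := T.card_ratio hz.1
      exact (by exact_mod_cast this : (Zq.card : ℝ) * (Nge Zp u (rad Zp Zq u) : ℝ) =
        Zp.card * (Nge Zq u (rad Zp Zq u) : ℝ))
  set β := ∑ u ∈ B, (1 : ℝ) / nu0 Zp Zq u with hβ
  have hsumee : ∑ u ∈ Zp, ee Zp Zq u = ∑ u ∈ B, (1 : ℝ) / nu0 Zp Zq u * (1 - 1 / k u) := by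
    rw [← Finset.sum_congr rfl hee, hB_def, Finset.sum_filter_ne_zero]
  have hp0 : ∀ u, 0 ≤ p u := fun u => Nat.cast_nonneg _
  have hle : ∀ u ∈ B, (1 : ℝ) / nu0 Zp Zq u ≤ -bq Zp Zq u := by
    intro u hu
    obtain ⟨-, hn, -, hb⟩ := T.bad_facts (hB u hu).1 (hB u hu).2
    have := T.one_le_p (hB u hu).1 hb
    rw [hn] at this
    rw [div_le_iff₀ (h0' u hu)]; linarith
  have hSp : ∑ u ∈ B, p u * (1 / nu0 Zp Zq u) ≤ ∑ u ∈ B, p u * -bq Zp Zq u :=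
    Finset.sum_le_sum fun u hu => mul_le_mul_of_nonneg_left (hle u hu) (hp0 u)
  have hSp2 : ∑ u ∈ B, p u * -bq Zp Zq u =
      ∑ v ∈ Zp, if ∃ u ∈ B, Ge (u - v) (rad Zp Zq u) then -bq Zp Zq v else 0 :=
    T.sum_bad_eq hBc Zp (fun v => -bq Zp Zq v) (fun v => -bq Zp Zq v)
      fun u hu v _ h => by rw [((T.term_p (hB u hu).1).class_eq h).2.2.1]
  have hbnn : ∀ v ∈ Zp, 0 ≤ -bq Zp Zq v := fun v hv => by
    linarith [(T.ap_nonpos (T.term_p hv)).2]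
  have hSp3 : ∀ v ∈ Zp, (if ∃ u ∈ B, Ge (u - v) (rad Zp Zq u) then -bq Zp Zq v else 0) ≤
      -bq Zp Zq v := fun v hv => by
    split_ifs
    · exact le_rfl
    · exact hbnn v hv
  have hSp4 : ∑ v ∈ Zp, -bq Zp Zq v = d := by rw [Finset.sum_neg_distrib]
  have hβ1 : 1 ≤ β := by
    obtain ⟨u, hu, hue⟩ := hbad
    have h2 := T.sigP.orbit_sum_le (g := fun y => if ee Zp Zq y ≠ 0 then (1 : ℝ) / nu0 Zp Zq y else 0)
      (fun y => by simp only [T.ee_sigma, T.nu0_sigma])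
      (fun y _ => by split_ifs <;> positivity) hu
    rw [← Finset.sum_filter, if_pos hue, (T.bad_facts hu hue).2.1,
      mul_one_div_cancel (h0' u (Finset.mem_filter.2 ⟨hu, hue⟩)).ne'] at h2
    exact h2
  have c1 : M * ∑ u ∈ Zp, ee Zp Zq u = ∑ u ∈ B, (1 : ℝ) / nu0 Zp Zq u * (M * (1 - 1 / k u)) := by
    rw [hsumee, Finset.mul_sum]
    exact Finset.sum_congr rfl fun u _ => by ring
  have c2 : ∑ u ∈ B, (1 : ℝ) / nu0 Zp Zq u * (M * (1 - 1 / k u)) ≤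
      ∑ u ∈ B, (1 : ℝ) / nu0 Zp Zq u * (M * (1 - 1 / q u)) :=
    Finset.sum_le_sum fun u hu => mul_le_mul_of_nonneg_left (hci u hu).1 (by positivity)
  have c3 : ∑ u ∈ B, (1 : ℝ) / nu0 Zp Zq u * (M * (1 - 1 / q u)) ≤
      ∑ u ∈ B, (1 : ℝ) / nu0 Zp Zq u * ((N - M) * (p u - 2)) :=
    Finset.sum_le_sum fun u hu => mul_le_mul_of_nonneg_left (hci u hu).2 (by positivity)
  have c4 : ∑ u ∈ B, (1 : ℝ) / nu0 Zp Zq u * ((N - M) * (p u - 2)) =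
      (N - M) * (∑ u ∈ B, p u * (1 / nu0 Zp Zq u) - 2 * β) := by
    rw [hβ, Finset.mul_sum, ← Finset.sum_sub_distrib, Finset.mul_sum]
    exact Finset.sum_congr rfl fun u _ => by ring
  have hNM : 0 < N - M := by linarith
  have c5 : ∑ u ∈ B, p u * (1 / nu0 Zp Zq u) ≤ d :=
    hSp.trans (hSp2.le.trans (hSp4 ▸ Finset.sum_le_sum hSp3))
  have c6 : (N - M) * (∑ u ∈ B, p u * (1 / nu0 Zp Zq u) - 2 * β) ≤ (N - M) * (d - 2) :=
    mul_le_mul_of_nonneg_left (by linarith) hNM.le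
  have c7 : (N - M) * (d - 2) ≤ N * κQ - M * κP := by linarith
  have e1 : (N - M) * (∑ u ∈ B, p u * (1 / nu0 Zp Zq u) - 2 * β) = (N - M) * (d - 2) := by linarith
  have e2 : ∑ u ∈ B, p u * (1 / nu0 Zp Zq u) - 2 * β = d - 2 := mul_left_cancel₀ hNM.ne' e1
  have hβe : β = 1 := by linarith
  have e3 : ∑ v ∈ Zp, (if ∃ u ∈ B, Ge (u - v) (rad Zp Zq u) then -bq Zp Zq v else 0) =
      ∑ v ∈ Zp, -bq Zp Zq v := by
    refine le_antisymm (Finset.sum_le_sum hSp3) ?_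
    rw [hSp4]; linarith
  have e4 := (Finset.sum_eq_sum_iff_of_le hSp3).1 e3
  have e5 : ∑ u ∈ B, (1 : ℝ) / nu0 Zp Zq u * (M * (1 - 1 / k u)) =
      ∑ u ∈ B, (1 : ℝ) / nu0 Zp Zq u * (M * (1 - 1 / q u)) := by linarith
  have e6 := (Finset.sum_eq_sum_iff_of_le fun u hu => mul_le_mul_of_nonneg_left (hci u hu).1
    (by positivity : (0 : ℝ) ≤ 1 / nu0 Zp Zq u)).1 e5
  have hkq : ∀ u ∈ B, (k u : ℝ) = q u := by
    intro u hu
    have h2 := mul_left_cancel₀ (one_div_pos.2 (h0' u hu)).ne' (e6 u hu)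
    have h3 := mul_left_cancel₀ hm.ne' h2
    have h4 : (1 : ℝ) / k u = 1 / q u := by linarith
    rw [one_div, one_div] at h4
    exact inv_injective h4
  have hsumq : ∑ u ∈ B, q u * (1 / nu1 Zp Zq u) = 1 := by
    refine Eq.trans ?_ hβe
    refine Finset.sum_congr rfl fun u hu => ?_
    have ha := h0' u hu
    have hb := hkpos' u hu
    rw [← hkq u hu, ← hkk u]
    push_cast
    field_simp
  refine ⟨?_, mul_left_cancel₀ hn.ne' (le_antisymm (by linarith) hnQ)⟩
  have hcov : ∀ w ∈ Zq, ap Zp Zq w < 0 → ∃ u ∈ B, Ge (u - w) (rad Zp Zq u) := by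
    intro w hw ha
    have ht := T.term_q hw
    obtain ⟨v, hv, hwv, -⟩ := T.exists_p_generic ht (Nge_self_pos hw _)
    obtain ⟨hr, _, hb, -⟩ := ht.class_eq hwv
    have hbv : bq Zp Zq v < 0 := by
      rcases T.ap_cases ht with h' | h'
      · rw [hb]; exact h'.2.2
      · exact absurd h'.1 ha.ne
    have h2 := e4 v hv
    by_cases hex : ∃ u ∈ B, Ge (u - v) (rad Zp Zq u)
    · obtain ⟨u, hu, huv⟩ := hex
      refine ⟨u, hu, ?_⟩
      have hr' := ((T.term_p (hB u hu).1).class_eq huv).1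
      rw [← hr, hr'] at hwv
      have := huv.sub hwv
      intro a ha
      have := this a ha
      have h5 := hwv a ha
      have h6 := huv a ha
      rw [HahnSeries.coeff_sub, sub_eq_zero] at h5 h6 ⊢
      rw [h6, h5]
    · rw [if_neg hex] at h2; linarith
  refine T.sigQ.oneOrbit (g := fun w => if ap Zp Zq w < 0 then (1 : ℝ) / nu w else 0) (c := 1)
    (fun y => by simp only [T.ap_sigma, nu_sigma]) (fun y _ => by split_ifs <;> positivity)
    (fun w hw ha => ?_) ?_
  · have : (nu w : ℝ) ≠ 0 := by exact_mod_cast (T.sigQ.nu_pos hw).ne'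
    rw [if_pos ha, mul_one_div_cancel this]
  have h3 : ∑ u ∈ B, q u * (1 / nu1 Zp Zq u) =
      ∑ v ∈ Zq, if ∃ u ∈ B, Ge (u - v) (rad Zp Zq u) then (1 : ℝ) / nu v else 0 :=
    T.sum_bad_eq hBc Zq (fun v => (1 : ℝ) / nu v) (fun v => 1 / nu1 Zp Zq v)
      fun u hu v hv h => by rw [T.nu_q_of_bad (hB u hu).1 (hBc u hu).2 hv h]
  have h4 : ∑ w ∈ Zq, (if ap Zp Zq w < 0 then (1 : ℝ) / nu w else 0) ≤
      ∑ v ∈ Zq, if ∃ u ∈ B, Ge (u - v) (rad Zp Zq u) then (1 : ℝ) / nu v else 0 := by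
    refine Finset.sum_le_sum fun w hw => ?_
    by_cases ha : ap Zp Zq w < 0
    · rw [if_pos ha, if_pos (hcov w hw ha)]
    · rw [if_neg ha]; split_ifs <;> positivity
  linarith

end KTree

/-- The embedding of `ℂ[x]` in the Hahn series field. -/
noncomputable def phi : Polynomial ℂ →+* HS := Polynomial.eval₂RingHom HahnSeries.C xx

@[simp] theorem phi_C (c : ℂ) : phi (Polynomial.C c) = HahnSeries.C c := by simp [phi]

@[simp] theorem phi_X : phi Polynomial.X = xx := by simp [phi]

theorem xx_pow (k : ℕ) : xx ^ k = HahnSeries.single (-(k : ℝ)) 1 := by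
  rw [xx, HahnSeries.single_pow]; simp

theorem phi_coeff (f : Polynomial ℂ) (k : ℕ) : (phi f).coeff (-(k : ℝ)) = f.coeff k := by
  induction f using Polynomial.induction_on' with
  | add p q hp hq => simp [hp, hq]
  | monomial i a =>
    rw [← Polynomial.C_mul_X_pow_eq_monomial, map_mul, map_pow, phi_C, phi_X, xx_pow,
      HahnSeries.C_mul_eq_smul, HahnSeries.coeff_smul, HahnSeries.coeff_single,
      Polynomial.coeff_C_mul_X_pow]
    simp

theorem phi_coeff_pos (f : Polynomial ℂ) {a : ℝ} (ha : 0 < a) : (phi f).coeff a = 0 := by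
  induction f using Polynomial.induction_on' with
  | add p q hp hq => simp [hp, hq]
  | monomial i c =>
    rw [← Polynomial.C_mul_X_pow_eq_monomial, map_mul, map_pow, phi_C, phi_X, xx_pow,
      HahnSeries.C_mul_eq_smul, HahnSeries.coeff_smul, HahnSeries.coeff_single_of_ne, smul_zero]
    have : (0 : ℝ) ≤ i := Nat.cast_nonneg i
    intro h; linarith

theorem sigma_phi (f : Polynomial ℂ) : sigma (phi f) = phi f := by
  induction f using Polynomial.induction_on' with
  | add p q hp hq => simp [hp, hq]
  | monomial i c =>
    rw [← Polynomial.C_mul_X_pow_eq_monomial, map_mul, map_pow, phi_C, phi_X, map_mul, map_pow]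
    have h1 : sigma xx = xx := by simpa [xx] using sigma_single_int (-1) 1
    have h2 : sigma (HahnSeries.C c) = HahnSeries.C c := by
      simpa [HahnSeries.C_apply] using sigma_single_int 0 c
    rw [h1, h2]

theorem phi_injective : Function.Injective phi := by
  intro f g h
  ext k
  rw [← phi_coeff, ← phi_coeff, h]

theorem exists_ge (y : HS) : ∃ b, Ge y b := by
  by_cases h : y = 0
  · exact ⟨0, h ▸ ge_zero 0⟩
  · exact ⟨y.order, (exists_lead h).ge⟩

theorem exists_ge_finset {ι : Type*} (s : Finset ι) (y : ι → HS) : ∃ b, ∀ i ∈ s, Ge (y i) b := by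
  classical
  induction s using Finset.induction_on with
  | empty => exact ⟨0, by simp⟩
  | insert i s hi ih =>
    obtain ⟨b, hb⟩ := ih
    obtain ⟨b', hb'⟩ := exists_ge (y i)
    refine ⟨min b b', fun k hk => ?_⟩
    rcases Finset.mem_insert.1 hk with rfl | hk
    · exact hb'.mono (min_le_right _ _)
    · exact (hb k hk).mono (min_le_left _ _)

/-- A series with integral exponents is a polynomial in `x` plus a tail. -/
theorem exists_poly_tail {y : HS} (hy : sigma y = y) :
    ∃ f : Polynomial ℂ, ∀ M : ℕ, (∀ i : ℕ, 1 ≤ i → i ≤ M → y.coeff i = 0) →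
      Ge (y - phi f) (M + 1) := by
  have hcoe : ∀ a, y.coeff a ≠ 0 → ∃ n : ℤ, a = n := by
    have := (sigma_iterate_eq_iff 1 y).1 (by simpa using hy)
    simpa using this
  obtain ⟨b, hb⟩ := exists_ge y
  obtain ⟨N, hN⟩ := exists_nat_gt (-b)
  set f : Polynomial ℂ := ∑ k ∈ Finset.range (N + 1), Polynomial.monomial k (y.coeff (-(k : ℝ)))
  refine ⟨f, fun M hM a ha => ?_⟩
  rw [HahnSeries.coeff_sub]
  by_cases hy0 : ∃ n : ℤ, a = n
  · obtain ⟨n, rfl⟩ := hy0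
    by_cases hn : 0 < n
    · obtain ⟨k, rfl⟩ := Int.eq_ofNat_of_zero_le hn.le
      rw [phi_coeff_pos _ (by exact_mod_cast hn)]
      have := hM k (by exact_mod_cast hn) (by
        have : (k : ℝ) < M + 1 := by exact_mod_cast ha
        exact Nat.lt_succ_iff.1 (by exact_mod_cast this))
      simpa using this
    · obtain ⟨k, hk⟩ := Int.exists_eq_neg_ofNat (not_lt.1 hn)
      have hk' : ((n : ℤ) : ℝ) = -(k : ℝ) := by rw [hk]; simp
      rw [hk', phi_coeff]
      have hfk : f.coeff k = if k < N + 1 then y.coeff (-(k : ℝ)) else 0 := by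
        simp only [f, Polynomial.finsetSum_coeff, Polynomial.coeff_monomial]
        rw [Finset.sum_ite_eq']; simp
      rw [hfk]
      split_ifs with h
      · simp
      · rw [hb]; · simp
        have : (N : ℝ) + 1 ≤ k := by exact_mod_cast not_lt.1 h
        linarith
  · have h1 : y.coeff a = 0 := by by_contra h; exact hy0 (hcoe a h)
    have h2 : (phi f).coeff a = 0 := by
      by_contra h
      refine hy0 ?_
      have := (sigma_iterate_eq_iff 1 (phi f)).1 (by simpa using sigma_phi f) a h
      simpa using this
    rw [h1, h2, sub_zero]

/-- Evaluation of an element of `ℂ[x][y]` at a Hahn series. -/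
noncomputable def Ev (f : Polynomial (Polynomial ℂ)) (y : HS) : HS := f.eval₂ phi y

theorem Ev_eq (f : Polynomial (Polynomial ℂ)) (y : HS) : Ev f y = (f.map phi).eval y := by
  rw [Ev, Polynomial.eval_map]

theorem Ev_add (f g y) : Ev (f + g) y = Ev f y + Ev g y := Polynomial.eval₂_add _ _
theorem Ev_mul (f g y) : Ev (f * g) y = Ev f y * Ev g y := Polynomial.eval₂_mul _ _
theorem Ev_smul (c : ℂ) (f : Polynomial (Polynomial ℂ)) (y : HS) : Ev (c • f) y = c • Ev f y := by
  have : c • f = Polynomial.C (Polynomial.C c) * f := by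
    ext; simp
  rw [this, Ev_mul, Ev, Polynomial.eval₂_C, phi_C, HahnSeries.C_mul_eq_smul]

theorem sigma_Ev (f : Polynomial (Polynomial ℂ)) (y : HS) : sigma (Ev f y) = Ev f (sigma y) := by
  rw [Ev, Polynomial.hom_eval₂, Ev]
  congr 1
  exact RingHom.ext sigma_phi

theorem sigma_iterate_Ev (f : Polynomial (Polynomial ℂ)) (y : HS) (j : ℕ) :
    sigma^[j] (Ev f y) = Ev f (sigma^[j] y) := by
  induction j with
  | zero => rfl
  | succ j ih => rw [Function.iterate_succ_apply', ih, sigma_Ev, Function.iterate_succ_apply']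

theorem pd_of_mem (Z : Finset HS) {u : HS} (hu : u ∈ Z) :
    pd Z u = open Classical in ∏ v ∈ Z.erase u, (u - v) := by
  classical
  rw [pd, Finset.sum_eq_single u]
  · intro v hv hvu
    exact Finset.prod_eq_zero (Finset.mem_erase.2 ⟨hvu.symm, hu⟩) (sub_self u)
  · exact fun h => absurd hu h

theorem pd_ne_zero (Z : Finset HS) {u : HS} (hu : u ∈ Z) : pd Z u ≠ 0 := by
  classical
  rw [pd_of_mem Z hu, Finset.prod_ne_zero_iff]
  intro v hv
  exact sub_ne_zero.2 (Finset.ne_of_mem_erase hv).symm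

/-- `Z` is the set of roots of the monic polynomial `pp ∈ ℂ[x][y]`. -/
structure Cover (Z : Finset HS) (pp : Polynomial (Polynomial ℂ)) : Prop where
  stab : Stab Z
  monic : pp.Monic
  map_eq : pp.map phi = ∏ u ∈ Z, (Polynomial.X - Polynomial.C u)

namespace Cover

variable {Z : Finset HS} {pp : Polynomial (Polynomial ℂ)} (H : Cover Z pp)
include H

theorem natDegree : pp.natDegree = Z.card := by
  rw [← H.monic.natDegree_map phi, H.map_eq, Polynomial.natDegree_finsetProd_X_sub_C_eq_card]

theorem Ev_pp (y : HS) : Ev pp y = pf Z y := by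
  rw [Ev_eq, H.map_eq, Polynomial.eval_prod, pf]
  simp

theorem Ev_mem {u : HS} (hu : u ∈ Z) : Ev pp u = 0 := by
  rw [H.Ev_pp]; exact Finset.prod_eq_zero hu (sub_self u)

theorem mem_of_Ev {u : HS} (hu : Ev pp u = 0) : u ∈ Z := by
  rw [H.Ev_pp, pf, Finset.prod_eq_zero_iff] at hu
  obtain ⟨v, hv, h⟩ := hu
  rwa [sub_eq_zero.1 h]

theorem Ev_derivative (y : HS) : Ev pp.derivative y = pd Z y := by
  classical
  rw [Ev_eq, ← Polynomial.derivative_map, H.map_eq, Polynomial.derivative_prod_finset,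
    Polynomial.eval_finsetSum, pd]
  refine Finset.sum_congr rfl fun u _ => ?_
  simp [Polynomial.eval_prod]

theorem Ev_modByMonic (f : Polynomial (Polynomial ℂ)) {u : HS} (hu : u ∈ Z) :
    Ev (f %ₘ pp) u = Ev f u := by
  conv_rhs => rw [← Polynomial.modByMonic_add_div f pp]
  rw [Ev_add, Ev_mul, H.Ev_mem hu, zero_mul, add_zero]

theorem degree_modByMonic (f : Polynomial (Polynomial ℂ)) : (f %ₘ pp).degree < Z.card := by
  have := Polynomial.degree_modByMonic_lt f H.monic
  rwa [Polynomial.degree_eq_natDegree H.monic.ne_zero, H.natDegree] at this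

/-- The trace of `f / p'` is a polynomial. -/
theorem exists_trace (f : Polynomial (Polynomial ℂ)) :
    ∃ g : Polynomial ℂ, ∑ u ∈ Z, Ev f u / pd Z u = phi g := by
  classical
  refine ⟨(f %ₘ pp).coeff (Z.card - 1), ?_⟩
  rw [← Polynomial.coeff_map, Lagrange.coeff_eq_sum (s := Z) (v := id) (Set.injOn_id _)
    (lt_of_le_of_lt Polynomial.degree_map_le (H.degree_modByMonic f))]
  refine Finset.sum_congr rfl fun u hu => ?_
  rw [id, ← Ev_eq, H.Ev_modByMonic f hu, pd_of_mem Z hu]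
  rfl

/-- The inversion formula for the trace pairing. -/
theorem recover (s : HS → HS) {u : HS} (hu : u ∈ Z) :
    s u = ∑ k ∈ Finset.range (Z.card + 1), ∑ j ∈ Finset.range k,
      phi (pp.coeff k) * (∑ v ∈ Z, s v * v ^ j / pd Z v) * u ^ (k - 1 - j) := by
  classical
  have hE : ∀ y : HS, Ev pp y = ∑ k ∈ Finset.range (Z.card + 1), phi (pp.coeff k) * y ^ k := by
    intro y
    rw [Ev, Polynomial.eval₂_eq_sum_range, H.natDegree]
  have key : ∀ v ∈ Z, (∑ k ∈ Finset.range (Z.card + 1), ∑ j ∈ Finset.range k,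
      phi (pp.coeff k) * (v ^ j * u ^ (k - 1 - j))) = if v = u then pd Z u else 0 := by
    intro v hv
    split_ifs with h
    · subst h
      rw [← H.Ev_derivative, Ev_eq, ← Polynomial.derivative_map, Polynomial.derivative_eval,
        Polynomial.sum_over_range' _ (by simp) (Z.card + 1)
          (by rw [H.monic.natDegree_map, H.natDegree]; exact Nat.lt_succ_self _)]
      refine Finset.sum_congr rfl fun k _ => ?_
      rw [Finset.sum_congr rfl (g := fun _ => phi (pp.coeff k) * v ^ (k - 1)) fun j hj => by
        rw [← pow_add, Nat.add_sub_cancel' (Nat.le_sub_one_of_lt (Finset.mem_range.1 hj))]]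
      rw [Finset.sum_const, Finset.card_range, nsmul_eq_mul, Polynomial.coeff_map]
      ring
    · have hvu : v - u ≠ 0 := sub_ne_zero.2 h
      apply mul_right_cancel₀ hvu
      rw [zero_mul, Finset.sum_mul]
      have : Ev pp v - Ev pp u = 0 := by rw [H.Ev_mem hv, H.Ev_mem hu, sub_zero]
      rw [hE, hE, ← Finset.sum_sub_distrib] at this
      rw [← this]
      refine Finset.sum_congr rfl fun k _ => ?_
      rw [← Finset.mul_sum, mul_assoc, geom_sum₂_mul, mul_sub]
  calc s u = ∑ v ∈ Z, s v / pd Z v * (if v = u then pd Z u else 0) := by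
        rw [Finset.sum_eq_single u]
        · rw [if_pos rfl, div_mul_cancel₀ _ (pd_ne_zero Z hu)]
        · intro v _ h; rw [if_neg h, mul_zero]
        · exact fun h => absurd hu h
    _ = _ := by
        rw [Finset.sum_congr rfl fun v hv => by rw [← key v hv]]
        simp only [Finset.mul_sum, Finset.sum_mul]
        rw [Finset.sum_comm]
        refine Finset.sum_congr rfl fun k _ => ?_
        rw [Finset.sum_comm]
        refine Finset.sum_congr rfl fun j _ => Finset.sum_congr rfl fun v _ => ?_
        ring

end Cover

theorem Lead.inv {y : HS} {e : ℝ} {α : ℂ} (h : Lead y e α) (hα : α ≠ 0) : Lead y⁻¹ (-e) α⁻¹ := by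
  have hy : y ≠ 0 := h.ne_zero hα
  have h1 := h.mul (exists_lead (inv_ne_zero hy))
  rw [mul_inv_cancel₀ hy] at h1
  have hne := leadingCoeff_ne (inv_ne_zero hy)
  have he := h1.exp_unique lead_one (mul_ne_zero hα hne) one_ne_zero
  rw [he] at h1
  have hc := h1.unique lead_one
  have h2 := exists_lead (inv_ne_zero hy)
  rw [eq_neg_of_add_eq_zero_right he, eq_inv_of_mul_eq_one_right hc] at h2
  exact h2

theorem Lead.div {x y : HS} {e e' : ℝ} {α β : ℂ} (hx : Lead x e α) (hy : Lead y e' β)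
    (hβ : β ≠ 0) : Lead (x / y) (e - e') (α / β) := by
  rw [div_eq_mul_inv, sub_eq_add_neg, div_eq_mul_inv]
  exact hx.mul (hy.inv hβ)

theorem Lead.cast {y : HS} {e e' : ℝ} {α : ℂ} (h : Lead y e α) (he : e = e') : Lead y e' α :=
  he ▸ h

theorem sigma_iterate_single {k : ℕ} {a : ℝ} (h : ∃ n : ℤ, k * a = n) (c : ℂ) :
    sigma^[k] (HahnSeries.single a c) = HahnSeries.single a c := by
  rw [sigma_iterate_eq_iff]
  intro b hb
  have : b = a := by
    by_contra hne
    exact hb (HahnSeries.coeff_single_of_ne hne)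
  rwa [this]

/-- `u` lies in the orbit of `u0`. -/
def Orb (u0 u : HS) : Prop := ∃ j : ℕ, sigma^[j] u0 = u

theorem Orb.refl (u : HS) : Orb u u := ⟨0, rfl⟩

theorem Orb.invariant {α : Type*} {g : HS → α} (hg : ∀ y, g (sigma y) = g y) {u v : HS}
    (h : Orb u v) : g v = g u := by
  obtain ⟨j, rfl⟩ := h
  induction j with
  | zero => rfl
  | succ j ih => rw [Function.iterate_succ_apply', hg, ih]

namespace Stab

variable {Z : Finset HS} (hZ : Stab Z)
include hZ

theorem orb_sigma {u0 : HS} (hu : u0 ∈ Z) (u : HS) : Orb u0 (sigma u) ↔ Orb u0 u := by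
  constructor
  · rintro ⟨j, hj⟩
    refine ⟨j + (nu u0 - 1), sigma_injective ?_⟩
    have h1 := hZ.nu_pos hu
    rw [← Function.iterate_succ_apply' (⇑sigma), ← hj,
      show (j + (nu u0 - 1)).succ = j + nu u0 by omega, Function.iterate_add_apply,
      nu_dvd_iff.1 dvd_rfl]
  · rintro ⟨j, rfl⟩
    exact ⟨j + 1, Function.iterate_succ_apply' _ _ _⟩

theorem orb_card {u0 : HS} (hu : u0 ∈ Z) :
    open Classical in (Z.filter (Orb u0)).card = nu u0 := by
  classical
  rw [← Stab.orbit_card (u := u0)]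
  congr 1
  ext v
  simp only [Finset.mem_filter, Finset.mem_image, Finset.mem_range]
  constructor
  · rintro ⟨_, j, rfl⟩
    refine ⟨j % nu u0, Nat.mod_lt _ (hZ.nu_pos hu), ?_⟩
    conv_rhs => rw [← Nat.mod_add_div j (nu u0), Function.iterate_add_apply]
    rw [nu_dvd_iff.1 (Dvd.intro _ rfl)]
  · rintro ⟨j, _, rfl⟩
    exact ⟨hZ.iterate hu j, j, rfl⟩

/-- The coefficient of exponent one of an equivariant sum concentrated on one orbit. -/
theorem coeff_one_sum {u0 : HS} (hu : u0 ∈ Z) {h : HS → HS}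
    (heq : ∀ u ∈ Z, h (sigma u) = sigma (h u))
    (h0 : ∀ u ∈ Z, ¬ Orb u0 u → (h u).coeff 1 = 0) :
    (∑ u ∈ Z, h u).coeff 1 = nu u0 * (h u0).coeff 1 := by
  classical
  rw [HahnSeries.coeff_sum, ← Finset.sum_filter_add_sum_filter_not Z (Orb u0),
    Finset.sum_eq_zero (s := Z.filter fun u => ¬ Orb u0 u), add_zero,
    Finset.sum_congr rfl (g := fun _ => (h u0).coeff 1), Finset.sum_const, hZ.orb_card hu,
    nsmul_eq_mul]
  · rintro u hu'
    obtain ⟨hu', j, rfl⟩ := Finset.mem_filter.1 hu'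
    have : ∀ j : ℕ, h (sigma^[j] u0) = sigma^[j] (h u0) := by
      intro j
      induction j with
      | zero => rfl
      | succ j ih =>
        rw [Function.iterate_succ_apply', heq _ (hZ.iterate hu j), ih,
          Function.iterate_succ_apply']
    rw [this, sigma_iterate_coeff, (chr_eq_one_iff _).2 ⟨j, by simp⟩, one_mul]
  · intro u hu'
    exact h0 u (Finset.mem_filter.1 hu').1 (Finset.mem_filter.1 hu').2

/-- The equivariant function supported on the orbit of `u0` with value `y` at `u0`. -/
theorem exists_equivariant {u0 : HS} (hu : u0 ∈ Z) {y : HS} (hy : sigma^[nu u0] y = y) :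
    ∃ s : HS → HS, s u0 = y ∧ (∀ u, s (sigma u) = sigma (s u)) ∧
      (∀ u, ¬ Orb u0 u → s u = 0) ∧ ∀ u, Orb u0 u → ∀ b, Ge y b → Ge (s u) b := by
  classical
  have hper : ∀ i j : ℕ, sigma^[i] u0 = sigma^[j] u0 → sigma^[i] y = sigma^[j] y := by
    have : ∀ i j : ℕ, i ≤ j → sigma^[i] u0 = sigma^[j] u0 → sigma^[i] y = sigma^[j] y := by
      intro i j hij h
      obtain ⟨k, rfl⟩ := Nat.exists_eq_add_of_le hij
      rw [Function.iterate_add_apply] at h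
      have h1 := (sigma_injective.iterate i) h
      obtain ⟨m, hm⟩ := nu_dvd_iff.2 h1.symm
      rw [Function.iterate_add_apply]
      congr 1
      rw [hm, Function.iterate_mul]
      exact (Function.iterate_fixed hy m).symm
    intro i j h
    rcases le_total i j with hij | hij
    · exact this i j hij h
    · exact (this j i hij h.symm).symm
  set s : HS → HS := fun u => if h : Orb u0 u then sigma^[h.choose] y else 0 with hs
  have hsj : ∀ j : ℕ, s (sigma^[j] u0) = sigma^[j] y := by
    intro j
    have h : Orb u0 (sigma^[j] u0) := ⟨j, rfl⟩
    rw [hs]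
    simp only [dif_pos h]
    exact hper _ _ h.choose_spec
  refine ⟨s, hsj 0, fun u => ?_, fun u h => by simp only [hs, dif_neg h], ?_⟩
  · by_cases h : Orb u0 u
    · obtain ⟨j, rfl⟩ := h
      rw [← Function.iterate_succ_apply' (⇑sigma), hsj, hsj, Function.iterate_succ_apply']
    · have h' : ¬ Orb u0 (sigma u) := fun h' => h ((hZ.orb_sigma hu u).1 h')
      simp only [hs, dif_neg h, dif_neg h', map_zero]
  · rintro u ⟨j, rfl⟩ b hb
    rw [hsj]
    induction j with
    | zero => exact hb
    | succ j ih => rw [Function.iterate_succ_apply']; exact ge_sigma_iff.2 ih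

end Stab

/-- The space of polynomials whose values at the elements of `Z` have prescribed valuations. -/
noncomputable def LL (Z : Finset HS) (e : HS → ℤ) : Submodule ℂ (Polynomial (Polynomial ℂ)) where
  carrier := {f | f.degree < Z.card ∧ ∀ u ∈ Z, Ge (Ev f u) (e u / nu u)}
  add_mem' := by
    rintro f g ⟨hf, hf'⟩ ⟨hg, hg'⟩
    refine ⟨lt_of_le_of_lt (Polynomial.degree_add_le _ _) (max_lt hf hg), fun u hu => ?_⟩
    rw [Ev_add]; exact (hf' u hu).add (hg' u hu)
  zero_mem' := ⟨by simp [bot_lt_iff_ne_bot], fun u _ => by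
    have : Ev 0 u = 0 := Polynomial.eval₂_zero _ _
    rw [this]; exact ge_zero _⟩
  smul_mem' := by
    rintro c f ⟨hf, hf'⟩
    refine ⟨lt_of_le_of_lt (Polynomial.degree_smul_le _ _) hf, fun u hu => ?_⟩
    rw [Ev_smul]
    intro a ha
    rw [HahnSeries.coeff_smul, hf' u hu a ha, smul_zero]

theorem mem_LL {Z : Finset HS} {e : HS → ℤ} {f : Polynomial (Polynomial ℂ)} :
    f ∈ LL Z e ↔ f.degree < Z.card ∧ ∀ u ∈ Z, Ge (Ev f u) (e u / nu u) := Iff.rfl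

/-- The coefficient functional at a place. -/
noncomputable def cf (u : HS) (a : ℝ) : Polynomial (Polynomial ℂ) →ₗ[ℂ] ℂ where
  toFun f := (Ev f u).coeff a
  map_add' f g := by rw [Ev_add]; simp
  map_smul' c f := by rw [Ev_smul]; simp

open Classical in
/-- Increase `e` by one on an orbit. -/
noncomputable def bump (e : HS → ℤ) (u0 : HS) : HS → ℤ := fun u => e u + if Orb u0 u then 1 else 0

/-- The dual exponent. -/
noncomputable def star (dl e : HS → ℤ) : HS → ℤ := fun u => nu u + dl u + 1 - e u

theorem finrank_ker_functional {V : Type*} [AddCommGroup V] [Module ℂ V] (A B : Submodule ℂ V)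
    [FiniteDimensional ℂ A] (l : V →ₗ[ℂ] ℂ) (hB : ∀ v, v ∈ B ↔ v ∈ A ∧ l v = 0) :
    Module.finrank ℂ A = Module.finrank ℂ B +
      open Classical in if ∃ v ∈ A, l v ≠ 0 then 1 else 0 := by
  classical
  have h := LinearMap.finrank_range_add_finrank_ker (l.domRestrict A)
  have hk : Module.finrank ℂ (LinearMap.ker (l.domRestrict A)) = Module.finrank ℂ B := by
    have : B = (LinearMap.ker (l.domRestrict A)).map A.subtype := by
      ext v
      simp only [hB, Submodule.mem_map, LinearMap.mem_ker, LinearMap.domRestrict_apply,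
        Submodule.subtype_apply, Subtype.exists, exists_and_left, exists_prop]
      constructor
      · rintro ⟨h1, h2⟩; exact ⟨v, h2, h1, rfl⟩
      · rintro ⟨w, h2, h1, rfl⟩; exact ⟨h1, h2⟩
    rw [this, LinearEquiv.finrank_eq (Submodule.equivMapOfInjective _ A.injective_subtype _)]
  rw [← h, hk, add_comm]
  congr 1
  split_ifs with h1
  · obtain ⟨v, hv, hne⟩ := h1
    rw [LinearMap.range_eq_top.2, finrank_top, Module.finrank_self]
    apply LinearMap.surjective
    intro h0
    exact hne (by simpa using LinearMap.congr_fun h0 ⟨v, hv⟩)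
  · push Not at h1
    rw [show l.domRestrict A = 0 from LinearMap.ext fun v => h1 v v.2, LinearMap.range_zero,
      finrank_bot]

namespace Cover

variable {Z : Finset HS} {pp : Polynomial (Polynomial ℂ)} (H : Cover Z pp)
include H

omit H in
theorem finiteDimensional_LL (Z : Finset HS) (e : HS → ℤ) : FiniteDimensional ℂ (LL Z e) := by
  classical
  obtain ⟨b, hb⟩ := exists_ge_finset (Z ×ˢ Finset.range Z.card)
    fun p => (Lagrange.basis Z id p.1).coeff p.2
  obtain ⟨B, hB⟩ : ∃ B : ℝ, ∀ u ∈ Z, B ≤ (e u : ℝ) / nu u := by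
    obtain ⟨B, hB⟩ := (Z.image fun u => -((e u : ℝ) / nu u)).exists_le
    exact ⟨-B, fun u hu => neg_le.1 (hB _ (Finset.mem_image_of_mem _ hu))⟩
  obtain ⟨N, hN⟩ := exists_nat_gt (-(B + b))
  have hdeg : ∀ f ∈ LL Z e, ∀ i k : ℕ, N ≤ k → (f.coeff i).coeff k = 0 := by
    intro f hf i k hk
    by_cases hi : i < Z.card
    · have h1 : f.map phi = Lagrange.interpolate Z id fun u => Ev f u := by
        rw [Lagrange.eq_interpolate (s := Z) (v := id) (f := f.map phi) (Set.injOn_id _)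
          (lt_of_le_of_lt Polynomial.degree_map_le hf.1)]
        simp [Ev_eq]
      rw [← phi_coeff, ← Polynomial.coeff_map, h1, Lagrange.interpolate_apply,
        Polynomial.finsetSum_coeff]
      have : Ge (∑ u ∈ Z, (Polynomial.C (Ev f u) * Lagrange.basis Z id u).coeff i) (B + b) := by
        refine Ge.sum _ fun u hu => ?_
        rw [Polynomial.coeff_C_mul]
        exact ((hf.2 u hu).mono (hB u hu)).mul
          (hb (u, i) (Finset.mem_product.2 ⟨hu, Finset.mem_range.2 hi⟩))
      apply this
      have : (N : ℝ) ≤ k := by exact_mod_cast hk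
      linarith
    · rw [Polynomial.coeff_eq_zero_of_degree_lt (p := f)
        (lt_of_lt_of_le hf.1 (by exact_mod_cast not_lt.1 hi)), Polynomial.coeff_zero]
  let l : LL Z e →ₗ[ℂ] (Fin Z.card → Fin N → ℂ) :=
    { toFun := fun f i k => (f.1.coeff i).coeff k
      map_add' := fun f g => by ext; simp
      map_smul' := fun c f => by ext; simp }
  refine FiniteDimensional.of_injective l ?_
  rw [injective_iff_map_eq_zero]
  intro f hf
  apply Subtype.ext
  ext i k
  rw [Submodule.coe_zero, Polynomial.coeff_zero, Polynomial.coeff_zero]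
  by_cases hi : i < Z.card
  · by_cases hk : k < N
    · exact congrFun (congrFun hf ⟨i, hi⟩) ⟨k, hk⟩
    · exact hdeg f f.2 i k (not_lt.1 hk)
  · rw [Polynomial.coeff_eq_zero_of_degree_lt (p := f.1)
      (lt_of_lt_of_le f.2.1 (by exact_mod_cast not_lt.1 hi)), Polynomial.coeff_zero]

/-- Values of elements of `ℂ[x][y]` at `u` only involve exponents in `(1 / nu u) ℤ`. -/
theorem exp_Ev (f : Polynomial (Polynomial ℂ)) {u : HS} {a : ℝ} (h : (Ev f u).coeff a ≠ 0)
    (hu : u ∈ Z) : ∃ n : ℤ, a = n / nu u := by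
  have h1 : sigma^[nu u] (Ev f u) = Ev f u := by
    rw [sigma_iterate_Ev, nu_dvd_iff.1 dvd_rfl]
  obtain ⟨n, hn⟩ := (sigma_iterate_eq_iff _ _).1 h1 a h
  have := H.stab.nu_pos hu
  refine ⟨n, ?_⟩
  rw [← hn]
  field_simp

theorem finrank_bump (e : HS → ℤ) (he : ∀ u, e (sigma u) = e u) {u0 : HS} (hu : u0 ∈ Z) :
    Module.finrank ℂ (LL Z e) = Module.finrank ℂ (LL Z (bump e u0)) +
      open Classical in if ∃ f ∈ LL Z e, cf u0 (e u0 / nu u0) f ≠ 0 then 1 else 0 := by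
  classical
  have := finiteDimensional_LL Z e
  refine finrank_ker_functional _ _ _ fun f => ?_
  constructor
  · rintro ⟨h1, h2⟩
    refine ⟨⟨h1, fun u hu => (h2 u hu).mono ?_⟩, ?_⟩
    · gcongr
      simp only [bump]
      split_ifs <;> omega
    · apply h2 u0 hu
      have := H.stab.nu_pos hu
      gcongr
      simp [bump, Orb.refl]
  · rintro ⟨⟨h1, h2⟩, h3⟩
    refine ⟨h1, fun u huZ => ?_⟩
    by_cases h : Orb u0 u
    · intro a ha
      by_contra hne
      obtain ⟨n, rfl⟩ := H.exp_Ev f hne huZ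
      have hpos : (0 : ℝ) < nu u := by exact_mod_cast H.stab.nu_pos huZ
      rw [div_lt_div_iff_of_pos_right hpos] at ha
      have ha' : n ≤ e u := by
        have : n < bump e u0 u := by exact_mod_cast ha
        rw [bump, if_pos h] at this
        omega
      rcases ha'.lt_or_eq with hlt | rfl
      · refine hne (h2 u huZ _ ?_)
        rw [div_lt_div_iff_of_pos_right hpos]
        exact_mod_cast hlt
      · rw [h.invariant he, h.invariant nu_sigma] at hne
        obtain ⟨j, rfl⟩ := h
        rw [← sigma_iterate_Ev, sigma_iterate_coeff] at hne
        exact hne (by rw [show (Ev f u0).coeff _ = 0 from h3, mul_zero])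
    · rw [bump, if_neg h, add_zero]
      exact h2 u huZ

end Cover

theorem star_apply (dl e : HS → ℤ) (u : HS) : star dl e u = nu u + dl u + 1 - e u := rfl

/-- `dl u / nu u` is the valuation of the derivative of `pf Z` at the root `u`. -/
structure Diff (Z : Finset HS) (dl : HS → ℤ) : Prop where
  inv : ∀ u, dl (sigma u) = dl u
  lead : ∀ u ∈ Z, ∃ α : ℂ, α ≠ 0 ∧ Lead (pd Z u) (dl u / nu u) α

theorem star_sigma {dl e : HS → ℤ} (hdl : ∀ u, dl (sigma u) = dl u)
    (he : ∀ u, e (sigma u) = e u) (u : HS) : star dl e (sigma u) = star dl e u := by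
  rw [star_apply, star_apply, nu_sigma, hdl, he]

theorem star_star (dl e : HS → ℤ) : star dl (star dl e) = e := by
  funext u; simp [star_apply]

theorem star_eq_bump (dl e : HS → ℤ) (u0 : HS) :
    star dl e = bump (star dl (bump e u0)) u0 := by
  classical
  funext u
  simp only [star_apply, bump]
  split_ifs <;> ring

namespace Cover

variable {Z : Finset HS} {pp : Polynomial (Polynomial ℂ)} (H : Cover Z pp)
  {dl : HS → ℤ} (D : Diff Z dl)
include H D

theorem exclusive (e : HS → ℤ) {u0 : HS} (hu : u0 ∈ Z) {f g : Polynomial (Polynomial ℂ)}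
    (hf : f ∈ LL Z e) (hg : g ∈ LL Z (star dl (bump e u0)))
    (hf0 : cf u0 (e u0 / nu u0) f ≠ 0)
    (hg0 : cf u0 (star dl (bump e u0) u0 / nu u0) g ≠ 0) : False := by
  classical
  obtain ⟨r, hr⟩ := H.exists_trace (f * g)
  have h1 : (∑ u ∈ Z, Ev (f * g) u / pd Z u).coeff 1 = 0 := by
    rw [hr, phi_coeff_pos _ one_pos]
  rw [H.stab.coeff_one_sum hu] at h1
  · have hpos := H.stab.nu_pos hu
    have hpos' : (nu u0 : ℝ) ≠ 0 := by exact_mod_cast hpos.ne'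
    obtain ⟨α, hα, hL⟩ := D.lead u0 hu
    have h2 := (((hf.2 u0 hu).lead.mul (hg.2 u0 hu).lead).div hL hα).cast (e' := 1) (by
      rw [star_apply, bump, if_pos (Orb.refl u0)]
      push_cast
      field_simp
      ring)
    rw [Ev_mul, h2.2] at h1
    rcases mul_eq_zero.1 h1 with h | h
    · exact hpos.ne' (by exact_mod_cast h)
    · exact div_ne_zero (mul_ne_zero hf0 hg0) hα h
  · intro u _
    rw [← sigma_Ev, ← H.stab.sigma_pd, map_div₀]
  · intro u huZ ho
    have hpos : (0 : ℝ) < nu u := by exact_mod_cast H.stab.nu_pos huZ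
    obtain ⟨α, hα, hL⟩ := D.lead u huZ
    have h2 := ((hf.2 u huZ).lead.mul (hg.2 u huZ).lead).div hL hα
    rw [Ev_mul]
    apply h2.1
    rw [star_apply, bump, if_neg ho, ← add_div, ← sub_div, lt_div_iff₀ hpos]
    push_cast
    linarith

omit D in
theorem exists_decomp (e : HS → ℤ) : ∃ M : ℕ, ∀ s : HS → HS,
    (∀ u, s (sigma u) = sigma (s u)) →
    (∀ j < Z.card, ∀ i : ℕ, 1 ≤ i → i ≤ M → (∑ v ∈ Z, s v * v ^ j / pd Z v).coeff i = 0) →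
    ∃ r : Polynomial (Polynomial ℂ), ∀ u ∈ Z, Ge (s u - Ev r u) (e u / nu u) := by
  classical
  obtain ⟨b, hb⟩ := exists_ge_finset (Z ×ˢ (Finset.range (Z.card + 1) ×ˢ Finset.range (Z.card + 1)))
    fun p => phi (pp.coeff p.2.1) * p.1 ^ p.2.2
  obtain ⟨B, hB⟩ : ∃ B : ℝ, ∀ u ∈ Z, (e u : ℝ) / nu u ≤ B := by
    obtain ⟨B, hB⟩ := (Z.image fun u => (e u : ℝ) / nu u).exists_le
    exact ⟨B, fun u hu => hB _ (Finset.mem_image_of_mem _ hu)⟩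
  obtain ⟨M, hM⟩ := exists_nat_gt (B - b)
  refine ⟨M, fun s hs h0 => ?_⟩
  set sh : ℕ → HS := fun j => ∑ v ∈ Z, s v * v ^ j / pd Z v with hsh
  have hfix : ∀ j, sigma (sh j) = sh j := by
    intro j
    simp only [hsh]
    conv_rhs => rw [← H.stab.image]
    rw [Finset.sum_image fun _ _ _ _ h => sigma_injective h, map_sum]
    refine Finset.sum_congr rfl fun u _ => ?_
    rw [map_div₀, map_mul, map_pow, H.stab.sigma_pd, hs, H.stab.image]
  choose f hf using fun j => exists_poly_tail (hfix j)
  refine ⟨∑ k ∈ Finset.range (Z.card + 1), ∑ j ∈ Finset.range k,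
    Polynomial.C (pp.coeff k * f j) * Polynomial.X ^ (k - 1 - j), fun u hu => ?_⟩
  have : s u - Ev (∑ k ∈ Finset.range (Z.card + 1), ∑ j ∈ Finset.range k,
      Polynomial.C (pp.coeff k * f j) * Polynomial.X ^ (k - 1 - j)) u =
      ∑ k ∈ Finset.range (Z.card + 1), ∑ j ∈ Finset.range k,
        (phi (pp.coeff k) * u ^ (k - 1 - j)) * (sh j - phi (f j)) := by
    rw [H.recover s hu]
    simp only [Ev, Polynomial.eval₂_finsetSum, Polynomial.eval₂_mul, Polynomial.eval₂_C,
      Polynomial.eval₂_pow, Polynomial.eval₂_X, ← Finset.sum_sub_distrib, map_mul]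
    refine Finset.sum_congr rfl fun k _ => Finset.sum_congr rfl fun j _ => ?_
    simp only [hsh]
    ring
  rw [this]
  refine Ge.sum _ fun k hk => Ge.sum _ fun j hj => ?_
  have hk' := Finset.mem_range.1 hk
  have hj' := Finset.mem_range.1 hj
  refine ((hb (u, k, k - 1 - j) ?_).mul (hf j M (h0 j (by omega)))).mono ?_
  · simp only [Finset.mem_product, Finset.mem_range]
    exact ⟨hu, by omega, by omega⟩
  · linarith [hB u hu]

theorem existence (e : HS → ℤ) (he : ∀ u, e (sigma u) = e u) {u0 : HS} (hu : u0 ∈ Z)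
    (hno : ∀ f ∈ LL Z e, cf u0 (e u0 / nu u0) f = 0) :
    ∃ g ∈ LL Z (star dl (bump e u0)), cf u0 (star dl (bump e u0) u0 / nu u0) g ≠ 0 := by
  classical
  have hpos := H.stab.nu_pos hu
  have hpos' : (nu u0 : ℝ) ≠ 0 := by exact_mod_cast hpos.ne'
  set e' := bump e u0 with he'
  have hee : ∀ u, (e u : ℝ) ≤ e' u := by
    intro u; rw [he', bump]; split_ifs <;> simp
  have hmono : ∀ u ∈ Z, (e u : ℝ) / nu u ≤ e' u / nu u := by
    intro u _; gcongr; exact_mod_cast hee u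
  have he'inv : ∀ u, e' (sigma u) = e' u := by
    intro u; simp only [he', bump, he, H.stab.orb_sigma hu]
  have he'0 : e' u0 = e u0 + 1 := by rw [he', bump, if_pos (Orb.refl u0)]
  obtain ⟨s0, hs0, hs0eq, hs0off, hs0ge⟩ := H.stab.exists_equivariant hu
    (y := HahnSeries.single ((e u0 : ℝ) / nu u0) 1)
    (sigma_iterate_single ⟨e u0, by field_simp⟩ 1)
  obtain ⟨M, hM⟩ := H.exists_decomp e'
  let sh : (HS → HS) → ℕ → HS := fun s j => ∑ v ∈ Z, s v * v ^ j / pd Z v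
  let π : (HS → HS) →ₗ[ℂ] (Fin Z.card × Fin M → ℂ) :=
    { toFun := fun s p => (sh s p.1).coeff ((p.2 : ℕ) + 1 : ℝ)
      map_add' := fun s t => by
        ext p
        simp only [sh, Pi.add_apply, add_mul, add_div, Finset.sum_add_distrib,
          HahnSeries.coeff_add]
      map_smul' := fun c s => by
        ext p
        simp only [sh, Pi.smul_apply, RingHom.id_apply, ← HahnSeries.C_mul_eq_smul, mul_assoc,
          mul_div_assoc, ← Finset.mul_sum]
        rw [HahnSeries.C_mul_eq_smul, HahnSeries.coeff_smul] }
  let Λ : Submodule ℂ (HS → HS) :=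
    { carrier := {s | (∀ u, s (sigma u) = sigma (s u)) ∧ ∀ u ∈ Z, Ge (s u) (e' u / nu u)}
      add_mem' := fun {s t} hs ht => ⟨fun u => by simp [hs.1 u, ht.1 u], fun u hu =>
        (hs.2 u hu).add (ht.2 u hu)⟩
      zero_mem' := ⟨fun u => by simp, fun u _ => ge_zero _⟩
      smul_mem' := fun c s hs => ⟨fun u => by
          have h2 : sigma (HahnSeries.C c) = HahnSeries.C c := by
            simpa [HahnSeries.C_apply] using sigma_single_int 0 c
          rw [Pi.smul_apply, Pi.smul_apply, ← HahnSeries.C_mul_eq_smul,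
            ← HahnSeries.C_mul_eq_smul, map_mul, h2, hs.1], fun u hu => by
          intro a ha
          rw [Pi.smul_apply, HahnSeries.coeff_smul, hs.2 u hu a ha, smul_zero]⟩ }
  have hnot : π s0 ∉ Λ.map π := by
    rintro ⟨l, hl, hπ⟩
    obtain ⟨r, hr⟩ := hM (s0 - l) (fun u => by
        simp only [Pi.sub_apply, hs0eq, hl.1 u, map_sub]) (by
      intro j hj i hi1 hi2
      have h1 := congrFun hπ (⟨j, hj⟩, ⟨i - 1, by omega⟩)
      have h2 : π (s0 - l) (⟨j, hj⟩, ⟨i - 1, by omega⟩) = 0 := by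
        rw [map_sub, Pi.sub_apply, h1, sub_self]
      have h3 : (((i - 1 : ℕ) : ℝ) + 1) = i := by
        have : i - 1 + 1 = i := by omega
        exact_mod_cast this
      rw [← h3]
      exact h2)
    have hval : ∀ u ∈ Z, Ge (s0 u - Ev (r %ₘ pp) u) (e' u / nu u) := by
      intro u huZ
      rw [H.Ev_modByMonic r huZ]
      have h1 := (hr u huZ).add (hl.2 u huZ)
      rwa [Pi.sub_apply, show s0 u - l u - Ev r u + l u = s0 u - Ev r u by ring] at h1
    have hmem : r %ₘ pp ∈ LL Z e := by
      refine ⟨H.degree_modByMonic r, fun u huZ => ?_⟩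
      have h1 : Ge (s0 u) (e u / nu u) := by
        by_cases ho : Orb u0 u
        · refine hs0ge u ho _ ?_
          rw [ho.invariant he, ho.invariant nu_sigma]
          exact (lead_single _ _).ge
        · rw [hs0off u ho]; exact ge_zero _
      have h2 := h1.sub ((hval u huZ).mono (hmono u huZ))
      rwa [sub_sub_cancel] at h2
    have h1 := hno _ hmem
    have h2 := hval u0 hu (e u0 / nu u0) (by
      rw [he'0]
      gcongr
      linarith)
    rw [HahnSeries.coeff_sub, hs0, HahnSeries.coeff_single_same] at h2
    rw [show (Ev (r %ₘ pp) u0).coeff _ = 0 from h1, sub_zero] at h2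
    exact one_ne_zero h2
  obtain ⟨ψ, hψ, hker⟩ := Submodule.exists_le_ker_of_notMem hnot
  set c : Fin Z.card × Fin M → ℂ := fun p => ψ (Pi.single p 1)
  have hψc : ∀ w, ψ w = ∑ p, w p * c p := by
    intro w
    rw [LinearMap.pi_apply_eq_sum_univ ψ w]
    refine Finset.sum_congr rfl fun p _ => ?_
    rw [smul_eq_mul]
    congr 2
    funext q
    rw [Pi.single_apply]
    simp only [eq_comm]
  set t : Polynomial (Polynomial ℂ) := ∑ p : Fin Z.card × Fin M,
    Polynomial.C (Polynomial.C (c p) * Polynomial.X ^ (p.2 : ℕ)) * Polynomial.X ^ (p.1 : ℕ)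
  have hpair : ∀ s : HS → HS, (∑ u ∈ Z, Ev t u * s u / pd Z u).coeff 1 = ψ (π s) := by
    intro s
    have : ∑ u ∈ Z, Ev t u * s u / pd Z u =
        ∑ p : Fin Z.card × Fin M, HahnSeries.single (-((p.2 : ℕ) : ℝ)) (c p) * sh s p.1 := by
      simp only [t, sh, Ev, Polynomial.eval₂_finsetSum, Polynomial.eval₂_mul, Polynomial.eval₂_C,
        Polynomial.eval₂_pow, Polynomial.eval₂_X, map_mul, map_pow, phi_C, phi_X, Finset.mul_sum,
        Finset.sum_mul, Finset.sum_div]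
      rw [Finset.sum_comm]
      refine Finset.sum_congr rfl fun p _ => Finset.sum_congr rfl fun u _ => ?_
      have : HahnSeries.single (-((p.2 : ℕ) : ℝ)) (c p) = HahnSeries.C (c p) * xx ^ (p.2 : ℕ) := by
        rw [xx_pow, HahnSeries.C_apply, HahnSeries.single_mul_single]
        simp
      rw [this]
      ring
    rw [this, HahnSeries.coeff_sum, hψc]
    refine Finset.sum_congr rfl fun p _ => ?_
    rw [HahnSeries.coeff_single_mul, mul_comm]
    congr 2
    ring
  have hteq : ∀ s : HS → HS, (∀ u, s (sigma u) = sigma (s u)) → ∀ u ∈ Z,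
      Ev t (sigma u) * s (sigma u) / pd Z (sigma u) = sigma (Ev t u * s u / pd Z u) := by
    intro s hs u _
    rw [← sigma_Ev, ← H.stab.sigma_pd, hs, map_div₀, map_mul]
  have htge : ∀ u ∈ Z, Ge (Ev t u) (star dl e' u / nu u) := by
    intro u1 hu1 a ha
    by_contra hne
    have hpos1 := H.stab.nu_pos hu1
    have hpos1' : (0 : ℝ) < nu u1 := by exact_mod_cast hpos1
    have hy : Ev t u1 ≠ 0 := fun h => hne (by rw [h]; simp)
    have hL := exists_lead hy
    have hlc := leadingCoeff_ne hy
    obtain ⟨b, hb⟩ := H.exp_Ev t (u := u1) (a := (Ev t u1).order) (by rw [hL.2]; exact hlc) hu1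
    have hb' : b < star dl e' u1 := by
      have h1 : (Ev t u1).order ≤ a := HahnSeries.order_le_of_coeff_ne_zero hne
      have h2 : (b : ℝ) / nu u1 < star dl e' u1 / nu u1 := by rw [← hb]; linarith
      rw [div_lt_div_iff_of_pos_right hpos1'] at h2
      exact_mod_cast h2
    obtain ⟨α, hα, hLd⟩ := D.lead u1 hu1
    set m : ℤ := nu u1 + dl u1 - b with hm
    obtain ⟨s, hs1, hseq, hsoff, hsge⟩ := H.stab.exists_equivariant hu1
      (y := HahnSeries.single ((m : ℝ) / nu u1) 1)
      (sigma_iterate_single ⟨m, by field_simp⟩ 1)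
    have hsΛ : s ∈ Λ := by
      refine ⟨hseq, fun u huZ => ?_⟩
      by_cases ho : Orb u1 u
      · refine hsge u ho _ ?_
        rw [ho.invariant he'inv, ho.invariant nu_sigma]
        refine (lead_single _ _).ge.mono ?_
        gcongr
        rw [star_apply] at hb'
        omega
      · rw [hsoff u ho]; exact ge_zero _
    have h0 : ψ (π s) = 0 := hker (Submodule.mem_map_of_mem hsΛ)
    rw [← hpair, H.stab.coeff_one_sum hu1 (hteq s hseq)] at h0
    · rw [hs1] at h0
      have h2 := ((hL.mul (lead_single ((m : ℝ) / nu u1) 1)).div hLd hα).cast (e' := 1) (by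
        rw [hb, hm]
        push_cast
        field_simp
        ring)
      rw [h2.2] at h0
      rcases mul_eq_zero.1 h0 with h | h
      · exact hpos1.ne' (by exact_mod_cast h)
      · exact div_ne_zero (mul_ne_zero hlc one_ne_zero) hα h
    · intro u _ ho
      rw [hsoff u ho]; simp
  refine ⟨t %ₘ pp, ⟨H.degree_modByMonic t, fun u huZ => ?_⟩, ?_⟩
  · rw [H.Ev_modByMonic t huZ]; exact htge u huZ
  · intro h0
    have h0' : (Ev t u0).coeff (star dl e' u0 / nu u0) = 0 := by
      rw [← H.Ev_modByMonic t hu]; exact h0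
    obtain ⟨α, hα, hLd⟩ := D.lead u0 hu
    apply hψ
    rw [← hpair, H.stab.coeff_one_sum hu (hteq s0 hs0eq)]
    · have h1 := (htge u0 hu).lead
      rw [h0'] at h1
      have h2 := ((h1.mul (lead_single ((e u0 : ℝ) / nu u0) 1)).div hLd hα).cast (e' := 1) (by
        rw [star_apply, he'0]
        push_cast
        field_simp
        ring)
      rw [hs0, h2.2]
      simp
    · intro u _ ho
      rw [hs0off u ho]; simp

omit D in
theorem finrank_star_bump (D : Diff Z dl) (e : HS → ℤ) (he : ∀ u, e (sigma u) = e u) {u0 : HS}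
    (hu : u0 ∈ Z) :
    Module.finrank ℂ (LL Z e) + Module.finrank ℂ (LL Z (star dl (bump e u0))) =
      Module.finrank ℂ (LL Z (bump e u0)) + Module.finrank ℂ (LL Z (star dl e)) + 1 := by
  classical
  have he' : ∀ u, bump e u0 (sigma u) = bump e u0 u := by
    intro u; simp only [bump, he, H.stab.orb_sigma hu]
  have h1 := H.finrank_bump e he hu
  have h2 := H.finrank_bump (star dl (bump e u0)) (star_sigma D.inv he') hu
  rw [← star_eq_bump] at h2
  by_cases hf : ∃ f ∈ LL Z e, cf u0 (e u0 / nu u0) f ≠ 0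
  · by_cases hg : ∃ g ∈ LL Z (star dl (bump e u0)), cf u0 (star dl (bump e u0) u0 / nu u0) g ≠ 0
    · obtain ⟨f, hf, hf0⟩ := hf
      obtain ⟨g, hg, hg0⟩ := hg
      exact (H.exclusive D e hu hf hg hf0 hg0).elim
    · rw [if_pos hf] at h1
      rw [if_neg hg] at h2
      omega
  · have hg := H.existence D e he hu (by push Not at hf; exact hf)
    rw [if_neg hf] at h1
    rw [if_pos hg] at h2
    omega

omit D in
theorem euler_char_eq (D : Diff Z dl) (k : ℕ) : ∀ e e' : HS → ℤ, (∀ u, e (sigma u) = e u) →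
    (∀ u, e' (sigma u) = e' u) → (∀ u ∈ Z, e u ≤ e' u) → ∑ u ∈ Z, (e' u - e u) = k →
    2 * ((Module.finrank ℂ (LL Z e) : ℝ) - Module.finrank ℂ (LL Z (star dl e))) +
        ∑ u ∈ Z, (2 * e u : ℝ) / nu u =
      2 * ((Module.finrank ℂ (LL Z e') : ℝ) - Module.finrank ℂ (LL Z (star dl e'))) +
        ∑ u ∈ Z, (2 * e' u : ℝ) / nu u := by
  classical
  induction k using Nat.strong_induction_on with
  | _ k ih =>
    intro e e' he he' hle hk
    by_cases hall : ∀ u ∈ Z, e u = e' u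
    · have h1 : LL Z e = LL Z e' := by
        ext f
        simp only [mem_LL]
        refine and_congr_right fun _ => forall₂_congr fun u hu => by rw [hall u hu]
      have h2 : LL Z (star dl e) = LL Z (star dl e') := by
        ext f
        simp only [mem_LL, star_apply]
        refine and_congr_right fun _ => forall₂_congr fun u hu => by rw [hall u hu]
      rw [h1, h2, Finset.sum_congr rfl fun u hu => by rw [hall u hu]]
    · push Not at hall
      obtain ⟨u0, hu0, hne⟩ := hall
      have hinv : ∀ u, bump e u0 (sigma u) = bump e u0 u := by
        intro u; simp only [bump, he, H.stab.orb_sigma hu0]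
      have hpos : (nu u0 : ℝ) ≠ 0 := by exact_mod_cast (H.stab.nu_pos hu0).ne'
      have hsum : ∑ u ∈ Z, (if Orb u0 u then (1 : ℤ) else 0) = nu u0 := by
        rw [Finset.sum_boole, H.stab.orb_card hu0]
      have hle' : ∀ u ∈ Z, bump e u0 u ≤ e' u := by
        intro u hu
        simp only [bump]
        split_ifs with ho
        · have h1 := ho.invariant he
          have h2 := ho.invariant he'
          have := hle u0 hu0
          omega
        · have := hle u hu; omega
      have hs : ∑ u ∈ Z, (e' u - bump e u0 u) = (k : ℤ) - nu u0 := by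
        rw [← hk, ← hsum, ← Finset.sum_sub_distrib]
        refine Finset.sum_congr rfl fun u _ => ?_
        rw [bump]; ring
      have hnn : (0 : ℤ) ≤ ∑ u ∈ Z, (e' u - bump e u0 u) :=
        Finset.sum_nonneg fun u hu => sub_nonneg.2 (hle' u hu)
      have hp := H.stab.nu_pos hu0
      rw [← ih (k - nu u0) (by omega) (bump e u0) e' hinv he' hle' (by rw [hs]; omega)]
      have h1 := H.finrank_star_bump D e he hu0
      have h2 : ∑ u ∈ Z, (2 * (bump e u0 u : ℤ) : ℝ) / nu u =
          ∑ u ∈ Z, (2 * e u : ℝ) / nu u + 2 := by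
        have h3 : ∑ u ∈ Z, (if Orb u0 u then (2 : ℝ) / nu u0 else 0) = 2 := by
          rw [← Finset.sum_filter, Finset.sum_const, H.stab.orb_card hu0, nsmul_eq_mul]
          field_simp
        refine Eq.trans ?_ (congrArg (∑ u ∈ Z, (2 * e u : ℝ) / nu u + ·) h3)
        rw [← Finset.sum_add_distrib]
        refine Finset.sum_congr rfl fun u _ => ?_
        simp only [bump]
        split_ifs with ho
        · rw [ho.invariant nu_sigma]; push_cast; ring
        · simp
      rw [h2]
      have h4 : (Module.finrank ℂ (LL Z e) : ℝ) + Module.finrank ℂ (LL Z (star dl (bump e u0))) =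
        Module.finrank ℂ (LL Z (bump e u0)) + Module.finrank ℂ (LL Z (star dl e)) + 1 := by
        exact_mod_cast h1
      linarith

omit D in
/-- The Riemann–Roch formula for the curve `pp = 0`. -/
theorem riemann_roch (D : Diff Z dl) (e : HS → ℤ) (he : ∀ u, e (sigma u) = e u) :
    2 * ((Module.finrank ℂ (LL Z e) : ℝ) - Module.finrank ℂ (LL Z (star dl e))) =
      ∑ u ∈ Z, (1 + (dl u + 1 - 2 * e u : ℝ) / nu u) := by
  have hs := star_sigma D.inv he
  set E : HS → ℤ := fun u => max (e u) (star dl e u) with hE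
  have hEinv : ∀ u, E (sigma u) = E u := by intro u; simp only [hE, he, hs]
  have key : ∀ e1 : HS → ℤ, (∀ u, e1 (sigma u) = e1 u) → (∀ u, e1 u ≤ E u) → _ :=
    fun e1 h1 h2 => H.euler_char_eq D (∑ u ∈ Z, (E u - e1 u)).toNat e1 E h1 hEinv
      (fun u _ => h2 u) (Int.toNat_of_nonneg
        (Finset.sum_nonneg fun u _ => sub_nonneg.2 (h2 u))).symm
  have h1 := key e he fun u => le_max_left _ _
  have h2 := key (star dl e) hs fun u => le_max_right _ _
  rw [star_star] at h2
  have h3 : ∑ u ∈ Z, (1 + (dl u + 1 - 2 * e u : ℝ) / nu u) =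
      (∑ u ∈ Z, (2 * (star dl e u : ℤ) : ℝ) / nu u - ∑ u ∈ Z, (2 * e u : ℝ) / nu u) / 2 := by
    rw [← Finset.sum_sub_distrib, Finset.sum_div]
    refine Finset.sum_congr rfl fun u hu => ?_
    have hpos : (nu u : ℝ) ≠ 0 := by exact_mod_cast (H.stab.nu_pos hu).ne'
    rw [star_apply]
    push_cast
    field_simp
    ring
  rw [h3]
  linarith

end Cover

/-- Bivariate complex polynomials. -/
abbrev Bi := MvPolynomial (Fin 2) ℂ

/-- Evaluation of a bivariate polynomial at `(x, y)` for a series `y`. -/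
noncomputable def ev (y : HS) : Bi →+* HS := eval₂Hom HahnSeries.C ![xx, y]

@[simp] theorem ev_C (y : HS) (c : ℂ) : ev y (MvPolynomial.C c) = HahnSeries.C c := by simp [ev]
@[simp] theorem ev_X0 (y : HS) : ev y (MvPolynomial.X 0) = xx := by simp [ev]
@[simp] theorem ev_X1 (y : HS) : ev y (MvPolynomial.X 1) = y := by simp [ev]

instance : CharZero HS := charZero_of_injective_ringHom HahnSeries.C_injective

/-- A bivariate polynomial as a polynomial in `y` over `ℂ[x]`. -/
noncomputable def yp : Bi →+* Polynomial (Polynomial ℂ) :=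
  eval₂Hom (Polynomial.C.comp Polynomial.C) ![Polynomial.C Polynomial.X, Polynomial.X]

@[simp] theorem yp_C (c : ℂ) : yp (MvPolynomial.C c) = Polynomial.C (Polynomial.C c) := by simp [yp]
@[simp] theorem yp_X0 : yp (MvPolynomial.X 0) = Polynomial.C Polynomial.X := by simp [yp]
@[simp] theorem yp_X1 : yp (MvPolynomial.X 1) = Polynomial.X := by simp [yp]

/-- The inverse of `yp`. -/
noncomputable def py : Polynomial (Polynomial ℂ) →+* Bi :=
  Polynomial.eval₂RingHom (Polynomial.eval₂RingHom MvPolynomial.C (MvPolynomial.X 0))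
    (MvPolynomial.X 1)

theorem py_yp (f : Bi) : py (yp f) = f := by
  have : py.comp yp = RingHom.id _ := by
    apply MvPolynomial.ringHom_ext
    · intro r; simp [py]
    · intro i; fin_cases i <;> simp [py]
  exact RingHom.congr_fun this f

theorem yp_py (f : Polynomial (Polynomial ℂ)) : yp (py f) = f := by
  have : yp.comp py = RingHom.id _ := by
    apply Polynomial.ringHom_ext
    · intro a
      have : (yp.comp py).comp Polynomial.C = Polynomial.C := by
        apply Polynomial.ringHom_ext
        · intro r; simp [py]
        · simp [py]
      exact RingHom.congr_fun this a
    · simp [py]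
  exact RingHom.congr_fun this f

/-- `yp` as an equivalence. -/
noncomputable def ypEquiv : Bi ≃+* Polynomial (Polynomial ℂ) :=
  RingEquiv.ofRingHom yp py (RingHom.ext yp_py) (RingHom.ext py_yp)

theorem yp_injective : Function.Injective yp := ypEquiv.injective

theorem irreducible_yp_iff {f : Bi} : Irreducible (yp f) ↔ Irreducible f :=
  MulEquiv.irreducible_iff ypEquiv

theorem Ev_yp (f : Bi) (y : HS) : Ev (yp f) y = ev y f := by
  have : (Polynomial.eval₂RingHom phi y).comp yp = ev y := by
    apply MvPolynomial.ringHom_ext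
    · intro r; simp [phi]
    · intro i; fin_cases i <;> simp [phi]
  exact RingHom.congr_fun this f

theorem dx_sub (x y : HS) : dx (x - y) = dx x - dx y := by
  have := dx_add (x - y) y
  rw [sub_add_cancel] at this
  rw [this]; ring

theorem dx_ev (f : Bi) (y : HS) :
    dx (ev y f) = ev y (pderiv 0 f) + ev y (pderiv 1 f) * dx y := by
  induction f using MvPolynomial.induction_on with
  | C a => rw [ev_C, dx_C]; simp
  | add p q hp hq => rw [map_add, dx_add, hp, hq]; simp only [map_add]; ring
  | mul_X p i hp =>
    rw [map_mul, dx_mul, hp]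
    fin_cases i
    · simp [dx_xx, smul_eq_mul]; ring
    · simp [smul_eq_mul]; ring

theorem derivative_yp (f : Bi) : (yp f).derivative = yp (pderiv 1 f) := by
  induction f using MvPolynomial.induction_on with
  | C a => simp
  | add p q hp hq => simp only [map_add, hp, hq]
  | mul_X p i hp =>
    fin_cases i
    · simp [hp]; ring
    · simp [hp]; ring

theorem C_of_dx_eq_zero {y : HS} (h : dx y = 0) : y = HahnSeries.C (y.coeff 0) := by
  ext a
  by_cases ha : a = 0
  · subst ha; simp
  · rw [HahnSeries.C_apply, HahnSeries.coeff_single_of_ne ha]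
    have := congrArg (fun s : HS => s.coeff (a + 1)) h
    simpa [dx_coeff, ha] using this

/-- `(P, Q)` is a pair of `y`-monic polynomials with Jacobian determinant `κ`. -/
structure JPair (P Q : Bi) (κ : ℂ) : Prop where
  kappa_ne : κ ≠ 0
  jac : pderiv 0 P * pderiv 1 Q - pderiv 1 P * pderiv 0 Q = MvPolynomial.C κ
  monP : (yp P).Monic
  monQ : (yp Q).Monic
  posP : 0 < (yp P).natDegree
  posQ : 0 < (yp Q).natDegree

/-- The fibre `P = c` at infinity. -/
noncomputable def Zr (P : Bi) (c : ℂ) : Finset HS :=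
  open Classical in ((yp (P - MvPolynomial.C c)).map phi).roots.toFinset

theorem ev_sub_C (P : Bi) (c : ℂ) (y : HS) :
    ev y (P - MvPolynomial.C c) = ev y P - HahnSeries.C c := by simp

theorem pderiv_sub_C (P : Bi) (c : ℂ) (i : Fin 2) : pderiv i (P - MvPolynomial.C c) = pderiv i P := by
  simp

theorem yp_sub_C_monic {P : Bi} (hm : (yp P).Monic) (hd : 0 < (yp P).natDegree) (c : ℂ) :
    (yp (P - MvPolynomial.C c)).Monic := by
  rw [map_sub, yp_C]
  apply hm.sub_of_left
  refine lt_of_le_of_lt Polynomial.degree_C_le ?_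
  rw [← Polynomial.natDegree_pos_iff_degree_pos]; exact hd

theorem yp_sub_C_natDegree (P : Bi) (c : ℂ) :
    (yp (P - MvPolynomial.C c)).natDegree = (yp P).natDegree := by
  rw [map_sub, yp_C]; exact Polynomial.natDegree_sub_C

theorem Cover.of_factor {Z : Finset HS} {f g pp : Polynomial (Polynomial ℂ)} (H : Cover Z pp)
    (hf : f.Monic) (hfg : f * g = pp) :
    open Classical in Cover (Z.filter fun u => Ev f u = 0) f := by
  classical
  have hfm := hf.map phi
  have hne : pp.map phi ≠ 0 := (H.monic.map phi).ne_zero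
  have hle : (f.map phi).roots ≤ Z.val := by
    have h1 : (f.map phi).roots ≤ (pp.map phi).roots :=
      Polynomial.roots.le_of_dvd hne ⟨g.map phi, by rw [← hfg, Polynomial.map_mul]⟩
    rwa [H.map_eq, Polynomial.roots_prod_X_sub_C] at h1
  have hnd : (f.map phi).roots.Nodup := Multiset.nodup_of_le hle Z.nodup
  have hset : (f.map phi).roots = (Z.filter fun u => Ev f u = 0).val := by
    refine (Multiset.Nodup.ext hnd (Finset.nodup _)).2 fun u => ?_
    rw [Polynomial.mem_roots hfm.ne_zero, Finset.mem_val, Finset.mem_filter, Ev_eq,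
      Polynomial.IsRoot.def]
    refine ⟨fun h => ⟨?_, h⟩, fun h => h.2⟩
    exact Multiset.mem_of_le hle ((Polynomial.mem_roots hfm.ne_zero).2 h)
  refine ⟨?_, hf, ?_⟩
  · intro u hu
    rw [Finset.mem_filter] at hu ⊢
    refine ⟨H.stab u hu.1, ?_⟩
    rw [← sigma_Ev, hu.2, map_zero]
  · rw [(IsAlgClosed.splits (f.map phi)).eq_prod_roots_of_monic hfm, hset]
    rfl

namespace JPair

variable {P Q : Bi} {κ : ℂ} (J : JPair P Q κ)
include J

theorem symm : JPair Q P (-κ) where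
  kappa_ne := neg_ne_zero.2 J.kappa_ne
  jac := by rw [map_neg, ← J.jac]; ring
  monP := J.monQ
  monQ := J.monP
  posP := J.posQ
  posQ := J.posP

theorem ev_jac (y : HS) : dx (ev y P) * ev y (pderiv 1 Q) - ev y (pderiv 1 P) * dx (ev y Q) =
    HahnSeries.C κ := by
  have := congrArg (ev y) J.jac
  rw [ev_C] at this
  rw [← this, dx_ev, dx_ev]
  simp only [map_sub, map_mul]; ring

theorem C_kappa_ne : (HahnSeries.C κ : HS) ≠ 0 := by
  rw [Ne, map_eq_zero]; exact J.kappa_ne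

theorem simple {y : HS} {c : ℂ} (h : ev y P = HahnSeries.C c) : ev y (pderiv 1 P) ≠ 0 := by
  intro h0
  have := J.ev_jac y
  rw [h0, h, dx_C] at this
  exact J.C_kappa_ne (by rw [← this]; ring)

theorem cover (c : ℂ) : Cover (Zr P c) (yp (P - MvPolynomial.C c)) := by
  classical
  have hm := yp_sub_C_monic J.monP J.posP c
  have hmm := hm.map phi
  have hsep : ((yp (P - MvPolynomial.C c)).map phi).roots.Nodup := by
    rw [Multiset.nodup_iff_count_le_one]
    intro y
    rw [Polynomial.count_roots]
    by_contra! hcop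
    obtain ⟨hy1, hy2⟩ := (Polynomial.one_lt_rootMultiplicity_iff_isRoot hmm.ne_zero).1 hcop
    rw [Polynomial.IsRoot.def, Polynomial.derivative_map, derivative_yp, ← Ev_eq, Ev_yp,
      pderiv_sub_C] at hy2
    rw [Polynomial.IsRoot.def, ← Ev_eq, Ev_yp, ev_sub_C, sub_eq_zero] at hy1
    exact J.simple hy1 hy2
  refine ⟨?_, hm, ?_⟩
  · intro u hu
    simp only [Zr, Multiset.mem_toFinset, Polynomial.mem_roots hmm.ne_zero,
      Polynomial.IsRoot.def, ← Ev_eq] at hu ⊢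
    rw [← sigma_Ev, hu, map_zero]
  · rw [(IsAlgClosed.splits ((yp (P - MvPolynomial.C c)).map phi)).eq_prod_roots_of_monic hmm]
    rw [Zr, Finset.prod, Multiset.toFinset_val, Multiset.dedup_eq_self.2 hsep]

theorem mem_Zr {c : ℂ} {y : HS} : y ∈ Zr P c ↔ ev y P = HahnSeries.C c := by
  rw [← sub_eq_zero, ← ev_sub_C, ← Ev_yp]
  exact ⟨(J.cover c).Ev_mem, (J.cover c).mem_of_Ev⟩

theorem pf_eq (c : ℂ) (y : HS) : pf (Zr P c) y = ev y P - HahnSeries.C c := by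
  rw [← (J.cover c).Ev_pp, Ev_yp, ev_sub_C]

theorem pd_eq (c : ℂ) (y : HS) : pd (Zr P c) y = ev y (pderiv 1 P) := by
  rw [← (J.cover c).Ev_derivative, derivative_yp, Ev_yp, pderiv_sub_C]

theorem card_Zr (c : ℂ) : (Zr P c).card = (yp P).natDegree := by
  rw [← (J.cover c).natDegree, yp_sub_C_natDegree]

theorem kpair (hlt : (yp Q).natDegree < (yp P).natDegree) (c c' : ℂ) :
    KPair (Zr P c) (Zr Q c') κ where
  kappa_ne := J.kappa_ne
  key y := by
    rw [J.pf_eq, J.pd_eq, J.symm.pf_eq, J.symm.pd_eq, dx_sub, dx_sub, dx_C, dx_C, sub_zero,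
      sub_zero, J.ev_jac]
  card_pos := by rw [J.symm.card_Zr]; exact J.posQ
  card_lt := by rw [J.card_Zr, J.symm.card_Zr]; exact hlt

end JPair

namespace Cover

variable {Z : Finset HS} {pp : Polynomial (Polynomial ℂ)} (H : Cover Z pp)
include H

theorem exists_sum (f : Polynomial (Polynomial ℂ)) :
    ∃ g : Polynomial ℂ, ∑ u ∈ Z, Ev f u = phi g := by
  obtain ⟨g, hg⟩ := H.exists_trace (f * pp.derivative)
  refine ⟨g, hg ▸ Finset.sum_congr rfl fun u hu => ?_⟩
  rw [Ev_mul, H.Ev_derivative, mul_div_cancel_right₀ _ (pd_ne_zero Z hu)]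

omit H in
theorem _root_.KellerRational.phi_eq_C_of_ge {g : Polynomial ℂ} (h : Ge (phi g) 0) :
    phi g = HahnSeries.C (g.coeff 0) := by
  have : g = Polynomial.C (g.coeff 0) := by
    ext k
    rcases Nat.eq_zero_or_pos k with rfl | hk
    · simp
    · rw [Polynomial.coeff_C_of_ne_zero hk.ne', ← phi_coeff]
      exact h _ (by simpa using hk)
  conv_lhs => rw [this]
  simp [phi]

theorem const_of_bounded (f : Polynomial (Polynomial ℂ)) (hf : ∀ u ∈ Z, Ge (Ev f u) 0) {u : HS}
    (hu : u ∈ Z) : ∃ c : ℂ, Ev f u = HahnSeries.C c := by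
  classical
  have hpow : ∀ k : ℕ, ∑ v ∈ Z, Ev f v ^ k * dx (Ev f v) = 0 := by
    intro k
    obtain ⟨g, hg⟩ := H.exists_sum (f ^ (k + 1))
    have hE : ∀ v, Ev (f ^ (k + 1)) v = Ev f v ^ (k + 1) := fun v => Polynomial.eval₂_pow _ _ _
    simp only [hE] at hg
    have hge : Ge (phi g) 0 := by
      rw [← hg]
      refine Ge.sum _ fun v hv => ?_
      have := ((hf v hv).lead.pow (k + 1)).ge
      rwa [mul_zero] at this
    rw [phi_eq_C_of_ge hge] at hg
    have hd : ∀ (s : Finset HS) (h : HS → HS), dx (∑ v ∈ s, h v) = ∑ v ∈ s, dx (h v) := by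
      intro s h
      induction s using Finset.induction_on with
      | empty => simpa using dx_C 0
      | insert a s ha ih => rw [Finset.sum_insert ha, Finset.sum_insert ha, dx_add, ih]
    have hp : ∀ (a : HS) (k : ℕ), dx (a ^ (k + 1)) = (k + 1) * (a ^ k * dx a) := by
      intro a k
      induction k with
      | zero => simp
      | succ k ih => rw [pow_succ a (k + 1), dx_mul, ih]; push_cast; ring
    have h2 := congrArg dx hg
    rw [dx_C, hd] at h2
    simp only [hp, ← Finset.mul_sum] at h2
    rcases mul_eq_zero.1 h2 with h3 | h3
    · exact absurd h3 (by exact_mod_cast Nat.succ_ne_zero k)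
    · exact h3
  have hpoly : ∀ h : Polynomial HS, ∑ v ∈ Z, h.eval (Ev f v) * dx (Ev f v) = 0 := by
    intro h
    induction h using Polynomial.induction_on' with
    | add p q hp hq => simp only [Polynomial.eval_add, add_mul, Finset.sum_add_distrib, hp, hq, add_zero]
    | monomial n a =>
      simp only [Polynomial.eval_monomial, mul_assoc, ← Finset.mul_sum, hpow, mul_zero]
  set I := Z.image (Ev f)
  have hI : Ev f u ∈ I := Finset.mem_image_of_mem _ hu
  have := hpoly (Lagrange.interpolate I id (Pi.single (Ev f u) 1))
  have hev : ∀ v ∈ Z, (Lagrange.interpolate I id (Pi.single (Ev f u) 1)).eval (Ev f v) =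
      if Ev f v = Ev f u then 1 else 0 := by
    intro v hv
    have := Lagrange.eval_interpolate_at_node (v := id) (Pi.single (Ev f u) (1 : HS))
      (Set.injOn_id (I : Set HS)) (Finset.mem_image_of_mem _ hv)
    rw [id] at this
    rw [this, Pi.single_apply]
  rw [Finset.sum_congr rfl fun v hv => by rw [hev v hv]] at this
  have h2 : ∀ v ∈ Z, (if Ev f v = Ev f u then (1 : HS) else 0) * dx (Ev f v) =
      (if Ev f v = Ev f u then (1 : HS) else 0) * dx (Ev f u) := by
    intro v _
    split_ifs with h
    · rw [h]
    · simp
  rw [Finset.sum_congr rfl h2, ← Finset.sum_mul, Finset.sum_boole] at this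
  rcases mul_eq_zero.1 this with h3 | h3
  · exfalso
    rw [Nat.cast_eq_zero, Finset.card_eq_zero] at h3
    exact Finset.notMem_empty u (h3 ▸ Finset.mem_filter.2 ⟨hu, rfl⟩)
  · exact ⟨_, C_of_dx_eq_zero h3⟩

end Cover

theorem lead_family {Z : Finset HS} {z : HS} {r A : ℝ} {G : Polynomial ℂ} (hG : G ≠ 0)
    (h : ∀ ξ, Lead (pf Z (z + HahnSeries.single r ξ)) A (G.eval ξ)) :
    Av Z z r = A ∧ hat Z z r = G := by
  have h' : ∀ ξ, Lead (pf Z (z + HahnSeries.single r ξ)) (Av Z z r) ((hat Z z r).eval ξ) := by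
    intro ξ
    refine lead_pf Z ?_
    rw [add_sub_cancel_left]; exact lead_single r ξ
  have hA : Av Z z r = A := by
    have : hat Z z r * G ≠ 0 := mul_ne_zero (hat_ne_zero Z z r) hG
    obtain ⟨ξ, hξ⟩ : ∃ ξ, (hat Z z r * G).eval ξ ≠ 0 := by
      by_contra! hc
      exact this (Polynomial.funext fun ξ => by rw [hc ξ, Polynomial.eval_zero])
    rw [Polynomial.eval_mul] at hξ
    exact (h' ξ).exp_unique (h ξ) (left_ne_zero_of_mul hξ) (right_ne_zero_of_mul hξ)
  refine ⟨hA, Polynomial.funext fun ξ => ?_⟩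
  have := h' ξ
  rw [hA] at this
  exact this.unique (h ξ)

theorem hat_shift_neg {Z Z' : Finset HS} {c : ℂ} (hZ : ∀ y, pf Z' y = pf Z y + HahnSeries.C c)
    {z : HS} {r : ℝ} (hA : Av Z z r < 0) : Av Z' z r = Av Z z r ∧ hat Z' z r = hat Z z r := by
  refine lead_family (hat_ne_zero Z z r) fun ξ => ?_
  rw [hZ]
  refine Lead.add_gt (lead_pf Z ?_) ((lead_C c).ge.gt hA)
  rw [add_sub_cancel_left]; exact lead_single r ξ

theorem hat_shift_zero {Z Z' : Finset HS} {c : ℂ} (hZ : ∀ y, pf Z' y = pf Z y + HahnSeries.C c)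
    {z : HS} {r : ℝ} (hA : Av Z z r = 0) (hN : hat Z z r + Polynomial.C c ≠ 0) :
    Av Z' z r = 0 ∧ hat Z' z r = hat Z z r + Polynomial.C c := by
  refine lead_family hN fun ξ => ?_
  rw [hZ, Polynomial.eval_add, Polynomial.eval_C, ← hA]
  refine Lead.add (lead_pf Z ?_) (hA ▸ lead_C c)
  rw [add_sub_cancel_left]; exact lead_single r ξ

namespace JPair

variable {P Q : Bi} {κ : ℂ} (J : JPair P Q κ)
include J

theorem pf_shift (c c' : ℂ) (y : HS) :
    pf (Zr P c') y = pf (Zr P c) y + HahnSeries.C (c - c') := by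
  rw [J.pf_eq, J.pf_eq, map_sub]; ring

/-- Irreducibility of `P - c` from transitivity of the monodromy on the part of the fibre at
infinity where `Q` is unbounded. -/
theorem irreducible_of_oneOrbit {c : ℂ}
    (h : OneOrbit (Zr P c) fun u => ¬ Ge (ev u Q) 0) : Irreducible (P - MvPolynomial.C c) := by
  classical
  have H := J.cover c
  rw [← irreducible_yp_iff]
  have hne1 : yp (P - MvPolynomial.C c) ≠ 1 := by
    intro h1
    have := J.posP
    rw [← yp_sub_C_natDegree P c, h1] at this
    simp at this
  rw [H.monic.irreducible_iff_natDegree]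
  refine ⟨hne1, fun f g hf hg hfg => ?_⟩
  by_contra! hcon
  have key : ∀ f g : Polynomial (Polynomial ℂ), f.Monic → f.natDegree ≠ 0 →
      f * g = yp (P - MvPolynomial.C c) → ∃ u ∈ Zr P c, Ev f u = 0 ∧ ¬ Ge (ev u Q) 0 := by
    intro f g hf hd hfg
    have Hf := H.of_factor hf hfg
    by_contra! hb
    have hpos : 0 < ((Zr P c).filter fun u => Ev f u = 0).card := by
      rw [← Hf.natDegree]; exact Nat.pos_of_ne_zero hd
    obtain ⟨u, hu⟩ := Finset.card_pos.1 hpos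
    obtain ⟨a, ha⟩ := Hf.const_of_bounded (yp Q) (fun v hv => by
      rw [Ev_yp]; rw [Finset.mem_filter] at hv; exact hb v hv.1 hv.2) hu
    rw [Ev_yp] at ha
    have hj := J.ev_jac u
    rw [ha, J.mem_Zr.1 (Finset.mem_filter.1 hu).1, dx_C, dx_C] at hj
    exact J.C_kappa_ne (by rw [← hj]; ring)
  obtain ⟨u, hu, huf, huQ⟩ := key f g hf hcon.1 hfg
  obtain ⟨v, hv, hvg, hvQ⟩ := key g f hg hcon.2 (by rw [mul_comm]; exact hfg)
  obtain ⟨j, hj⟩ := h u hu v hv huQ hvQ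
  have hvf : Ev f v = 0 := by
    rw [← hj, ← sigma_iterate_Ev, huf]
    exact Function.iterate_fixed (map_zero sigma) j
  have hd := H.Ev_derivative v
  rw [← hfg, Polynomial.derivative_mul, Ev_add, Ev_mul, Ev_mul, hvf, hvg] at hd
  refine pd_ne_zero _ hv ?_
  rw [← hd]; ring

end JPair

namespace KTree

theorem exists_term_of_order_zero {Zp Zq : Finset HS} {κ : ℂ} (T : KTree Zp Zq κ) {z : HS} {c : ℂ}
    (hc : c ≠ 0) (h : pf Zp z = HahnSeries.C c ∨ pf Zq z = HahnSeries.C c) :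
    ∃ r, Term Zp Zq z r := by
  have key : ∀ Z : Finset HS, pf Z z = HahnSeries.C c → ∀ᶠ s in atTop, Av Z z s = 0 := by
    intro Z hZ
    have hz : z ∉ Z := by
      intro hz
      have : pf Z z = 0 := Finset.prod_eq_zero hz (sub_self z)
      rw [this] at hZ
      exact hc ((map_eq_zero (HahnSeries.C : ℂ →+* HS)).1 hZ.symm)
    have h1 := order_pf hz
    rw [hZ] at h1
    have h2 := h1.exp_unique (lead_C c) (Finset.prod_ne_zero_iff.2 fun u hu =>
      leadingCoeff_ne (sub_ne_zero.2 fun e => hz (e ▸ hu))) hc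
    filter_upwards [eventually_Av Z hz] with s hs
    rw [hs, h2]
  rcases h with h | h
  · obtain ⟨s, hs⟩ := (key Zp h).exists
    exact T.exists_term ⟨s, fun h' => by rw [hs] at h'; exact lt_irrefl _ h'.2⟩
  · exact T.exists_term_of_eventually ((key Zq h).frequently.mono fun s hs => hs.ge)

end KTree

namespace JPair

variable {P Q : Bi} {κ : ℂ} (J : JPair P Q κ)
include J

theorem exists_term_p {cP cQ : ℂ} (T : KTree (Zr P cP) (Zr Q cQ) κ) {c : ℂ} {u : HS}
    (hu : u ∈ Zr P c) : ∃ r, Term (Zr P cP) (Zr Q cQ) u r := by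
  by_cases h : c = cP
  · subst h; exact T.exists_term_of_mem_p hu
  · refine T.exists_term_of_order_zero (sub_ne_zero.2 h) (Or.inl ?_)
    rw [J.pf_eq, J.mem_Zr.1 hu, map_sub]

theorem exists_term_q {cP cQ : ℂ} (T : KTree (Zr P cP) (Zr Q cQ) κ) {c : ℂ} {u : HS}
    (hu : u ∈ Zr Q c) : ∃ r, Term (Zr P cP) (Zr Q cQ) u r := by
  by_cases h : c = cQ
  · subst h; exact T.exists_term_of_mem_q hu
  · refine T.exists_term_of_order_zero (sub_ne_zero.2 h) (Or.inr ?_)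
    rw [J.symm.pf_eq, J.symm.mem_Zr.1 hu, map_sub]

omit J in
theorem ge_ev_iff (J : JPair P Q κ) {c : ℂ} {y : HS} :
    Ge (ev y P) 0 ↔ Ge (pf (Zr P c) y) 0 := by
  rw [J.pf_eq]
  refine ⟨fun h => h.sub (lead_C c).ge, fun h => ?_⟩
  have := h.add (lead_C c).ge
  rwa [sub_add_cancel] at this

/-- A root `u` of `P - c` at which the disc is not good is close to exactly one root of
`P - c₀`, and conversely. -/
theorem oneOrbit_transfer {c c' : ℂ} {rd : HS → ℝ} (hrd : ∀ y, rd (sigma y) = rd y)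
    {S S' : HS → Prop}
    (hclose : ∀ u ∈ Zr P c', S' u → ∃ w ∈ Zr P c, S w ∧ Gt (w - u) (rd w) ∧
      Av (Zr P c) w (rd w) < 0 ∧
      ∀ ξ, (hat (Zr P c) w (rd w)).eval ξ = 0 →
        (hat (Zr P c) w (rd w)).derivative.eval ξ ≠ 0)
    (h : OneOrbit (Zr P c) S) : OneOrbit (Zr P c') S' := by
  intro u hu v hv hSu hSv
  obtain ⟨w, hw, hSw, hwu, hA, hs⟩ := hclose u hu hSu
  obtain ⟨w', hw', hSw', hwv, hA', hs'⟩ := hclose v hv hSv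
  obtain ⟨j, hj⟩ := h w hw w' hw' hSw hSw'
  refine ⟨j, ?_⟩
  have hrw : rd w' = rd w := by
    rw [← hj]
    clear hj
    induction j with
    | zero => rfl
    | succ j ih => rw [Function.iterate_succ_apply' (⇑sigma), hrd, ih]
  have hju : Gt (w' - sigma^[j] u) (rd w') := by
    rw [← hj]
    have : ∀ j, Gt (sigma^[j] w - sigma^[j] u) (rd w) := by
      intro j
      induction j with
      | zero => exact hwu
      | succ j ih =>
        rw [Function.iterate_succ_apply' (⇑sigma), Function.iterate_succ_apply' (⇑sigma),
          ← map_sub, gt_sigma_iff]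
        exact ih
    rw [hj, hrw, ← hj]; exact this j
  have hhat := (hat_shift_neg (J.pf_shift c c') hA').2
  rw [← hhat] at hs'
  refine Term.eq_of_gt hs' ((J.cover c').stab.iterate hu j) hv hju.ge ?_
  have := hwv.sub hju
  rwa [sub_sub_sub_cancel_left] at this

theorem irreducible_q {cP cQ : ℂ} (T : KTree (Zr P cP) (Zr Q cQ) κ)
    (h : OneOrbit (Zr Q cQ) fun w => ap (Zr P cP) (Zr Q cQ) w < 0) (c : ℂ) :
    Irreducible (Q - MvPolynomial.C c) := by
  refine J.symm.irreducible_of_oneOrbit (J.symm.oneOrbit_transfer (c := cQ)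
    (rd := rad (Zr P cP) (Zr Q cQ)) T.rad_sigma ?_ h)
  intro u hu hS
  obtain ⟨r, hr⟩ := J.exists_term_q T hu
  rw [J.ge_ev_iff (c := cP)] at hS
  have hneg : Av (Zr P cP) u r < 0 ∧ Av (Zr Q cQ) u r < 0 := by
    rcases T.term_cases hr with h1 | h1
    · exact h1.2
    · refine absurd ?_ hS
      have := (lead_pf (Zr P cP) (KTree.lead_self u r)).ge
      rwa [h1.1] at this
  have hq := lead_pf (Zr Q cQ) (KTree.lead_self u r)
  have hq0 : Ge (pf (Zr Q cQ) u) 0 := by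
    rw [← J.symm.ge_ev_iff, J.symm.mem_Zr.1 hu]; exact (lead_C c).ge
  have h0 : (hat (Zr Q cQ) u r).eval 0 = 0 := hq.2.symm.trans (hq0 _ hneg.2)
  obtain ⟨w, hw, hwu⟩ := (hat_eval_eq_zero_iff _ _ _ _).1 h0
  have hg : Ge (u - w) r := by
    have := hwu.ge.neg; rwa [neg_sub] at this
  have hr' := hr.congr hg
  have hrad := hr'.rad_eq
  refine ⟨w, hw, ?_, ?_, ?_, ?_⟩
  · rw [ap, hrad, ← Av_congr _ hg le_rfl]; exact hneg.1
  · rw [hrad]; exact hwu.gt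
  · rw [hrad, ← Av_congr _ hg le_rfl]; exact hneg.2
  · rw [hrad]; exact T.simple_q hr'

theorem irreducible_p {cP cQ : ℂ} (T : KTree (Zr P cP) (Zr Q cQ) κ)
    (h : OneOrbit (Zr P cP) fun w => bq (Zr P cP) (Zr Q cQ) w < 0) (c : ℂ) :
    Irreducible (P - MvPolynomial.C c) := by
  refine J.irreducible_of_oneOrbit (J.oneOrbit_transfer (c := cP)
    (rd := rad (Zr P cP) (Zr Q cQ)) T.rad_sigma ?_ h)
  intro u hu hS
  obtain ⟨r, hr⟩ := J.exists_term_p T hu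
  rw [J.symm.ge_ev_iff (c := cQ)] at hS
  have hneg : Av (Zr P cP) u r < 0 ∧ Av (Zr Q cQ) u r < 0 := by
    rcases T.term_cases hr with h1 | h1
    · exact h1.2
    · refine absurd ?_ hS
      have := (lead_pf (Zr Q cQ) (KTree.lead_self u r)).ge
      rwa [h1.2.1] at this
  have hq := lead_pf (Zr P cP) (KTree.lead_self u r)
  have hq0 : Ge (pf (Zr P cP) u) 0 := by
    rw [← J.ge_ev_iff, J.mem_Zr.1 hu]; exact (lead_C c).ge
  have h0 : (hat (Zr P cP) u r).eval 0 = 0 := hq.2.symm.trans (hq0 _ hneg.1)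
  obtain ⟨w, hw, hwu⟩ := (hat_eval_eq_zero_iff _ _ _ _).1 h0
  have hg : Ge (u - w) r := by
    have := hwu.ge.neg; rwa [neg_sub] at this
  have hr' := hr.congr hg
  have hrad := hr'.rad_eq
  refine ⟨w, hw, ?_, ?_, ?_, ?_⟩
  · rw [bq, hrad, ← Av_congr _ hg le_rfl]; exact hneg.2
  · rw [hrad]; exact hwu.gt
  · rw [hrad, ← Av_congr _ hg le_rfl]; exact hneg.1
  · rw [hrad]; exact T.simple_p hr'

end JPair

theorem hat_translate (Z : Finset HS) {z z' : HS} {r : ℝ} (h : Ge (z - z') r) :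
    hat Z z r = (hat Z z' r).comp (Polynomial.X + Polynomial.C ((z - z').coeff r)) := by
  refine (lead_family ?_ (A := Av Z z' r) fun ξ => ?_).2
  · intro h0
    have := congrArg (fun f => f.comp (Polynomial.X - Polynomial.C ((z - z').coeff r))) h0
    simp only [Polynomial.comp_assoc, Polynomial.add_comp, Polynomial.X_comp,
      Polynomial.C_comp, sub_add_cancel, Polynomial.comp_X, Polynomial.zero_comp] at this
    exact hat_ne_zero Z z' r this
  · simp only [Polynomial.eval_comp, Polynomial.eval_add, Polynomial.eval_X, Polynomial.eval_C]
    refine lead_pf Z ?_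
    have := (lead_single r ξ).add h.lead
    rwa [show HahnSeries.single r ξ + (z - z') = z + HahnSeries.single r ξ - z' by ring] at this

theorem mnv_mono (y : HS) {r s : ℝ} (h : r ≤ s) : mnv y r ≤ mnv y s := by
  unfold mnv
  split_ifs
  · exact h
  · exact min_le_min le_rfl h

theorem Av_strictMono {Z : Finset HS} {u : HS} (hu : u ∈ Z) {r s : ℝ} (h : r < s) :
    Av Z u r < Av Z u s := by
  refine Finset.sum_lt_sum (fun v _ => mnv_mono _ h.le) ⟨u, hu, ?_⟩
  rw [sub_self]; simpa [mnv] using h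

/-- The discs around points of `Z` on which `pf Z` has generic valuation zero. -/
def ZeroDiscs (Z : Finset HS) : Set (HS × ℝ) := {a | a.1 ∈ Z ∧ Av Z a.1 a.2 = 0}

theorem zeroDiscs_finite (Z : Finset HS) : (ZeroDiscs Z).Finite := by
  refine Set.Finite.of_finite_image (f := Prod.fst) (Z.finite_toSet.subset ?_) ?_
  · rintro _ ⟨a, ha, rfl⟩; exact ha.1
  · rintro ⟨u, r⟩ ⟨hu, hr⟩ ⟨v, s⟩ ⟨hv, hs⟩ (rfl : u = v)
    rcases lt_trichotomy r s with h | h | h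
    · have := Av_strictMono hu h; simp only at hr hs; linarith
    · rw [h]
    · have := Av_strictMono hu h; simp only at hr hs; linarith

namespace JPair

variable {P Q : Bi} {κ : ℂ} (J : JPair P Q κ)
include J

theorem exists_generic (hlt : (yp Q).natDegree < (yp P).natDegree) :
    ∃ EP : Set ℂ, EP.Finite ∧ ∀ cP ∉ EP, ∃ EQ : Set ℂ, EQ.Finite ∧ ∀ cQ ∉ EQ,
      KTree (Zr P cP) (Zr Q cQ) κ := by
  classical
  refine ⟨⋃ a ∈ ZeroDiscs (Zr P 0), (((hat (Zr P 0) a.1 a.2).derivative.roots.toFinset.image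
    fun ξ => (hat (Zr P 0) a.1 a.2).eval ξ : Finset ℂ) : Set ℂ),
    (zeroDiscs_finite _).biUnion fun a _ => Finset.finite_toSet _, fun cP hcP => ?_⟩
  refine ⟨⋃ a ∈ ZeroDiscs (Zr P 0), (((hat (Zr Q 0) a.1 a.2).derivative.roots.toFinset.image
      fun ξ => (hat (Zr Q 0) a.1 a.2).eval ξ) ∪
      ((hat (Zr P 0) a.1 a.2 - Polynomial.C cP).roots.toFinset.image
        fun ξ => (hat (Zr Q 0) a.1 a.2).eval ξ) : Finset ℂ),
    (zeroDiscs_finite _).biUnion fun a _ => Finset.finite_toSet _, fun cQ hcQ => ?_⟩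
  have K := J.kpair hlt cP cQ
  refine ⟨K, (J.cover cP).stab, (J.symm.cover cQ).stab, fun z r hT hA => ?_⟩
  have hB : Av (Zr Q cQ) z r = 0 := by
    rcases K.term_cases hT with h | h
    · exact absurd hA h.2.1.ne
    · exact h.2.1
  have hcard := K.card_ratio hT.1
  have hconst : ∀ Z : Finset HS, Nge Z z r = 0 → ∀ ξ, (hat Z z r).eval ξ ≠ 0 := by
    intro Z hZ ξ h0
    rw [← hat_natDegree] at hZ
    rw [Polynomial.eq_C_of_natDegree_eq_zero hZ, Polynomial.eval_C] at h0
    apply hat_ne_zero Z z r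
    rw [Polynomial.eq_C_of_natDegree_eq_zero hZ, h0, map_zero]
  have hq0 := K.card_pos
  have hp0 := K.card_pos.trans K.card_lt
  by_cases hN : Nge (Zr Q cQ) z r = 0
  · have hN' : Nge (Zr P cP) z r = 0 := by
      rw [hN, mul_zero] at hcard
      exact (Nat.mul_eq_zero.1 hcard).resolve_left hq0.ne'
    exact fun ξ => ⟨fun h => absurd h (hconst _ hN' ξ), fun h => absurd h (hconst _ hN ξ)⟩
  have hN' : Nge (Zr P cP) z r ≠ 0 := by
    intro h
    rw [h, mul_zero] at hcard
    exact hN ((Nat.mul_eq_zero.1 hcard.symm).resolve_left hp0.ne')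
  have hnd : ∀ (Z : Finset HS) (c : ℂ), Nge Z z r ≠ 0 → hat Z z r + Polynomial.C c ≠ 0 := by
    intro Z c h h0
    rw [← hat_natDegree, ← Polynomial.natDegree_add_C (a := c), h0] at h
    exact h (by simp)
  obtain ⟨hA0, hP0⟩ := hat_shift_zero (J.pf_shift cP 0) hA (hnd _ _ hN')
  obtain ⟨hB0, hQ0⟩ := hat_shift_zero (J.symm.pf_shift cQ 0) hB (hnd _ _ hN)
  rw [sub_zero] at hP0 hQ0
  have hPd : Nge (Zr P 0) z r ≠ 0 := by
    rw [← hat_natDegree, hP0, Polynomial.natDegree_add_C, hat_natDegree]; exact hN'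
  obtain ⟨u, hu⟩ := Finset.card_pos.1 (Nat.pos_of_ne_zero hPd)
  rw [Finset.mem_filter] at hu
  have hmem : (u, r) ∈ ZeroDiscs (Zr P 0) :=
    ⟨hu.1, by rw [← hA0]; exact (Av_congr _ hu.2 le_rfl).symm⟩
  have htP := hat_translate (Zr P 0) hu.2
  have htQ := hat_translate (Zr Q 0) hu.2
  set a := (z - u).coeff r
  set φ := hat (Zr P 0) u r with hφ
  set ψ := hat (Zr Q 0) u r with hψ
  rw [htP] at hP0
  rw [htQ] at hQ0
  have hp : hat (Zr P cP) z r = φ.comp (Polynomial.X + Polynomial.C a) - Polynomial.C cP := by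
    rw [hP0]; ring
  have hq : hat (Zr Q cQ) z r = ψ.comp (Polynomial.X + Polynomial.C a) - Polynomial.C cQ := by
    rw [hQ0]; ring
  have hφd : φ.natDegree ≠ 0 := by
    intro h
    rw [← hat_natDegree, hp, Polynomial.natDegree_sub_C, Polynomial.natDegree_comp, h,
      zero_mul] at hN'
    exact hN' rfl
  have hψd : ψ.natDegree ≠ 0 := by
    intro h
    rw [← hat_natDegree, hq, Polynomial.natDegree_sub_C, Polynomial.natDegree_comp, h,
      zero_mul] at hN
    exact hN rfl
  have hder : ∀ f : Polynomial ℂ, f.natDegree ≠ 0 → f.derivative ≠ 0 := fun f hf h =>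
    hf (Polynomial.derivative_eq_zero.1 h)
  have hsub : φ - Polynomial.C cP ≠ 0 := by
    intro h
    apply hφd
    rw [← Polynomial.natDegree_sub_C (a := cP), h, Polynomial.natDegree_zero]
  intro ξ
  simp only [hp, hq, Polynomial.eval_sub, Polynomial.eval_comp, Polynomial.eval_add,
    Polynomial.eval_X, Polynomial.eval_C, Polynomial.derivative_sub, Polynomial.derivative_C,
    Polynomial.derivative_comp, Polynomial.derivative_add, Polynomial.derivative_X, add_zero,
    sub_zero, one_mul, sub_eq_zero]
  simp only [Set.mem_iUnion, not_exists] at hcP hcQ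
  have hcP := hcP _ hmem
  have hcQ := hcQ _ hmem
  simp only [Finset.coe_union, Finset.coe_image, Set.mem_union, Set.mem_image, Finset.mem_coe,
    Multiset.mem_toFinset, Polynomial.mem_roots (hder _ hφd), Polynomial.mem_roots (hder _ hψd),
    Polynomial.mem_roots hsub, Polynomial.IsRoot.def, ← hφ, ← hψ, not_or, not_exists, not_and,
    Polynomial.eval_sub, Polynomial.eval_C, sub_eq_zero] at hcP hcQ
  exact ⟨fun h => ⟨fun h' => hcP _ h' h, fun h' => hcQ.2 _ h (sub_eq_zero.1 h')⟩, fun h h' => hcQ.1 _ h' h⟩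

end JPair

theorem one_mem_LL {Z : Finset HS} (hZ : 0 < Z.card) {e : HS → ℤ} (he : ∀ u ∈ Z, e u ≤ 0) :
    (1 : Polynomial (Polynomial ℂ)) ∈ LL Z e := by
  refine ⟨by rw [Polynomial.degree_one]; exact_mod_cast hZ, fun u hu => ?_⟩
  have : Ev 1 u = 1 := Polynomial.eval₂_one _ _
  rw [this]
  refine lead_one.ge.mono (div_nonpos_of_nonpos_of_nonneg ?_ (Nat.cast_nonneg _))
  exact_mod_cast he u hu

theorem one_le_finrank_LL {Z : Finset HS} (hZ : 0 < Z.card) {e : HS → ℤ}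
    (he : ∀ u ∈ Z, e u ≤ 0) : 1 ≤ Module.finrank ℂ (LL Z e) := by
  have := Cover.finiteDimensional_LL Z e
  rw [Nat.one_le_iff_ne_zero, Ne, Submodule.finrank_eq_zero]
  intro h
  have h1 := one_mem_LL hZ he
  rw [h, Submodule.mem_bot] at h1
  exact one_ne_zero h1

theorem LL_anti {Z : Finset HS} {e e' : HS → ℤ} (h : ∀ u ∈ Z, e u ≤ e' u) : LL Z e' ≤ LL Z e := by
  intro f hf
  refine ⟨hf.1, fun u hu => (hf.2 u hu).mono ?_⟩
  gcongr
  exact_mod_cast h u hu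

/-- Valuation of the `y`-derivative of the first polynomial, in units of `1 / nu`. -/
noncomputable def dlp (Zp Zq : Finset HS) (u : HS) : ℤ :=
  ⌊nu u * (ap Zp Zq u - rad Zp Zq u)⌋

/-- Valuation of the `y`-derivative of the second polynomial, in units of `1 / nu`. -/
noncomputable def dlq (Zp Zq : Finset HS) (u : HS) : ℤ :=
  ⌊nu u * (bq Zp Zq u - rad Zp Zq u)⌋

namespace KTree

variable {Zp Zq : Finset HS} {κ : ℂ} (T : KTree Zp Zq κ)
include T

theorem dlp_div {u : HS} (hu : u ∈ Zp) :
    (dlp Zp Zq u : ℝ) / nu u = ap Zp Zq u - rad Zp Zq u := by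
  obtain ⟨n, hn⟩ := T.int_dp hu
  have hν : (0 : ℝ) < nu u := by exact_mod_cast T.sigP.nu_pos hu
  rw [dlp, hn, Int.floor_intCast, ← hn]
  field_simp

theorem dlq_div {u : HS} (hu : u ∈ Zq) :
    (dlq Zp Zq u : ℝ) / nu u = bq Zp Zq u - rad Zp Zq u := by
  obtain ⟨n, hn⟩ := T.int_dq hu
  have hν : (0 : ℝ) < nu u := by exact_mod_cast T.sigQ.nu_pos hu
  rw [dlq, hn, Int.floor_intCast, ← hn]
  field_simp

theorem diff_p : Diff Zp (dlp Zp Zq) where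
  inv u := by rw [dlp, dlp, T.ap_sigma, T.rad_sigma, nu_sigma]
  lead u hu := by
    refine ⟨_, T.simple_p (T.term_p hu) 0 (hat_self hu _), ?_⟩
    rw [T.dlp_div hu]
    exact lead_pd Zp (lead_self u _)

theorem diff_q : Diff Zq (dlq Zp Zq) where
  inv u := by rw [dlq, dlq, T.bq_sigma, T.rad_sigma, nu_sigma]
  lead u hu := by
    refine ⟨_, T.simple_q (T.term_q hu) 0 (hat_self hu _), ?_⟩
    rw [T.dlq_div hu]
    exact lead_pd Zq (lead_self u _)

theorem rr_p {pp : Polynomial (Polynomial ℂ)} (H : Cover Zp pp) :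
    ∑ u ∈ Zp, (fd Zp Zq u - 1 / nu u) = -∑ u ∈ Zp, bq Zp Zq u -
      2 * ((Module.finrank ℂ (LL Zp 0) : ℝ) - Module.finrank ℂ (LL Zp (star (dlp Zp Zq) 0))) := by
  rw [H.riemann_roch T.diff_p 0 fun _ => rfl, ← Finset.sum_neg_distrib, ← Finset.sum_sub_distrib]
  refine Finset.sum_congr rfl fun u hu => ?_
  rw [add_sub_assoc, add_div, T.dlp_div hu, fd, ff, ap, bq]
  simp only [Pi.zero_apply, Int.cast_zero]
  ring

theorem rr_q {qq : Polynomial (Polynomial ℂ)} (H : Cover Zq qq) :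
    ∑ u ∈ Zq, (fd Zp Zq u - 1 / nu u) = -∑ u ∈ Zp, bq Zp Zq u -
      2 * ((Module.finrank ℂ (LL Zq 0) : ℝ) - Module.finrank ℂ (LL Zq (star (dlq Zp Zq) 0))) := by
  rw [T.sum_bq_eq_sum_ap, H.riemann_roch T.diff_q 0 fun _ => rfl, ← Finset.sum_neg_distrib,
    ← Finset.sum_sub_distrib]
  refine Finset.sum_congr rfl fun u hu => ?_
  rw [add_sub_assoc, add_div, T.dlq_div hu, fd, ff, ap, bq]
  simp only [Pi.zero_apply, Int.cast_zero]
  ring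

/-- Functions on the second curve with at most a simple pole along the branches where the first
polynomial is unbounded. -/
noncomputable def _root_.KellerRational.pole (Zp Zq : Finset HS) (w : HS) : ℤ :=
  open Classical in if ap Zp Zq w < 0 then -1 else 0

theorem two_le_finrank_pole {qq : Polynomial (Polynomial ℂ)} (H : Cover Zq qq)
    (hS : OneOrbit Zq fun w => ap Zp Zq w < 0) {w0 : HS} (hw0 : w0 ∈ Zq) (hneg : ap Zp Zq w0 < 0)
    (hΩ : Module.finrank ℂ (LL Zq (star (dlq Zp Zq) 0)) = 0) :
    2 ≤ Module.finrank ℂ (LL Zq (pole Zp Zq)) := by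
  classical
  have hinv : ∀ u, pole Zp Zq (sigma u) = pole Zp Zq u := fun u => by
    rw [pole, pole, T.ap_sigma]
  have h1 := H.riemann_roch T.diff_q (pole Zp Zq) hinv
  have h0 := H.riemann_roch T.diff_q 0 fun _ => rfl
  have hΩ' : Module.finrank ℂ (LL Zq (star (dlq Zp Zq) (pole Zp Zq))) = 0 := by
    have := Cover.finiteDimensional_LL Zq (star (dlq Zp Zq) 0)
    rw [← Nat.le_zero, ← hΩ]
    refine Submodule.finrank_mono (LL_anti fun u _ => ?_)
    rw [star_apply, star_apply, pole, Pi.zero_apply]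
    split_ifs <;> omega
  have hsum : ∑ u ∈ Zq, (1 + (dlq Zp Zq u + 1 - 2 * pole Zp Zq u : ℝ) / nu u) =
      ∑ u ∈ Zq, (1 + (dlq Zp Zq u + 1 - 2 * (0 : HS → ℤ) u : ℝ) / nu u) + 2 := by
    have : ∑ u ∈ Zq, (if Orb w0 u then (1 : ℝ) / nu w0 else 0) = 1 := by
      rw [← Finset.sum_filter, Finset.sum_const, T.sigQ.orb_card hw0, nsmul_eq_mul]
      have hν : (0 : ℝ) < nu w0 := by exact_mod_cast T.sigQ.nu_pos hw0
      field_simp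
    have h2 : ∑ u ∈ Zq, 2 * (if Orb w0 u then (1 : ℝ) / nu w0 else 0) = 2 := by
      rw [← Finset.mul_sum, this, mul_one]
    conv_rhs => rw [← h2]
    rw [← Finset.sum_add_distrib]
    refine Finset.sum_congr rfl fun u hu => ?_
    by_cases hu' : ap Zp Zq u < 0
    · have ho : Orb w0 u := hS w0 hw0 u hu hneg hu'
      rw [if_pos ho, pole, if_pos hu', ho.invariant nu_sigma]
      simp only [Pi.zero_apply, Int.cast_zero, Int.cast_neg, Int.cast_one]
      ring
    · have ho : ¬ Orb w0 u := fun ho => hu' (by rw [ho.invariant T.ap_sigma]; exact hneg)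
      rw [if_neg ho, pole, if_neg hu']
      simp
  rw [hsum, ← h0, hΩ, hΩ'] at h1
  have h2 := one_le_finrank_LL T.card_pos (e := 0) fun _ _ => le_rfl
  have h3 : (Module.finrank ℂ (LL Zq (pole Zp Zq)) : ℝ) = Module.finrank ℂ (LL Zq 0) + 1 := by
    push_cast at h1; linarith
  have h4 : Module.finrank ℂ (LL Zq (pole Zp Zq)) = Module.finrank ℂ (LL Zq 0) + 1 := by
    exact_mod_cast h3
  omega

end KTree

theorem exists_ringEquiv_of_countable {A K L : Type} [Field A] [Field K] [Field L]
    [IsAlgClosed K] [IsAlgClosed L] (φ : A →+* K) (ψ : A →+* L)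
    (hA : Cardinal.mk A ≤ Cardinal.aleph0) (hK : Cardinal.aleph0 < Cardinal.mk K)
    (hKL : Cardinal.mk K = Cardinal.mk L) :
    ∃ τ : K ≃+* L, ∀ a, τ (φ a) = ψ a := by
  let := φ.toAlgebra
  let := ψ.toAlgebra
  obtain ⟨s, hs⟩ := exists_isTranscendenceBasis A K
  obtain ⟨t, ht⟩ := exists_isTranscendenceBasis A L
  have h : Cardinal.mk s = Cardinal.mk t := by
    rw [← IsAlgClosed.cardinal_eq_cardinal_transcendence_basis_of_aleph0_lt' _ hs hA hK,
      ← IsAlgClosed.cardinal_eq_cardinal_transcendence_basis_of_aleph0_lt' _ ht hA (hKL ▸ hK), hKL]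
  obtain ⟨e⟩ := Cardinal.eq.1 h
  let := IsAlgClosed.isAlgClosure_of_transcendence_basis _ hs
  let := IsAlgClosed.isAlgClosure_of_transcendence_basis _ ht
  let e' : Algebra.adjoin A (Set.range ((↑) : s → K)) ≃ₐ[A]
      Algebra.adjoin A (Set.range ((↑) : t → L)) :=
    hs.1.aevalEquiv.symm.trans ((renameEquiv A e).trans ht.1.aevalEquiv)
  refine ⟨IsAlgClosure.equivOfEquiv K L e'.toRingEquiv, fun a => ?_⟩
  have h1 := IsAlgClosure.equivOfEquiv_algebraMap K L e'.toRingEquiv (algebraMap A _ a)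
  have h2 : e'.toRingEquiv (algebraMap A _ a) = algebraMap A _ a := e'.commutes a
  rw [h2] at h1
  exact h1

theorem exists_algHom_of_transcendental (k : Subfield ℂ) {z z' : ℂ} (ht : Transcendental k z)
    (ht' : Transcendental k z') :
    ∃ φ : IntermediateField.adjoin k {z} →ₐ[k] ℂ,
      φ (IntermediateField.AdjoinSimple.gen k z) = z' := by
  refine ⟨(IntermediateField.val _).comp
      ((RatFunc.algEquivOfTranscendental z ht).symm.trans
        (RatFunc.algEquivOfTranscendental z' ht')).toAlgHom, ?_⟩
  have h1 : (RatFunc.algEquivOfTranscendental z ht).symm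
      (IntermediateField.AdjoinSimple.gen k z) = algebraMap (Polynomial k) _ Polynomial.X := by
    rw [AlgEquiv.symm_apply_eq, RatFunc.algEquivOfTranscendental_algebraMap, Polynomial.aeval_X]
  change ((RatFunc.algEquivOfTranscendental z' ht')
    ((RatFunc.algEquivOfTranscendental z ht).symm _) : ℂ) = z'
  rw [h1, RatFunc.algEquivOfTranscendental_algebraMap, Polynomial.aeval_X]
  rfl

theorem transcendental_add_natCast (k : Subfield ℂ) {z : ℂ} (ht : Transcendental k z) (n : ℕ) :
    Transcendental k (z + n) := by
  intro h
  have h2 : IsAlgebraic k ((n : ℕ) : ℂ) := isAlgebraic_natCast n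
  apply ht
  simpa using h.sub h2

theorem exists_algHom_ne (k : Subfield ℂ) {z : ℂ} (hz : z ∉ k) :
    ∃ φ : IntermediateField.adjoin k {z} →ₐ[k] ℂ,
      φ (IntermediateField.AdjoinSimple.gen k z) ≠ z := by
  by_cases hi : IsIntegral k z
  · have hsp : ((minpoly k z).map (algebraMap k ℂ)).Splits := IsAlgClosed.splits _
    have hnd : ((minpoly k z).aroots ℂ).Nodup :=
      Polynomial.nodup_aroots_iff_of_splits (minpoly.ne_zero hi) hsp |>.2
        (minpoly.irreducible hi).separable
    have hdeg : (minpoly k z).natDegree ≠ 1 := fun h => by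
      obtain ⟨a, ha⟩ := (minpoly.natDegree_eq_one_iff).1 h
      exact hz (ha ▸ a.2)
    have hcard : Multiset.card ((minpoly k z).aroots ℂ) = (minpoly k z).natDegree := by
      rw [Polynomial.aroots, ← hsp.natDegree_eq_card_roots, Polynomial.natDegree_map]
    have hpos := minpoly.natDegree_pos hi
    obtain ⟨z', hz', hne⟩ : ∃ z' ∈ (minpoly k z).aroots ℂ, z' ≠ z := by
      by_contra! h
      have h2 := Multiset.eq_replicate_card.2 h
      rw [hcard] at h2
      rw [h2, Multiset.nodup_iff_count_le_one] at hnd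
      have := hnd z
      rw [Multiset.count_replicate_self] at this
      omega
    let φ := (IntermediateField.algHomAdjoinIntegralEquiv k hi).symm ⟨z', hz'⟩
    refine ⟨φ, ?_⟩
    have := IntermediateField.algHomAdjoinIntegralEquiv_symm_apply_gen k hi ⟨z', hz'⟩
    intro h
    exact hne (this.symm.trans h)
  · have ht : Transcendental k z := fun h => hi h.isIntegral
    obtain ⟨φ, hφ⟩ := exists_algHom_of_transcendental k ht (transcendental_add_natCast k ht 1)
    exact ⟨φ, by simp [hφ]⟩

theorem exists_aut_extending (k : Subfield ℂ) (hk : Cardinal.mk k ≤ Cardinal.aleph0) {z : ℂ}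
    (φ : IntermediateField.adjoin k {z} →ₐ[k] ℂ) :
    ∃ τ : ℂ ≃+* ℂ, (∀ a ∈ k, τ a = a) ∧ τ z = φ (IntermediateField.AdjoinSimple.gen k z) := by
  have hc : Cardinal.mk (IntermediateField.adjoin k {z}) ≤ Cardinal.aleph0 := by
    refine (IntermediateField.cardinalMk_adjoin_le k {z}).trans ?_
    simp [hk]
  obtain ⟨τ, hτ⟩ := exists_ringEquiv_of_countable
    (algebraMap (IntermediateField.adjoin k {z}) ℂ) φ.toRingHom hc
    (by rw [Cardinal.mk_complex]; exact Cardinal.aleph0_lt_continuum) rfl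
  exact ⟨τ, fun a ha => (hτ (algebraMap k _ ⟨a, ha⟩)).trans (φ.commutes ⟨a, ha⟩),
    hτ (IntermediateField.AdjoinSimple.gen k z)⟩

theorem exists_aut_add_natCast (k : Subfield ℂ) (hk : Cardinal.mk k ≤ Cardinal.aleph0) {z : ℂ}
    (hz : Transcendental k z) (n : ℕ) : ∃ τ : ℂ ≃+* ℂ, (∀ a ∈ k, τ a = a) ∧ τ z = z + n := by
  obtain ⟨φ, hφ⟩ := exists_algHom_of_transcendental k hz (transcendental_add_natCast k hz n)
  exact hφ ▸ exists_aut_extending k hk φ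

/-- A countable subfield of `ℂ` is the fixed field of the automorphisms fixing it. -/
theorem exists_aut_ne (k : Subfield ℂ) (hk : Cardinal.mk k ≤ Cardinal.aleph0) {z : ℂ}
    (hz : z ∉ k) : ∃ τ : ℂ ≃+* ℂ, (∀ a ∈ k, τ a = a) ∧ τ z ≠ z := by
  obtain ⟨φ, hφ⟩ := exists_algHom_ne k hz
  obtain ⟨τ, h1, h2⟩ := exists_aut_extending k hk φ
  exact ⟨τ, h1, h2 ▸ hφ⟩

/-- Galois descent for spaces of polynomials. -/
theorem exists_coeff_mem_of_aut_stable (k : Subfield ℂ) (hk : Cardinal.mk k ≤ Cardinal.aleph0)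
    (V : Submodule ℂ Bi)
    (hV : ∀ τ : ℂ ≃+* ℂ, (∀ a ∈ k, τ a = a) → ∀ f ∈ V, map (τ : ℂ →+* ℂ) f ∈ V)
    {f : Bi} (hf : f ∈ V) (hf0 : f ≠ 0) : ∃ g ∈ V, g ≠ 0 ∧ ∀ s, g.coeff s ∈ k := by
  induction hN : f.support.card using Nat.strong_induction_on generalizing f with
  | _ N ih =>
    obtain ⟨s0, hs0⟩ := MvPolynomial.ne_zero_iff.1 hf0
    set g := (f.coeff s0)⁻¹ • f with hg
    have hgV : g ∈ V := V.smul_mem _ hf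
    have hg0 : g ≠ 0 := smul_ne_zero (inv_ne_zero hs0) hf0
    have hg1 : g.coeff s0 = 1 := by rw [hg, coeff_smul, smul_eq_mul, inv_mul_cancel₀ hs0]
    by_cases hall : ∀ s, g.coeff s ∈ k
    · exact ⟨g, hgV, hg0, hall⟩
    · push Not at hall
      obtain ⟨s, hs⟩ := hall
      obtain ⟨τ, hτ, hne⟩ := exists_aut_ne k hk hs
      have hdV : map (τ : ℂ →+* ℂ) g - g ∈ V := V.sub_mem (hV τ hτ g hgV) hgV
      refine ih _ ?_ hdV ?_ rfl
      · rw [← hN]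
        apply Finset.card_lt_card
        refine ⟨fun t ht => ?_, fun h => ?_⟩
        · rw [mem_support_iff] at ht ⊢
          intro h0
          apply ht
          have : g.coeff t = 0 := by rw [hg, coeff_smul, h0, smul_zero]
          rw [coeff_sub, coeff_map, this]
          simp
        · have := h (mem_support_iff.2 hs0)
          rw [mem_support_iff, coeff_sub, coeff_map, hg1] at this
          simp at this
      · intro h0
        apply hne
        have := congrArg (coeff s) h0
        rw [coeff_sub, coeff_map, coeff_zero, sub_eq_zero] at this
        exact this

/-! ### Conjugating series by automorphisms of the coefficients -/

/-- The coefficientwise action of an automorphism of `ℂ`. -/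
noncomputable def tw (τ : ℂ ≃+* ℂ) : HS →+* HS where
  toFun y := HahnSeries.map y (τ : ℂ →+* ℂ)
  map_one' := HahnSeries.map_one (τ : ℂ →+* ℂ).toMonoidWithZeroHom
  map_mul' _ _ := HahnSeries.map_mul (τ : ℂ →ₙ+* ℂ)
  map_zero' := by ext; simp
  map_add' x y := by ext; simp

theorem tw_coeff (τ : ℂ ≃+* ℂ) (y : HS) (a : ℝ) : (tw τ y).coeff a = τ (y.coeff a) := rfl

theorem ge_tw {τ : ℂ ≃+* ℂ} {y : HS} {e : ℝ} : Ge (tw τ y) e ↔ Ge y e := by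
  simp [Ge, tw_coeff]

theorem tw_C (τ : ℂ ≃+* ℂ) (a : ℂ) : tw τ (HahnSeries.C a) = HahnSeries.C (τ a) :=
  HahnSeries.map_C a (τ : ℂ →+* ℂ)

theorem tw_xx (τ : ℂ ≃+* ℂ) : tw τ xx = xx := by
  ext a
  rw [tw_coeff, xx, HahnSeries.coeff_single]
  split_ifs <;> simp

theorem tw_symm (τ : ℂ ≃+* ℂ) (y : HS) : tw τ (tw τ.symm y) = y := by
  ext a
  simp [tw_coeff]

theorem tw_ev (τ : ℂ ≃+* ℂ) (y : HS) (f : Bi) :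
    tw τ (ev y f) = ev (tw τ y) (map (τ : ℂ →+* ℂ) f) := by
  induction f using MvPolynomial.induction_on with
  | C a => rw [map_C, ev_C, ev_C, tw_C]; rfl
  | add p q hp hq => simp only [map_add, hp, hq]
  | mul_X p i hp =>
    rw [map_mul, map_mul, hp, map_mul, map_mul, map_X]
    congr 1
    fin_cases i
    · change tw τ (ev y (X 0)) = ev (tw τ y) (X 0)
      rw [ev_X0, ev_X0, tw_xx]
    · change tw τ (ev y (X 1)) = ev (tw τ y) (X 1)
      rw [ev_X1, ev_X1]

theorem yp_map (τ : ℂ ≃+* ℂ) (f : Bi) :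
    yp (map (τ : ℂ →+* ℂ) f) = (yp f).map (Polynomial.mapRingHom (τ : ℂ →+* ℂ)) := by
  induction f using MvPolynomial.induction_on with
  | C a => simp [yp_C]
  | add p q hp hq => simp only [map_add, hp, hq, Polynomial.map_add]
  | mul_X p i hp =>
    rw [map_mul, map_mul, hp, map_mul, Polynomial.map_mul, map_X]
    congr 1
    fin_cases i
    · change yp (X 0) = (yp (X 0)).map _
      simp [yp_X0]
    · change yp (X 1) = (yp (X 1)).map _
      simp [yp_X1]

theorem degree_yp_map (τ : ℂ ≃+* ℂ) (f : Bi) :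
    (yp (map (τ : ℂ →+* ℂ) f)).degree = (yp f).degree := by
  rw [yp_map]
  exact Polynomial.degree_map_eq_of_injective
    (Polynomial.map_injective _ τ.injective) _

/-! ### Polynomials over a subfield -/

/-- Polynomials with coefficients in a subfield. -/
noncomputable def overf (K : Subfield ℂ) : Subring Bi := (MvPolynomial.map (algebraMap K ℂ)).range

theorem mem_overf {K : Subfield ℂ} {f : Bi} : f ∈ overf K ↔ ∀ s, f.coeff s ∈ K := by
  constructor
  · rintro ⟨g, rfl⟩ s
    rw [coeff_map]
    exact (g.coeff s).2
  · intro h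
    have : f ∈ Set.range (MvPolynomial.map (algebraMap K ℂ)) := by
      rw [mem_range_map_iff_coeffs_subset]
      intro a ha
      obtain ⟨s, -, rfl⟩ := mem_coeffs_iff.1 ha
      exact ⟨⟨_, h s⟩, rfl⟩
    exact this

theorem C_mem_overf {K : Subfield ℂ} {a : ℂ} (ha : a ∈ K) : MvPolynomial.C a ∈ overf K :=
  ⟨MvPolynomial.C ⟨a, ha⟩, MvPolynomial.map_C _ _⟩

theorem pderiv_mem_overf {K : Subfield ℂ} {f : Bi} (hf : f ∈ overf K) (i : Fin 2) :
    pderiv i f ∈ overf K := by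
  obtain ⟨g, rfl⟩ := hf
  exact ⟨pderiv i g, pderiv_map.symm⟩

theorem map_eq_of_overf {K : Subfield ℂ} {f : Bi} (hf : f ∈ overf K) {τ : ℂ ≃+* ℂ}
    (hτ : ∀ a ∈ K, τ a = a) : map (τ : ℂ →+* ℂ) f = f := by
  ext s
  rw [coeff_map]
  exact hτ _ (mem_overf.1 hf s)

/-- A polynomial over `K` vanishing on the curve `Q = c` with `c` transcendental is zero. -/
theorem eq_zero_of_ev_eq_zero {P Q : Bi} {κ : ℂ} (J : JPair P Q κ) {K : Subfield ℂ}
    (hK : Cardinal.mk K ≤ Cardinal.aleph0) (hQ : Q ∈ overf K) {c : ℂ} (hc : Transcendental K c)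
    {b : Bi} (hb : b ∈ overf K) (h : ∀ w ∈ Zr Q c, ev w b = 0) : b = 0 := by
  classical
  by_contra hb0
  have hroot : ∀ n : ℕ, ∃ w, ev w b = 0 ∧ ev w Q = HahnSeries.C (c + n) := by
    intro n
    obtain ⟨τ, hτ, hτc⟩ := exists_aut_add_natCast K hK hc n
    have hne : (Zr Q c).Nonempty := by
      rw [← Finset.card_pos, J.symm.card_Zr]
      exact J.posQ
    obtain ⟨w, hw⟩ := hne
    refine ⟨tw τ w, ?_, ?_⟩
    · have := tw_ev τ w b
      rw [h w hw, map_zero, map_eq_of_overf hb hτ] at this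
      exact this.symm
    · have := tw_ev τ w Q
      rw [J.symm.mem_Zr.1 hw, map_eq_of_overf hQ hτ, tw_C, hτc] at this
      exact this.symm
  choose w hw1 hw2 using hroot
  have hinj : Function.Injective w := by
    intro i j hij
    have h1 := hw2 i
    rw [hij, hw2 j] at h1
    have := HahnSeries.C_injective h1
    simpa using this.symm
  have hb1 : (yp b).map phi ≠ 0 := by
    rw [Polynomial.map_ne_zero_iff phi_injective]
    exact fun h => hb0 (yp_injective (by rw [h, map_zero]))
  refine Set.infinite_range_of_injective hinj
    (((yp b).map phi).roots.toFinset.finite_toSet.subset ?_)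
  rintro _ ⟨n, rfl⟩
  simp only [Finset.mem_coe, Multiset.mem_toFinset, Polynomial.mem_roots hb1, Polynomial.IsRoot]
  rw [← Ev_eq, Ev_yp, hw1]

/-! ### The kernel of the Jacobian derivation -/

theorem pderiv_comm (f : Bi) : pderiv 0 (pderiv 1 f) = pderiv 1 (pderiv 0 f) := by
  ext s
  simp only [coeff_pderiv, add_right_comm s]
  simp
  ring

theorem eq_C_of_pderiv_eq_zero {b : Bi} (h0 : pderiv 0 b = 0) (h1 : pderiv 1 b = 0) :
    b = MvPolynomial.C (b.coeff 0) := by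
  have hall : ∀ i : Fin 2, pderiv i b = 0 := by
    intro i
    fin_cases i
    · exact h0
    · exact h1
  ext s
  rw [coeff_C]
  split_ifs with hs
  · rw [← hs]
  · obtain ⟨i, hi⟩ : ∃ i, s i ≠ 0 := by
      by_contra! h
      exact hs (by ext i; simp [h i])
    have h2 := congrArg (coeff (s - Finsupp.single i 1)) (hall i)
    have h3 : s - Finsupp.single i 1 + Finsupp.single i 1 = s :=
      tsub_add_cancel_of_le (Finsupp.single_le_iff.2 (Nat.one_le_iff_ne_zero.2 hi))
    rw [coeff_pderiv, h3, coeff_zero] at h2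
    rcases mul_eq_zero.1 h2 with h4 | h4
    · exact h4
    · norm_cast at h4

theorem pderiv_aeval (q : Polynomial ℂ) (f : Bi) (i : Fin 2) :
    pderiv i (Polynomial.aeval f q) = Polynomial.aeval f q.derivative * pderiv i f := by
  induction q using Polynomial.induction_on' with
  | add p q hp hq => simp only [map_add, hp, hq, add_mul]
  | monomial n a =>
    rw [Polynomial.derivative_monomial, Polynomial.aeval_monomial, Polynomial.aeval_monomial]
    change pderiv i (MvPolynomial.C a * f ^ n) =
      MvPolynomial.C (a * n) * f ^ (n - 1) * pderiv i f
    rw [pderiv_C_mul, pderiv_pow, map_mul, map_natCast]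
    ring

theorem exists_antiderivative (q : Polynomial ℂ) : ∃ r : Polynomial ℂ, r.derivative = q := by
  induction q using Polynomial.induction_on' with
  | add p q hp hq =>
    obtain ⟨a, rfl⟩ := hp
    obtain ⟨b, rfl⟩ := hq
    exact ⟨a + b, by simp⟩
  | monomial n a =>
    refine ⟨Polynomial.monomial (n + 1) (a / (n + 1)), ?_⟩
    rw [Polynomial.derivative_monomial]
    congr 1
    push_cast
    field_simp

namespace JPair
variable {P Q : Bi} {κ : ℂ} (J : JPair P Q κ)
include J

theorem pderiv_q_ne : pderiv 1 Q ≠ 0 := by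
  intro h
  have h1 := derivative_yp Q
  rw [h, map_zero] at h1
  exact J.posQ.ne' (Polynomial.derivative_eq_zero.1 h1)

/-- Polynomials commuting with `Q` for the Jacobian bracket are polynomials in `Q`. -/
theorem exists_aeval_of_jac_eq_zero {b : Bi}
    (h : pderiv 0 b * pderiv 1 Q - pderiv 1 b * pderiv 0 Q = 0) :
    ∃ q : Polynomial ℂ, b = Polynomial.aeval Q q := by
  induction hn : (yp b).natDegree using Nat.strong_induction_on generalizing b with
  | _ n ih =>
  subst hn
  set e := pderiv 0 P * pderiv 1 b - pderiv 1 P * pderiv 0 b with he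
  have hy : MvPolynomial.C κ * pderiv 1 b = pderiv 1 Q * e := by
    rw [← J.jac, he]
    linear_combination (pderiv 1 P) * h
  have hx : MvPolynomial.C κ * pderiv 0 b = pderiv 0 Q * e := by
    rw [← J.jac, he]
    linear_combination (pderiv 0 P) * h
  have hκ : (MvPolynomial.C κ : Bi) ≠ 0 := by simpa using J.kappa_ne
  by_cases hb : pderiv 1 b = 0
  · have he0 : e = 0 := by
      rw [hb, mul_zero] at hy
      exact (mul_eq_zero.1 hy.symm).resolve_left J.pderiv_q_ne
    rw [he0, mul_zero] at hx
    have hb0 := (mul_eq_zero.1 hx).resolve_left hκ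
    exact ⟨Polynomial.C (b.coeff 0), by
      rw [Polynomial.aeval_C]; exact eq_C_of_pderiv_eq_zero hb0 hb⟩
  have he0 : e ≠ 0 := by
    intro h0
    rw [h0, mul_zero] at hy
    exact hb ((mul_eq_zero.1 hy).resolve_left hκ)
  have hJ : pderiv 0 e * pderiv 1 Q - pderiv 1 e * pderiv 0 Q = 0 := by
    have h1 := congrArg (pderiv 0) hy
    have h2 := congrArg (pderiv 1) hx
    rw [pderiv_C_mul, pderiv_mul, pderiv_comm] at h1
    rw [pderiv_C_mul, pderiv_mul] at h2
    have h3 := pderiv_comm Q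
    rw [h3] at h1
    linear_combination h2 - h1
  have hlt : (yp e).natDegree < (yp b).natDegree := by
    have h1 := congrArg (fun f => (yp f).natDegree) hy
    have hd : (yp (pderiv 1 b)).natDegree < (yp b).natDegree := by
      rw [← derivative_yp]
      refine Polynomial.natDegree_derivative_lt ?_
      intro h0
      apply hb
      apply yp_injective
      rw [← derivative_yp, map_zero, Polynomial.eq_C_of_natDegree_eq_zero h0,
        Polynomial.derivative_C]
    have hz : ∀ f : Bi, f ≠ 0 → yp f ≠ 0 := fun f hf =>
      (map_ne_zero_iff yp yp_injective).2 hf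
    simp only [map_mul] at h1
    rw [Polynomial.natDegree_mul (hz _ hκ) (hz _ hb),
      Polynomial.natDegree_mul (hz _ J.pderiv_q_ne) (hz _ he0), yp_C,
      Polynomial.natDegree_C] at h1
    omega
  obtain ⟨q, hq⟩ := ih _ hlt hJ rfl
  obtain ⟨r, hr⟩ := exists_antiderivative q
  have hgrad : ∀ i, MvPolynomial.C κ * pderiv i b = pderiv i Q * e →
      pderiv i (MvPolynomial.C κ * b - Polynomial.aeval Q r) = 0 := by
    intro i hi
    rw [map_sub, pderiv_C_mul, pderiv_aeval, hr, ← hq, hi]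
    ring
  have hc := eq_C_of_pderiv_eq_zero (hgrad 0 hx) (hgrad 1 hy)
  set a := coeff 0 (MvPolynomial.C κ * b - Polynomial.aeval Q r)
  refine ⟨Polynomial.C κ⁻¹ * (r + Polynomial.C a), ?_⟩
  have h1 : MvPolynomial.C κ⁻¹ * MvPolynomial.C κ = (1 : Bi) := by
    rw [← map_mul, inv_mul_cancel₀ J.kappa_ne, map_one]
  rw [map_mul, map_add, Polynomial.aeval_C, Polynomial.aeval_C]
  change b = MvPolynomial.C κ⁻¹ * (Polynomial.aeval Q r + MvPolynomial.C a)
  rw [← hc]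
  linear_combination -b * h1

end JPair

/-! ### Descent of coefficients on a generic fiber -/

/-- The subfield generated by `c` over `K`. -/
noncomputable def adj (K : Subfield ℂ) (c : ℂ) : Subfield ℂ :=
  (IntermediateField.adjoin K {c}).toSubfield

theorem mem_adj {K : Subfield ℂ} {c x : ℂ} :
    x ∈ adj K c ↔ ∃ r s : Polynomial K, x = Polynomial.aeval c r / Polynomial.aeval c s :=
  IntermediateField.mem_adjoin_simple_iff K x

theorem le_adj (K : Subfield ℂ) (c : ℂ) : K ≤ adj K c := fun a ha =>
  (IntermediateField.adjoin K {c}).algebraMap_mem ⟨a, ha⟩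

theorem self_mem_adj (K : Subfield ℂ) (c : ℂ) : c ∈ adj K c :=
  IntermediateField.mem_adjoin_simple_self K c

theorem mk_adj_le {K : Subfield ℂ} (hK : Cardinal.mk K ≤ Cardinal.aleph0) (c : ℂ) :
    Cardinal.mk (adj K c) ≤ Cardinal.aleph0 := by
  have : Countable K := Cardinal.mk_le_aleph0_iff.1 hK
  have hp : Countable (Polynomial K) := by
    rw [← Cardinal.mk_le_aleph0_iff]
    exact Polynomial.cardinalMk_le_max.trans (max_le hK le_rfl)
  rw [Cardinal.mk_le_aleph0_iff]
  have hsub : (adj K c : Set ℂ) ⊆ Set.range fun p : Polynomial K × Polynomial K =>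
      Polynomial.aeval c p.1 / Polynomial.aeval c p.2 := by
    intro x hx
    obtain ⟨r, s, rfl⟩ := mem_adj.1 hx
    exact ⟨(r, s), rfl⟩
  exact ((Set.countable_range _).mono hsub).to_subtype

theorem ev_aeval (w : HS) (f : Bi) (q : Polynomial ℂ) :
    ev w (Polynomial.aeval f q) = q.eval₂ HahnSeries.C (ev w f) := by
  induction q using Polynomial.induction_on' with
  | add p q hp hq => simp only [map_add, hp, hq, Polynomial.eval₂_add]
  | monomial n a =>
    rw [Polynomial.aeval_monomial, Polynomial.eval₂_monomial, map_mul, map_pow]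
    congr 1
    exact ev_C _ _

theorem ev_aeval_of_eq {w : HS} {Q : Bi} {c : ℂ} (h : ev w Q = HahnSeries.C c)
    (q : Polynomial ℂ) : ev w (Polynomial.aeval Q q) = HahnSeries.C (q.eval c) := by
  rw [ev_aeval, h, Polynomial.eval₂_at_apply]

theorem aeval_mem_overf {K : Subfield ℂ} {Q : Bi} (hQ : Q ∈ overf K) (r : Polynomial K) :
    Polynomial.aeval Q (r.map (algebraMap K ℂ)) ∈ overf K := by
  induction r using Polynomial.induction_on' with
  | add p q hp hq =>
    rw [Polynomial.map_add, map_add]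
    exact add_mem hp hq
  | monomial n a =>
    rw [Polynomial.map_monomial, Polynomial.aeval_monomial]
    exact mul_mem (C_mem_overf a.2) (pow_mem hQ n)

theorem ev_aeval_map {K : Subfield ℂ} {w : HS} {Q : Bi} {c : ℂ} (h : ev w Q = HahnSeries.C c)
    (r : Polynomial K) : ev w (Polynomial.aeval Q (r.map (algebraMap K ℂ))) =
      HahnSeries.C (Polynomial.aeval c r) := by
  rw [ev_aeval_of_eq h, Polynomial.eval_map_algebraMap]

/-- Clearing denominators in the coefficients of a polynomial over `K(c)`. -/
theorem exists_overf {K : Subfield ℂ} {Q : Bi} (hQ : Q ∈ overf K) {c : ℂ} {g : Bi}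
    (hg : ∀ s, g.coeff s ∈ adj K c) :
    ∃ b ∈ overf K, ∃ r : Polynomial K, Polynomial.aeval c r ≠ 0 ∧
      ∀ w, ev w Q = HahnSeries.C c →
        ev w b = HahnSeries.C (Polynomial.aeval c r) * ev w g := by
  rw [g.as_sum]
  refine Finset.sum_induction _ (fun g => ∃ b ∈ overf K, ∃ r : Polynomial K,
    Polynomial.aeval c r ≠ 0 ∧ ∀ w, ev w Q = HahnSeries.C c →
        ev w b = HahnSeries.C (Polynomial.aeval c r) * ev w g) ?_ ?_ ?_
  · rintro g₁ g₂ ⟨b₁, hb₁, r₁, hr₁, h₁⟩ ⟨b₂, hb₂, r₂, hr₂, h₂⟩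
    refine ⟨b₁ * Polynomial.aeval Q (r₂.map (algebraMap K ℂ)) +
      b₂ * Polynomial.aeval Q (r₁.map (algebraMap K ℂ)),
      add_mem (mul_mem hb₁ (aeval_mem_overf hQ _)) (mul_mem hb₂ (aeval_mem_overf hQ _)),
      r₁ * r₂, by rw [map_mul]; exact mul_ne_zero hr₁ hr₂, ?_⟩
    intro w hw
    rw [map_add, map_mul, map_mul, ev_aeval_map hw, ev_aeval_map hw, h₁ w hw, h₂ w hw,
      map_mul, map_mul, map_add]
    ring
  · exact ⟨0, zero_mem _, 1, by simp, by simp⟩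
  · intro m _
    obtain ⟨r, s, hrs⟩ := mem_adj.1 (hg m)
    by_cases hs : Polynomial.aeval c s = 0
    · rw [hrs, hs, div_zero, monomial_zero]
      exact ⟨0, zero_mem _, 1, by simp, by simp⟩
    · refine ⟨Polynomial.aeval Q (r.map (algebraMap K ℂ)) * monomial m 1,
        mul_mem (aeval_mem_overf hQ _) (mem_overf.2 fun t => ?_), s, hs, ?_⟩
      · rw [coeff_monomial]
        split_ifs
        · exact one_mem _
        · exact zero_mem _
      · intro w hw
        have h1 : monomial m (g.coeff m) = MvPolynomial.C (g.coeff m) * monomial m 1 := by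
          rw [C_mul_monomial, mul_one]
        rw [map_mul, ev_aeval_map hw, h1, map_mul, ev_C, ← mul_assoc, ← map_mul, hrs,
          mul_div_cancel₀ _ hs]

theorem ev_map_aut (τ : ℂ ≃+* ℂ) (w : HS) (f : Bi) :
    ev w (MvPolynomial.map (τ : ℂ →+* ℂ) f) = tw τ (ev (tw τ.symm w) f) := by
  rw [tw_ev, tw_symm]

theorem ge_C (a : ℂ) : Ge (HahnSeries.C a : HS) 0 := by
  intro b hb
  rw [HahnSeries.C_apply, HahnSeries.coeff_single_of_ne hb.ne]

/-- The series of order at least `e`. -/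
def geSub (e : ℝ) : Submodule ℂ HS where
  carrier := {y | Ge y e}
  add_mem' := Ge.add
  zero_mem' := ge_zero e
  smul_mem' a y hy b hb := by rw [HahnSeries.coeff_smul, hy b hb, smul_zero]

theorem degree_C_mul_le {R : Type*} [Semiring R] (a : R) (f : Polynomial R) :
    (Polynomial.C a * f).degree ≤ f.degree :=
  (Polynomial.degree_mul_le _ _).trans (add_le_of_nonpos_left Polynomial.degree_C_le)

theorem eq_zero_of_degree_lt {Q : Bi} {c : ℂ} {g : Bi} (hd : (yp g).degree < (Zr Q c).card)
    (h : ∀ w ∈ Zr Q c, ev w g = 0) : g = 0 := by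
  apply yp_injective
  rw [map_zero]
  apply Polynomial.map_injective _ phi_injective
  rw [Polynomial.map_zero]
  refine Polynomial.eq_zero_of_degree_lt_of_eval_finset_eq_zero (Zr Q c)
    (lt_of_le_of_lt (Polynomial.degree_map_le) hd) fun w hw => ?_
  rw [← Ev_eq, Ev_yp, h w hw]

namespace JPair
variable {P Q : Bi} {κ : ℂ} (J : JPair P Q κ)
include J

theorem tw_mem_Zr {K : Subfield ℂ} (hQ : Q ∈ overf K) {c : ℂ} {τ : ℂ ≃+* ℂ}
    (hτ : ∀ a ∈ adj K c, τ a = a) {w : HS} (hw : w ∈ Zr Q c) : tw τ.symm w ∈ Zr Q c := by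
  have hs : ∀ a ∈ adj K c, τ.symm a = a := fun a ha => by
    rw [RingEquiv.symm_apply_eq, hτ a ha]
  have h1 := tw_ev τ.symm w Q
  rw [J.symm.mem_Zr.1 hw, map_eq_of_overf hQ fun a ha => hs a (le_adj K c ha), tw_C,
    hs c (self_mem_adj K c)] at h1
  exact J.symm.mem_Zr.2 h1.symm

theorem zr_nonempty (c : ℂ) : (Zr Q c).Nonempty := by
  rw [← Finset.card_pos, J.symm.card_Zr]
  exact J.posQ

/-- The remainder modulo `Q - c`. -/
theorem exists_remainder (c : ℂ) (f : Bi) :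
    ∃ g : Bi, (yp g).degree < (Zr Q c).card ∧ ∀ w ∈ Zr Q c, ev w g = ev w f := by
  refine ⟨py (yp f %ₘ yp (Q - MvPolynomial.C c)), ?_, fun w hw => ?_⟩
  · rw [yp_py]
    exact (J.symm.cover c).degree_modByMonic _
  · rw [← Ev_yp, yp_py, (J.symm.cover c).Ev_modByMonic _ hw, Ev_yp]

theorem jac_ev_eq_zero {b : Bi} {c : ℂ} {w : HS} (hw : w ∈ Zr Q c) (h : dx (ev w b) = 0) :
    ev w (pderiv 0 b * pderiv 1 Q - pderiv 1 b * pderiv 0 Q) = 0 := by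
  have h1 : dx (ev w Q) = 0 := by rw [J.symm.mem_Zr.1 hw, dx_C]
  rw [dx_ev] at h h1
  rw [map_sub, map_mul, map_mul]
  linear_combination ev w (pderiv 1 Q) * h - ev w (pderiv 1 b) * h1

theorem degree_C_lt (c a : ℂ) : (yp (MvPolynomial.C a)).degree < (Zr Q c).card := by
  rw [yp_C]
  refine lt_of_le_of_lt Polynomial.degree_C_le ?_
  exact_mod_cast Finset.card_pos.2 (J.zr_nonempty c)

theorem exists_const_of_aeval {K : Subfield ℂ} (hK : Cardinal.mk K ≤ Cardinal.aleph0)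
    (hQ : Q ∈ overf K) {c : ℂ} (hc : Transcendental K c) {b : Bi} (hb : b ∈ overf K)
    (h : ∀ w ∈ Zr Q c, dx (ev w b) = 0) :
    ∃ a, ∀ w ∈ Zr Q c, ev w b = HahnSeries.C a := by
  have h0 := eq_zero_of_ev_eq_zero J hK hQ hc
    (sub_mem (mul_mem (pderiv_mem_overf hb 0) (pderiv_mem_overf hQ 1))
      (mul_mem (pderiv_mem_overf hb 1) (pderiv_mem_overf hQ 0)))
    fun w hw => J.jac_ev_eq_zero hw (h w hw)
  obtain ⟨q, rfl⟩ := J.exists_aeval_of_jac_eq_zero h0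
  exact ⟨q.eval c, fun w hw => ev_aeval_of_eq (J.symm.mem_Zr.1 hw) q⟩

/-- Galois descent: a family of linear conditions along the branches of a generic fiber which is
stable under automorphisms of the coefficients and satisfied by a nonconstant polynomial is
satisfied by a nonconstant polynomial over the base field. -/
theorem exists_descent {K : Subfield ℂ} (hK : Cardinal.mk K ≤ Cardinal.aleph0)
    (hQ : Q ∈ overf K) {c : ℂ} (B : HS → Submodule ℂ HS)
    (hC : ∀ w ∈ Zr Q c, ∀ a, HahnSeries.C a ∈ B w)
    (hB : ∀ τ : ℂ ≃+* ℂ, (∀ a ∈ adj K c, τ a = a) → ∀ w ∈ Zr Q c, ∀ y ∈ B (tw τ.symm w),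
      tw τ y ∈ B w)
    {f : Bi} (hf : ∀ w ∈ Zr Q c, ev w f ∈ B w)
    (hnc : ¬ ∃ a, ∀ w ∈ Zr Q c, ev w f = HahnSeries.C a) :
    ∃ b ∈ overf K, (∀ w ∈ Zr Q c, ev w b ∈ B w) ∧
      ¬ ∃ a, ∀ w ∈ Zr Q c, ev w b = HahnSeries.C a := by
  let V : Submodule ℂ Bi :=
    { carrier := {g | (yp g).degree < (Zr Q c).card ∧ (∀ w ∈ Zr Q c, ev w g ∈ B w) ∧
        g.coeff 0 = 0}
      add_mem' := by
        rintro a b ⟨h1, h2, h3⟩ ⟨h4, h5, h6⟩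
        refine ⟨?_, fun w hw => ?_, by rw [coeff_add, h3, h6, add_zero]⟩
        · rw [map_add]
          exact lt_of_le_of_lt (Polynomial.degree_add_le _ _) (max_lt h1 h4)
        · rw [map_add]
          exact add_mem (h2 w hw) (h5 w hw)
      zero_mem' := ⟨by simp, fun w hw => by rw [map_zero]; exact zero_mem _, by simp⟩
      smul_mem' := by
        rintro a b ⟨h1, h2, h3⟩
        rw [MvPolynomial.smul_eq_C_mul]
        refine ⟨?_, fun w hw => ?_, by rw [coeff_C_mul, h3, mul_zero]⟩
        · rw [map_mul, yp_C]
          exact lt_of_le_of_lt (degree_C_mul_le _ _) h1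
        · rw [map_mul, ev_C, HahnSeries.C_mul_eq_smul]
          exact (B w).smul_mem a (h2 w hw) }
  obtain ⟨f', hf'd, hf'⟩ := J.exists_remainder c f
  have h0 : f' - MvPolynomial.C (f'.coeff 0) ≠ 0 := fun h0 =>
    hnc ⟨f'.coeff 0, fun w hw => by
      rw [← hf' w hw, ← ev_C, ← sub_eq_zero, ← map_sub, h0, map_zero]⟩
  have hV : f' - MvPolynomial.C (f'.coeff 0) ∈ V := by
    refine ⟨?_, fun w hw => ?_, by rw [coeff_sub, coeff_zero_C, sub_self]⟩
    · rw [map_sub]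
      exact lt_of_le_of_lt (Polynomial.degree_sub_le _ _) (max_lt hf'd (J.degree_C_lt _ _))
    · rw [map_sub, hf' w hw, ev_C]
      exact sub_mem (hf w hw) (hC w hw _)
  obtain ⟨g, hgV, hg0, hg⟩ := exists_coeff_mem_of_aut_stable (adj K c) (mk_adj_le hK c) V
    (by
      rintro τ hτ g ⟨h1, h2, h3⟩
      refine ⟨by rw [degree_yp_map]; exact h1, fun w hw => ?_, ?_⟩
      · rw [ev_map_aut]
        exact hB τ hτ w hw _ (h2 _ (J.tw_mem_Zr hQ hτ hw))
      · rw [coeff_map, h3, map_zero]) hV h0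
  obtain ⟨b, hb, r, hr, hbg⟩ := exists_overf hQ hg
  refine ⟨b, hb, fun w hw => ?_, fun ⟨a, ha⟩ => hg0 ?_⟩
  · rw [hbg w (J.symm.mem_Zr.1 hw), HahnSeries.C_mul_eq_smul]
    exact (B w).smul_mem _ (hgV.2.1 w hw)
  have h1 : g - MvPolynomial.C (a / Polynomial.aeval c r) = 0 := by
    apply eq_zero_of_degree_lt (c := c)
    · rw [map_sub]
      exact lt_of_le_of_lt (Polynomial.degree_sub_le _ _) (max_lt hgV.1 (J.degree_C_lt _ _))
    · intro w hw
      have h2 := hbg w (J.symm.mem_Zr.1 hw)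
      rw [ha w hw] at h2
      have h3 : (HahnSeries.C (Polynomial.aeval c r) : HS) ≠ 0 := by
        rwa [map_ne_zero_iff _ HahnSeries.C_injective]
      rw [map_sub, ev_C, map_div₀, h2, mul_div_cancel_left₀ _ h3, sub_self]
  have h2 := hgV.2.2
  rw [sub_eq_zero.1 h1, coeff_zero_C] at h2
  rw [sub_eq_zero.1 h1, h2, map_zero]

/-- On a generic fiber of `Q`, bounded polynomials are constant. -/
theorem const_of_bounded {K : Subfield ℂ} (hK : Cardinal.mk K ≤ Cardinal.aleph0)
    (hQ : Q ∈ overf K) {c : ℂ} (hc : Transcendental K c) {f : Bi}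
    (hf : ∀ w ∈ Zr Q c, Ge (ev w f) 0) : ∃ a, ∀ w ∈ Zr Q c, ev w f = HahnSeries.C a := by
  by_contra hnc
  obtain ⟨b, hb, hbB, hbnc⟩ := J.exists_descent hK hQ (fun _ => geSub 0)
    (fun _ _ a => ge_C a) (fun τ _ w _ y hy => ge_tw.2 hy) hf hnc
  refine hbnc (J.exists_const_of_aeval hK hQ hc hb fun w hw => ?_)
  obtain ⟨a, ha⟩ := (J.symm.cover c).const_of_bounded (yp b)
    (fun u hu => by rw [Ev_yp]; exact hbB u hu) hw
  rw [← Ev_yp, ha, dx_C]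

end JPair

/-! ### No simple pole on a generic fiber -/

theorem eq_C_of_eval₂_eq_zero {Ψ : Polynomial ℂ} (h0 : Ψ ≠ 0) {y : HS}
    (h : Ψ.eval₂ HahnSeries.C y = 0) : ∃ a, y = HahnSeries.C a := by
  have h1 := IsAlgClosed.splits Ψ
  have h2 : y ∈ (Polynomial.map (HahnSeries.C : ℂ →+* HS) Ψ).roots := by
    rw [Polynomial.mem_roots (Polynomial.map_ne_zero h0), Polynomial.IsRoot,
      Polynomial.eval_map, h]
  obtain ⟨a, ha⟩ := Polynomial.Splits.mem_range_of_isRoot h1 h0 (Polynomial.isRoot_of_mem_roots h2)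
  exact ⟨a, ha.symm⟩

theorem exists_aeval_of_dvd {Q : Bi} (hirr : ∀ e, Irreducible (Q - MvPolynomial.C e)) {κ : ℂ}
    (hκ : κ ≠ 0) (s : Multiset ℂ) {G : Bi}
    (h : G ∣ MvPolynomial.C κ * (s.map fun e => Q - MvPolynomial.C e).prod) :
    ∃ q : Polynomial ℂ, G = Polynomial.aeval Q q := by
  induction s using Multiset.induction_on generalizing G with
  | empty =>
    have hu : IsUnit G := isUnit_of_dvd_unit h (by
      simpa using hκ)
    obtain ⟨a, -, ha⟩ := MvPolynomial.isUnit_iff_eq_C_of_isReduced.1 hu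
    exact ⟨Polynomial.C a, by rw [Polynomial.aeval_C]; exact ha⟩
  | cons e s ih =>
    rw [Multiset.map_cons, Multiset.prod_cons, mul_left_comm] at h
    have hp : Prime (Q - MvPolynomial.C e) := (hirr e).prime
    obtain ⟨H, hH⟩ := h
    by_cases hG : Q - MvPolynomial.C e ∣ G
    · obtain ⟨G', rfl⟩ := hG
      obtain ⟨q, hq⟩ := ih (G := G') ⟨H, by
        apply mul_left_cancel₀ hp.ne_zero
        rw [hH, mul_assoc]⟩
      refine ⟨(Polynomial.X - Polynomial.C e) * q, ?_⟩
      rw [map_mul, ← hq, map_sub, Polynomial.aeval_X, Polynomial.aeval_C]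
      rfl
    · obtain ⟨H', rfl⟩ := (hp.dvd_or_dvd (Dvd.intro _ hH)).resolve_left hG
      refine ih ⟨H', ?_⟩
      apply mul_left_cancel₀ hp.ne_zero
      rw [hH]
      ring

theorem exists_aeval_of_dvd_aeval {Q : Bi} (hirr : ∀ e, Irreducible (Q - MvPolynomial.C e)) {κ : ℂ}
    (hκ : κ ≠ 0) {r : Polynomial ℂ} (hr : r ≠ 0) {G : Bi}
    (h : G ∣ MvPolynomial.C κ * Polynomial.aeval Q r) :
    ∃ q : Polynomial ℂ, G = Polynomial.aeval Q q := by
  have h1 := (IsAlgClosed.splits r).eq_prod_roots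
  refine exists_aeval_of_dvd hirr (mul_ne_zero hκ (Polynomial.leadingCoeff_ne_zero.2 hr)) r.roots ?_
  convert h using 1
  conv_rhs => rw [h1]
  rw [map_mul (Polynomial.aeval (R := ℂ) Q), map_multiset_prod (Polynomial.aeval (R := ℂ) Q),
    Multiset.map_map, Polynomial.aeval_C, map_mul, mul_assoc]
  congr 3
  refine Multiset.map_congr rfl fun e _ => ?_
  rw [Function.comp_apply, map_sub, Polynomial.aeval_X, Polynomial.aeval_C]
  rfl

theorem aeval_mem_overf' {K : Subfield ℂ} {b : Bi} (hb : b ∈ overf K) {Φ : Polynomial ℂ}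
    (hΦ : ∀ i, Φ.coeff i ∈ K) : Polynomial.aeval b Φ ∈ overf K := by
  rw [Polynomial.aeval_eq_sum_range]
  refine sum_mem fun i _ => ?_
  rw [MvPolynomial.smul_eq_C_mul]
  exact mul_mem (C_mem_overf (hΦ i)) (pow_mem hb i)

theorem overf_mono {K L : Subfield ℂ} (h : K ≤ L) {b : Bi} (hb : b ∈ overf K) : b ∈ overf L :=
  mem_overf.2 fun s => h (mem_overf.1 hb s)

theorem map_aeval_aut (τ : ℂ ≃+* ℂ) (b : Bi) (Φ : Polynomial ℂ) :
    MvPolynomial.map (τ : ℂ →+* ℂ) (Polynomial.aeval b Φ) =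
      Polynomial.aeval (MvPolynomial.map (τ : ℂ →+* ℂ) b) (Φ.map (τ : ℂ →+* ℂ)) := by
  induction Φ using Polynomial.induction_on' with
  | add p q hp hq => simp only [map_add, Polynomial.map_add, hp, hq]
  | monomial n a =>
    rw [Polynomial.map_monomial, Polynomial.aeval_monomial, Polynomial.aeval_monomial, map_mul,
      map_pow]
    congr 1
    exact map_C _ _

theorem sigma_iterate_ev (f : Bi) (y : HS) (j : ℕ) :
    sigma^[j] (ev y f) = ev (sigma^[j] y) f := by
  rw [← Ev_yp, ← Ev_yp, sigma_iterate_Ev]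

theorem ge_sigma_iterate {y : HS} {e : ℝ} (j : ℕ) : Ge (sigma^[j] y) e ↔ Ge y e := by
  induction j with
  | zero => rfl
  | succ j ih => rw [Function.iterate_succ_apply' (⇑sigma), ge_sigma_iff, ih]

theorem Ge.pow {y : HS} {e : ℝ} (h : Ge y e) (n : ℕ) : Ge (y ^ n) (n * e) := by
  induction n with
  | zero => rw [pow_zero, Nat.cast_zero, zero_mul]; exact ge_C 1
  | succ n ih =>
    rw [pow_succ]
    exact (ih.mul h).mono (by push_cast; linarith)

namespace JPair
variable {P Q : Bi} {κ : ℂ} (J : JPair P Q κ)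
include J

theorem ge_of_gt {c : ℂ} {w : HS} (hw : w ∈ Zr Q c) {f : Bi} {n : ℕ}
    (h : Gt (ev w f) (-(n + 1 : ℕ) / nu w)) : Ge (ev w f) (-(n : ℝ) / nu w) := by
  intro a ha
  by_contra hne
  obtain ⟨k, rfl⟩ := (J.symm.cover c).exp_Ev (yp f) (by rwa [Ev_yp]) hw
  have hν : (0 : ℝ) < nu w := by exact_mod_cast (J.symm.cover c).stab.nu_pos hw
  have h1 : ¬ (k / nu w : ℝ) ≤ -(n + 1 : ℕ) / nu w := fun hle => hne (h _ hle)
  rw [not_le, div_lt_div_iff_of_pos_right hν] at h1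
  rw [div_lt_div_iff_of_pos_right hν] at ha
  have h2 : (-(n + 1 : ℕ) : ℤ) < k := by exact_mod_cast h1
  have h3 : k < (-(n : ℤ)) := by exact_mod_cast ha
  push_cast at h2
  omega

theorem false_of_simple_pole {K : Subfield ℂ} (hK : Cardinal.mk K ≤ Cardinal.aleph0)
    (hP : P ∈ overf K) (hQ : Q ∈ overf K) (hκ : κ ∈ K) {c : ℂ} (hc : Transcendental K c)
    (hirr : ∀ e, Irreducible (Q - MvPolynomial.C e))
    (hS : OneOrbit (Zr Q c) fun w => ¬ Ge (ev w P) 0) {w0 : HS} (hw0 : w0 ∈ Zr Q c)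
    (h0 : ¬ Ge (ev w0 P) (-1 / nu w0)) {f : Bi}
    (hf : ∀ w ∈ Zr Q c, Ge (ev w f) (-1 / nu w0) ∧ (Ge (ev w P) 0 → Ge (ev w f) 0))
    (hnc : ¬ ∃ a, ∀ w ∈ Zr Q c, ev w f = HahnSeries.C a) : False := by
  classical
  have hν : (0 : ℝ) < nu w0 := by exact_mod_cast (J.symm.cover c).stab.nu_pos hw0
  have hle : (-1 / nu w0 : ℝ) ≤ 0 := div_nonpos_of_nonpos_of_nonneg (by norm_num) hν.le
  have hinP : ¬ Ge (ev w0 P) 0 := fun h => h0 (h.mono hle)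
  have hτP : ∀ τ : ℂ ≃+* ℂ, (∀ a ∈ adj K c, τ a = a) → ∀ {b : Bi}, b ∈ overf K →
      MvPolynomial.map (τ : ℂ →+* ℂ) b = b := fun τ hτ b hb =>
    map_eq_of_overf hb fun a ha => hτ a (le_adj K c ha)
  obtain ⟨b, hb, hbB, hbnc⟩ := J.exists_descent hK hQ
    (fun w => geSub (-1 / nu w0) ⊓ (if Ge (ev w P) 0 then geSub 0 else ⊤))
    (fun w _ a => by
      refine ⟨(ge_C a).mono hle, ?_⟩
      split_ifs
      · exact ge_C a
      · trivial)
    (fun τ hτ w hw y hy => by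
      refine ⟨ge_tw.2 hy.1, ?_⟩
      have h1 := hy.2
      have h2 : Ge (ev (tw τ.symm w) P) 0 ↔ Ge (ev w P) 0 := by
        rw [← ge_tw (τ := τ), ← ev_map_aut, hτP τ hτ hP]
      simp only [h2] at h1
      split_ifs with h3
      · rw [if_pos h3] at h1
        exact ge_tw.2 h1
      · trivial)
    (f := f) (fun w hw => by
      refine ⟨(hf w hw).1, ?_⟩
      split_ifs with h3
      · exact (hf w hw).2 h3
      · trivial) hnc
  have hb1 : ∀ w ∈ Zr Q c, Ge (ev w b) (-1 / nu w0) := fun w hw => (hbB w hw).1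
  have hb2 : ∀ w ∈ Zr Q c, Ge (ev w P) 0 → Ge (ev w b) 0 := fun w hw h => by
    have := (hbB w hw).2
    rwa [if_pos h] at this
  have hbdd : ∀ f : Bi, Ge (ev w0 f) 0 → (∀ w ∈ Zr Q c, Ge (ev w P) 0 → Ge (ev w f) 0) →
      ∃ a, ∀ w ∈ Zr Q c, ev w f = HahnSeries.C a := by
    intro f h1 h2
    refine J.const_of_bounded hK hQ hc fun w hw => ?_
    by_cases hw' : Ge (ev w P) 0
    · exact h2 w hw hw'
    · obtain ⟨j, rfl⟩ := hS w0 hw0 w hw hinP hw'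
      rw [← sigma_iterate_ev, ge_sigma_iterate]
      exact h1
  have hbw0 : ¬ Ge (ev w0 b) 0 := fun h => hbnc (hbdd b h hb2)
  set β := (ev w0 b).coeff (-1 / nu w0) with hβ
  have hβ0 : β ≠ 0 := by
    intro h
    refine hbw0 ?_
    have := J.ge_of_gt (n := 0) hw0 (f := b) ?_
    · simpa using this
    · intro a ha
      simp only [zero_add, Nat.cast_one] at ha
      rcases ha.lt_or_eq with h1 | rfl
      · exact hb1 w0 hw0 a h1
      · exact h
  have hblead : Lead (ev w0 b) (-1 / nu w0) β := (hb1 w0 hw0).lead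
  have htr : ∀ Ψ : Polynomial ℂ, ev w0 (Polynomial.aeval b Ψ) = 0 → Ψ = 0 := by
    intro Ψ hΨ
    by_contra hne
    rw [ev_aeval] at hΨ
    obtain ⟨a, ha⟩ := eq_C_of_eval₂_eq_zero hne hΨ
    exact hbw0 (by rw [ha]; exact ge_C a)
  have hexp : ∀ n : ℕ, ∀ f : Bi, Ge (ev w0 f) (-(n : ℝ) / nu w0) →
      (∀ w ∈ Zr Q c, Ge (ev w P) 0 → Ge (ev w f) 0) →
      ∃ Φ : Polynomial ℂ, ∀ w ∈ Zr Q c, ev w f = ev w (Polynomial.aeval b Φ) := by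
    intro n
    induction n with
    | zero =>
      intro f h1 h2
      obtain ⟨a, ha⟩ := hbdd f (by simpa using h1) h2
      refine ⟨Polynomial.C a, fun w hw => ?_⟩
      rw [ha w hw, ev_aeval, Polynomial.eval₂_C]
    | succ n ih =>
      intro f h1 h2
      set α := (ev w0 f).coeff (-(n + 1 : ℕ) / nu w0) / β ^ (n + 1) with hα
      obtain ⟨Φ, hΦ⟩ := ih (f - MvPolynomial.C α * b ^ (n + 1))
        (by
          refine J.ge_of_gt hw0 ?_
          have h3 : Lead (ev w0 (b ^ (n + 1))) (-(n + 1 : ℕ) / nu w0) (β ^ (n + 1)) := by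
            rw [map_pow]
            exact (hblead.pow (n + 1)).cast (by push_cast; ring)
          have h4 := (lead_C α).mul h3
          have h5 := h1.lead.sub (h4.cast (zero_add _))
          rw [← ev_C (y := w0), ← map_mul, ← map_sub, hα,
            div_mul_cancel₀ _ (pow_ne_zero _ hβ0), sub_self] at h5
          intro a ha
          rcases ha.lt_or_eq with h6 | rfl
          · exact h5.1 a h6
          · exact h5.2)
        (fun w hw hw' => by
          rw [map_sub, map_mul, ev_C, map_pow]
          refine (h2 w hw hw').sub ?_
          simpa using (ge_C α).mul ((hb2 w hw hw').pow (n + 1)))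
      refine ⟨Φ + Polynomial.C α * Polynomial.X ^ (n + 1), fun w hw => ?_⟩
      have h3 := hΦ w hw
      rw [map_sub, sub_eq_iff_eq_add] at h3
      rw [h3, map_add (Polynomial.aeval (R := ℂ) b), map_add, map_mul (Polynomial.aeval (R := ℂ) b), map_pow,
        Polynomial.aeval_X, Polynomial.aeval_C]
      rfl
  obtain ⟨Φ, hΦ⟩ : ∃ Φ : Polynomial ℂ, ∀ w ∈ Zr Q c, ev w P = ev w (Polynomial.aeval b Φ) := by
    obtain ⟨e, he⟩ := exists_ge (ev w0 P)
    obtain ⟨n, hn⟩ := exists_nat_ge (-e * nu w0)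
    refine hexp n P (he.mono ?_) fun w hw h => h
    rw [div_le_iff₀ hν]
    linarith
  have hdeg : ¬ Φ.natDegree ≤ 1 := by
    intro h
    obtain ⟨a, a', rfl⟩ := Polynomial.exists_eq_X_add_C_of_natDegree_le_one h
    refine h0 ?_
    rw [hΦ w0 hw0, ev_aeval, Polynomial.eval₂_add, Polynomial.eval₂_mul, Polynomial.eval₂_C,
      Polynomial.eval₂_C, Polynomial.eval₂_X]
    refine Ge.add ?_ ((ge_C _).mono hle)
    simpa using (ge_C a).mul (hb1 w0 hw0)
  have hΦk : ∀ i, Φ.coeff i ∈ adj K c := by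
    intro i
    by_contra hi
    obtain ⟨τ, hτ, hne⟩ := exists_aut_ne (adj K c) (mk_adj_le hK c) hi
    have h1 : ev w0 (MvPolynomial.map (τ : ℂ →+* ℂ) (P - Polynomial.aeval b Φ)) = 0 := by
      rw [ev_map_aut, map_sub, hΦ _ (J.tw_mem_Zr hQ hτ hw0), sub_self, map_zero]
    rw [map_sub, map_aeval_aut, hτP τ hτ hP, hτP τ hτ hb, map_sub, hΦ w0 hw0, ← map_sub,
      ← map_sub] at h1
    have h2 := htr _ h1
    rw [sub_eq_zero] at h2
    apply hne
    conv_rhs => rw [h2]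
    rw [Polynomial.coeff_map]
    rfl
  obtain ⟨G, hG, r, hr, hGr⟩ := exists_overf (K := K) hQ (c := c)
    (g := Polynomial.aeval b Φ.derivative) (mem_overf.1 (aeval_mem_overf'
      (overf_mono (le_adj K c) hb) fun i => by
        rw [Polynomial.coeff_derivative]
        exact mul_mem (hΦk _) (add_mem (natCast_mem _ _) (one_mem _))))
  have hjac : ∀ w ∈ Zr Q c, ev w (Polynomial.aeval b Φ.derivative) *
      ev w (pderiv 0 b * pderiv 1 Q - pderiv 1 b * pderiv 0 Q) = HahnSeries.C κ := by
    intro w hw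
    have h1 : dx (ev w (P - Polynomial.aeval b Φ)) = 0 := by
      rw [map_sub, hΦ w hw, sub_self, ← map_zero HahnSeries.C, dx_C, map_zero]
    have h2 := J.jac_ev_eq_zero hw h1
    have h3 := congrArg (ev w) J.jac
    simp only [map_sub, map_mul, pderiv_aeval, ev_C] at h2 h3 ⊢
    linear_combination h3 - h2
  have hGJ : G * (pderiv 0 b * pderiv 1 Q - pderiv 1 b * pderiv 0 Q) =
      MvPolynomial.C κ * Polynomial.aeval Q (r.map (algebraMap K ℂ)) := by
    rw [← sub_eq_zero]
    refine eq_zero_of_ev_eq_zero J hK hQ hc (sub_mem (mul_mem hG (sub_mem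
      (mul_mem (pderiv_mem_overf hb 0) (pderiv_mem_overf hQ 1))
      (mul_mem (pderiv_mem_overf hb 1) (pderiv_mem_overf hQ 0))))
      (mul_mem (C_mem_overf hκ) (aeval_mem_overf hQ _))) fun w hw => ?_
    have hwQ := J.symm.mem_Zr.1 hw
    rw [map_sub, map_mul, hGr w hwQ, map_mul, ev_aeval_map hwQ, mul_assoc, hjac w hw, ev_C]
    ring
  have hr0 : r.map (algebraMap K ℂ) ≠ 0 := by
    rw [Ne, Polynomial.map_eq_zero]
    rintro rfl
    simp at hr
  obtain ⟨q, hq⟩ := exists_aeval_of_dvd_aeval hirr J.kappa_ne hr0 (Dvd.intro _ hGJ)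
  have hw0Q := J.symm.mem_Zr.1 hw0
  have h1 := hGr w0 hw0Q
  rw [hq, ev_aeval_of_eq hw0Q] at h1
  have h2 : ev w0 (Polynomial.aeval b (Φ.derivative - Polynomial.C
      (q.eval c / Polynomial.aeval c r))) = 0 := by
    have h3 : (HahnSeries.C (Polynomial.aeval c r) : HS) ≠ 0 := by
      rwa [map_ne_zero_iff _ HahnSeries.C_injective]
    apply mul_left_cancel₀ h3
    rw [map_sub (Polynomial.aeval (R := ℂ) b), map_sub, mul_sub, ← h1, ev_aeval w0 b (Polynomial.C _),
      Polynomial.eval₂_C, ← map_mul, mul_div_cancel₀ _ hr, sub_self, mul_zero]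
  have h3 := sub_eq_zero.1 (htr _ h2)
  refine hdeg ?_
  have h4 := congrArg Polynomial.natDegree h3
  rw [Polynomial.natDegree_C, Polynomial.natDegree_derivative] at h4
  omega

end JPair

/-! ### Irreducibility of all fibers from the vanishing of differentials -/

theorem Lead.ge_iff {y : HS} {e b : ℝ} {α : ℂ} (h : Lead y e α) (hα : α ≠ 0) :
    Ge y b ↔ b ≤ e := by
  refine ⟨fun hb => not_lt.1 fun hlt => hα ?_, fun hb => h.ge.mono hb⟩
  rw [← h.2]
  exact hb e hlt

theorem eq_C_of_const {f : Polynomial (Polynomial ℂ)} {Q : Bi} {c a : ℂ}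
    (hd : f.degree < (Zr Q c).card) (hpos : 1 ≤ (Zr Q c).card)
    (h : ∀ w ∈ Zr Q c, Ev f w = HahnSeries.C a) : f = a • 1 := by
  have h1 : py f - MvPolynomial.C a = 0 := by
    refine eq_zero_of_degree_lt (Q := Q) (c := c) ?_ fun w hw => ?_
    · rw [map_sub, yp_py]
      refine (Polynomial.degree_sub_le _ _).trans_lt (max_lt hd ?_)
      have h2 : yp (MvPolynomial.C a) = Polynomial.C (Polynomial.C a) := by simp [yp]
      rw [h2]
      exact Polynomial.degree_C_le.trans_lt (by exact_mod_cast hpos)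
    · rw [ev_sub_C, ← Ev_yp, yp_py, h w hw, sub_self]
  have h2 : f = yp (MvPolynomial.C a) := by rw [← sub_eq_zero.1 h1, yp_py]
  have h3 : yp (MvPolynomial.C a) = Polynomial.C (Polynomial.C a) := by simp [yp]
  rw [h2, h3, ← Polynomial.C_1, ← Polynomial.C_1, Polynomial.smul_C, Polynomial.smul_C]
  simp

namespace JPair
variable {P Q : Bi} {κ : ℂ} (J : JPair P Q κ)
include J

theorem irreducible_of_finrank_eq_zero {K : Subfield ℂ} (hK : Cardinal.mk K ≤ Cardinal.aleph0)
    (hP : P ∈ overf K) (hQ : Q ∈ overf K) (hκ : κ ∈ K) {cP c : ℂ} (hc : Transcendental K c)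
    (T : KTree (Zr P cP) (Zr Q c) κ)
    (hΩ : Module.finrank ℂ (LL (Zr P cP) (star (dlp (Zr P cP) (Zr Q c)) 0)) = 0) :
    (∀ e, Irreducible (P - MvPolynomial.C e)) ∧ ∀ e, Irreducible (Q - MvPolynomial.C e) := by
  classical
  set Zp := Zr P cP with hZp
  set Zq := Zr Q c with hZq
  by_cases hd : -∑ u ∈ Zp, bq Zp Zq u < 2
  · exact ⟨J.irreducible_p T (T.oneOrbit_p_of_lt hd), J.irreducible_q T (T.oneOrbit_q_of_lt hd)⟩
  push Not at hd
  exfalso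
  have hcq : 0 < Zq.card := T.card_pos
  have hcp : 0 < Zp.card := T.card_pos.trans T.card_lt
  have hLq : Module.finrank ℂ (LL Zq 0) ≤ 1 := by
    refine finrank_le_one ⟨1, one_mem_LL hcq fun _ _ => le_rfl⟩ fun f => ?_
    have hf := mem_LL.1 f.2
    obtain ⟨a, ha⟩ := J.const_of_bounded hK hQ hc (f := py f.1) fun w hw => by
      have := hf.2 w hw
      rw [← Ev_yp, yp_py]
      simpa using this
    refine ⟨a, Subtype.ext (eq_C_of_const hf.1 hcq fun w hw => ?_).symm⟩
    rw [← ha w hw, ← Ev_yp, yp_py]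
  have h1q : 1 ≤ Module.finrank ℂ (LL Zq 0) := one_le_finrank_LL hcq fun _ _ => le_rfl
  have h1p : 1 ≤ Module.finrank ℂ (LL Zp 0) := one_le_finrank_LL hcp fun _ _ => le_rfl
  have hrp := T.rr_p (J.cover cP)
  have hrq := T.rr_q (J.symm.cover c)
  rw [hΩ] at hrp
  have h1p' : (1 : ℝ) ≤ Module.finrank ℂ (LL Zp 0) := by exact_mod_cast h1p
  have h1q' : (Module.finrank ℂ (LL Zq 0) : ℝ) = 1 := by exact_mod_cast le_antisymm hLq h1q
  have hnn : (0 : ℝ) ≤ Module.finrank ℂ (LL Zq (star (dlq Zp Zq) 0)) := Nat.cast_nonneg _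
  push_cast at hrp
  obtain ⟨hS, heq⟩ := T.dichotomy (by linarith) (by linarith) hd
  have hΩq : Module.finrank ℂ (LL Zq (star (dlq Zp Zq) 0)) = 0 := by
    have : (Module.finrank ℂ (LL Zq (star (dlq Zp Zq) 0)) : ℝ) = 0 := by linarith
    exact_mod_cast this
  have hsum := T.sum_bq_eq_sum_ap
  obtain ⟨w0, hw0, hneg⟩ : ∃ w ∈ Zq, ap Zp Zq w < 0 := by
    by_contra! hall
    have := Finset.sum_nonneg hall
    linarith
  have hν : (0 : ℝ) < nu w0 := by exact_mod_cast T.sigQ.nu_pos hw0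
  have hsum2 : ∑ w ∈ Zq, ap Zp Zq w = nu w0 * ap Zp Zq w0 := by
    rw [← Finset.sum_filter_add_sum_filter_not Zq (Orb w0)]
    rw [Finset.sum_congr rfl (g := fun _ => ap Zp Zq w0) fun w hw =>
        (Finset.mem_filter.1 hw).2.invariant T.ap_sigma, Finset.sum_const, nsmul_eq_mul,
      T.sigQ.orb_card hw0, Finset.sum_eq_zero (s := Zq.filter fun w => ¬ Orb w0 w), add_zero]
    intro w hw
    obtain ⟨hw, hno⟩ := Finset.mem_filter.1 hw
    refine le_antisymm (T.ap_nonpos (T.term_q hw)).1 (not_lt.1 fun h => hno ?_)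
    exact hS w0 hw0 w hw hneg h
  have hiff : ∀ w ∈ Zq, (¬ Ge (ev w P) 0 ↔ ap Zp Zq w < 0) := fun w hw => by
    rw [J.ge_ev_iff (c := cP), ← not_le]
    refine not_congr ?_
    exact (KTree.lead_p_at_q w).ge_iff (T.hat_p_ne hw)
  obtain ⟨f, hf⟩ : ∃ f ∈ LL Zq (pole Zp Zq), ∀ a : ℂ, f ≠ a • 1 := by
    by_contra! hall
    have h2 := T.two_le_finrank_pole (J.symm.cover c) hS hw0 hneg hΩq
    have h3 : Module.finrank ℂ (LL Zq (pole Zp Zq)) ≤ 1 := by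
      refine finrank_le_one ⟨1, one_mem_LL hcq fun w _ => ?_⟩ fun f => ?_
      · rw [pole]; split_ifs <;> norm_num
      · obtain ⟨a, ha⟩ := hall f.1 f.2
        exact ⟨a, Subtype.ext ha.symm⟩
    omega
  have hfL := mem_LL.1 hf.1
  refine J.false_of_simple_pole hK hP hQ hκ hc (J.irreducible_q T hS)
    (fun u hu v hv h h' => hS u hu v hv ((hiff u hu).1 h) ((hiff v hv).1 h')) hw0 ?_
    (f := py f) (fun w hw => ?_) ?_
  · intro h
    have h1 : Ge (pf Zp w0) (-1 / nu w0) := by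
      rw [J.pf_eq, sub_eq_add_neg, ← map_neg]
      refine h.add ((ge_C _).mono ?_)
      rw [neg_div, neg_nonpos]; positivity
    have h2 := ((KTree.lead_p_at_q w0).ge_iff (T.hat_p_ne hw0)).1 h1
    rw [div_le_iff₀ hν] at h2
    nlinarith
  · have h1 := hfL.2 w hw
    rw [← Ev_yp, yp_py]
    by_cases hneg' : ap Zp Zq w < 0
    · obtain ⟨j, rfl⟩ := hS w0 hw0 w hw hneg hneg'
      rw [pole, if_pos hneg', Orb.invariant nu_sigma ⟨j, rfl⟩] at h1
      refine ⟨by exact_mod_cast h1, fun h => absurd h ((hiff _ hw).2 hneg')⟩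
    · rw [pole, if_neg hneg'] at h1
      have h1 : Ge (Ev f w) 0 := by simpa using h1
      refine ⟨h1.mono ?_, fun _ => h1⟩
      rw [neg_div, neg_nonpos]; positivity
  · rintro ⟨a, ha⟩
    refine hf.2 a (eq_C_of_const hfL.1 hcq fun w hw => ?_)
    rw [← ha w hw, ← Ev_yp, yp_py]

end JPair

/-! ### Topological preliminaries -/

/-- The complex numbers with the discrete topology. -/
def DiscreteComplex : Type := ℂ

instance : TopologicalSpace DiscreteComplex := ⊥

instance : DiscreteTopology DiscreteComplex := ⟨rfl⟩

theorem continuousAt_of_eventually_eq {X Y : Type*} [TopologicalSpace X] [TopologicalSpace Y]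
    {f : X → Y} {x : X} (h : ∀ᶠ z in nhds x, f z = f x) : ContinuousAt f x :=
  tendsto_const_nhds.congr' (h.mono fun _ hz => hz.symm)

/-- On a simply connected space, functions on an open cover which agree up to locally constant
functions come from a global function. -/
theorem exists_glue {X : Type*} [TopologicalSpace X] [SimplyConnectedSpace X]
    [LocallyPathConnectedSpace X] (U : X → Set X) (hU : ∀ x, IsOpen (U x)) (hxU : ∀ x, x ∈ U x)
    (g : X → X → ℂ)
    (hg : ∀ x x', ∀ y ∈ U x ∩ U x', ∀ᶠ z in nhds y, g x z - g x' z = g x y - g x' y) :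
    ∃ G : X → ℂ, ∀ x, ∀ y ∈ U x, ∀ᶠ z in nhds y, G z - g x z = G y - g x y := by
  let Z : FiberBundleCore X X DiscreteComplex :=
    { baseSet := U
      isOpen_baseSet := hU
      indexAt := id
      mem_baseSet_at := hxU
      coordChange := fun i j x (v : ℂ) => (v + (g i x - g j x) : ℂ)
      coordChange_self := fun i x _ (v : ℂ) => by
        change (v + (g i x - g i x) : ℂ) = v
        ring
      continuousOn_coordChange := fun i j => by
        rintro ⟨y, v⟩ ⟨hy, -⟩
        refine ContinuousAt.continuousWithinAt ?_
        refine continuousAt_of_eventually_eq ?_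
        rw [nhds_prod_eq, nhds_discrete DiscreteComplex, Filter.prod_pure, eventually_map]
        filter_upwards [hg i j y hy] with z hz
        exact congrArg (HAdd.hAdd (show ℂ from v)) hz
      coordChange_comp := fun i j k x _ (v : ℂ) => by
        change (v + (g i x - g j x) + (g j x - g k x) : ℂ) = v + (g i x - g k x)
        ring }
  obtain ⟨x0⟩ := (inferInstance : Nonempty X)
  have hcov : IsCoveringMap Z.proj :=
    IsFiberBundle.isCoveringMap fun x => ⟨Z.localTriv x, hxU x⟩
  obtain ⟨F, ⟨-, hF⟩, -⟩ := hcov.existsUnique_continuousMap_lifts (ContinuousMap.id X) x0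
    (⟨x0, (0 : ℂ)⟩ : Z.TotalSpace) rfl
  have hF1 : ∀ z, (F z).1 = z := fun z => congrFun hF z
  let val : Z.TotalSpace → ℂ := fun t => t.2
  refine ⟨fun z => val (F z) + g (F z).1 z, fun x y hy => ?_⟩
  have hcont : ContinuousAt (fun z => ((Z.localTriv x) (F z)).2) y := by
    refine continuous_snd.continuousAt.comp (ContinuousAt.comp ?_ F.continuous.continuousAt)
    refine (Z.localTriv x).continuousOn.continuousAt
      ((Z.localTriv x).open_source.mem_nhds ?_)
    rw [Z.mem_localTriv_source, hF1]
    exact hy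
  rw [ContinuousAt, nhds_discrete DiscreteComplex, tendsto_pure] at hcont
  filter_upwards [hcont] with z hz
  have hz : val (F z) + (g (F z).1 (F z).1 - g x (F z).1) =
    val (F y) + (g (F y).1 (F y).1 - g x (F y).1) := hz
  rw [hF1, hF1] at hz
  rw [hF1, hF1]
  linear_combination hz

theorem false_of_compact_open {K U F : Set ℂ} (hK : IsCompact K) (hU : IsOpen U)
    (hne : U.Nonempty) (hF : F.Finite) (hUK : U ⊆ K) (hKU : K ⊆ U ∪ F) : False := by
  have hrank : 1 < Module.rank ℝ ℂ := by rw [Complex.rank_real_complex]; norm_num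
  have hC : IsConnected Fᶜ := hF.countable.isConnected_compl_of_one_lt_rank hrank
  have h1 : Fᶜ ⊆ U ∩ Fᶜ := by
    refine hC.isPreconnected.subset_left_of_subset_union (v := Kᶜ)
      (hU.inter hF.isClosed.isOpen_compl) hK.isClosed.isOpen_compl ?_ ?_ ?_
    · rw [Set.disjoint_compl_right_iff_subset]
      exact Set.inter_subset_left.trans hUK
    · intro x hx
      by_cases hxK : x ∈ K
      · exact Or.inl ⟨(hKU hxK).resolve_right hx, hx⟩
      · exact Or.inr hxK
    · have hinf : U.Infinite := by
        obtain ⟨x, hx⟩ := hne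
        exact infinite_of_mem_nhds x (hU.mem_nhds hx)
      obtain ⟨x, hx, hxF⟩ := (hinf.sdiff hF).nonempty
      exact ⟨x, hxF, hx, hxF⟩
  have h2 : (Set.univ : Set ℂ) ⊆ K ∪ F := fun x _ => by
    by_cases hx : x ∈ F
    · exact Or.inr hx
    · exact Or.inl (hUK (h1 hx).1)
  have := (hK.union hF.isCompact).of_isClosed_subset isClosed_univ h2
  exact noncompact_univ ℂ this

theorem isPreconnected_norm_gt {R : ℝ} (hR : 0 < R) : IsPreconnected {z : ℂ | R < ‖z‖} := by
  have h : {z : ℂ | R < ‖z‖} = Complex.exp '' {w : ℂ | Real.log R < w.re} := by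
    ext z
    constructor
    · intro hz
      have hz : R < ‖z‖ := hz
      have h0 : z ≠ 0 := norm_pos_iff.1 (hR.trans hz)
      refine ⟨Complex.log z, ?_, Complex.exp_log h0⟩
      change Real.log R < (Complex.log z).re
      rw [Complex.log_re]
      exact Real.log_lt_log hR hz
    · rintro ⟨w, hw, rfl⟩
      change R < ‖Complex.exp w‖
      rw [Complex.norm_exp]
      exact (Real.log_lt_iff_lt_exp hR).1 hw
  rw [h]
  exact (convex_halfSpace_re_gt _).isPreconnected.image _ Complex.continuous_exp.continuousOn

/-- A function that is locally constant on a preconnected set is constant there. -/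
theorem eq_of_locally_eq {X Y : Type*} [TopologicalSpace X] {S : Set X} (hS : IsPreconnected S)
    {f : X → Y} (hf : ∀ x ∈ S, ∀ᶠ z in nhds x, f z = f x) {x y : X} (hx : x ∈ S) (hy : y ∈ S) :
    f x = f y := by
  let _ : TopologicalSpace Y := ⊥
  have : DiscreteTopology Y := ⟨rfl⟩
  refine hS.constant (f := f) (fun z hz => ContinuousAt.continuousWithinAt ?_) hx hy
  exact continuousAt_of_eventually_eq (hf z hz)

/-! ### Decay of small algebraic functions -/

/-- Evaluate the first variable. -/
noncomputable def spec (x : ℂ) : Bi →+* Polynomial ℂ :=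
  (Polynomial.mapRingHom (Polynomial.evalRingHom x)).comp yp

theorem eval_spec (x y : ℂ) (f : Bi) : (spec x f).eval y = MvPolynomial.eval ![x, y] f := by
  have : (Polynomial.evalRingHom y).comp (spec x) = MvPolynomial.eval ![x, y] := by
    apply MvPolynomial.ringHom_ext
    · intro a; simp [spec]
    · intro i; fin_cases i <;> simp [spec]
  exact congrArg (fun φ : Bi →+* ℂ => φ f) this

theorem spec_eq (x : ℂ) (f : Bi) : spec x f = (yp f).map (Polynomial.evalRingHom x) := rfl

theorem spec_monic {f : Bi} (hf : (yp f).Monic) (x : ℂ) : (spec x f).Monic := hf.map _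

theorem spec_natDegree {f : Bi} (hf : (yp f).Monic) (x : ℂ) :
    (spec x f).natDegree = (yp f).natDegree := hf.natDegree_map _

theorem coeff_prod_gt {ι : Type*} (s : Finset ι) (θ : ι → HS) (h : ∀ i ∈ s, Gt (θ i) 0) :
    ∀ k < s.card, Gt ((∏ i ∈ s, (Polynomial.X - Polynomial.C (θ i))).coeff k) 0 := by
  classical
  induction s using Finset.induction_on with
  | empty => simp
  | insert a s ha ih =>
    intro k hk
    have ih := ih fun i hi => h i (Finset.mem_insert_of_mem hi)
    set G := ∏ i ∈ s, (Polynomial.X - Polynomial.C (θ i)) with hG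
    have hm : G.Monic := Polynomial.monic_prod_X_sub_C _ _
    have hd : G.natDegree = s.card := by rw [hG]; simp
    have hge : ∀ k, Ge (G.coeff k) 0 := fun k => by
      rcases lt_trichotomy k s.card with h1 | h1 | h1
      · exact (ih k h1).ge
      · rw [h1, ← hd, hm.coeff_natDegree, ← map_one HahnSeries.C]; exact ge_C 1
      · rw [Polynomial.coeff_eq_zero_of_natDegree_lt (hd ▸ h1)]; exact fun _ _ => rfl
    have h2 : Gt (θ a * G.coeff k) 0 := by
      simpa using (h a (Finset.mem_insert_self a s)).mul_ge (hge k)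
    rw [Finset.prod_insert ha, ← hG,
      show (Polynomial.X - Polynomial.C (θ a)) * G = Polynomial.X * G - Polynomial.C (θ a) * G by ring,
      Polynomial.coeff_sub, Polynomial.coeff_C_mul]
    rw [Finset.card_insert_of_notMem ha] at hk
    cases k with
    | zero => rw [Polynomial.coeff_X_mul_zero, zero_sub]; exact h2.neg
    | succ k =>
      rw [Polynomial.coeff_X_mul]
      exact (ih k (by omega)).sub h2

theorem degree_lt_of_phi {p q : Polynomial ℂ} {s : HS} (h : phi p = phi q * s) (hs : Gt s 0)
    (hq : q ≠ 0) : p.degree < q.degree := by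
  rw [Polynomial.degree_eq_natDegree hq, Polynomial.degree_lt_iff_coeff_zero]
  intro m hm
  have h1 : Ge (phi q) (-(q.natDegree : ℝ)) := by
    have h0 := congrArg phi (Polynomial.as_sum_range_C_mul_X_pow q)
    rw [map_sum] at h0
    rw [h0]
    refine Ge.sum _ fun i hi => ?_
    have hi : i ≤ q.natDegree := Nat.lt_succ_iff.1 (Finset.mem_range.1 hi)
    have h2 : phi (Polynomial.C (q.coeff i) * Polynomial.X ^ i) =
        HahnSeries.C (q.coeff i) * xx ^ i := by simp [phi]
    rw [h2, xx_pow]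
    have h3 := (ge_C (q.coeff i)).mul (lead_single (-(i : ℝ)) (1 : ℂ)).ge
    refine h3.mono ?_
    rw [zero_add]
    exact neg_le_neg (by exact_mod_cast hi)
  have h2 : Gt (phi p) (-(q.natDegree : ℝ)) := by
    rw [h, mul_comm]
    simpa using hs.mul_ge h1
  rw [← phi_coeff]
  exact h2 _ (neg_le_neg (by exact_mod_cast hm))

theorem bounded_ratio {p q : Polynomial ℂ} (h : p.degree < q.degree) :
    ∃ C R : ℝ, 0 < C ∧ ∀ x : ℂ, R < ‖x‖ → q.eval x ≠ 0 ∧ ‖p.eval x‖ ≤ C / ‖x‖ * ‖q.eval x‖ := by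
  have hq : q ≠ 0 := by rintro rfl; simp at h
  have h1 : (Polynomial.X * p).degree ≤ q.degree := by
    rw [Polynomial.degree_mul, Polynomial.degree_X]
    by_cases hp : p = 0
    · simp [hp]
    · rw [Polynomial.degree_eq_natDegree hp, Polynomial.degree_eq_natDegree hq] at h ⊢
      have : p.natDegree < q.natDegree := by exact_mod_cast h
      exact_mod_cast (by omega : 1 + p.natDegree ≤ q.natDegree)
  have h2 := Polynomial.isBigO_cobounded_of_degree_le (R := ℂ) h1
  obtain ⟨C, hC, hb⟩ := h2.exists_pos
  rw [Asymptotics.isBigOWith_iff] at hb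
  have h3 : ∀ᶠ x in Bornology.cobounded ℂ, q.eval x ≠ 0 := by
    rw [Metric.cobounded_eq_cocompact]
    have : {x | q.eval x = 0}.Finite := by
      refine (q.roots.toFinset.finite_toSet).subset fun x hx => ?_
      simpa [hq] using hx
    exact this.isCompact.compl_mem_cocompact
  have h4 := (hb.and h3).and (Bornology.eventually_ne_cobounded (0 : ℂ))
  rw [← comap_norm_atTop, eventually_comap, ] at h4
  obtain ⟨R, hR⟩ := eventually_atTop.1 h4
  refine ⟨C, R, hC, fun x hx => ?_⟩
  obtain ⟨⟨h5, h6⟩, h7⟩ := hR _ hx.le x rfl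
  refine ⟨h6, ?_⟩
  have h8 : 0 < ‖x‖ := norm_pos_iff.2 h7
  rw [Polynomial.eval_mul, Polynomial.eval_X, norm_mul] at h5
  rw [div_mul_eq_mul_div, le_div_iff₀ h8, mul_comm]
  exact h5

/-- A root of a polynomial whose lower coefficients are small is small. -/
theorem root_small {n : ℕ} (a : ℕ → Polynomial ℂ) (hn : a n ≠ 0)
    (ha : ∀ k < n, (a k).degree < (a n).degree) :
    ∃ C R : ℝ, 0 < C ∧ 0 < R ∧ ∀ x t : ℂ, R < ‖x‖ → (a n).eval x ≠ 0 ∧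
      (∑ k ∈ Finset.range (n + 1), (a k).eval x * t ^ k = 0 → ‖t‖ ^ n ≤ C / ‖x‖) := by
  have h : ∀ k, ∃ C R : ℝ, 0 < C ∧ ∀ x : ℂ, k < n → R < ‖x‖ →
      ‖(a k).eval x‖ ≤ C / ‖x‖ * ‖(a n).eval x‖ := fun k => by
    by_cases hk : k < n
    · obtain ⟨C, R, hC, h⟩ := bounded_ratio (ha k hk)
      exact ⟨C, R, hC, fun x _ hx => (h x hx).2⟩
    · exact ⟨1, 1, one_pos, fun x h => absurd h hk⟩
  choose C R hC hR using h
  obtain ⟨_, R0, _, hR0⟩ := bounded_ratio (p := 0) (q := a n) (by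
    rw [Polynomial.degree_zero, bot_lt_iff_ne_bot]; simpa using hn)
  set S := ∑ k ∈ Finset.range n, C k with hS
  have hS0 : 0 ≤ S := Finset.sum_nonneg fun k _ => (hC k).le
  set M := max (max R0 (S + 1)) (∑ k ∈ Finset.range n, |R k|) with hM
  refine ⟨S + 1, M, by linarith, lt_of_lt_of_le (by linarith) ((le_max_right _ _).trans
    (le_max_left _ _)), fun x t hx => ⟨(hR0 x (lt_of_le_of_lt ((le_max_left _ _).trans
      (le_max_left _ _)) hx)).1, fun ht => ?_⟩⟩
  have han := (hR0 x (lt_of_le_of_lt ((le_max_left _ _).trans (le_max_left _ _)) hx)).1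
  have hx1 : S + 1 < ‖x‖ := lt_of_le_of_lt ((le_max_right _ _).trans (le_max_left _ _)) hx
  have hx0 : 0 < ‖x‖ := by linarith
  have han' : 0 < ‖(a n).eval x‖ := norm_pos_iff.2 han
  have hsum : ‖t‖ ^ n * ‖(a n).eval x‖ ≤
      ∑ k ∈ Finset.range n, C k / ‖x‖ * ‖(a n).eval x‖ * ‖t‖ ^ k := by
    rw [Finset.sum_range_succ] at ht
    rw [← norm_pow, ← norm_mul, mul_comm, eq_neg_of_add_eq_zero_right ht, norm_neg]
    refine (norm_sum_le _ _).trans (Finset.sum_le_sum fun k hk => ?_)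
    rw [norm_mul, norm_pow]
    refine mul_le_mul_of_nonneg_right (hR k x (Finset.mem_range.1 hk) ?_) (by positivity)
    refine lt_of_le_of_lt ((le_abs_self _).trans ?_) hx
    exact (Finset.single_le_sum (f := fun k => |R k|) (fun i _ => abs_nonneg _) hk).trans
      (le_max_right _ _)
  have hsum2 : ‖t‖ ^ n ≤ ∑ k ∈ Finset.range n, C k / ‖x‖ * ‖t‖ ^ k := by
    rw [← mul_le_mul_iff_left₀ han', Finset.sum_mul]
    refine hsum.trans_eq (Finset.sum_congr rfl fun k _ => by ring)
  have hle : ‖t‖ ≤ 1 := by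
    by_contra! h1
    have h2 : ∑ k ∈ Finset.range n, C k / ‖x‖ * ‖t‖ ^ k ≤
        ∑ k ∈ Finset.range n, C k / ‖x‖ * ‖t‖ ^ n :=
      Finset.sum_le_sum fun k hk => mul_le_mul_of_nonneg_left
        (pow_le_pow_right₀ h1.le (Finset.mem_range.1 hk).le) (div_nonneg (hC k).le hx0.le)
    rw [← Finset.sum_mul, ← Finset.sum_div, ← hS] at h2
    have h3 : S / ‖x‖ < 1 := by rw [div_lt_one hx0]; linarith
    have h4 : 0 < ‖t‖ ^ n := by positivity
    nlinarith
  refine hsum2.trans ?_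
  calc ∑ k ∈ Finset.range n, C k / ‖x‖ * ‖t‖ ^ k ≤ ∑ k ∈ Finset.range n, C k / ‖x‖ :=
        Finset.sum_le_sum fun k _ => mul_le_of_le_one_right (div_nonneg (hC k).le hx0.le)
          (pow_le_one₀ (norm_nonneg _) hle)
    _ = S / ‖x‖ := by rw [← Finset.sum_div]
    _ ≤ (S + 1) / ‖x‖ := by gcongr; linarith

theorem resultant_eq_prod {A : Type*} [CommRing A] [IsDomain A] (s : Finset A) (g : Polynomial A)
    {N : ℕ} (hN : g.natDegree ≤ N) :
    Polynomial.resultant (∏ u ∈ s, (Polynomial.X - Polynomial.C u)) g s.card N =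
      ∏ u ∈ s, g.eval u := by
  have h1 : (∏ u ∈ s, (Polynomial.X - Polynomial.C u)).natDegree = s.card := by simp
  have h2 := Polynomial.resultant_eq_prod_eval (∏ u ∈ s, (Polynomial.X - Polynomial.C u)) g N hN
    (Polynomial.Splits.prod fun u _ => Polynomial.Splits.X_sub_C u)
  rw [h1, Polynomial.roots_prod_X_sub_C, (Polynomial.monic_prod_X_sub_C _ _).leadingCoeff,
    one_pow, one_mul] at h2
  exact h2

theorem resultant_eq_zero_of_root {f g : Polynomial ℂ} (hf : f.Monic) {y : ℂ}
    (hfy : f.eval y = 0) (hgy : g.eval y = 0) {N : ℕ} (hN : g.natDegree ≤ N) :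
    Polynomial.resultant f g f.natDegree N = 0 := by
  rw [Polynomial.resultant_eq_prod_eval f g N hN (IsAlgClosed.splits f), hf.leadingCoeff, one_pow,
    one_mul, Multiset.prod_eq_zero_iff, Multiset.mem_map]
  exact ⟨y, (Polynomial.mem_roots hf.ne_zero).2 hfy, hgy⟩

theorem map_prod_X_sub_C {A B : Type*} [CommRing A] [CommRing B] (φ : A →+* B) (s : Finset A) :
    (∏ u ∈ s, (Polynomial.X - Polynomial.C u)).map φ =
      ∏ u ∈ s, (Polynomial.X - Polynomial.C (φ u)) := by
  rw [Polynomial.map_prod]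
  simp

theorem map_C_prod_X_sub_C {A : Type*} [CommRing A] [DecidableEq (Polynomial A)] (s : Finset A) :
    (∏ u ∈ s, (Polynomial.X - Polynomial.C u)).map Polynomial.C =
      ∏ u ∈ s.image (Polynomial.C : A →+* Polynomial A), (Polynomial.X - Polynomial.C u) := by
  rw [map_prod_X_sub_C, Finset.prod_image fun _ _ _ _ h => Polynomial.C_injective h]

theorem resultant_map_C {A : Type*} [CommRing A] [IsDomain A] (s : Finset A)
    (g : Polynomial (Polynomial A)) {N : ℕ} (hN : g.natDegree ≤ N) :
    Polynomial.resultant ((∏ u ∈ s, (Polynomial.X - Polynomial.C u)).map Polynomial.C) g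
      s.card N = ∏ u ∈ s, g.eval (Polynomial.C u) := by
  classical
  have e3 : (s.image (Polynomial.C : A →+* Polynomial A)).card = s.card :=
    Finset.card_image_of_injective _ Polynomial.C_injective
  rw [map_C_prod_X_sub_C, ← e3, resultant_eq_prod _ _ hN,
    Finset.prod_image fun _ _ _ _ h => Polynomial.C_injective h]

theorem map_resultant_map_C {A B : Type*} [CommRing A] [CommRing B] [IsDomain B] (φ : A →+* B)
    {f : Polynomial A} {s : Finset B} (hf : f.map φ = ∏ u ∈ s, (Polynomial.X - Polynomial.C u))
    (g : Polynomial (Polynomial A)) :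
    (Polynomial.resultant (f.map Polynomial.C) g s.card g.natDegree).map φ =
      ∏ u ∈ s, (g.map (Polynomial.mapRingHom φ)).eval (Polynomial.C u) := by
  have ec : (Polynomial.mapRingHom φ).comp Polynomial.C = Polynomial.C.comp φ := by
    ext : 1; simp
  rw [← Polynomial.coe_mapRingHom, ← Polynomial.resultant_map_map, Polynomial.map_map, ec,
    ← Polynomial.map_map, hf, resultant_map_C s _ Polynomial.natDegree_map_le]

theorem eval_map_map_C {A B : Type*} [CommRing A] [CommRing B] (φ : A →+* B)
    (h : Polynomial A) (u : B) :
    ((h.map Polynomial.C).map (Polynomial.mapRingHom φ)).eval (Polynomial.C u) =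
      Polynomial.C ((h.map φ).eval u) := by
  have ec : (Polynomial.mapRingHom φ).comp Polynomial.C = Polynomial.C.comp φ := by
    ext : 1; simp
  rw [Polynomial.map_map, ec, ← Polynomial.map_map, Polynomial.eval_map_apply]

namespace JPair
variable {P Q : Bi} {κ : ℂ} (J : JPair P Q κ)
include J

theorem exists_decay {c : ℂ} {r : Bi}
    (hr : ∀ u ∈ Zr P c, Gt (ev u r / ev u (pderiv 1 P)) 1) :
    ∃ C R : ℝ, 0 < C ∧ 0 < R ∧ ∀ x y : ℂ, MvPolynomial.eval ![x, y] P = c → R < ‖x‖ →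
      MvPolynomial.eval ![x, y] (pderiv 1 P) ≠ 0 ∧
      ‖x * MvPolynomial.eval ![x, y] r / MvPolynomial.eval ![x, y] (pderiv 1 P)‖ ^
        (yp P).natDegree ≤ C / ‖x‖ := by
  classical
  set Z := Zr P c with hZ
  set f := yp (P - MvPolynomial.C c) with hf
  have hcov := J.cover c
  have hfm : f.Monic := hcov.monic
  have hcard : Z.card = (yp P).natDegree := J.card_Zr c
  set d1 := yp (pderiv 1 P) with hd1
  set d2 := yp (MvPolynomial.X 0 * r) with hd2
  set g : Polynomial (Polynomial (Polynomial ℂ)) :=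
    d1.map Polynomial.C * Polynomial.C Polynomial.X - d2.map Polynomial.C with hg
  set N := g.natDegree with hN
  set Res := Polynomial.resultant (f.map Polynomial.C) g Z.card N with hRes
  -- the resultant in terms of the formal roots
  have h1 : Res.map phi = ∏ u ∈ Z, (Polynomial.C (ev u (pderiv 1 P)) * Polynomial.X -
      Polynomial.C (xx * ev u r)) := by
    refine (map_resultant_map_C phi hcov.map_eq g).trans ?_
    refine Finset.prod_congr rfl fun u _ => ?_
    have e4 : ∀ h : Polynomial (Polynomial ℂ),
        ((h.map Polynomial.C).map (Polynomial.mapRingHom phi)).eval (Polynomial.C u) =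
          Polynomial.C (Ev h u) := fun h => by
      rw [Ev_eq]; exact eval_map_map_C phi h u
    rw [hg, Polynomial.map_sub, Polynomial.map_mul, Polynomial.eval_sub, Polynomial.eval_mul]
    rw [e4, e4, hd1, hd2, Ev_yp, Ev_yp, map_mul, ev_X0]
    simp
  -- the resultant vanishes at points of the curve
  have h2 : ∀ x y t : ℂ, MvPolynomial.eval ![x, y] P = c →
      MvPolynomial.eval ![x, y] (pderiv 1 P) * t = x * MvPolynomial.eval ![x, y] r →
      (Res.map (Polynomial.evalRingHom x)).eval t = 0 := fun x y t hP ht => by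
    let ψ : Polynomial (Polynomial ℂ) →+* ℂ :=
      (Polynomial.evalRingHom t).comp (Polynomial.mapRingHom (Polynomial.evalRingHom x))
    have e1 : (Res.map (Polynomial.evalRingHom x)).eval t = ψ Res := rfl
    have ec : ψ.comp Polynomial.C = Polynomial.evalRingHom x := by ext <;> simp [ψ]
    have e2 : (f.map Polynomial.C).map ψ = spec x (P - MvPolynomial.C c) := by
      rw [Polynomial.map_map, ec, spec_eq]
    have e3 : (spec x (P - MvPolynomial.C c)).natDegree = Z.card := by
      rw [spec_natDegree hfm, hcov.natDegree]
    rw [e1, hRes, ← Polynomial.resultant_map_map, e2, ← e3]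
    refine resultant_eq_zero_of_root (y := y) (spec_monic hfm x) ?_ ?_ Polynomial.natDegree_map_le
    · rw [eval_spec]; simp [hP]
    · have e4 : g.map ψ = spec x (pderiv 1 P) * Polynomial.C t - spec x (MvPolynomial.X 0 * r) := by
        rw [hg, Polynomial.map_sub, Polynomial.map_mul, Polynomial.map_map, Polynomial.map_map, ec,
          Polynomial.map_C, show ψ Polynomial.X = t by simp [ψ]]
        rfl
      rw [e4, Polynomial.eval_sub, Polynomial.eval_mul, eval_spec, eval_spec, Polynomial.eval_C, ht]
      simp
  -- sizes of the coefficients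
  have hne : ∀ u ∈ Z, ev u (pderiv 1 P) ≠ 0 := fun u hu => J.simple (J.mem_Zr.1 hu)
  set a0 := ∏ u ∈ Z, ev u (pderiv 1 P) with ha0
  have ha0ne : a0 ≠ 0 := Finset.prod_ne_zero_iff.2 hne
  set θ : HS → HS := fun u => xx * (ev u r / ev u (pderiv 1 P)) with hθ
  have hθ0 : ∀ u ∈ Z, Gt (θ u) 0 := fun u hu => by
    have := (hr u hu).mul_ge (lead_single (-1 : ℝ) (1 : ℂ)).ge
    rw [mul_comm, show (1 : ℝ) + -1 = 0 by norm_num] at this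
    exact this
  set G := ∏ u ∈ Z, (Polynomial.X - Polynomial.C (θ u)) with hG
  have h3 : Res.map phi = Polynomial.C a0 * G := by
    rw [h1, ha0, map_prod, hG, ← Finset.prod_mul_distrib]
    refine Finset.prod_congr rfl fun u hu => ?_
    have h4 : ev u (pderiv 1 P) * θ u = xx * ev u r := by
      have := hne u hu
      simp only [hθ]
      field_simp
    rw [← h4, map_mul]
    ring
  have hGd : G.natDegree = Z.card := by rw [hG]; simp
  have hGm : G.Monic := Polynomial.monic_prod_X_sub_C _ _
  have hcoef : ∀ k, phi (Res.coeff k) = a0 * G.coeff k := fun k => by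
    rw [← Polynomial.coeff_map, h3, Polynomial.coeff_C_mul]
  have htop : phi (Res.coeff Z.card) = a0 := by
    rw [hcoef, ← hGd, hGm.coeff_natDegree, mul_one]
  have hRd : Res.natDegree = Z.card := by
    rw [← Polynomial.natDegree_map_eq_of_injective phi_injective, h3,
      Polynomial.natDegree_C_mul ha0ne, hGd]
  obtain ⟨C, R, hC, hR, hroot⟩ := root_small (n := Z.card) Res.coeff
    (fun h => ha0ne (by rw [← htop, h, map_zero])) fun k hk =>
      degree_lt_of_phi (s := G.coeff k) (by rw [hcoef, htop]) (coeff_prod_gt Z θ hθ0 k hk)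
        (fun h => ha0ne (by rw [← htop, h, map_zero]))
  -- the discriminant-like coefficient
  set Res1 := Polynomial.resultant f d1 Z.card d1.natDegree with hRes1
  have hR1 : Res1 = Res.coeff Z.card := by
    refine phi_injective ?_
    rw [htop, hRes1, ← Polynomial.resultant_map_map, hcov.map_eq,
      resultant_eq_prod _ _ Polynomial.natDegree_map_le]
    refine Finset.prod_congr rfl fun u _ => ?_
    rw [hd1, ← Ev_yp, Ev_eq]
  have h5 : ∀ x y : ℂ, MvPolynomial.eval ![x, y] P = c →
      MvPolynomial.eval ![x, y] (pderiv 1 P) = 0 → (Res.coeff Z.card).eval x = 0 :=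
    fun x y hP hy => by
      have e3 : (spec x (P - MvPolynomial.C c)).natDegree = Z.card := by
        rw [spec_natDegree hfm, hcov.natDegree]
      rw [← hR1, ← Polynomial.coe_evalRingHom, hRes1, ← Polynomial.resultant_map_map, ← e3]
      refine resultant_eq_zero_of_root (y := y) (spec_monic hfm x) ?_ ?_ Polynomial.natDegree_map_le
      · rw [eval_spec]; simp [hP]
      · exact (eval_spec x y _).trans hy
  refine ⟨C, R, hC, hR, fun x y hP hx => ?_⟩
  have hy : MvPolynomial.eval ![x, y] (pderiv 1 P) ≠ 0 := fun h =>
    (hroot x 0 hx).1 (h5 x y hP h)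
  refine ⟨hy, ?_⟩
  rw [← hcard]
  refine (hroot x _ hx).2 ?_
  have h6 := h2 x y (x * MvPolynomial.eval ![x, y] r / MvPolynomial.eval ![x, y] (pderiv 1 P)) hP
    (by field_simp)
  rw [Polynomial.eval_eq_sum_range' (n := Z.card + 1)
    (Nat.lt_succ_of_le (Polynomial.natDegree_map_le.trans hRd.le))] at h6
  simpa using h6

end JPair

end KellerRational

namespace KellerRational

/-! ### Local analysis on a level curve -/

open Topology

/-- Evaluation at a point of the plane. -/
noncomputable def pev (p : ℂ × ℂ) : Bi →+* ℂ := MvPolynomial.eval ![p.1, p.2]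

theorem pev_def (p : ℂ × ℂ) (f : Bi) : pev p f = MvPolynomial.eval ![p.1, p.2] f := rfl

theorem pev_X0 (p : ℂ × ℂ) : pev p (X 0) = p.1 := by simp [pev_def]

theorem pev_X1 (p : ℂ × ℂ) : pev p (X 1) = p.2 := by simp [pev_def]

theorem hasStrictFDerivAt_pev (f : Bi) (p : ℂ × ℂ) :
    HasStrictFDerivAt (fun p : ℂ × ℂ => pev p f)
      (pev p (pderiv 0 f) • ContinuousLinearMap.fst ℂ ℂ ℂ +
        pev p (pderiv 1 f) • ContinuousLinearMap.snd ℂ ℂ ℂ) p := by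
  induction f using MvPolynomial.induction_on with
  | C a =>
    have h : (fun p : ℂ × ℂ => pev p (MvPolynomial.C a)) = fun _ => a := by
      funext p; simp [pev_def]
    rw [h]
    refine (hasStrictFDerivAt_const (𝕜 := ℂ) a p).congr_fderiv ?_
    ext <;> simp
  | add f g hf hg =>
    simp only [map_add]
    refine (hf.add hg).congr_fderiv ?_
    ext <;> simp
  | mul_X f i hf =>
    simp only [map_mul, Derivation.leibniz, smul_eq_mul, map_add]
    have hX : HasStrictFDerivAt (fun p : ℂ × ℂ => pev p (X i))
        (pev p (pderiv 0 (X i : Bi)) • ContinuousLinearMap.fst ℂ ℂ ℂ +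
          pev p (pderiv 1 (X i : Bi)) • ContinuousLinearMap.snd ℂ ℂ ℂ) p := by
      match i with
      | 0 =>
        simp_rw [pev_X0]
        refine (hasStrictFDerivAt_fst (𝕜 := ℂ) (p := p)).congr_fderiv ?_
        ext <;> simp [pderiv_X]
      | 1 =>
        simp_rw [pev_X1]
        refine (hasStrictFDerivAt_snd (𝕜 := ℂ) (p := p)).congr_fderiv ?_
        ext <;> simp [pderiv_X]
    refine (hf.mul hX).congr_fderiv ?_
    ext <;> simp

theorem continuous_pev (f : Bi) : Continuous fun p : ℂ × ℂ => pev p f :=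
  continuous_iff_continuousAt.2 fun p => (hasStrictFDerivAt_pev f p).continuousAt

theorem differentiable_pev (f : Bi) : Differentiable ℂ fun p : ℂ × ℂ => pev p f :=
  fun p => (hasStrictFDerivAt_pev f p).hasFDerivAt.differentiableAt

theorem contDiff_pev (f : Bi) : ContDiff ℂ 1 fun p : ℂ × ℂ => pev p f := by
  have h : ∀ p, fderiv ℂ (fun p : ℂ × ℂ => pev p f) p =
      pev p (pderiv 0 f) • ContinuousLinearMap.fst ℂ ℂ ℂ +
        pev p (pderiv 1 f) • ContinuousLinearMap.snd ℂ ℂ ℂ :=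
    fun p => (hasStrictFDerivAt_pev f p).hasFDerivAt.fderiv
  rw [contDiff_one_iff_fderiv]
  refine ⟨differentiable_pev f, ?_⟩
  simp_rw [funext h]
  exact ((continuous_pev _).smul continuous_const).add ((continuous_pev _).smul continuous_const)

/-- The linear map with matrix `!![a, b; c, d]`. -/
noncomputable def linEquiv (a b c d : ℂ) (h : a * d - b * c ≠ 0) : (ℂ × ℂ) ≃L[ℂ] (ℂ × ℂ) :=
  ContinuousLinearEquiv.equivOfInverse
    ((a • ContinuousLinearMap.fst ℂ ℂ ℂ + b • ContinuousLinearMap.snd ℂ ℂ ℂ).prod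
      (c • ContinuousLinearMap.fst ℂ ℂ ℂ + d • ContinuousLinearMap.snd ℂ ℂ ℂ))
    ((a * d - b * c)⁻¹ • ((d • ContinuousLinearMap.fst ℂ ℂ ℂ - b • ContinuousLinearMap.snd ℂ ℂ ℂ).prod
      (a • ContinuousLinearMap.snd ℂ ℂ ℂ - c • ContinuousLinearMap.fst ℂ ℂ ℂ)))
    (fun p => by
      ext
      · simp only [_root_.smul_apply, ContinuousLinearMap.prod_apply,
          _root_.add_apply, _root_.sub_apply, ContinuousLinearMap.coe_fst',
          ContinuousLinearMap.coe_snd', smul_eq_mul, Prod.smul_mk]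
        rw [inv_mul_eq_iff_eq_mul₀ h]; ring
      · simp only [_root_.smul_apply, ContinuousLinearMap.prod_apply,
          _root_.add_apply, _root_.sub_apply, ContinuousLinearMap.coe_fst',
          ContinuousLinearMap.coe_snd', smul_eq_mul, Prod.smul_mk]
        rw [inv_mul_eq_iff_eq_mul₀ h]; ring)
    (fun p => by
      ext
      · simp only [_root_.smul_apply, ContinuousLinearMap.prod_apply,
          _root_.add_apply, _root_.sub_apply, ContinuousLinearMap.coe_fst',
          ContinuousLinearMap.coe_snd', smul_eq_mul, Prod.smul_mk]
        rw [← mul_right_inj' h]; field_simp; ring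
      · simp only [_root_.smul_apply, ContinuousLinearMap.prod_apply,
          _root_.add_apply, _root_.sub_apply, ContinuousLinearMap.coe_fst',
          ContinuousLinearMap.coe_snd', smul_eq_mul, Prod.smul_mk]
        rw [← mul_right_inj' h]; field_simp; ring)

/-- The planar map given by two polynomials. -/
noncomputable def pmap (A B : Bi) (p : ℂ × ℂ) : ℂ × ℂ := (pev p A, pev p B)

theorem exists_strict_equiv {A B : Bi} {p : ℂ × ℂ}
    (h : pev p (pderiv 0 A) * pev p (pderiv 1 B) - pev p (pderiv 1 A) * pev p (pderiv 0 B) ≠ 0) :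
    ∃ e : (ℂ × ℂ) ≃L[ℂ] (ℂ × ℂ),
      HasStrictFDerivAt (pmap A B) (e : (ℂ × ℂ) →L[ℂ] (ℂ × ℂ)) p :=
  ⟨linEquiv _ _ _ _ h, (hasStrictFDerivAt_pev A p).prodMk (hasStrictFDerivAt_pev B p)⟩

/-- Restricted to a level curve of `A`, the polynomial `B` is open and locally injective. -/
theorem map_pev_nhdsWithin {A B : Bi} {p : ℂ × ℂ} {c : ℂ} (hp : pev p A = c)
    (h : pev p (pderiv 0 A) * pev p (pderiv 1 B) - pev p (pderiv 1 A) * pev p (pderiv 0 B) ≠ 0) :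
    map (fun p => pev p B) (𝓝[{p | pev p A = c}] p) = 𝓝 (pev p B) := by
  obtain ⟨e, he⟩ := exists_strict_equiv h
  have h1 := he.map_nhds_eq_of_equiv
  have h2 : map (pmap A B) (𝓝[{p | pev p A = c}] p) = 𝓝[{q | q.1 = c}] (pmap A B p) := by
    have : {p | pev p A = c} = pmap A B ⁻¹' {q | q.1 = c} := rfl
    rw [nhdsWithin, nhdsWithin, this, Filter.map_inf_principal_preimage, h1]
  have h3 : (fun p => pev p B) = Prod.snd ∘ pmap A B := rfl
  rw [h3, ← Filter.map_map, h2]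
  have h4 : {q : ℂ × ℂ | q.1 = c} = {c} ×ˢ Set.univ := by ext; simp
  have h5 : pmap A B p = (c, pev p B) := Prod.ext hp rfl
  rw [h4, h5, nhdsWithin_prod_eq, nhdsWithin_univ, nhdsWithin_singleton, Filter.map_snd_prod]

theorem exists_local_inverse {A B : Bi} {p : ℂ × ℂ}
    (h : pev p (pderiv 0 A) * pev p (pderiv 1 B) - pev p (pderiv 1 A) * pev p (pderiv 0 B) ≠ 0) :
    ∃ Ψ : ℂ × ℂ → ℂ × ℂ, (∀ᶠ q in 𝓝 (pmap A B p), DifferentiableAt ℂ Ψ q) ∧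
      ∀ᶠ p' in 𝓝 p, Ψ (pmap A B p') = p' := by
  obtain ⟨e, he⟩ := exists_strict_equiv h
  have h1 : ContDiffAt ℂ 1 (pmap A B) p := ((contDiff_pev A).prodMk (contDiff_pev B)).contDiffAt
  refine ⟨h1.localInverse he.hasFDerivAt one_ne_zero, ?_, ?_⟩
  · have h2 := h1.to_localInverse he.hasFDerivAt one_ne_zero
    exact (h2.eventually (by simp)).mono fun q hq => hq.differentiableAt one_ne_zero
  · exact (h1.hasStrictFDerivAt' he.hasFDerivAt one_ne_zero).eventually_left_inverse

theorem eventually_injOn {A B : Bi} {p : ℂ × ℂ}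
    (h : pev p (pderiv 0 A) * pev p (pderiv 1 B) - pev p (pderiv 1 A) * pev p (pderiv 0 B) ≠ 0) :
    ∃ U ∈ 𝓝 p, Set.InjOn (pmap A B) U := by
  obtain ⟨Ψ, -, h2⟩ := exists_local_inverse h
  exact ⟨_, h2, fun x hx y hy hxy => by rw [← hx, ← hy, hxy]⟩

/-- `g` is, near `p` on the level curve `A = c`, a function of `B` with derivative `ρ`. -/
def Prim (A B ρ : Bi) (c : ℂ) (g : ℂ × ℂ → ℂ) (p : ℂ × ℂ) : Prop :=
  ∃ h : ℂ → ℂ, ∀ᶠ p' in 𝓝[{p | pev p A = c}] p,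
    g p' = h (pev p' B) ∧ HasDerivAt h (pev p' ρ) (pev p' B)

namespace Prim
variable {A B ρ : Bi} {c : ℂ} {p : ℂ × ℂ} {g g₁ g₂ : ℂ × ℂ → ℂ}

theorem eventually (h : Prim A B ρ c g p) : ∀ᶠ p' in 𝓝[{p | pev p A = c}] p, Prim A B ρ c g p' := by
  obtain ⟨k, hk⟩ := h
  rw [← eventually_eventually_nhdsWithin] at hk
  exact hk.mono fun p' h => ⟨k, h⟩

theorem continuousWithinAt (h : Prim A B ρ c g p) (hp : pev p A = c) :
    ContinuousWithinAt g {p | pev p A = c} p := by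
  obtain ⟨k, hk⟩ := h
  have h1 : p ∈ {p | pev p A = c} := hp
  obtain ⟨h2, h3⟩ := hk.self_of_nhdsWithin h1
  have h4 : ContinuousWithinAt (fun p => k (pev p B)) {p | pev p A = c} p :=
    (h3.continuousAt.comp (f := fun p => pev p B)
      (continuous_pev B).continuousAt).continuousWithinAt
  exact h4.congr_of_eventuallyEq (hk.mono fun p' h => h.1) h2

theorem sub_eventually_const (hp : pev p A = c)
    (h : pev p (pderiv 0 A) * pev p (pderiv 1 B) - pev p (pderiv 1 A) * pev p (pderiv 0 B) ≠ 0)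
    (h₁ : Prim A B ρ c g₁ p) (h₂ : Prim A B ρ c g₂ p) :
    ∀ᶠ p' in 𝓝[{p | pev p A = c}] p, g₁ p' - g₂ p' = g₁ p - g₂ p := by
  obtain ⟨k₁, hk₁⟩ := h₁
  obtain ⟨k₂, hk₂⟩ := h₂
  have hk := hk₁.and hk₂
  have hm := map_pev_nhdsWithin hp h
  have h1 : ∀ᶠ q in 𝓝 (pev p B), HasDerivAt (fun z => k₁ z - k₂ z) 0 q := by
    rw [← hm, eventually_map]
    filter_upwards [hk] with p' hp'
    have := hp'.1.2.sub hp'.2.2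
    rw [sub_self] at this
    exact this
  obtain ⟨ε, hε, hb⟩ := Metric.eventually_nhds_iff_ball.1 h1
  have h2 : ∀ q ∈ Metric.ball (pev p B) ε, k₁ q - k₂ q = k₁ (pev p B) - k₂ (pev p B) :=
    fun q hq => Metric.isOpen_ball.is_const_of_deriv_eq_zero
      (convex_ball _ _).isPreconnected
      (fun z hz => (hb z hz).differentiableAt.differentiableWithinAt)
      (fun z hz => (hb z hz).deriv) hq (Metric.mem_ball_self hε)
  have h3 : ∀ᶠ p' in 𝓝[{p | pev p A = c}] p, pev p' B ∈ Metric.ball (pev p B) ε :=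
    ((continuous_pev B).continuousAt.eventually
      (Metric.ball_mem_nhds _ hε)).filter_mono nhdsWithin_le_nhds
  have hp1 : p ∈ {p | pev p A = c} := hp
  obtain ⟨⟨e1, -⟩, ⟨e2, -⟩⟩ := hk.self_of_nhdsWithin hp1
  filter_upwards [hk, h3] with p' hp' hq
  rw [hp'.1.1, hp'.2.1, e1, e2, h2 _ hq]

theorem exists_local (hp : pev p A = c)
    (h : pev p (pderiv 0 A) * pev p (pderiv 1 B) - pev p (pderiv 1 A) * pev p (pderiv 0 B) ≠ 0) :
    ∃ g, Prim A B ρ c g p := by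
  obtain ⟨Ψ, hΨ, hinv⟩ := exists_local_inverse h
  have h0 : pmap A B p = (c, pev p B) := Prod.ext hp rfl
  rw [h0] at hΨ
  have h1 : ∀ᶠ q in 𝓝 (pev p B), DifferentiableAt ℂ (fun q => pev (Ψ (c, q)) ρ) q := by
    have : ContinuousAt (fun q : ℂ => (c, q)) (pev p B) := by fun_prop
    filter_upwards [this.eventually hΨ] with q hq
    exact (differentiable_pev ρ _).comp q (f := fun q => Ψ (c, q))
      (DifferentiableAt.comp (f := fun q : ℂ => (c, q)) q hq (by fun_prop))
  obtain ⟨ε, hε, hb⟩ := Metric.eventually_nhds_iff_ball.1 h1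
  have h2 : DifferentiableOn ℂ (fun q => pev (Ψ (c, q)) ρ) (Metric.ball (pev p B) ε) :=
    fun z hz => (hb z hz).differentiableWithinAt
  obtain ⟨k, hk⟩ := h2.isExactOn_ball
  refine ⟨fun p' => k (pev p' B), k, ?_⟩
  have h3 : ∀ᶠ p' in 𝓝[{p | pev p A = c}] p, pev p' B ∈ Metric.ball (pev p B) ε :=
    ((continuous_pev B).continuousAt.eventually
      (Metric.ball_mem_nhds _ hε)).filter_mono nhdsWithin_le_nhds
  filter_upwards [h3, hinv.filter_mono nhdsWithin_le_nhds, self_mem_nhdsWithin] with p' hq hi hA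
  refine ⟨rfl, ?_⟩
  have h4 := hk _ hq
  have h5 : pmap A B p' = (c, pev p' B) := Prod.ext hA rfl
  rw [h5] at hi
  beta_reduce at h4
  rwa [hi] at h4

/-- Either the derivative vanishes identically or the primitive is open. -/
theorem zero_or_open (hp : pev p A = c)
    (h : pev p (pderiv 0 A) * pev p (pderiv 1 B) - pev p (pderiv 1 A) * pev p (pderiv 0 B) ≠ 0)
    (hg : Prim A B ρ c g p) :
    (∀ᶠ p' in 𝓝[{p | pev p A = c}] p, pev p' ρ = 0) ∨
      𝓝 (g p) ≤ map g (𝓝[{p | pev p A = c}] p) := by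
  obtain ⟨k, hk⟩ := hg
  have hm := map_pev_nhdsWithin hp h
  have h1 : ∀ᶠ q in 𝓝 (pev p B), DifferentiableAt ℂ k q := by
    rw [← hm, eventually_map]
    exact hk.mono fun p' h => h.2.differentiableAt
  have hp1 : p ∈ {p | pev p A = c} := hp
  have han : AnalyticAt ℂ k (pev p B) := Complex.analyticAt_iff_eventually_differentiableAt.2 h1
  rcases han.eventually_constant_or_nhds_le_map_nhds with h2 | h2
  · left
    have h3 : ∀ᶠ q in 𝓝 (pev p B), deriv k q = 0 := by
      have h4 := eventually_eventually_nhds.2 h2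
      filter_upwards [h4] with q hq
      have h5 : k =ᶠ[𝓝 q] fun _ => k (pev p B) := hq
      rw [h5.deriv_eq]; simp
    rw [← hm, eventually_map] at h3
    filter_upwards [hk, h3] with p' h5 h6
    rw [← h5.2.deriv, h6]
  · right
    have h3 : map g (𝓝[{p | pev p A = c}] p) = map k (𝓝 (pev p B)) := by
      rw [← hm, Filter.map_map]
      exact Filter.map_congr (hk.mono fun p' h => h.1)
    rw [h3, (hk.self_of_nhdsWithin hp1).1]
    exact h2

end Prim

/-- The zero locus of a polynomial on a level curve, up to isolated points, is closed. -/
theorem zero_near_closed {A B ρ : Bi} {c : ℂ} {p : ℂ × ℂ} (hp : pev p A = c)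
    (h : ∀ p, pev p (pderiv 0 A) * pev p (pderiv 1 B) -
      pev p (pderiv 1 A) * pev p (pderiv 0 B) ≠ 0)
    (hcl : ∃ᶠ p' in 𝓝[{p | pev p A = c}] p, ∀ᶠ p'' in 𝓝[{p | pev p A = c}] p', pev p'' ρ = 0) :
    ∀ᶠ p' in 𝓝[{p | pev p A = c}] p, pev p' ρ = 0 := by
  obtain ⟨g, k, hk⟩ := Prim.exists_local (ρ := ρ) hp (h p)
  have hm := map_pev_nhdsWithin hp (h p)
  have h1 : ∀ᶠ q in 𝓝 (pev p B), DifferentiableAt ℂ k q := by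
    rw [← hm, eventually_map]
    exact hk.mono fun p' h => h.2.differentiableAt
  have han : AnalyticAt ℂ (deriv k) (pev p B) :=
    (Complex.analyticAt_iff_eventually_differentiableAt.2 h1).deriv
  rcases han.eventually_eq_zero_or_eventually_ne_zero with h2 | h2
  · rw [← hm, eventually_map] at h2
    filter_upwards [hk, h2] with p' h5 h6
    rw [← h5.2.deriv, h6]
  · exfalso
    have h3 : ∀ᶠ p' in 𝓝[{p | pev p A = c}] p, pev p' ρ = 0 → pev p' B = pev p B := by
      rw [eventually_nhdsWithin_iff, ← hm, eventually_map] at h2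
      filter_upwards [h2, hk] with p' h5 h6 h7
      by_contra h8
      exact h5 h8 (by rw [h6.2.deriv, h7])
    obtain ⟨p', h4, h5, h6⟩ := (hcl.and_eventually ((eventually_eventually_nhdsWithin.2 h3).and
      self_mem_nhdsWithin)).exists
    have h7 : ∀ᶠ q in 𝓝 (pev p' B), q = pev p B := by
      rw [← map_pev_nhdsWithin h6 (h p'), eventually_map]
      filter_upwards [h4, h5] with p'' h8 h9 using h9 h8
    have h8 := h7.self_of_nhds
    rw [← h8] at h7
    obtain ⟨q, h9, h10⟩ := ((h7.filter_mono nhdsWithin_le_nhds).and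
      (self_mem_nhdsWithin (s := {pev p' B}ᶜ))).exists
    exact h10 h9

end KellerRational

namespace KellerRational

/-! ### Primitives vanishing at infinity on a half plane -/

open Topology MeasureTheory

theorem re_halfplane_open (a : ℝ) : IsOpen {w : ℂ | a < w.re} :=
  isOpen_lt continuous_const Complex.continuous_re

section Tail
variable {F : ℂ → ℂ} {a C δ : ℝ}

theorem integrableOn_exp_bound (hδ : 0 < δ) (K b : ℝ) :
    IntegrableOn (fun t : ℝ => K * Real.exp (-δ * (b + t))) (Set.Ioi 0) := by
  have h := (exp_neg_integrableOn_Ioi 0 hδ).const_mul (K * Real.exp (-δ * b))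
  refine h.congr (Filter.Eventually.of_forall fun t => ?_)
  show K * Real.exp (-δ * b) * Real.exp (-δ * t) = _
  rw [mul_assoc, ← Real.exp_add]
  ring_nf

theorem tail_continuousOn (hF : DifferentiableOn ℂ F {w | a < w.re}) {w : ℂ} (hw : a < w.re) :
    ContinuousOn (fun t : ℝ => F (w + t)) (Set.Ioi 0) := by
  refine hF.continuousOn.comp (by fun_prop) fun t ht => ?_
  have : (0 : ℝ) < t := ht
  simp only [Set.mem_ofPred_eq, Complex.add_re, Complex.ofReal_re]
  linarith

theorem tail_integrable (hδ : 0 < δ) (hF : DifferentiableOn ℂ F {w | a < w.re})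
    (hb : ∀ w : ℂ, a < w.re → ‖F w‖ ≤ C * Real.exp (-δ * w.re)) {w : ℂ} (hw : a < w.re) :
    IntegrableOn (fun t : ℝ => F (w + t)) (Set.Ioi 0) := by
  refine (integrableOn_exp_bound hδ C w.re).mono'
    ((tail_continuousOn hF hw).aestronglyMeasurable measurableSet_Ioi) ?_
  refine (ae_restrict_iff' measurableSet_Ioi).2 (Filter.Eventually.of_forall fun t ht => ?_)
  have h0 : (0 : ℝ) < t := ht
  have := hb (w + t) (by simp; linarith)
  simpa using this

theorem norm_tail_le (hδ : 0 < δ)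
    (hb : ∀ w : ℂ, a < w.re → ‖F w‖ ≤ C * Real.exp (-δ * w.re)) {w : ℂ} (hw : a < w.re) :
    ‖∫ t in Set.Ioi (0 : ℝ), F (w + t)‖ ≤ C / δ * Real.exp (-δ * w.re) := by
  have h1 : ‖∫ t in Set.Ioi (0 : ℝ), F (w + t)‖ ≤
      ∫ t in Set.Ioi (0 : ℝ), C * Real.exp (-δ * (w.re + t)) := by
    refine norm_integral_le_of_norm_le (integrableOn_exp_bound hδ C w.re) ?_
    refine (ae_restrict_iff' measurableSet_Ioi).2 (Filter.Eventually.of_forall fun t ht => ?_)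
    have h0 : (0 : ℝ) < t := ht
    have := hb (w + t) (by simp; linarith)
    simpa using this
  refine h1.trans (le_of_eq ?_)
  have h2 : (fun t : ℝ => C * Real.exp (-δ * (w.re + t))) =
      fun t => C * Real.exp (-δ * w.re) * Real.exp (-δ * t) := by
    funext t
    rw [mul_assoc, ← Real.exp_add]; ring_nf
  rw [h2, integral_const_mul, integral_exp_mul_Ioi (by linarith)]
  simp
  field_simp

theorem hasDerivAt_tail (hδ : 0 < δ) (hF : DifferentiableOn ℂ F {w | a < w.re})
    (hb : ∀ w : ℂ, a < w.re → ‖F w‖ ≤ C * Real.exp (-δ * w.re)) {w : ℂ} (hw : a < w.re) :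
    HasDerivAt (fun w : ℂ => -∫ t in Set.Ioi (0 : ℝ), F (w + t)) (F w) w := by
  have hC : 0 ≤ C := by
    have h := (norm_nonneg _).trans (hb w hw)
    have := Real.exp_pos (-δ * w.re)
    exact nonneg_of_mul_nonneg_left h this
  obtain ⟨ε, hε, hεa⟩ : ∃ ε : ℝ, 0 < ε ∧ a < w.re - 2 * ε :=
    ⟨(w.re - a) / 4, by linarith, by linarith⟩
  have hd : ∀ z : ℂ, a < z.re → HasDerivAt F (deriv F z) z := fun z hz =>
    ((hF z hz).differentiableAt ((re_halfplane_open a).mem_nhds hz)).hasDerivAt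
  have hre : ∀ x ∈ Metric.ball w ε, w.re - ε < x.re := fun x hx => by
    have h1 : |(x - w).re| < ε := (Complex.abs_re_le_norm _).trans_lt (by
      rwa [Metric.mem_ball, dist_eq_norm] at hx)
    rw [Complex.sub_re] at h1
    linarith [(abs_lt.1 h1).1]
  have hbd : ∀ t : ℝ, 0 < t → ∀ x ∈ Metric.ball w ε,
      ‖deriv F (x + t)‖ ≤ C / ε * Real.exp (-δ * (w.re - 2 * ε + t)) := fun t ht x hx => by
    have h1 := hre x hx
    have h2 : ∀ z ∈ Metric.closedBall (x + t) ε, w.re - 2 * ε + t < z.re := fun z hz => by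
      have h3 : |(z - (x + t)).re| ≤ ε := (Complex.abs_re_le_norm _).trans (by
        rwa [Metric.mem_closedBall, dist_eq_norm] at hz)
      simp only [Complex.sub_re, Complex.add_re, Complex.ofReal_re] at h3
      linarith [(abs_le.1 h3).1]
    refine (Complex.norm_deriv_le_of_forall_mem_sphere_norm_le (R := ε)
      (C := C * Real.exp (-δ * (w.re - 2 * ε + t))) hε ?_ fun z hz => ?_).trans (le_of_eq ?_)
    · refine DifferentiableOn.diffContOnCl_ball (U := {w | a < w.re}) hF fun z hz => ?_
      have := h2 z hz
      show a < z.re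
      linarith
    · have h3 := h2 z (Metric.sphere_subset_closedBall hz)
      refine (hb z (by linarith)).trans (mul_le_mul_of_nonneg_left (Real.exp_le_exp.2 ?_) hC)
      nlinarith
    · ring
  have hcont : ContinuousOn (deriv F) {w | a < w.re} :=
    (hF.deriv (re_halfplane_open a)).continuousOn
  have hre' : ∀ x ∈ Metric.ball w ε, a < x.re := fun x hx => by linarith [hre x hx]
  have key := hasDerivAt_integral_of_dominated_loc_of_deriv_le
    (μ := volume.restrict (Set.Ioi (0 : ℝ))) (F := fun (x : ℂ) (t : ℝ) => F (x + t))
    (F' := fun (x : ℂ) (t : ℝ) => deriv F (x + t)) (x₀ := w)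
    (bound := fun t => C / ε * Real.exp (-δ * (w.re - 2 * ε + t))) (s := Metric.ball w ε)
    (Metric.ball_mem_nhds w hε)
    (by
      filter_upwards [Metric.ball_mem_nhds w hε] with x hx
      exact (tail_continuousOn hF (hre' x hx)).aestronglyMeasurable measurableSet_Ioi)
    (tail_integrable hδ hF hb hw)
    ((hcont.comp (by fun_prop) fun t ht => by
      have h0 : (0 : ℝ) < t := ht
      show a < (w + (t : ℂ)).re
      rw [Complex.add_re, Complex.ofReal_re]; linarith).aestronglyMeasurable measurableSet_Ioi)
    ((ae_restrict_iff' measurableSet_Ioi).2 (Filter.Eventually.of_forall fun t ht x hx =>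
      hbd t ht x hx))
    (integrableOn_exp_bound hδ _ _)
    ((ae_restrict_iff' measurableSet_Ioi).2 (Filter.Eventually.of_forall fun t ht x hx => by
      have h0 : (0 : ℝ) < t := ht
      exact (hd (x + t) (by
        rw [Complex.add_re, Complex.ofReal_re]; linarith [hre' x hx])).comp_add_const x (t : ℂ)))
  have h3 : ∫ t in Set.Ioi (0 : ℝ), deriv F (w + t) = 0 - F (w + (0 : ℝ)) := by
    refine integral_Ioi_of_hasDerivAt_of_tendsto' (f := fun t : ℝ => F (w + t))
      (fun t ht => ?_) key.1 ?_
    · have h0 : (0 : ℝ) ≤ t := ht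
      exact ((hd (w + t) (by
        rw [Complex.add_re, Complex.ofReal_re]; linarith)).comp_const_add w (t : ℂ)).comp_ofReal
    · refine squeeze_zero_norm' (a := fun t => C * Real.exp (-δ * (w.re + t))) ?_ ?_
      · filter_upwards [eventually_ge_atTop 0] with t ht
        have := hb (w + t) (by rw [Complex.add_re, Complex.ofReal_re]; linarith)
        simpa using this
      · rw [← mul_zero C]
        refine (Real.tendsto_exp_atBot.comp ?_).const_mul C
        exact (tendsto_atTop_add_const_left _ _ tendsto_id).const_mul_atTop_of_neg (by linarith)
  have h4 := key.2.neg
  rw [h3] at h4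
  rw [zero_sub, neg_neg, Complex.ofReal_zero, add_zero] at h4
  exact h4

end Tail

end KellerRational

namespace KellerRational

/-! ### Sections of a level curve over a half plane -/

open Topology

/-- A bound for the roots of a polynomial monic in the second variable. -/
noncomputable def rootBound (A : Bi) (x : ℂ) : ℝ :=
  1 + ∑ i ∈ Finset.range (yp A).natDegree, ‖((yp A).coeff i).eval x‖

theorem continuous_rootBound (A : Bi) : Continuous (rootBound A) := by
  unfold rootBound
  exact continuous_const.add (continuous_finsetSum _ fun i _ =>
    (Polynomial.continuous _).norm)

theorem pev_eq_sum {A : Bi} (hA : (yp A).Monic) (x y : ℂ) :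
    pev (x, y) A = y ^ (yp A).natDegree +
      ∑ i ∈ Finset.range (yp A).natDegree, ((yp A).coeff i).eval x * y ^ i := by
  have h := eval_spec x y A
  rw [pev_def]
  dsimp only
  rw [← h, Polynomial.eval_eq_sum_range, spec_natDegree hA, Finset.sum_range_succ, add_comm]
  have h1 : (spec x A).coeff (yp A).natDegree = 1 := by
    have := spec_monic hA x
    rw [Polynomial.Monic.def, Polynomial.leadingCoeff, spec_natDegree hA] at this
    exact this
  rw [h1, one_mul]
  simp [spec_eq]

theorem norm_le_rootBound {A : Bi} (hA : (yp A).Monic) {x y : ℂ} (h : pev (x, y) A = 0) :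
    ‖y‖ ≤ rootBound A x := by
  by_contra! hlt
  have hS : 0 ≤ ∑ i ∈ Finset.range (yp A).natDegree, ‖((yp A).coeff i).eval x‖ :=
    Finset.sum_nonneg fun _ _ => norm_nonneg _
  have h1 : 1 < ‖y‖ := by unfold rootBound at hlt; linarith
  rw [pev_eq_sum hA] at h
  rcases Nat.eq_zero_or_pos (yp A).natDegree with h0 | h0
  · simp [h0] at h
  have h2 : ‖y‖ ^ (yp A).natDegree ≤
      ∑ i ∈ Finset.range (yp A).natDegree, ‖((yp A).coeff i).eval x‖ *
        ‖y‖ ^ ((yp A).natDegree - 1) := by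
    rw [← norm_pow, eq_neg_of_add_eq_zero_left h, norm_neg]
    refine (norm_sum_le _ _).trans (Finset.sum_le_sum fun i hi => ?_)
    rw [norm_mul, norm_pow]
    have := Finset.mem_range.1 hi
    exact mul_le_mul_of_nonneg_left (pow_le_pow_right₀ h1.le (by omega)) (norm_nonneg _)
  have e : ‖y‖ ^ (yp A).natDegree = ‖y‖ * ‖y‖ ^ ((yp A).natDegree - 1) := by
    rw [← pow_succ', Nat.sub_add_cancel h0]
  rw [← Finset.sum_mul, e] at h2
  have h3 : 0 < ‖y‖ ^ ((yp A).natDegree - 1) := by positivity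
  have h4 := le_of_mul_le_mul_right h2 h3
  unfold rootBound at hlt
  linarith

theorem isCompact_curve {A : Bi} {c : ℂ} (hA : (yp (A - MvPolynomial.C c)).Monic) {K : Set ℂ}
    (hK : IsCompact K) : IsCompact {p : ℂ × ℂ | p.1 ∈ K ∧ pev p A = c} := by
  obtain ⟨M, hM⟩ := hK.exists_bound_of_continuousOn
    (continuous_rootBound (A - MvPolynomial.C c)).continuousOn
  refine IsCompact.of_isClosed_subset (hK.prod (isCompact_closedBall (0 : ℂ) M)) ?_ fun p hp => ?_
  · exact (hK.isClosed.preimage continuous_fst).inter (isClosed_singleton.preimage (continuous_pev A))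
  · refine ⟨hp.1, mem_closedBall_zero_iff.2 ?_⟩
    refine (norm_le_rootBound hA (x := p.1) (y := p.2) ?_).trans
      ((le_abs_self _).trans (hM _ hp.1))
    rw [map_sub, hp.2]; simp [pev_def]

/-- The level curve of `A` pulled back along the exponential map. -/
def expCurve (A : Bi) (c : ℂ) (a : ℝ) : Set (ℂ × ℂ) :=
  {q | a < q.1.re ∧ pev (Complex.exp q.1, q.2) A = c}

/-- The projection of the pulled back curve to the half plane. -/
def expProj (A : Bi) (c : ℂ) (a : ℝ) (q : expCurve A c a) : {w : ℂ | a < w.re} := ⟨q.1.1, q.2.1⟩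

theorem continuous_expProj (A : Bi) (c : ℂ) (a : ℝ) : Continuous (expProj A c a) :=
  Continuous.subtype_mk (continuous_fst.comp continuous_subtype_val) _

theorem continuous_pev_exp (A : Bi) :
    Continuous fun q : ℂ × ℂ => pev (Complex.exp q.1, q.2) A :=
  (continuous_pev A).comp (by fun_prop)

theorem exists_strict_equiv_exp {A : Bi} {q : ℂ × ℂ}
    (h : pev (Complex.exp q.1, q.2) (pderiv 1 A) ≠ 0) :
    ∃ e : (ℂ × ℂ) ≃L[ℂ] (ℂ × ℂ),
      HasStrictFDerivAt (fun q : ℂ × ℂ => (q.1, pev (Complex.exp q.1, q.2) A))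
        (e : (ℂ × ℂ) →L[ℂ] (ℂ × ℂ)) q := by
  set p : ℂ × ℂ := (Complex.exp q.1, q.2) with hp
  refine ⟨linEquiv 1 0 (pev p (pderiv 0 A) * Complex.exp q.1) (pev p (pderiv 1 A)) (by simpa using h),
    ?_⟩
  have h1 : HasStrictFDerivAt (fun q : ℂ × ℂ => (Complex.exp q.1, q.2))
      ((Complex.exp q.1 • ContinuousLinearMap.fst ℂ ℂ ℂ).prod (ContinuousLinearMap.snd ℂ ℂ ℂ)) q :=
    (HasStrictFDerivAt.cexp (hasStrictFDerivAt_fst (𝕜 := ℂ) (p := q))).prodMk hasStrictFDerivAt_snd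
  have h2 := (hasStrictFDerivAt_pev A p).comp q h1
  refine ((hasStrictFDerivAt_fst (𝕜 := ℂ) (p := q)).prodMk h2).congr_fderiv ?_
  ext <;> simp [linEquiv]

theorem map_expProj_nhds {A : Bi} {c : ℂ} {a : ℝ} (q : expCurve A c a)
    (h : pev (Complex.exp q.1.1, q.1.2) (pderiv 1 A) ≠ 0) :
    map (expProj A c a) (𝓝 q) = 𝓝 (expProj A c a q) := by
  obtain ⟨e, he⟩ := exists_strict_equiv_exp h
  have h1 := he.map_nhds_eq_of_equiv
  set Φ : ℂ × ℂ → ℂ × ℂ := fun q => (q.1, pev (Complex.exp q.1, q.2) A) with hΦ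
  have h2 : map Φ (𝓝[expCurve A c a] q.1) = 𝓝[{q | a < q.1.re ∧ q.2 = c}] (Φ q.1) := by
    generalize q.1 = q0 at h1
    have : expCurve A c a = Φ ⁻¹' {q | a < q.1.re ∧ q.2 = c} := rfl
    rw [nhdsWithin, nhdsWithin, this, Filter.map_inf_principal_preimage, h1]
  have h4 : {q : ℂ × ℂ | a < q.1.re ∧ q.2 = c} = {w | a < w.re} ×ˢ {c} := by ext; simp
  have h5 : Φ q.1 = (q.1.1, c) := Prod.ext rfl q.2.2
  have h6 : map (fun q : ℂ × ℂ => q.1) (𝓝[expCurve A c a] q.1) = 𝓝 q.1.1 := by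
    have h3 : (fun q : ℂ × ℂ => q.1) = Prod.fst ∘ Φ := rfl
    rw [h3, ← Filter.map_map, h2, h4, h5, nhdsWithin_prod_eq, nhdsWithin_singleton,
      Filter.map_fst_prod, (re_halfplane_open a).nhdsWithin_eq q.2.1]
  refine Filter.map_injective Subtype.val_injective ?_
  rw [map_nhds_subtype_val, Filter.map_map]
  have h7 : Subtype.val ∘ expProj A c a = (fun q : ℂ × ℂ => q.1) ∘ Subtype.val := rfl
  rw [h7, ← Filter.map_map, map_nhds_subtype_val, h6]
  exact ((re_halfplane_open a).nhdsWithin_eq q.2.1).symm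

theorem isLocalHomeomorph_expProj {A : Bi} {c : ℂ} {a : ℝ}
    (h : ∀ q ∈ expCurve A c a, pev (Complex.exp q.1, q.2) (pderiv 1 A) ≠ 0) :
    IsLocalHomeomorph (expProj A c a) := by
  have hopen : IsOpenMap (expProj A c a) :=
    isOpenMap_iff_nhds_le.2 fun q => (map_expProj_nhds q (h _ q.2)).ge
  rw [isLocalHomeomorph_iff_isOpenEmbedding_restrict]
  intro q
  obtain ⟨e, he⟩ := exists_strict_equiv_exp (h _ q.2)
  have h1 := he.eventually_left_inverse
  obtain ⟨U, hU, hUo, hqU⟩ := _root_.eventually_nhds_iff.1 h1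
  refine ⟨Subtype.val ⁻¹' U, (hUo.preimage continuous_subtype_val).mem_nhds hqU, ?_⟩
  refine .of_continuous_injective_isOpenMap
    ((continuous_expProj A c a).comp continuous_subtype_val) ?_ ?_
  · rintro ⟨⟨q1, h1⟩, hq1⟩ ⟨⟨q2, h2⟩, hq2⟩ h12
    have h12' : q1.1 = q2.1 := congrArg Subtype.val h12
    have e1 := hU q1 hq1
    have e2 := hU q2 hq2
    rw [h1.2] at e1
    rw [h2.2, ← h12', e1] at e2
    subst e2
    rfl
  · exact hopen.comp (hUo.preimage continuous_subtype_val).isOpenMap_subtype_val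

theorem isCoveringMap_expProj {A : Bi} {c : ℂ} {a : ℝ} (hA : (yp (A - MvPolynomial.C c)).Monic)
    (h : ∀ q ∈ expCurve A c a, pev (Complex.exp q.1, q.2) (pderiv 1 A) ≠ 0) :
    IsCoveringMap (expProj A c a) := by
  rw [isCoveringMap_iff_isCoveringMapOn_univ]
  refine IsClosedMap.isCoveringMapOn_of_isLocalHomeomorphOn ?_ ?_
    fun q _ => isLocalHomeomorph_expProj h q
  · have : LocallyCompactSpace {w : ℂ | a < w.re} := (re_halfplane_open a).locallyCompactSpace
    refine (isProperMap_iff_isCompact_preimage.2 ⟨continuous_expProj A c a, fun K hK => ?_⟩).isClosedMap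
    rw [Subtype.isCompact_iff]
    have hK' : IsCompact ((Subtype.val : {w : ℂ | a < w.re} → ℂ) '' K) := hK.image continuous_subtype_val
    obtain ⟨M, hM⟩ := hK'.exists_bound_of_continuousOn
      ((continuous_rootBound (A - MvPolynomial.C c)).comp Complex.continuous_exp).continuousOn
    refine IsCompact.of_isClosed_subset (hK'.prod (isCompact_closedBall (0 : ℂ) M)) ?_ ?_
    · have : Subtype.val '' (expProj A c a ⁻¹' K) =
          {q : ℂ × ℂ | q.1 ∈ (Subtype.val '' K : Set ℂ)} ∩
            {q | pev (Complex.exp q.1, q.2) A = c} := by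
        ext q
        constructor
        · rintro ⟨q, hq, rfl⟩
          exact ⟨⟨_, hq, rfl⟩, q.2.2⟩
        · rintro ⟨⟨w, hw, h1⟩, h2⟩
          have h3 : a < q.1.re := h1 ▸ w.2
          refine ⟨⟨q, h3, h2⟩, ?_, rfl⟩
          have : expProj A c a ⟨q, h3, h2⟩ = w := Subtype.ext h1.symm
          rwa [Set.mem_preimage, this]
      rw [this]
      exact (hK'.isClosed.preimage continuous_fst).inter
        (isClosed_singleton.preimage (continuous_pev_exp A))
    · rintro _ ⟨q, hq, rfl⟩
      have h1 : q.1.1 ∈ (Subtype.val '' K : Set ℂ) := ⟨_, hq, rfl⟩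
      refine ⟨h1, mem_closedBall_zero_iff.2 ?_⟩
      refine (norm_le_rootBound hA (x := Complex.exp q.1.1) (y := q.1.2) ?_).trans
        ((le_abs_self _).trans (hM _ h1))
      rw [map_sub, q.2.2]; simp [pev_def]
  · intro w _
    have hs : {y : ℂ | pev (Complex.exp w.1, y) (A - MvPolynomial.C c) = 0}.Finite := by
      refine ((spec (Complex.exp w.1) (A - MvPolynomial.C c)).roots.toFinset.finite_toSet).subset
        fun y hy => ?_
      have h0 := (spec_monic hA (Complex.exp w.1)).ne_zero
      have h1 : (spec (Complex.exp w.1) (A - MvPolynomial.C c)).eval y = 0 := by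
        rw [eval_spec]; exact hy
      exact Multiset.mem_toFinset.2 ((Polynomial.mem_roots h0).2 h1)
    refine Set.Finite.of_finite_image (f := fun q : expCurve A c a => q.1.2) (hs.subset ?_) ?_
    · rintro _ ⟨q, hq, rfl⟩
      have h1 : q.1.1 = w.1 := congrArg Subtype.val hq
      show pev (Complex.exp w.1, q.1.2) _ = 0
      rw [← h1, map_sub, q.2.2]; simp [pev_def]
    · intro q hq q' hq' h1
      have h2 : q.1.1 = w.1 := congrArg Subtype.val hq
      have h3 : q'.1.1 = w.1 := congrArg Subtype.val hq'
      exact Subtype.ext (Prod.ext (h2.trans h3.symm) h1)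

theorem exists_section {A : Bi} {c : ℂ} {a : ℝ} (hA : (yp (A - MvPolynomial.C c)).Monic)
    (h : ∀ q ∈ expCurve A c a, pev (Complex.exp q.1, q.2) (pderiv 1 A) ≠ 0)
    {q : ℂ × ℂ} (hq : q ∈ expCurve A c a) :
    ∃ s : ℂ → ℂ, s q.1 = q.2 ∧ ContinuousOn s {w | a < w.re} ∧
      ∀ w : ℂ, a < w.re → pev (Complex.exp w, s w) A = c := by
  classical
  have hconv : Convex ℝ {w : ℂ | a < w.re} := convex_halfSpace_re_gt a
  have : ContractibleSpace {w : ℂ | a < w.re} := hconv.contractibleSpace ⟨q.1, hq.1⟩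
  have : LocallyPathConnectedSpace {w : ℂ | a < w.re} :=
    (re_halfplane_open a).locallyPathConnectedSpace
  obtain ⟨S, ⟨h1, h2⟩, -⟩ := (isCoveringMap_expProj hA h).existsUnique_continuousMap_lifts
    (ContinuousMap.id {w : ℂ | a < w.re}) ⟨q.1, hq.1⟩ ⟨q, hq⟩ rfl
  have h3 : ∀ w : {w : ℂ | a < w.re}, (S w).1.1 = w.1 := fun w =>
    congrArg Subtype.val (congrFun h2 w)
  refine ⟨fun w => if hw : a < w.re then (S ⟨w, hw⟩).1.2 else 0, ?_, ?_, fun w hw => ?_⟩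
  · have : a < q.1.re := hq.1
    simp only [this, dif_pos]
    rw [h1]
  · rw [continuousOn_iff_continuous_domRestrict]
    have : Set.domRestrict {w : ℂ | a < w.re} (fun w => if hw : a < w.re then (S ⟨w, hw⟩).1.2 else 0) =
        fun w => (S w).1.2 := by
      funext w
      have hw : a < w.1.re := w.2
      simp [Set.domRestrict, hw]
    rw [this]
    exact continuous_snd.comp (continuous_subtype_val.comp S.continuous)
  · simp only [hw, dif_pos]
    have h4 := (S ⟨w, hw⟩).2.2
    rwa [h3] at h4

theorem section_unique {A : Bi} {c : ℂ} {a : ℝ} (hA : (yp (A - MvPolynomial.C c)).Monic)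
    (h : ∀ q ∈ expCurve A c a, pev (Complex.exp q.1, q.2) (pderiv 1 A) ≠ 0) {s s' : ℂ → ℂ}
    (hs : ContinuousOn s {w | a < w.re}) (hs' : ContinuousOn s' {w | a < w.re})
    (hsc : ∀ w : ℂ, a < w.re → pev (Complex.exp w, s w) A = c)
    (hsc' : ∀ w : ℂ, a < w.re → pev (Complex.exp w, s' w) A = c)
    {w₀ : ℂ} (hw₀ : a < w₀.re) (h0 : s w₀ = s' w₀) {w : ℂ} (hw : a < w.re) : s w = s' w := by
  have hconv : Convex ℝ {w : ℂ | a < w.re} := convex_halfSpace_re_gt a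
  have : PreconnectedSpace {w : ℂ | a < w.re} :=
    isPreconnected_iff_preconnectedSpace.1 hconv.isPreconnected
  have hg : ∀ {t : ℂ → ℂ} (ht : ContinuousOn t {w | a < w.re})
      (htc : ∀ w : ℂ, a < w.re → pev (Complex.exp w, t w) A = c),
      Continuous fun w : {w : ℂ | a < w.re} =>
        (⟨(w.1, t w.1), w.2, htc w.1 w.2⟩ : expCurve A c a) := fun ht _ =>
    (continuous_subtype_val.prodMk (continuousOn_iff_continuous_domRestrict.1 ht)).subtype_mk _
  have := (isCoveringMap_expProj hA h).eq_of_comp_eq (hg hs hsc) (hg hs' hsc') rfl ⟨w₀, hw₀⟩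
    (by simp only [h0])
  exact congrArg (fun q => q.1.2) (congrFun this ⟨w, hw⟩)

end KellerRational

namespace KellerRational

/-! ### The primitive near infinity -/

open Topology MeasureTheory

/-- The form `r dx / P_y` decays along the level curve `P = c` outside the disc of radius `R`. -/
structure Decay (P r : Bi) (c : ℂ) (R D δ : ℝ) : Prop where
  monic : (yp (P - MvPolynomial.C c)).Monic
  pos : 0 < R
  exp_pos : 0 < δ
  ne : ∀ p : ℂ × ℂ, pev p P = c → R < ‖p.1‖ → pev p (pderiv 1 P) ≠ 0
  le : ∀ p : ℂ × ℂ, pev p P = c → R < ‖p.1‖ →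
    ‖p.1 * pev p r / pev p (pderiv 1 P)‖ ≤ D * ‖p.1‖ ^ (-δ)

theorem JPair.exists_Decay {P Q : Bi} {κ : ℂ} (J : JPair P Q κ) {c : ℂ} {r : Bi}
    (hm : (yp (P - MvPolynomial.C c)).Monic)
    (hr : ∀ u ∈ Zr P c, Gt (ev u r / ev u (pderiv 1 P)) 1) :
    ∃ R D δ : ℝ, Decay P r c R D δ := by
  obtain ⟨C, R, hC, hR, h⟩ := J.exists_decay hr
  have hn : (0 : ℝ) < (yp P).natDegree := Nat.cast_pos.2 J.posP
  refine ⟨R, C ^ (((yp P).natDegree : ℝ)⁻¹), ((yp P).natDegree : ℝ)⁻¹, hm, hR, inv_pos.2 hn,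
    fun p hp hpR => (h p.1 p.2 hp hpR).1, fun p hp hpR => ?_⟩
  have h1 := (h p.1 p.2 hp hpR).2
  have hx : 0 < ‖p.1‖ := hR.trans hpR
  have h2 := Real.rpow_le_rpow (by positivity) h1 (inv_pos.2 hn).le
  rw [← Real.rpow_natCast, ← Real.rpow_mul (norm_nonneg _), mul_inv_cancel₀ hn.ne', Real.rpow_one,
    Real.div_rpow hC.le hx.le] at h2
  rw [Real.rpow_neg hx.le, ← div_eq_mul_inv]
  exact h2

/-- A continuous choice of points of the level curve over the logarithmic half plane. -/
structure IsSec (P : Bi) (c : ℂ) (R : ℝ) (s : ℂ → ℂ) : Prop where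
  cont : ContinuousOn s {w | Real.log R < w.re}
  eq : ∀ w : ℂ, Real.log R < w.re → pev (Complex.exp w, s w) P = c

/-- The form `r dx / P_y` along a section. -/
noncomputable def secForm (P r : Bi) (s : ℂ → ℂ) (w : ℂ) : ℂ :=
  Complex.exp w * pev (Complex.exp w, s w) r / pev (Complex.exp w, s w) (pderiv 1 P)

theorem log_lt_re_iff {R : ℝ} (hR : 0 < R) (w : ℂ) : Real.log R < w.re ↔ R < ‖Complex.exp w‖ := by
  rw [Complex.norm_exp, Real.log_lt_iff_lt_exp hR]

variable {P r : Bi} {c : ℂ} {R D δ : ℝ}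

namespace Decay

variable (H : Decay P r c R D δ)
include H

theorem ne_exp : ∀ q ∈ expCurve P c (Real.log R),
    pev (Complex.exp q.1, q.2) (pderiv 1 P) ≠ 0 := fun _ hq =>
  H.ne _ hq.2 ((log_lt_re_iff H.pos _).1 hq.1)

theorem exists_sec {w y : ℂ} (hw : Real.log R < w.re) (hp : pev (Complex.exp w, y) P = c) :
    ∃ s, IsSec P c R s ∧ s w = y := by
  obtain ⟨s, h1, h2, h3⟩ := exists_section H.monic H.ne_exp (q := (w, y)) ⟨hw, hp⟩
  exact ⟨s, ⟨h2, h3⟩, h1⟩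

theorem sec_ne {s : ℂ → ℂ} (hs : IsSec P c R s) {w : ℂ} (hw : Real.log R < w.re) :
    pev (Complex.exp w, s w) (pderiv 1 P) ≠ 0 :=
  H.ne_exp (w, s w) ⟨hw, hs.eq w hw⟩

theorem hasDerivAt_sec {s : ℂ → ℂ} (hs : IsSec P c R s) {w : ℂ} (hw : Real.log R < w.re) :
    HasDerivAt s (-(pev (Complex.exp w, s w) (pderiv 0 P) * Complex.exp w /
      pev (Complex.exp w, s w) (pderiv 1 P))) w := by
  have hne := H.sec_ne hs hw
  obtain ⟨e, he⟩ := exists_strict_equiv_exp (q := (w, s w)) hne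
  have hH : ∀ᶠ w' in 𝓝 w, Real.log R < w'.re := (re_halfplane_open _).mem_nhds hw
  have hc : ContinuousAt s w := hs.cont.continuousAt hH
  have h1 := he.eventually_left_inverse
  have h2 : ∀ᶠ w' in 𝓝 w, s w' = (he.localInverse _ _ _ (w', c)).2 := by
    filter_upwards [(continuousAt_id.prodMk hc).eventually h1, hH] with w' h3 h4
    rw [id, hs.eq w' h4] at h3
    rw [h3]
  have h3 : DifferentiableAt ℂ s w := by
    have h4 := he.to_localInverse.hasFDerivAt.differentiableAt
    dsimp only at h4
    rw [hs.eq w hw] at h4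
    have h5 : DifferentiableAt ℂ (fun w' : ℂ => (w', c)) w := by fun_prop
    have h6 : DifferentiableAt ℂ (fun w' : ℂ => (he.localInverse _ _ _ (w', c)).2) w :=
      (DifferentiableAt.comp (𝕜 := ℂ) w h4 h5).snd
    exact h6.congr_of_eventuallyEq h2
  have h4 := h3.hasDerivAt
  have h5 := ((hasStrictFDerivAt_pev P (Complex.exp w, s w)).hasFDerivAt.comp_hasDerivAt w
    ((Complex.hasDerivAt_exp w).prodMk h4))
  have h6 : HasDerivAt ((fun p : ℂ × ℂ => pev p P) ∘ fun w => (Complex.exp w, s w)) 0 w := by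
    refine (hasDerivAt_const w c).congr_of_eventuallyEq ?_
    filter_upwards [hH] with w' h7 using hs.eq w' h7
  have h7 := h5.unique h6
  have h8 : pev (Complex.exp w, s w) (pderiv 0 P) * Complex.exp w +
      pev (Complex.exp w, s w) (pderiv 1 P) * deriv s w = 0 := by simpa using h7
  have h9 : -(pev (Complex.exp w, s w) (pderiv 0 P) * Complex.exp w /
      pev (Complex.exp w, s w) (pderiv 1 P)) = deriv s w := by
    field_simp
    linear_combination -h8
  rw [h9]
  exact h4

theorem hasDerivAt_pev_sec (f : Bi) {s : ℂ → ℂ} (hs : IsSec P c R s) {w : ℂ}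
    (hw : Real.log R < w.re) :
    HasDerivAt (fun w => pev (Complex.exp w, s w) f)
      (pev (Complex.exp w, s w) (pderiv 0 f * pderiv 1 P - pderiv 1 f * pderiv 0 P) *
        Complex.exp w / pev (Complex.exp w, s w) (pderiv 1 P)) w := by
  have h5 := ((hasStrictFDerivAt_pev f (Complex.exp w, s w)).hasFDerivAt.comp_hasDerivAt w
    ((Complex.hasDerivAt_exp w).prodMk (H.hasDerivAt_sec hs hw)))
  have hne := H.sec_ne hs hw
  refine h5.congr_deriv ?_
  simp
  field_simp
  ring

theorem differentiableOn_secForm {s : ℂ → ℂ} (hs : IsSec P c R s) :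
    DifferentiableOn ℂ (secForm P r s) {w | Real.log R < w.re} := by
  intro w hw
  refine DifferentiableAt.differentiableWithinAt ?_
  exact ((Complex.differentiableAt_exp).mul (H.hasDerivAt_pev_sec r hs hw).differentiableAt).div
    (H.hasDerivAt_pev_sec _ hs hw).differentiableAt (H.sec_ne hs hw)

theorem norm_secForm_le {s : ℂ → ℂ} (hs : IsSec P c R s) (w : ℂ) (hw : Real.log R < w.re) :
    ‖secForm P r s w‖ ≤ D * Real.exp (-δ * w.re) := by
  have h := H.le (Complex.exp w, s w) (hs.eq w hw) ((log_lt_re_iff H.pos _).1 hw)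
  dsimp only at h
  rw [Complex.norm_exp, ← Real.exp_mul, mul_comm w.re] at h
  exact h

theorem exists_primitive :
    ∃ g : ℂ × ℂ → ℂ, ∀ s, IsSec P c R s → ∀ w : ℂ, Real.log R < w.re →
      g (Complex.exp w, s w) = -∫ t in Set.Ioi (0 : ℝ), secForm P r s (w + t) := by
  classical
  have h : ∀ p : ℂ × ℂ, ∃ s, pev p P = c → R < ‖p.1‖ → IsSec P c R s ∧ s (Complex.log p.1) = p.2 := by
    intro p
    by_cases h1 : pev p P = c ∧ R < ‖p.1‖
    · have h2 : p.1 ≠ 0 := norm_pos_iff.1 (H.pos.trans h1.2)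
      have h3 := Complex.exp_log h2
      obtain ⟨s, h4⟩ := H.exists_sec (w := Complex.log p.1) (y := p.2)
        ((log_lt_re_iff H.pos _).2 (h3.symm ▸ h1.2)) (by rw [h3]; exact h1.1)
      exact ⟨s, fun _ _ => h4⟩
    · exact ⟨0, fun h2 h3 => absurd ⟨h2, h3⟩ h1⟩
  choose S hS using h
  refine ⟨fun p => -∫ t in Set.Ioi (0 : ℝ), secForm P r (S p) (Complex.log p.1 + t),
    fun s hs w hw => ?_⟩
  obtain ⟨h1, h2⟩ := hS (Complex.exp w, s w) (hs.eq w hw) ((log_lt_re_iff H.pos _).1 hw)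
  dsimp only at h2 ⊢
  generalize S (Complex.exp w, s w) = s' at h1 h2 ⊢
  set w' := Complex.log (Complex.exp w) with hw'
  have hexp : Complex.exp w' = Complex.exp w := Complex.exp_log (Complex.exp_ne_zero w)
  have hexp1 : Complex.exp (w' - w) = 1 := by
    rw [Complex.exp_sub, hexp, div_self (Complex.exp_ne_zero w)]
  have hre : (w' - w).re = 0 := by
    have := congrArg norm hexp1
    rwa [Complex.norm_exp, norm_one, Real.exp_eq_one_iff] at this
  have hre' : ∀ v : ℂ, (v + (w' - w)).re = v.re := fun v => by rw [Complex.add_re, hre, add_zero]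
  have he : ∀ v : ℂ, Complex.exp (v + (w' - w)) = Complex.exp v := fun v => by
    rw [Complex.exp_add, hexp1, mul_one]
  have hu : ∀ v : ℂ, Real.log R < v.re → s' (v + (w' - w)) = s v := by
    intro v hv
    refine section_unique (s := fun v => s' (v + (w' - w))) H.monic H.ne_exp
      (h1.cont.comp (by fun_prop) fun v hv => ?_) hs.cont
      (fun v hv => ?_) hs.eq (w₀ := w) hw ?_ hv
    · show Real.log R < (v + (w' - w)).re
      rw [hre']; exact hv
    · rw [← he]; exact h1.eq _ (by rw [hre']; exact hv)
    · rw [add_sub_cancel, h2]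
  congr 1
  refine setIntegral_congr_fun measurableSet_Ioi fun t ht => ?_
  have ht0 : (0 : ℝ) < t := ht
  have hwt : Real.log R < (w + t).re := by
    rw [Complex.add_re, Complex.ofReal_re]; linarith
  have e1 : w' + (t : ℂ) = (w + t) + (w' - w) := by ring
  rw [e1, secForm, he, hu _ hwt, secForm]

/-- Nearby points of the level curve lie on the section. -/
theorem eventually_eq_sec {s : ℂ → ℂ} (hs : IsSec P c R s) {w : ℂ} (hw : Real.log R < w.re) :
    𝓝[{p | pev p P = c}] (Complex.exp w, s w) ≤ map (fun w => (Complex.exp w, s w)) (𝓝 w) := by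
  set p : ℂ × ℂ := (Complex.exp w, s w) with hp
  have hne : pev p (pderiv 1 P) ≠ 0 := H.sec_ne hs hw
  obtain ⟨U, hU, hinj⟩ := eventually_injOn (A := P) (B := X 0) (p := p) (by simpa using hne)
  have hH : ∀ᶠ w' in 𝓝 w, Real.log R < w'.re := (re_halfplane_open _).mem_nhds hw
  have hc : ContinuousAt (fun w => (Complex.exp w, s w)) w :=
    Complex.continuous_exp.continuousAt.prodMk (hs.cont.continuousAt hH)
  set ψ : ℂ × ℂ → ℂ := fun p' => w + Complex.log (p'.1 / Complex.exp w) with hψ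
  have h1 : ContinuousAt ψ p := by
    refine continuousAt_const.add (ContinuousAt.clog (by fun_prop) ?_)
    rw [hp]; simp [Complex.exp_ne_zero]
  have h2 : ψ p = w := by simp [hψ, hp, Complex.exp_ne_zero]
  have h3 : Tendsto ψ (𝓝 p) (𝓝 w) := by
    have := h1.tendsto; rwa [h2] at this
  have h0 : ∀ᶠ p' : ℂ × ℂ in 𝓝 p, p'.1 ≠ 0 :=
    (continuous_fst.continuousAt (x := p)).eventually_ne (Complex.exp_ne_zero w)
  have h4 : ∀ᶠ p' in 𝓝[{p | pev p P = c}] p, (Complex.exp (ψ p'), s (ψ p')) = p' := by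
    filter_upwards [mem_nhdsWithin_of_mem_nhds hU, self_mem_nhdsWithin,
      nhdsWithin_le_nhds (h3.eventually (hc.eventually (show ∀ᶠ z in 𝓝 p, z ∈ U from hU))),
      nhdsWithin_le_nhds (h3.eventually hH), nhdsWithin_le_nhds h0] with p' a1 a2 a3 a4 a5
    have a6 : Complex.exp (ψ p') = p'.1 := by
      simp only [hψ]
      rw [Complex.exp_add, Complex.exp_log (div_ne_zero a5 (Complex.exp_ne_zero w)),
        mul_div_cancel₀ _ (Complex.exp_ne_zero w)]
    refine hinj a3 a1 (Prod.ext ?_ ?_)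
    · simp only [pmap]
      rw [hs.eq _ a4]; exact a2.symm
    · simp only [pmap, pev_X0]
      exact a6
  intro T hT
  have h5 := nhdsWithin_le_nhds (s := {p | pev p P = c}) (h3.eventually (mem_map.1 hT))
  filter_upwards [h4, h5] with p' a1 a2
  have : (Complex.exp (ψ p'), s (ψ p')) ∈ T := a2
  rwa [a1] at this

omit H in
theorem tendsto_sec {s : ℂ → ℂ} (hs : IsSec P c R s) {w : ℂ} (hw : Real.log R < w.re) :
    Tendsto (fun w => (Complex.exp w, s w)) (𝓝 w) (𝓝[{p | pev p P = c}] (Complex.exp w, s w)) := by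
  have hH : ∀ᶠ w' in 𝓝 w, Real.log R < w'.re := (re_halfplane_open _).mem_nhds hw
  refine tendsto_nhdsWithin_iff.2 ⟨Complex.continuous_exp.continuousAt.prodMk
    (hs.cont.continuousAt hH), ?_⟩
  filter_upwards [hH] with w' h7 using hs.eq w' h7

theorem exists_prim_infty {Q : Bi} {κ : ℂ} (J : JPair P Q κ) :
    ∃ g : ℂ × ℂ → ℂ, (∀ p, pev p P = c → R < ‖p.1‖ →
      Prim P Q (MvPolynomial.C (-κ⁻¹) * r) c g p) ∧
      ∀ p, pev p P = c → R < ‖p.1‖ → ‖g p‖ ≤ D / δ * ‖p.1‖ ^ (-δ) := by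
  obtain ⟨g, hg⟩ := H.exists_primitive
  have hsec : ∀ p : ℂ × ℂ, pev p P = c → R < ‖p.1‖ → ∃ s w, IsSec P c R s ∧ Real.log R < w.re ∧
      p = (Complex.exp w, s w) := by
    intro p hp hR
    have h3 := Complex.exp_log (norm_pos_iff.1 (H.pos.trans hR))
    have h1 : Real.log R < (Complex.log p.1).re := (log_lt_re_iff H.pos _).2 (h3.symm ▸ hR)
    obtain ⟨s, h4, h5⟩ := H.exists_sec h1 (y := p.2) (by rw [h3]; exact hp)
    exact ⟨s, _, h4, h1, by rw [h3, h5]⟩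
  refine ⟨g, fun p hp hR => ?_, fun p hp hR => ?_⟩
  · obtain ⟨s, w, hs, hw, rfl⟩ := hsec p hp hR
    have hjac : ∀ p, pev p (pderiv 0 P) * pev p (pderiv 1 Q) -
        pev p (pderiv 1 P) * pev p (pderiv 0 Q) = κ := fun p => by
      have := congrArg (pev p) J.jac
      simpa [pev_def] using this
    obtain ⟨g₀, h₀, hg₀⟩ := Prim.exists_local (ρ := MvPolynomial.C (-κ⁻¹) * r) hp
      (by rw [hjac]; exact J.kappa_ne)
    have hH : ∀ᶠ w' in 𝓝 w, Real.log R < w'.re := (re_halfplane_open _).mem_nhds hw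
    have h1 : ∀ᶠ w' in 𝓝 w, HasDerivAt
        (fun w => h₀ (pev (Complex.exp w, s w) Q) + ∫ t in Set.Ioi (0 : ℝ), secForm P r s (w + t))
        0 w' := by
      filter_upwards [(tendsto_sec hs hw).eventually hg₀, hH] with w' h1 h2
      have h3 := h1.2.comp w' (H.hasDerivAt_pev_sec Q hs h2)
      have h4 := hasDerivAt_tail H.exp_pos (H.differentiableOn_secForm hs)
        (H.norm_secForm_le hs) h2
      have h5 := h3.sub h4
      refine (h5.congr_deriv ?_).congr_of_eventuallyEq (Eventually.of_forall fun v => ?_)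
      · have hne := H.sec_ne hs h2
        have e1 := hjac (Complex.exp w', s w')
        have hκ := J.kappa_ne
        have e2 : pev (Complex.exp w', s w') (pderiv 0 Q * pderiv 1 P - pderiv 1 Q * pderiv 0 P) =
            -κ := by
          rw [map_sub, map_mul, map_mul]; linear_combination -e1
        have e3 : ∀ z : ℂ, pev (Complex.exp w', s w') (MvPolynomial.C z) = z := fun z => by
          simp [pev_def]
        rw [e2, map_mul, e3, secForm]
        field_simp
        ring
      · simp
    obtain ⟨ε, hε, hball⟩ := Metric.eventually_nhds_iff_ball.1 h1
    set I := fun w => h₀ (pev (Complex.exp w, s w) Q) +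
      ∫ t in Set.Ioi (0 : ℝ), secForm P r s (w + t) with hI
    have h2 : ∀ᶠ w' in 𝓝 w, I w' = I w := by
      filter_upwards [Metric.ball_mem_nhds w hε] with w' hw'
      exact (convex_ball w ε).is_const_of_fderivWithin_eq_zero (𝕜 := ℂ)
        (fun v hv => (hball v hv).differentiableAt.differentiableWithinAt)
        (fun v hv => by
          rw [fderivWithin_of_isOpen Metric.isOpen_ball hv]
          ext; simp [(hball v hv).deriv]) hw' (Metric.mem_ball_self hε)
    refine ⟨fun z => h₀ z - I w, ?_⟩
    have h3 : ∀ᶠ p' in 𝓝[{p | pev p P = c}] (Complex.exp w, s w), g p' = h₀ (pev p' Q) - I w := by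
      refine H.eventually_eq_sec hs hw ?_
      rw [mem_map]
      filter_upwards [h2, hH] with w' h2 h4
      show g (Complex.exp w', s w') = h₀ (pev (Complex.exp w', s w') Q) - I w
      rw [hg s hs w' h4, ← h2]
      simp only [hI]
      ring
    filter_upwards [h3, hg₀] with p' a1 a2
    exact ⟨a1, a2.2.sub_const _⟩
  · obtain ⟨s, w, hs, hw, rfl⟩ := hsec p hp hR
    rw [hg s hs w hw, norm_neg]
    dsimp only
    rw [Complex.norm_exp, ← Real.exp_mul, mul_comm w.re]
    exact norm_tail_le H.exp_pos (H.norm_secForm_le hs) hw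

end Decay

end KellerRational

namespace KellerRational

/-! ### Exact forms on a rational level curve -/

open Topology

theorem eq_zero_of_vanishing {A r : Bi} {R : ℝ} (hA : (yp A).Monic)
    (hdeg : (yp r).natDegree < (yp A).natDegree)
    (hne : ∀ p : ℂ × ℂ, pev p A = 0 → R < ‖p.1‖ → pev p (pderiv 1 A) ≠ 0)
    (h : ∀ p : ℂ × ℂ, pev p A = 0 → R < ‖p.1‖ → pev p r = 0) : r = 0 := by
  classical
  have key : ∀ x : ℂ, R < ‖x‖ → spec x r = 0 := by
    intro x hx
    by_contra h0
    have hm := spec_monic hA x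
    have hnod : (spec x A).roots.Nodup := by
      refine Multiset.nodup_iff_count_le_one.2 fun y => ?_
      rw [Polynomial.count_roots]
      by_contra! hlt
      obtain ⟨h1, h2⟩ := (Polynomial.one_lt_rootMultiplicity_iff_isRoot hm.ne_zero).1 hlt
      have h3 : Polynomial.derivative (spec x A) = spec x (pderiv 1 A) := by
        rw [spec_eq, spec_eq, Polynomial.derivative_map, derivative_yp]
      rw [h3] at h2
      refine hne (x, y) ?_ hx ?_
      · exact (eval_spec x y A).symm.trans h1
      · exact (eval_spec x y _).symm.trans h2
    have hsub : (spec x A).roots ≤ (spec x r).roots := by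
      refine (Multiset.le_iff_subset hnod).2 fun y hy => ?_
      rw [Polynomial.mem_roots h0]
      refine (eval_spec x y r).trans (h (x, y) ?_ hx)
      exact (eval_spec x y A).symm.trans ((Polynomial.mem_roots hm.ne_zero).1 hy)
    have h1 := Multiset.card_le_card hsub
    rw [← (IsAlgClosed.splits (spec x A)).natDegree_eq_card_roots, spec_natDegree hA] at h1
    have h2 := Polynomial.card_roots' (spec x r)
    have h3 : (spec x r).natDegree ≤ (yp r).natDegree := Polynomial.natDegree_map_le
    omega
  apply yp_injective
  rw [map_zero]
  ext1 i
  rw [Polynomial.coeff_zero]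
  refine Polynomial.eq_zero_of_infinite_isRoot _ (Set.Infinite.mono (s := {x : ℂ | R < ‖x‖}) ?_ ?_)
  · intro x hx
    have h1 := congrArg (fun f => Polynomial.coeff f i) (key x hx)
    simpa [spec_eq, Polynomial.coeff_map] using h1
  · refine Set.Infinite.mono (s := Set.range fun n : ℕ => ((⌈|R|⌉₊ + 1 + n : ℕ) : ℂ)) ?_
      (Set.infinite_range_of_injective fun a b hab => ?_)
    · rintro _ ⟨n, rfl⟩
      show R < ‖_‖
      rw [Complex.norm_natCast]
      push_cast
      have := Nat.le_ceil |R|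
      have := le_abs_self R
      have : (0 : ℝ) ≤ n := n.cast_nonneg
      linarith
    · have := Nat.cast_injective (R := ℂ) hab
      omega

/-- A parametrisation of the level curve by a punctured plane. -/
structure Unif (P : Bi) (c : ℂ) (T : Finset ℂ) (σ : ℂ → ℂ × ℂ) : Prop where
  mem : ∀ z ∉ T, pev (σ z) P = c
  surj : ∀ p, pev p P = c → ∃ z ∉ T, σ z = p
  map_nhds : ∀ z ∉ T, map σ (𝓝 z) = 𝓝[{p | pev p P = c}] (σ z)
  compact : ∀ K : Set (ℂ × ℂ), IsCompact K → K ⊆ {p | pev p P = c} →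
    IsCompact {z | z ∉ T ∧ σ z ∈ K}

theorem exists_unif {P : Bi} {c : ℂ} {T : Finset ℂ}
    (φ : {p : ℂ × ℂ // pev p P = c} ≃ₜ {z : ℂ // z ∉ T}) : ∃ σ, Unif P c T σ := by
  classical
  set σ : ℂ → ℂ × ℂ := fun z => if h : z ∉ T then (φ.symm ⟨z, h⟩).1 else 0 with hσ
  have h1 : ∀ z : {z : ℂ // z ∉ T}, σ z.1 = (φ.symm z).1 := fun z => by
    have := z.2
    simp only [hσ, this, not_false_eq_true, dif_pos]
  have hopen : IsOpen {z : ℂ | z ∉ T} := T.finite_toSet.isClosed.isOpen_compl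
  refine ⟨σ, fun z hz => ?_, fun p hp => ?_, fun z hz => ?_, fun K hK hKL => ?_⟩
  · rw [h1 ⟨z, hz⟩]; exact (φ.symm _).2
  · refine ⟨(φ ⟨p, hp⟩).1, (φ ⟨p, hp⟩).2, ?_⟩
    rw [h1, φ.symm_apply_apply]
  · have h2 : map (Subtype.val : {z : ℂ // z ∉ T} → ℂ) (𝓝 ⟨z, hz⟩) = 𝓝 z :=
      hopen.isOpenEmbedding_subtypeVal.map_nhds_eq ⟨z, hz⟩
    have h3 : σ ∘ (Subtype.val : {z : ℂ // z ∉ T} → ℂ) = Subtype.val ∘ φ.symm := funext h1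
    rw [← h2, Filter.map_map, h3, ← Filter.map_map, φ.symm.map_nhds_eq, h1 ⟨z, hz⟩]
    exact map_nhds_subtype_val (s := {p : ℂ × ℂ | pev p P = c}) _
  · have h2 : IsCompact ((Subtype.val : {p : ℂ × ℂ // pev p P = c} → ℂ × ℂ) ⁻¹' K) := by
      refine Topology.IsEmbedding.subtypeVal.isInducing.isCompact_preimage' hK ?_
      rintro p hp
      exact ⟨⟨p, hKL hp⟩, rfl⟩
    have h3 := (h2.image φ.continuous).image continuous_subtype_val
    have h4 : {z | z ∉ T ∧ σ z ∈ K} = Subtype.val '' (φ '' (Subtype.val ⁻¹' K)) := by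
      ext z
      constructor
      · rintro ⟨hz, hzK⟩
        refine ⟨⟨z, hz⟩, ⟨φ.symm ⟨z, hz⟩, ?_, φ.apply_symm_apply _⟩, rfl⟩
        rw [Set.mem_preimage, ← h1]
        exact hzK
      · rintro ⟨_, ⟨p, hp, rfl⟩, rfl⟩
        refine ⟨(φ p).2, ?_⟩
        rw [h1, φ.symm_apply_apply]
        exact hp
    rw [h4]
    exact h3

section

variable {P Q r : Bi} {κ c : ℂ} {T : Finset ℂ} {σ : ℂ → ℂ × ℂ} {R D δ : ℝ}

theorem Unif.isOpen_compl (T : Finset ℂ) : IsOpen {z : ℂ | z ∉ T} :=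
  T.finite_toSet.isClosed.isOpen_compl

theorem Unif.compact_le (hσ : Unif P c T σ) (hP : (yp (P - MvPolynomial.C c)).Monic) (r : ℝ) :
    IsCompact {z | z ∉ T ∧ ‖(σ z).1‖ ≤ r} := by
  have h := hσ.compact _ (isCompact_curve hP (isCompact_closedBall (0 : ℂ) r)) fun p hp => hp.2
  convert h using 1
  ext z
  constructor
  · rintro ⟨h1, h2⟩
    exact ⟨h1, mem_closedBall_zero_iff.2 h2, hσ.mem z h1⟩
  · rintro ⟨h1, h2, -⟩
    exact ⟨h1, mem_closedBall_zero_iff.1 h2⟩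

theorem Unif.tendsto_puncture (hσ : Unif P c T σ) (hP : (yp (P - MvPolynomial.C c)).Monic)
    {t : ℂ} (ht : t ∈ T) : Tendsto (fun z => ‖(σ z).1‖) (𝓝[≠] t) atTop ∧ ∀ᶠ z in 𝓝[≠] t, z ∉ T := by
  have h1 : ∀ᶠ z in 𝓝[≠] t, z ∉ T := by
    have h2 : IsOpen {z : ℂ | z ∉ T.erase t} := Unif.isOpen_compl _
    filter_upwards [self_mem_nhdsWithin, nhdsWithin_le_nhds (h2.mem_nhds (T.notMem_erase t))]
      with z h3 h4 h5
    exact h4 (Finset.mem_erase.2 ⟨h3, h5⟩)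
  refine ⟨tendsto_atTop.2 fun r => ?_, h1⟩
  have h2 := (hσ.compact_le hP r).isClosed.isOpen_compl.mem_nhds
    (show t ∈ {z | z ∉ T ∧ ‖(σ z).1‖ ≤ r}ᶜ from fun h => h.1 ht)
  filter_upwards [h1, nhdsWithin_le_nhds h2] with z h3 h4
  by_contra! h5
  exact h4 ⟨h3, h5.le⟩

theorem Unif.tendsto_infty (hσ : Unif P c T σ) (hP : (yp (P - MvPolynomial.C c)).Monic) :
    Tendsto (fun z => ‖(σ z).1‖) (cocompact ℂ) atTop ∧ ∀ᶠ z in cocompact ℂ, z ∉ T := by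
  have h1 : ∀ᶠ z in cocompact ℂ, z ∉ T := T.finite_toSet.isCompact.compl_mem_cocompact
  refine ⟨tendsto_atTop.2 fun r => ?_, h1⟩
  filter_upwards [h1, (hσ.compact_le hP r).compl_mem_cocompact] with z h3 h4
  by_contra! h5
  exact h4 ⟨h3, h5.le⟩

theorem Decay.tendsto_zero {ι : Type*} {l : Filter ι} (H : Decay P r c R D δ) {g : ℂ × ℂ → ℂ}
    (hg : ∀ p, pev p P = c → R < ‖p.1‖ → ‖g p‖ ≤ D / δ * ‖p.1‖ ^ (-δ)) {f : ι → ℂ × ℂ}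
    (hf : Tendsto (fun i => ‖(f i).1‖) l atTop) (hc : ∀ᶠ i in l, pev (f i) P = c) :
    Tendsto (g ∘ f) l (𝓝 0) := by
  refine squeeze_zero_norm' (a := fun i => D / δ * ‖(f i).1‖ ^ (-δ)) ?_ ?_
  · filter_upwards [hc, hf.eventually_gt_atTop R] with i h1 h2 using hg _ h1 h2
  · have := ((tendsto_rpow_neg_atTop H.exp_pos).comp hf).const_mul (D / δ)
    simpa using this

/-- A primitive on the whole parametrising plane, extended by continuity over the punctures. -/
theorem exists_global_primitive (J : JPair P Q κ) (hσ : Unif P c T σ) (H : Decay P r c R D δ) :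
    ∃ G : ℂ → ℂ, ∃ v : ℂ, Continuous G ∧ Tendsto G (cocompact ℂ) (𝓝 v) ∧
      ∀ z ∉ T, ∃ g k, Prim P Q (MvPolynomial.C (-κ⁻¹) * r) c g (σ z) ∧
        ∀ᶠ z' in 𝓝 z, G z' = g (σ z') + k := by
  classical
  set ρ := MvPolynomial.C (-κ⁻¹) * r with hρ
  have hjac : ∀ p, pev p (pderiv 0 P) * pev p (pderiv 1 Q) -
      pev p (pderiv 1 P) * pev p (pderiv 0 Q) ≠ 0 := fun p => by
    have := congrArg (pev p) J.jac
    have h : pev p (pderiv 0 P) * pev p (pderiv 1 Q) -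
      pev p (pderiv 1 P) * pev p (pderiv 0 Q) = κ := by simpa [pev_def] using this
    rw [h]; exact J.kappa_ne
  obtain ⟨g, hg, hgb⟩ := H.exists_prim_infty J
  have hloc : ∀ x : ℂ, ∃ U : Set ℂ, ∃ g' : ℂ × ℂ → ℂ, IsOpen U ∧ x ∈ U ∧
      (∀ z ∈ U, z ∉ T → Prim P Q ρ c g' (σ z)) ∧ (∀ z ∈ U, z ∈ T → z = x) ∧ (x ∈ T → g' = g) := by
    intro x
    by_cases hx : x ∈ T
    · obtain ⟨h1, h2⟩ := hσ.tendsto_puncture H.monic hx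
      have h3 := h2.and (h1.eventually_gt_atTop R)
      rw [eventually_nhdsWithin_iff] at h3
      obtain ⟨U, hU, hUo, hxU⟩ := _root_.eventually_nhds_iff.1 h3
      refine ⟨U, g, hUo, hxU, fun z hz hzT => ?_, fun z hz hzT => ?_, fun _ => rfl⟩
      · have hne : z ≠ x := fun e => hzT (e ▸ hx)
        exact hg _ (hσ.mem z hzT) (hU z hz hne).2
      · by_contra hne
        exact (hU z hz hne).1 hzT
    · obtain ⟨g', hg'⟩ := Prim.exists_local (ρ := ρ) (hσ.mem x hx) (hjac _)
      have h1 := hg'.eventually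
      rw [← hσ.map_nhds x hx, eventually_map] at h1
      obtain ⟨U, hU, hUo, hxU⟩ := _root_.eventually_nhds_iff.1
        (h1.and ((Unif.isOpen_compl T).mem_nhds hx))
      exact ⟨U, g', hUo, hxU, fun z hz _ => (hU z hz).1, fun z hz hzT => absurd hzT (hU z hz).2,
        fun h => absurd h hx⟩
  choose U g' hUo hxU hprim hUT hgT using hloc
  have hsub : ∀ {z : ℂ}, z ∉ T → ∀ {g₁ g₂ : ℂ × ℂ → ℂ}, Prim P Q ρ c g₁ (σ z) →
      Prim P Q ρ c g₂ (σ z) → ∀ᶠ z' in 𝓝 z, z' ∉ T ∧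
        g₁ (σ z') - g₂ (σ z') = g₁ (σ z) - g₂ (σ z) := by
    intro z hz g₁ g₂ h1 h2
    have h3 := Prim.sub_eventually_const (hσ.mem z hz) (hjac _) h1 h2
    rw [← hσ.map_nhds z hz, eventually_map] at h3
    exact Filter.Eventually.and ((Unif.isOpen_compl T).mem_nhds hz) h3
  set γ : ℂ → ℂ → ℂ := fun x z => if z ∈ T then 0 else g' x (σ z) with hγ
  have hγ' : ∀ x z, z ∉ T → γ x z = g' x (σ z) := fun x z hz => if_neg hz
  obtain ⟨G, hG⟩ := exists_glue U hUo hxU γ (by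
    rintro x x' y ⟨hy, hy'⟩
    by_cases hyT : y ∈ T
    · rw [← hUT x y hy hyT, ← hUT x' y hy' hyT]
      exact Eventually.of_forall fun z => by simp
    · filter_upwards [hsub hyT (hprim x y hy hyT) (hprim x' y hy' hyT)] with z hz
      rw [hγ' _ _ hz.1, hγ' _ _ hz.1, hγ' _ _ hyT, hγ' _ _ hyT]
      exact hz.2)
  have hG1 : ∀ z, ∀ᶠ z' in 𝓝 z, G z' = γ z z' + (G z - γ z z) := fun z => by
    filter_upwards [hG z z (hxU z)] with z' h
    rw [← h]; ring
  have hG2 : ∀ z ∉ T, ∀ᶠ z' in 𝓝 z, G z' = g' z (σ z') + (G z - γ z z) := fun z hz => by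
    filter_upwards [hG1 z, (Unif.isOpen_compl T).mem_nhds hz] with z' h h'
    rw [h, hγ' _ _ h']
  have hcont : Continuous G := by
    refine continuous_iff_continuousAt.2 fun z => ?_
    have h1 : ContinuousAt (γ z) z := by
      by_cases hz : z ∈ T
      · rw [continuousAt_iff_punctured_nhds]
        obtain ⟨h1, h2⟩ := hσ.tendsto_puncture H.monic hz
        have h3 : Tendsto (g ∘ σ) (𝓝[≠] z) (𝓝 0) := H.tendsto_zero hgb h1 (by
          filter_upwards [h2] with z' h using hσ.mem z' h)
        have h4 : γ z z = 0 := if_pos hz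
        rw [h4]
        refine h3.congr' ?_
        filter_upwards [h2] with z' h
        rw [hγ' _ _ h, hgT z hz]
        rfl
      · have h1 := (hprim z z (hxU z) hz).continuousWithinAt (hσ.mem z hz)
        have h2 : Tendsto (fun z' => g' z (σ z')) (𝓝 z) (𝓝 (g' z (σ z))) := by
          refine h1.tendsto.comp ?_
          rw [← hσ.map_nhds z hz]
          exact tendsto_map
        rw [ContinuousAt, hγ' _ _ hz]
        refine h2.congr' ?_
        filter_upwards [(Unif.isOpen_compl T).mem_nhds hz] with z' h
        exact (hγ' _ _ h).symm
    exact (h1.add continuousAt_const).congr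
      ((hG1 z).mono fun z' h => h.symm)
  obtain ⟨h1, h2⟩ := hσ.tendsto_infty H.monic
  obtain ⟨R', hR'⟩ : ∃ R' : ℝ, ∀ z : ℂ, R' < ‖z‖ → z ∉ T ∧ R < ‖(σ z).1‖ := by
    have h3 := h2.and (h1.eventually_gt_atTop R)
    rw [← Metric.cobounded_eq_cocompact, ← comap_norm_atTop, eventually_comap] at h3
    obtain ⟨R', hR'⟩ := (h3.and (eventually_gt_atTop 0)).exists_forall_of_atTop
    exact ⟨R', fun z hz => (hR' _ hz.le).1 z rfl⟩
  have h3 : ∀ z ∈ {z : ℂ | max R' 1 < ‖z‖}, ∀ᶠ z' in 𝓝 z, G z' - g (σ z') = G z - g (σ z) := by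
    intro z hz
    obtain ⟨h4, h5⟩ := hR' z ((le_max_left _ _).trans_lt hz)
    filter_upwards [hG2 z h4, hsub h4 (hprim z z (hxU z) h4) (hg _ (hσ.mem z h4) h5)]
      with z' h6 h7
    rw [h6]
    rw [hγ' _ _ h4]
    linear_combination h7.2
  have h4 := isPreconnected_norm_gt (lt_max_of_lt_right one_pos : 0 < max R' 1)
  have h5 : ∀ᶠ z in cocompact ℂ, max R' 1 < ‖z‖ := by
    rw [← Metric.cobounded_eq_cocompact, ← comap_norm_atTop]
    exact (eventually_gt_atTop _).comap _
  obtain ⟨z₀, hz₀⟩ := h5.exists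
  refine ⟨G, G z₀ - g (σ z₀), hcont, ?_, fun z hz => ⟨g' z, _, hprim z z (hxU z) hz, hG2 z hz⟩⟩
  have h6 : Tendsto (g ∘ σ) (cocompact ℂ) (𝓝 0) := H.tendsto_zero hgb h1 (by
    filter_upwards [h2] with z' h using hσ.mem z' h)
  have h7 := h6.add_const (G z₀ - g (σ z₀))
  rw [zero_add] at h7
  refine h7.congr' ?_
  filter_upwards [h5] with z hz
  have := eq_of_locally_eq (f := fun z => G z - g (σ z)) h4 h3 hz hz₀
  simp only [Function.comp_apply]
  rw [← this]; ring

/-- A decaying form on a rational level curve vanishes. -/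
theorem Unif.eq_zero (J : JPair P Q κ) (hσ : Unif P c T σ) (H : Decay P r c R D δ)
    (hdeg : (yp r).natDegree < (yp P).natDegree) : r = 0 := by
  have hjac : ∀ p, pev p (pderiv 0 P) * pev p (pderiv 1 Q) -
      pev p (pderiv 1 P) * pev p (pderiv 0 Q) ≠ 0 := fun p => by
    have := congrArg (pev p) J.jac
    have h : pev p (pderiv 0 P) * pev p (pderiv 1 Q) -
      pev p (pderiv 1 P) * pev p (pderiv 0 Q) = κ := by simpa [pev_def] using this
    rw [h]; exact J.kappa_ne
  obtain ⟨G, v, hcont, hlim, hloc⟩ := exists_global_primitive J hσ H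
  set ρ := MvPolynomial.C (-κ⁻¹) * r with hρ
  by_cases hcase : ∀ z ∉ T, ¬ ∀ᶠ p in 𝓝[{p | pev p P = c}] (σ z), pev p ρ = 0
  · exfalso
    refine false_of_compact_open (K := insert v (Set.range G)) (U := G '' {z | z ∉ T})
      (F := insert v (G '' T)) (hlim.isCompact_insert_range_of_cocompact hcont) ?_ ?_
      ((T.finite_toSet.image G).insert v) ?_ ?_
    · rw [isOpen_iff_mem_nhds]
      rintro _ ⟨z, hz, rfl⟩
      obtain ⟨g, k, hg, hk⟩ := hloc z hz
      have h1 := (Prim.zero_or_open (hσ.mem z hz) (hjac _) hg).resolve_left (hcase z hz)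
      have h2 : 𝓝 (G z) ≤ map G (𝓝 z) := by
        have h3 : map G (𝓝 z) = map (fun w => w + k) (map g (map σ (𝓝 z))) := by
          rw [Filter.map_map, Filter.map_map]
          exact Filter.map_congr hk
        have h4 : 𝓝 (g (σ z) + k) = map (fun w => w + k) (𝓝 (g (σ z))) :=
          ((Homeomorph.addRight k).map_nhds_eq (g (σ z))).symm
        rw [h3, hk.self_of_nhds, h4, hσ.map_nhds z hz]
        exact Filter.map_mono h1
      exact h2 (Filter.image_mem_map ((Unif.isOpen_compl T).mem_nhds hz))
    · have : {z : ℂ | z ∉ T}.Nonempty := by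
        obtain ⟨z, hz⟩ := Infinite.exists_notMem_finset T
        exact ⟨z, hz⟩
      exact this.image G
    · exact (Set.image_subset_range _ _).trans (Set.subset_insert _ _)
    · rintro w (rfl | ⟨z, rfl⟩)
      · exact Or.inr (Set.mem_insert _ _)
      · by_cases hz : z ∈ T
        · exact Or.inr (Set.mem_insert_of_mem _ ⟨z, hz, rfl⟩)
        · exact Or.inl ⟨z, hz, rfl⟩
  · push Not at hcase
    obtain ⟨z₀, hz₀, h0⟩ := hcase
    have hconn : IsPreconnected {z : ℂ | z ∉ T} :=
      (T.countable_toSet.isConnected_compl_of_one_lt_rank (by simp)).isPreconnected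
    have hall : ∀ z ∉ T, ∀ᶠ p in 𝓝[{p | pev p P = c}] (σ z), pev p ρ = 0 := by
      intro z hz
      have := eq_of_locally_eq (f := fun z => ∀ᶠ p in 𝓝[{p | pev p P = c}] (σ z), pev p ρ = 0)
        hconn (fun z hz => ?_) hz hz₀
      · exact this.mpr h0
      · by_cases h1 : ∀ᶠ p in 𝓝[{p | pev p P = c}] (σ z), pev p ρ = 0
        · have h2 := eventually_eventually_nhdsWithin.2 h1
          rw [← hσ.map_nhds z hz, eventually_map] at h2
          filter_upwards [h2] with z' h3
          simp only [h1, h3]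
        · have h2 : ¬ ∃ᶠ p' in 𝓝[{p | pev p P = c}] (σ z),
              ∀ᶠ p'' in 𝓝[{p | pev p P = c}] p', pev p'' ρ = 0 := fun h =>
            h1 (zero_near_closed (hσ.mem z hz) hjac h)
          rw [not_frequently, ← hσ.map_nhds z hz, eventually_map] at h2
          filter_upwards [h2] with z' h3
          simp only [h1, h3]
    have hP := yp_sub_C_natDegree P c
    refine eq_zero_of_vanishing (A := P - MvPolynomial.C c) (R := R) H.monic (by rw [hP]; exact hdeg) ?_ ?_
    · intro p hp hR
      rw [map_sub, sub_eq_zero] at hp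
      rw [map_sub, pderiv_C, sub_zero]
      exact H.ne p (by rw [hp]; simp [pev_def]) hR
    · intro p hp _
      have hp' : pev p P = c := by
        rw [map_sub, sub_eq_zero] at hp
        rw [hp]; simp [pev_def]
      obtain ⟨z, hz, rfl⟩ := hσ.surj p hp'
      have h1 := (hall z hz).self_of_nhdsWithin hp'
      rw [hρ, map_mul] at h1
      refine (mul_eq_zero.1 h1).resolve_left ?_
      simpa [pev_def] using J.kappa_ne

end

end KellerRational

namespace KellerRational

/-! ### Irreducibility when the first polynomial is rational of larger degree -/

theorem finrank_star_eq_zero {P Q : Bi} {κ c : ℂ} (J : JPair P Q κ) {dl : HS → ℤ}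
    (Df : Diff (Zr P c) dl) {T : Finset ℂ} (φ : {p : ℂ × ℂ // pev p P = c} ≃ₜ {z : ℂ // z ∉ T}) :
    Module.finrank ℂ (LL (Zr P c) (star dl 0)) = 0 := by
  obtain ⟨σ, hσ⟩ := exists_unif φ
  have hz : LL (Zr P c) (star dl 0) = ⊥ := by
    refine (Submodule.eq_bot_iff _).2 fun f hf => ?_
    rw [mem_LL] at hf
    have hr : ∀ u ∈ Zr P c, Gt (ev u (py f) / ev u (pderiv 1 P)) 1 := by
      intro u hu
      obtain ⟨α, hα, hl⟩ := Df.lead u hu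
      have hν : (0 : ℝ) < nu u := by exact_mod_cast (J.cover c).stab.nu_pos hu
      have h1 := hf.2 u hu
      rw [J.pd_eq] at hl
      rw [← Ev_yp, yp_py]
      have h2 := (h1.lead.div hl hα).ge
      refine h2.gt ?_
      have e1 : ((star dl 0 u : ℤ) : ℝ) / nu u - dl u / nu u = 1 + 1 / nu u := by
        rw [star_apply]
        push_cast
        simp only [Pi.zero_apply, Int.cast_zero]
        field_simp
        ring
      rw [e1]
      have : 0 < 1 / (nu u : ℝ) := by positivity
      linarith
    obtain ⟨R, D, δ, H⟩ := J.exists_Decay (J.cover c).monic hr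
    have hdeg : (yp (py f)).natDegree < (yp P).natDegree := by
      rw [yp_py, ← J.card_Zr c]
      by_cases h0 : f = 0
      · rw [h0, Polynomial.natDegree_zero, J.card_Zr]; exact J.posP
      · exact (Polynomial.natDegree_lt_iff_degree_lt h0).2 hf.1
    have h3 := hσ.eq_zero J H hdeg
    rw [← yp_py f, h3, map_zero]
  rw [hz, finrank_bot]

/-- All but finitely many level curves are punctured planes. -/
def RatPoly (P : Bi) : Prop :=
  ∃ S : Finset ℂ, ∀ c ∉ S, ∃ T : Finset ℂ,
    Nonempty ({p : ℂ × ℂ // pev p P = c} ≃ₜ {z : ℂ // z ∉ T})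

theorem exists_countable_subfield (P Q : Bi) (κ : ℂ) :
    ∃ K : Subfield ℂ, Cardinal.mk K ≤ Cardinal.aleph0 ∧ P ∈ overf K ∧ Q ∈ overf K ∧ κ ∈ K := by
  classical
  set s : Finset ℂ := insert κ (P.support.image (fun i => P.coeff i) ∪
    Q.support.image fun i => Q.coeff i) with hs
  refine ⟨Subfield.closure s, (Subfield.cardinalMk_closure_le_max _).trans
    (max_le (Set.countable_coe_iff.2 s.countable_toSet |> Cardinal.mk_le_aleph0_iff.2) le_rfl), ?_, ?_,
    Subfield.subset_closure (Finset.mem_coe.2 (by simp [hs]))⟩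
  · refine mem_overf.2 fun i => ?_
    by_cases hi : P.coeff i = 0
    · rw [hi]; exact zero_mem _
    · refine Subfield.subset_closure (Finset.mem_coe.2 ?_)
      exact Finset.mem_insert_of_mem (Finset.mem_union_left _
        (Finset.mem_image_of_mem _ (mem_support_iff.2 hi)))
  · refine mem_overf.2 fun i => ?_
    by_cases hi : Q.coeff i = 0
    · rw [hi]; exact zero_mem _
    · refine Subfield.subset_closure (Finset.mem_coe.2 ?_)
      exact Finset.mem_insert_of_mem (Finset.mem_union_right _
        (Finset.mem_image_of_mem _ (mem_support_iff.2 hi)))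

theorem JPair.irreducible_of_ratPoly {P Q : Bi} {κ : ℂ} (J : JPair P Q κ)
    (hlt : (yp Q).natDegree < (yp P).natDegree) (hrat : RatPoly P) :
    (∀ e, Irreducible (P - MvPolynomial.C e)) ∧ ∀ e, Irreducible (Q - MvPolynomial.C e) := by
  obtain ⟨S, hS⟩ := hrat
  obtain ⟨EP, hEP, hP⟩ := J.exists_generic hlt
  obtain ⟨cP, hcP⟩ := (hEP.union S.finite_toSet).infinite_compl.nonempty
  rw [Set.mem_compl_iff, Set.mem_union, not_or] at hcP
  obtain ⟨EQ, hEQ, hQ⟩ := hP cP hcP.1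
  obtain ⟨K, hK, hPK, hQK, hκ⟩ := exists_countable_subfield P Q κ
  have hcount : ({x : ℂ | IsAlgebraic K x} ∪ EQ).Countable := by
    refine Set.Countable.union ?_ hEQ.countable
    have : Countable K := Cardinal.mk_le_aleph0_iff.1 hK
    exact Algebraic.countable K ℂ
  obtain ⟨c, hc⟩ : ∃ c : ℂ, c ∉ {x : ℂ | IsAlgebraic K x} ∪ EQ := by
    by_contra! hall
    have h1 : (Set.univ : Set ℂ).Countable := hcount.mono fun x _ => hall x
    have h2 := Set.countable_univ_iff.1 h1
    have h3 := Cardinal.mk_le_aleph0_iff.2 h2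
    rw [Cardinal.mk_complex] at h3
    exact absurd h3 (not_le.2 Cardinal.aleph0_lt_continuum)
  rw [Set.mem_union, not_or] at hc
  have T := hQ c hc.2
  obtain ⟨T', ⟨φ⟩⟩ := hS cP hcP.2
  exact J.irreducible_of_finrank_eq_zero hK hPK hQK hκ hc.1 T
    (finrank_star_eq_zero J T.diff_p φ)

end KellerRational

namespace KellerRational

/-- The linear substitution `x ↦ x + a y`, `y ↦ b y`. -/
noncomputable def shear (a b : ℂ) : Bi →ₐ[ℂ] Bi :=
  aeval ![MvPolynomial.X 0 + MvPolynomial.C a * MvPolynomial.X 1,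
    MvPolynomial.C b * MvPolynomial.X 1]

@[simp] theorem shear_C (a b z : ℂ) : shear a b (MvPolynomial.C z) = MvPolynomial.C z :=
  algHom_C _ z

@[simp] theorem shear_X0 (a b : ℂ) : shear a b (MvPolynomial.X 0) =
    MvPolynomial.X 0 + MvPolynomial.C a * MvPolynomial.X 1 := by simp [shear]

@[simp] theorem shear_X1 (a b : ℂ) : shear a b (MvPolynomial.X 1) =
    MvPolynomial.C b * MvPolynomial.X 1 := by simp [shear]

theorem shear_shear (a b a' b' : ℂ) (h0 : a' + a * b' = 0) (h1 : b * b' = 1) :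
    (shear a' b').comp (shear a b) = AlgHom.id ℂ Bi := by
  ext i : 1
  fin_cases i
  · have : (MvPolynomial.C a' + MvPolynomial.C a * MvPolynomial.C b' : Bi) = 0 := by
      rw [← MvPolynomial.C_mul, ← MvPolynomial.C_add, h0, MvPolynomial.C_0]
    simp
    linear_combination (MvPolynomial.X 1 : Bi) * this
  · have : (MvPolynomial.C b * MvPolynomial.C b' : Bi) = 1 := by
      rw [← MvPolynomial.C_mul, h1, MvPolynomial.C_1]
    simp
    linear_combination (MvPolynomial.X 1 : Bi) * this

/-- The shear as an automorphism. -/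
noncomputable def shearEquiv (a b : ℂ) (hb : b ≠ 0) : Bi ≃ₐ[ℂ] Bi :=
  AlgEquiv.ofAlgHom (shear a b) (shear (-a / b) b⁻¹)
    (shear_shear _ _ _ _ (by field_simp; ring) (by field_simp))
    (shear_shear _ _ _ _ (by field_simp; ring) (by field_simp))

theorem shearEquiv_apply (a b : ℂ) (hb : b ≠ 0) (f : Bi) : shearEquiv a b hb f = shear a b f := rfl

theorem pderiv_zero_shear (a b : ℂ) (f : Bi) :
    pderiv 0 (shear a b f) = shear a b (pderiv 0 f) := by
  induction f using MvPolynomial.induction_on with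
  | C z => simp
  | add p q hp hq => simp [hp, hq]
  | mul_X p i hp =>
    fin_cases i
    · simp [hp, pderiv_X]; try ring
    · simp [hp, pderiv_X]; try ring

theorem pderiv_one_shear (a b : ℂ) (f : Bi) :
    pderiv 1 (shear a b f) = MvPolynomial.C a * shear a b (pderiv 0 f) +
      MvPolynomial.C b * shear a b (pderiv 1 f) := by
  induction f using MvPolynomial.induction_on with
  | C z => simp
  | add p q hp hq => simp [hp, hq]; ring
  | mul_X p i hp =>
    fin_cases i
    · simp [hp, pderiv_X]; ring
    · simp [hp, pderiv_X]; ring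

theorem pev_shear (a b : ℂ) (p : ℂ × ℂ) (f : Bi) :
    pev p (shear a b f) = pev (p.1 + a * p.2, b * p.2) f := by
  induction f using MvPolynomial.induction_on with
  | C z => simp [pev_def]
  | add p q hp hq => simp [hp, hq]
  | mul_X p i hp =>
    rw [map_mul, map_mul, hp, map_mul]
    fin_cases i <;> simp [pev_def]

theorem yp_shear_monomial (a b : ℂ) (m : Fin 2 →₀ ℕ) (r : ℂ) :
    yp (shear a b (monomial m r)) = Polynomial.C (Polynomial.C r) *
      ((Polynomial.C Polynomial.X + Polynomial.C (Polynomial.C a) * Polynomial.X) ^ m 0 *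
      (Polynomial.C (Polynomial.C b) * Polynomial.X) ^ m 1) := by
  rw [monomial_eq, Finsupp.prod_fintype _ _ (by simp)]
  simp

theorem natDegree_yp_shear_monomial (a b : ℂ) (m : Fin 2 →₀ ℕ) (r : ℂ) :
    (yp (shear a b (monomial m r))).natDegree ≤ m 0 + m 1 := by
  rw [yp_shear_monomial]
  refine (Polynomial.natDegree_C_mul_le _ _).trans (Polynomial.natDegree_mul_le_of_le ?_ ?_)
  · refine (Polynomial.natDegree_pow_le_of_le (m 0) (m := 1) ?_).trans (mul_one _).le
    compute_degree
  · refine (Polynomial.natDegree_pow_le_of_le (m 1) (m := 1) ?_).trans (mul_one _).le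
    compute_degree

theorem coeff_yp_shear_monomial (a b : ℂ) (m : Fin 2 →₀ ℕ) (r : ℂ) :
    (yp (shear a b (monomial m r))).coeff (m 0 + m 1) =
      Polynomial.C (eval ![a, b] (monomial m r)) := by
  have h0 : (Polynomial.C Polynomial.X + Polynomial.C (Polynomial.C a) * Polynomial.X :
      Polynomial (Polynomial ℂ)).natDegree ≤ 1 := by compute_degree
  have h1 : (Polynomial.C (Polynomial.C b) * Polynomial.X :
      Polynomial (Polynomial ℂ)).natDegree ≤ 1 := by compute_degree
  rw [yp_shear_monomial, Polynomial.coeff_C_mul, Polynomial.coeff_mul_add_eq_of_natDegree_le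
    ((Polynomial.natDegree_pow_le_of_le _ h0).trans (mul_one _).le)
    ((Polynomial.natDegree_pow_le_of_le _ h1).trans (mul_one _).le)]
  have e0 := Polynomial.coeff_pow_of_natDegree_le (m := m 0) h0
  have e1 := Polynomial.coeff_pow_of_natDegree_le (m := m 1) h1
  rw [mul_one] at e0 e1
  rw [e0, e1, eval_monomial, Finsupp.prod_fintype _ _ (by simp)]
  simp

theorem degree_fin_two (m : Fin 2 →₀ ℕ) : m.degree = m 0 + m 1 := by
  rw [Finsupp.degree_eq_sum]; simp

theorem yp_shear_top (a b : ℂ) (f : Bi) (n : ℕ) (hn : f.totalDegree ≤ n) :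
    (yp (shear a b f)).natDegree ≤ n ∧
    (yp (shear a b f)).coeff n = Polynomial.C (eval ![a, b] (homogeneousComponent n f)) := by
  have key : ∀ m ∈ f.support, (yp (shear a b (monomial m (coeff m f)))).natDegree ≤ n ∧
      (yp (shear a b (monomial m (coeff m f)))).coeff n = Polynomial.C (eval ![a, b]
        (homogeneousComponent n (monomial m (coeff m f)))) := by
    intro m hm
    have hd : m 0 + m 1 ≤ n := by
      rw [← degree_fin_two]
      exact (le_totalDegree hm).trans hn
    have h1 := natDegree_yp_shear_monomial a b m (coeff m f)
    refine ⟨h1.trans hd, ?_⟩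
    rw [homogeneousComponent_of_mem (isHomogeneous_monomial (n := m 0 + m 1) _ (degree_fin_two m))]
    split_ifs with h
    · rw [h, coeff_yp_shear_monomial]
    · rw [Polynomial.coeff_eq_zero_of_natDegree_lt (by omega)]; simp
  constructor
  · conv_lhs => rw [f.as_sum]
    rw [map_sum, map_sum]
    exact Polynomial.natDegree_sum_le_of_forall_le _ _ fun m hm => (key m hm).1
  · conv_lhs => rw [f.as_sum]
    conv_rhs => rw [f.as_sum]
    rw [map_sum, map_sum, Polynomial.finsetSum_coeff, map_sum, map_sum, map_sum]
    exact Finset.sum_congr rfl fun m hm => (key m hm).2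

theorem homogeneousComponent_totalDegree_ne_zero {f : Bi} (hf : f ≠ 0) :
    homogeneousComponent f.totalDegree f ≠ 0 := by
  obtain ⟨m, hm, hd⟩ := Finset.exists_mem_eq_sup f.support (support_nonempty.2 hf)
    (fun s => s.degree)
  intro h
  have := congrArg (coeff m) h
  rw [coeff_homogeneousComponent, if_pos, coeff_zero] at this
  · exact mem_support_iff.1 hm this
  · exact hd.symm

theorem totalDegree_lt_of_homogeneousComponent_eq_zero {f : Bi} {n : ℕ} (h : f.totalDegree ≤ n)
    (hn : 0 < n) (h0 : homogeneousComponent n f = 0) : f.totalDegree < n := by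
  refine lt_of_le_of_ne h fun he => ?_
  have hf : f ≠ 0 := by rintro rfl; simp at he; omega
  exact homogeneousComponent_totalDegree_ne_zero hf (he ▸ h0)

theorem RatPoly.shear_scale {P : Bi} (h : RatPoly P) {a b l : ℂ} (hb : b ≠ 0) (hl : l ≠ 0) :
    RatPoly (MvPolynomial.C l * shear a b P) := by
  classical
  obtain ⟨S, hS⟩ := h
  refine ⟨S.image (l * ·), fun c hc => ?_⟩
  have hc' : l⁻¹ * c ∉ S := fun hm => hc (Finset.mem_image.2 ⟨_, hm, by field_simp⟩)
  obtain ⟨T, ⟨φ⟩⟩ := hS _ hc'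
  let ψ : ℂ × ℂ ≃ₜ ℂ × ℂ :=
    { toFun := fun p => (p.1 + a * p.2, b * p.2)
      invFun := fun p => (p.1 - a * (b⁻¹ * p.2), b⁻¹ * p.2)
      left_inv := fun p => by ext <;> simp [hb]
      right_inv := fun p => by ext <;> simp [hb]
      continuous_toFun := by fun_prop
      continuous_invFun := by fun_prop }
  refine ⟨T, ⟨(Homeomorph.subtype ψ fun p => ?_).trans φ⟩⟩
  rw [map_mul, pev_shear]
  have : pev p (MvPolynomial.C l) = l := by simp [pev_def]
  rw [this]
  change _ ↔ pev (p.1 + a * p.2, b * p.2) P = _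
  rw [eq_inv_mul_iff_mul_eq₀ hl]

theorem irreducible_of_shear_scale {f : Bi} {a b l : ℂ} (hb : b ≠ 0) (hl : l ≠ 0)
    (h : ∀ e, Irreducible (MvPolynomial.C l * shear a b f - MvPolynomial.C e)) (e : ℂ) :
    Irreducible (f - MvPolynomial.C e) := by
  have h1 := h (l * e)
  have h2 : MvPolynomial.C l * shear a b f - MvPolynomial.C (l * e) =
      MvPolynomial.C l * shearEquiv a b hb (f - MvPolynomial.C e) := by
    rw [shearEquiv_apply, map_sub, shear_C, MvPolynomial.C_mul]; ring
  rw [h2, irreducible_isUnit_mul ((isUnit_iff_ne_zero.2 hl).map MvPolynomial.C)] at h1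
  exact (MulEquiv.irreducible_iff (shearEquiv a b hb)).1 h1

theorem exists_shear {f : Bi} (hf : f ≠ 0) : ∃ a b : ℂ, b ≠ 0 ∧ eval ![a, b] f ≠ 0 := by
  have h : f * MvPolynomial.X 1 ≠ 0 := mul_ne_zero hf (X_ne_zero _)
  obtain ⟨v, hv⟩ : ∃ v, eval v (f * MvPolynomial.X 1) ≠ 0 := by
    by_contra! hall
    exact h (MvPolynomial.funext fun v => by rw [hall v, map_zero])
  rw [map_mul, eval_X] at hv
  refine ⟨v 0, v 1, right_ne_zero_of_mul hv, ?_⟩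
  have : ![v 0, v 1] = v := by ext i; fin_cases i <;> rfl
  rw [this]
  exact left_ne_zero_of_mul hv

theorem normalized {f : Bi} (a b : ℂ)
    (h : eval ![a, b] (homogeneousComponent f.totalDegree f) ≠ 0) :
    (yp (MvPolynomial.C (eval ![a, b] (homogeneousComponent f.totalDegree f))⁻¹ *
      shear a b f)).Monic ∧
    (yp (MvPolynomial.C (eval ![a, b] (homogeneousComponent f.totalDegree f))⁻¹ *
      shear a b f)).natDegree = f.totalDegree := by
  obtain ⟨h1, h2⟩ := yp_shear_top a b f _ le_rfl
  set l := eval ![a, b] (homogeneousComponent f.totalDegree f)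
  have h3 : (yp (shear a b f)).natDegree = f.totalDegree :=
    Polynomial.natDegree_eq_of_le_of_coeff_ne_zero h1 (by rw [h2]; simpa using h)
  rw [map_mul, yp_C]
  have h4 : (Polynomial.C (Polynomial.C l⁻¹) * yp (shear a b f)).natDegree = f.totalDegree := by
    rw [Polynomial.natDegree_C_mul (by simpa using h), h3]
  refine ⟨?_, h4⟩
  rw [Polynomial.Monic, Polynomial.leadingCoeff, h4, Polynomial.coeff_C_mul, h2,
    ← Polynomial.C_mul, inv_mul_cancel₀ h, Polynomial.C_1]

theorem irreducible_of_totalDegree_lt {P Q : Bi} {κ : ℂ} (hκ : κ ≠ 0)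
    (hjac : pderiv 0 P * pderiv 1 Q - pderiv 1 P * pderiv 0 Q = MvPolynomial.C κ)
    (hlt : Q.totalDegree < P.totalDegree) (hrat : RatPoly P) :
    (∀ e, Irreducible (P - MvPolynomial.C e)) ∧ ∀ e, Irreducible (Q - MvPolynomial.C e) := by
  have hQ : 0 < Q.totalDegree := by
    by_contra! h0
    have h0 := totalDegree_eq_zero_iff_eq_C.1 (Nat.le_zero.1 h0)
    rw [h0] at hjac
    simp at hjac
    exact hκ (by simpa using hjac.symm)
  have hP0 : P ≠ 0 := by rintro rfl; simp at hlt
  have hQ0 : Q ≠ 0 := by rintro rfl; simp at hQ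
  obtain ⟨a, b, hb, hab⟩ := exists_shear (mul_ne_zero
    (homogeneousComponent_totalDegree_ne_zero hP0) (homogeneousComponent_totalDegree_ne_zero hQ0))
  rw [map_mul] at hab
  obtain ⟨mP, dP⟩ := normalized a b (left_ne_zero_of_mul hab)
  obtain ⟨mQ, dQ⟩ := normalized a b (right_ne_zero_of_mul hab)
  have hp := inv_ne_zero (left_ne_zero_of_mul hab)
  have hq := inv_ne_zero (right_ne_zero_of_mul hab)
  set p := (eval ![a, b] (homogeneousComponent P.totalDegree P))⁻¹
  set q := (eval ![a, b] (homogeneousComponent Q.totalDegree Q))⁻¹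
  have J : JPair (MvPolynomial.C p * shear a b P) (MvPolynomial.C q * shear a b Q)
      (p * q * b * κ) :=
    { kappa_ne := mul_ne_zero (mul_ne_zero (mul_ne_zero hp hq) hb) hκ
      jac := by
        have h := congrArg (shear a b) hjac
        simp only [map_sub, map_mul, shear_C] at h
        simp only [pderiv_C_mul, pderiv_zero_shear, pderiv_one_shear, MvPolynomial.C_mul]
        linear_combination (MvPolynomial.C p * MvPolynomial.C q * MvPolynomial.C b : Bi) * h
      monP := mP
      monQ := mQ
      posP := by rw [dP]; omega
      posQ := by rw [dQ]; omega }
  obtain ⟨h1, h2⟩ := J.irreducible_of_ratPoly (by rw [dP, dQ]; exact hlt)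
    (hrat.shear_scale hb hp)
  exact ⟨irreducible_of_shear_scale hb hp h1, irreducible_of_shear_scale hb hq h2⟩

end KellerRational

namespace KellerRational

theorem totalDegree_pderiv_lt {f : Bi} {n : ℕ} (hn : 1 < n) (h : f.totalDegree < n) (i : Fin 2) :
    (pderiv i f).totalDegree < n - 1 := by
  have e : pderiv i f = ∑ k ∈ Finset.range (f.totalDegree + 1),
      pderiv i (homogeneousComponent k f) := by
    conv_lhs => rw [← sum_homogeneousComponent f]
    rw [map_sum]
  rw [e]
  refine lt_of_le_of_lt (totalDegree_finsetSum_le (d := n - 2) fun k hk => ?_) (by omega)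
  have := ((homogeneousComponent_isHomogeneous k f).pderiv (i := i)).totalDegree_le
  have := Finset.mem_range.1 hk
  omega

theorem totalDegree_sub_homogeneousComponent_lt {f : Bi} {n : ℕ} (h : f.totalDegree ≤ n)
    (hn : 0 < n) : (f - homogeneousComponent n f).totalDegree < n := by
  refine totalDegree_lt_of_homogeneousComponent_eq_zero ?_ hn ?_
  · exact (totalDegree_sub _ _).trans
      (max_le h (homogeneousComponent_isHomogeneous n f).totalDegree_le)
  · rw [map_sub, homogeneousComponent_eq_self (homogeneousComponent_isHomogeneous n f), sub_self]

theorem totalDegree_mul_lt {f g : Bi} {m n : ℕ} (hf : f.totalDegree ≤ m) (hg : g.totalDegree < n) :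
    (f * g).totalDegree < m + n :=
  lt_of_le_of_lt (totalDegree_mul f g) (by omega)

theorem jacobian_top_eq_zero {P Q : Bi} {κ : ℂ} {d : ℕ} (hd : 1 < d)
    (hjac : pderiv 0 P * pderiv 1 Q - pderiv 1 P * pderiv 0 Q = MvPolynomial.C κ)
    (hP : P.totalDegree ≤ d) (hQ : Q.totalDegree ≤ d) :
    pderiv 0 (homogeneousComponent d P) * pderiv 1 (homogeneousComponent d Q) -
      pderiv 1 (homogeneousComponent d P) * pderiv 0 (homogeneousComponent d Q) = 0 := by
  have hF := homogeneousComponent_isHomogeneous d P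
  have hG := homogeneousComponent_isHomogeneous d Q
  have hp := totalDegree_sub_homogeneousComponent_lt hP (by omega)
  have hq := totalDegree_sub_homogeneousComponent_lt hQ (by omega)
  set F := homogeneousComponent d P
  set G := homogeneousComponent d Q
  obtain ⟨p, hp'⟩ : ∃ p, p = P - F := ⟨_, rfl⟩
  obtain ⟨q, hq'⟩ : ∃ q, q = Q - G := ⟨_, rfl⟩
  rw [← hp'] at hp
  rw [← hq'] at hq
  have dF := fun i => (hF.pderiv (i := i)).totalDegree_le
  have dG := fun i => (hG.pderiv (i := i)).totalDegree_le
  have dp := totalDegree_pderiv_lt hd hp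
  have dq := totalDegree_pderiv_lt hd hq
  have hJ : (pderiv 0 F * pderiv 1 G - pderiv 1 F * pderiv 0 G).IsHomogeneous
      ((d - 1) + (d - 1)) :=
    (hF.pderiv.mul hG.pderiv).sub (hF.pderiv.mul hG.pderiv)
  have e : pderiv 0 F * pderiv 1 G - pderiv 1 F * pderiv 0 G = MvPolynomial.C κ
      - ((pderiv 0 F * pderiv 1 q - pderiv 1 F * pderiv 0 q)
        + (pderiv 1 G * pderiv 0 p - pderiv 0 G * pderiv 1 p)
        + (pderiv 0 p * pderiv 1 q - pderiv 1 p * pderiv 0 q)) := by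
    have h1 : P = F + p := by rw [hp']; ring
    have h2 : Q = G + q := by rw [hq']; ring
    rw [← hjac, h1, h2]
    simp only [map_add]
    ring
  have hsub : ∀ {f g : Bi} {n : ℕ}, f.totalDegree < n → g.totalDegree < n →
      (f - g).totalDegree < n := fun hf hg => lt_of_le_of_lt (totalDegree_sub _ _) (max_lt hf hg)
  have hadd : ∀ {f g : Bi} {n : ℕ}, f.totalDegree < n → g.totalDegree < n →
      (f + g).totalDegree < n := fun hf hg => lt_of_le_of_lt (totalDegree_add _ _) (max_lt hf hg)
  rw [← homogeneousComponent_eq_self hJ, e]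
  apply homogeneousComponent_eq_zero
  refine hsub (by rw [totalDegree_C]; omega) (hadd (hadd ?_ ?_) ?_)
  · exact hsub (totalDegree_mul_lt (dF 0) (dq 1)) (totalDegree_mul_lt (dF 1) (dq 0))
  · exact hsub (totalDegree_mul_lt (dG 1) (dp 0)) (totalDegree_mul_lt (dG 0) (dp 1))
  · exact hsub (totalDegree_mul_lt (dp 0).le (dq 1)) (totalDegree_mul_lt (dp 1).le (dq 0))

/-- Forms of the same degree with vanishing Jacobian have proportional gradients. -/
theorem mul_pderiv_comm_of_jacobian_eq_zero {F G : Bi} {d : ℕ} (hd : d ≠ 0)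
    (hF : F.IsHomogeneous d) (hG : G.IsHomogeneous d)
    (h : pderiv 0 F * pderiv 1 G - pderiv 1 F * pderiv 0 G = 0) (i : Fin 2) :
    F * pderiv i G = G * pderiv i F := by
  have e1 := hF.sum_X_mul_pderiv
  have e2 := hG.sum_X_mul_pderiv
  rw [Fin.sum_univ_two, nsmul_eq_mul] at e1 e2
  have hd' : (d : Bi) ≠ 0 := Nat.cast_ne_zero.2 hd
  apply mul_left_cancel₀ hd'
  fin_cases i
  · change (d : Bi) * (F * pderiv 0 G) = d * (G * pderiv 0 F)
    linear_combination (-pderiv 0 G) * e1 + pderiv 0 F * e2 - (MvPolynomial.X 1) * h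
  · change (d : Bi) * (F * pderiv 1 G) = d * (G * pderiv 1 F)
    linear_combination (-pderiv 1 G) * e1 + pderiv 1 F * e2 + (MvPolynomial.X 0) * h

theorem eq_zero_of_mul_derivative_comm {f h : Polynomial (Polynomial ℂ)} {d : ℕ}
    (hf : f.natDegree = d) (hd : 0 < d) (hh : h.natDegree < d)
    (e : f * h.derivative = h * f.derivative) : h = 0 := by
  by_contra h0
  have hf0 : f ≠ 0 := by rintro rfl; simp at hf; omega
  have hfl := Polynomial.leadingCoeff_ne_zero.2 hf0
  have hhl := Polynomial.leadingCoeff_ne_zero.2 h0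
  have df : f.derivative.natDegree ≤ d - 1 := hf ▸ Polynomial.natDegree_derivative_le f
  have cf : f.derivative.coeff (d - 1) = f.leadingCoeff * d := by
    rw [Polynomial.coeff_derivative, Nat.sub_add_cancel hd, Polynomial.leadingCoeff, hf]
    congr 1
    rw [← Nat.cast_succ, Nat.succ_eq_add_one, Nat.sub_add_cancel hd]
  obtain hk | hk := Nat.eq_zero_or_pos h.natDegree
  · rw [Polynomial.derivative_of_natDegree_zero hk, mul_zero, eq_comm, mul_eq_zero] at e
    have := e.resolve_left h0
    rw [this, Polynomial.coeff_zero, eq_comm, mul_eq_zero] at cf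
    obtain c | c := cf
    · exact hfl c
    · exact hd.ne' (Nat.cast_eq_zero.1 c)
  · have dh := Polynomial.natDegree_derivative_le h
    have ch : h.derivative.coeff (h.natDegree - 1) = h.leadingCoeff * h.natDegree := by
      rw [Polynomial.coeff_derivative, Nat.sub_add_cancel hk, Polynomial.leadingCoeff]
      congr 1
      rw [← Nat.cast_succ, Nat.succ_eq_add_one, Nat.sub_add_cancel hk]
    have c := congrArg (Polynomial.coeff · (d + (h.natDegree - 1))) e
    rw [Polynomial.coeff_mul_add_eq_of_natDegree_le hf.le dh,
      show d + (h.natDegree - 1) = h.natDegree + (d - 1) by omega,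
      Polynomial.coeff_mul_add_eq_of_natDegree_le le_rfl df, ch, cf,
      show f.coeff d = f.leadingCoeff by rw [Polynomial.leadingCoeff, hf],
      show h.coeff h.natDegree = h.leadingCoeff from rfl] at c
    have c' : f.leadingCoeff * h.leadingCoeff * (h.natDegree : Polynomial ℂ) =
        f.leadingCoeff * h.leadingCoeff * (d : Polynomial ℂ) := by linear_combination c
    have := Nat.cast_injective (mul_left_cancel₀ (mul_ne_zero hfl hhl) c')
    omega

theorem exists_eq_C_mul_of_jacobian_eq_zero {F G : Bi} {d : ℕ} (hd : 0 < d)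
    (hF : F.IsHomogeneous d) (hG : G.IsHomogeneous d) (hF0 : F ≠ 0)
    (h : pderiv 0 F * pderiv 1 G - pderiv 1 F * pderiv 0 G = 0) :
    ∃ l : ℂ, G = MvPolynomial.C l * F := by
  obtain ⟨a, b, hb, hab⟩ := exists_shear hF0
  refine ⟨eval ![a, b] G / eval ![a, b] F, ?_⟩
  set l := eval ![a, b] G / eval ![a, b] F with hl
  have hH : (G - MvPolynomial.C l * F).IsHomogeneous d := hG.sub (hF.C_mul l)
  have hcomm : ∀ i, F * pderiv i (G - MvPolynomial.C l * F) =
      (G - MvPolynomial.C l * F) * pderiv i F := by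
    intro i
    rw [map_sub, pderiv_C_mul]
    have := mul_pderiv_comm_of_jacobian_eq_zero hd.ne' hF hG h i
    linear_combination this
  obtain ⟨f1, f2⟩ := yp_shear_top a b F d hF.totalDegree_le
  obtain ⟨h1, h2⟩ := yp_shear_top a b _ d hH.totalDegree_le
  rw [homogeneousComponent_eq_self hF] at f2
  rw [homogeneousComponent_eq_self hH] at h2
  have hz : eval ![a, b] (G - MvPolynomial.C l * F) = 0 := by
    simp [hl, div_mul_cancel₀ _ hab]
  rw [hz, Polynomial.C_0] at h2
  set H := G - MvPolynomial.C l * F with hHdef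
  have hfd : (yp (shear a b F)).natDegree = d :=
    Polynomial.natDegree_eq_of_le_of_coeff_ne_zero f1 (by rw [f2]; simpa using hab)
  have hhd : (yp (shear a b H)).natDegree < d := by
    refine lt_of_le_of_ne h1 fun he => ?_
    have h3 : (yp (shear a b H)).leadingCoeff = 0 := by rw [Polynomial.leadingCoeff, he, h2]
    rw [Polynomial.leadingCoeff_eq_zero.1 h3] at he
    simp at he
    omega
  have e : yp (shear a b F) * (yp (shear a b H)).derivative =
      yp (shear a b H) * (yp (shear a b F)).derivative := by
    rw [derivative_yp, derivative_yp, ← map_mul, ← map_mul, pderiv_one_shear, pderiv_one_shear]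
    refine congrArg yp ?_
    have e0 := congrArg (shear a b) (hcomm 0)
    have e1 := congrArg (shear a b) (hcomm 1)
    rw [map_mul, map_mul] at e0 e1
    linear_combination (MvPolynomial.C a : Bi) * e0 + MvPolynomial.C b * e1
  have h0 := eq_zero_of_mul_derivative_comm hfd hd hhd e
  have h0' : shearEquiv a b hb H = 0 := yp_injective (h0.trans (map_zero yp).symm)
  have hH0 : H = 0 := (map_eq_zero_iff _ (shearEquiv a b hb).injective).1 h0'
  exact sub_eq_zero.1 hH0

theorem irreducible_sub_C_of_totalDegree_eq_one {P : Bi} (h : P.totalDegree = 1) (e : ℂ) :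
    Irreducible (P - MvPolynomial.C e) := by
  have hc : homogeneousComponent 1 (MvPolynomial.C e : Bi) = 0 :=
    homogeneousComponent_eq_zero _ _ (by simp)
  have hP0 : P ≠ 0 := by rintro rfl; simp at h
  have hne : P - MvPolynomial.C e ≠ 0 := by
    intro h0
    rw [sub_eq_zero.1 h0] at h
    simp at h
  have h1 : (P - MvPolynomial.C e).totalDegree = 1 := by
    refine le_antisymm ((totalDegree_sub_C_le _ _).trans h.le) ?_
    by_contra! hlt
    have := homogeneousComponent_totalDegree_ne_zero hP0
    rw [h] at this
    apply this
    have h2 := homogeneousComponent_eq_zero _ _ hlt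
    rwa [map_sub, hc, sub_zero] at h2
  refine irreducible_of_totalDegree_eq_one h1 fun x hx => isUnit_iff_ne_zero.2 ?_
  rintro rfl
  exact hne (MvPolynomial.ext _ _ fun i => by simpa using hx i)

theorem irreducible_of_ratPoly {P Q : Bi} {κ : ℂ} (hκ : κ ≠ 0)
    (hjac : pderiv 0 P * pderiv 1 Q - pderiv 1 P * pderiv 0 Q = MvPolynomial.C κ)
    (hP : RatPoly P) (hQ : RatPoly Q) (e : ℂ) : Irreducible (P - MvPolynomial.C e) := by
  obtain hlt | heq | hlt := lt_trichotomy Q.totalDegree P.totalDegree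
  · exact (irreducible_of_totalDegree_lt hκ hjac hlt hP).1 e
  · have hP1 : 0 < P.totalDegree := by
      by_contra! h0
      have h0 := totalDegree_eq_zero_iff_eq_C.1 (Nat.le_zero.1 h0)
      rw [h0] at hjac
      simp at hjac
      exact hκ (by simpa using hjac.symm)
    obtain h1 | h1 := (Nat.succ_le_of_lt hP1).eq_or_lt
    · exact irreducible_sub_C_of_totalDegree_eq_one h1.symm e
    · have hP0 : P ≠ 0 := by rintro rfl; simp at hP1
      obtain ⟨l, hl⟩ := exists_eq_C_mul_of_jacobian_eq_zero hP1
        (homogeneousComponent_isHomogeneous _ P) (homogeneousComponent_isHomogeneous _ Q)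
        (homogeneousComponent_totalDegree_ne_zero hP0)
        (jacobian_top_eq_zero h1 hjac le_rfl heq.le)
      have hlt : (Q - MvPolynomial.C l * P).totalDegree < P.totalDegree := by
        refine totalDegree_lt_of_homogeneousComponent_eq_zero ?_ hP1 ?_
        · refine (totalDegree_sub _ _).trans (max_le heq.le ?_)
          refine (totalDegree_mul _ _).trans ?_
          simp
        · rw [map_sub, homogeneousComponent_C_mul, hl, sub_self]
      refine (irreducible_of_totalDegree_lt hκ ?_ hlt hP).1 e
      rw [map_sub, map_sub, pderiv_C_mul, pderiv_C_mul, ← hjac]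
      ring
  · refine (irreducible_of_totalDegree_lt (neg_ne_zero.2 hκ) ?_ hlt hQ).2 e
    rw [MvPolynomial.C_neg, ← hjac]
    ring

end KellerRational

/-- for a Keller map with both components rational polynomials,
every fiber of `P` is irreducible. -/
theorem keller_rational_pair_fibers_irreducible
    (P Q : MvPolynomial (Fin 2) ℂ) (hK : IsKeller P Q)
    (hP : IsRationalPoly P) (hQ : IsRationalPoly Q) :
    ∀ c : ℂ, Irreducible (P - MvPolynomial.C c) := by
  obtain ⟨κ, hκ, hjac⟩ := hK
  exact KellerRational.irreducible_of_ratPoly hκ hjac hP hQ
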